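/- There exists an absolute constant C > 0 with the following property: if V : ℝ² → ℝ is measurable with |V(x)| ≤ 1 for almost every x, u is a real-valued weak solution of Δu + Vu = 0 on ℝ², and |u(x)| ≤ exp(−C·|x|·(log|x|)^{1/2}) for all x with |x| > 2, then u is identically zero. -/

import Mathlib

noncomputable section

open MeasureTheory Metric Filter Set
open scoped Topology ENNReal RealInnerProductSpace

/-- The Euclidean plane. -/
abbrev E2 : Type := EuclideanSpace ℝ (Fin 2)

/-- The Laplacian of a function on `ℝⁿ`, computed via iterated Fréchet derivatives in the
coordinate directions. -/
def lap {n : ℕ} (f : EuclideanSpace ℝ (Fin n) → ℝ) (x : EuclideanSpace ℝ (Fin n)) : ℝ :=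
  ∑ i : Fin n, fderiv ℝ (fun y => fderiv ℝ f y (EuclideanSpace.single i 1)) x
    (EuclideanSpace.single i 1)

/-- A test function on an open set `Ω`: smooth, compactly supported, with support inside `Ω`. -/
def IsTestFun {n : ℕ} (Ω : Set (EuclideanSpace ℝ (Fin n)))
    (h : EuclideanSpace ℝ (Fin n) → ℝ) : Prop :=
  ContDiff ℝ (⊤ : ℕ∞) h ∧ HasCompactSupport h ∧ tsupport h ⊆ Ω

/-- `u` is a weak solution of `Δu + Vu = 0` on `Ω`:
`∫_Ω u Δh + ∫_Ω V u h = 0` for every test function `h` on `Ω`. -/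
def IsWeakSol {n : ℕ} (Ω : Set (EuclideanSpace ℝ (Fin n)))
    (V u : EuclideanSpace ℝ (Fin n) → ℝ) : Prop :=
  ∀ h, IsTestFun Ω h →
    (∫ x in Ω, u x * lap h x) + (∫ x in Ω, V x * u x * h x) = 0

namespace Landis

open scoped ContDiff ComplexConjugate

section

variable {E : Type*} [NormedAddCommGroup E] [NormedSpace ℝ E]

/-- Partial derivative in the real direction. -/
def dX (f : ℂ → E) (z : ℂ) : E := fderiv ℝ f z 1

/-- Partial derivative in the imaginary direction. -/
def dY (f : ℂ → E) (z : ℂ) : E := fderiv ℝ f z Complex.I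

/-- The Laplacian on `ℂ`. -/
def lapl (f : ℂ → E) (z : ℂ) : E := dX (dX f) z + dY (dY f) z

theorem _root_.ContDiff.diffl {F : Type*} [NormedAddCommGroup F] [NormedSpace ℝ F] {f : F → E}
    (hf : ContDiff ℝ ∞ f) : Differentiable ℝ f :=
  hf.differentiable (by simp)

theorem contDiff_dX {f : ℂ → E} (hf : ContDiff ℝ ∞ f) : ContDiff ℝ ∞ (dX f) :=
  (hf.fderiv_right (m := ∞) (by simp)).clm_apply contDiff_const

theorem contDiff_dY {f : ℂ → E} (hf : ContDiff ℝ ∞ f) : ContDiff ℝ ∞ (dY f) :=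
  (hf.fderiv_right (m := ∞) (by simp)).clm_apply contDiff_const

theorem contDiff_lapl {f : ℂ → E} (hf : ContDiff ℝ ∞ f) : ContDiff ℝ ∞ (lapl f) :=
  (contDiff_dX (contDiff_dX hf)).add (contDiff_dY (contDiff_dY hf))

theorem fderiv_eq_dX_dY {f : ℂ → E} (z w : ℂ) :
    fderiv ℝ f z w = w.re • dX f z + w.im • dY f z := by
  have : w = w.re • (1 : ℂ) + w.im • Complex.I := by
    apply Complex.ext <;> simp
  conv_lhs => rw [this]
  rw [map_add, map_smul, map_smul]; rfl

theorem dX_comm_dY {f : ℂ → E} (hf : ContDiff ℝ ∞ f) : dX (dY f) = dY (dX f) := by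
  funext z
  have h : IsSymmSndFDerivAt ℝ f z :=
    (hf.contDiffAt).isSymmSndFDerivAt (by simp only [minSmoothness_of_isRCLikeNormedField]; exact WithTop.coe_le_coe.2 le_top)
  have hd : Differentiable ℝ (fderiv ℝ f) := (hf.fderiv_right (m := ∞) (by simp)).diffl
  have e1 : ∀ a b : ℂ, fderiv ℝ (fun y => fderiv ℝ f y a) z b = fderiv ℝ (fderiv ℝ f) z b a := by
    intro a b
    rw [fderiv_clm_apply (hd z) (differentiableAt_const a)]
    simp
  change fderiv ℝ (fun y => fderiv ℝ f y _) z _ = fderiv ℝ (fun y => fderiv ℝ f y _) z _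
  rw [e1, e1]
  exact h.eq _ _

section algebra
variable {f g : ℂ → E}

theorem dX_add (hf : Differentiable ℝ f) (hg : Differentiable ℝ g) :
    dX (fun z => f z + g z) = fun z => dX f z + dX g z := by
  funext z; simp [dX, fderiv_fun_add (hf z) (hg z)]
theorem dY_add (hf : Differentiable ℝ f) (hg : Differentiable ℝ g) :
    dY (fun z => f z + g z) = fun z => dY f z + dY g z := by
  funext z; simp [dY, fderiv_fun_add (hf z) (hg z)]
theorem dX_sub (hf : Differentiable ℝ f) (hg : Differentiable ℝ g) :
    dX (fun z => f z - g z) = fun z => dX f z - dX g z := by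
  funext z; simp [dX, fderiv_fun_sub (hf z) (hg z)]
theorem dY_sub (hf : Differentiable ℝ f) (hg : Differentiable ℝ g) :
    dY (fun z => f z - g z) = fun z => dY f z - dY g z := by
  funext z; simp [dY, fderiv_fun_sub (hf z) (hg z)]
theorem dX_neg : dX (fun z => - f z) = fun z => - dX f z := by
  funext z; simp [dX]
theorem dY_neg : dY (fun z => - f z) = fun z => - dY f z := by
  funext z; simp [dY]
theorem dX_const (c : E) : dX (fun _ => c) = fun _ => 0 := by
  funext z; simp [dX]
theorem dY_const (c : E) : dY (fun _ => c) = fun _ => 0 := by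
  funext z; simp [dY]

theorem lapl_add (hf : ContDiff ℝ ∞ f) (hg : ContDiff ℝ ∞ g) :
    lapl (fun z => f z + g z) = fun z => lapl f z + lapl g z := by
  funext z
  simp only [lapl, dX_add hf.diffl hg.diffl, dY_add hf.diffl hg.diffl,
    dX_add (contDiff_dX hf).diffl (contDiff_dX hg).diffl,
    dY_add (contDiff_dY hf).diffl (contDiff_dY hg).diffl]
  abel
theorem lapl_sub (hf : ContDiff ℝ ∞ f) (hg : ContDiff ℝ ∞ g) :
    lapl (fun z => f z - g z) = fun z => lapl f z - lapl g z := by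
  funext z
  simp only [lapl, dX_sub hf.diffl hg.diffl, dY_sub hf.diffl hg.diffl,
    dX_sub (contDiff_dX hf).diffl (contDiff_dX hg).diffl,
    dY_sub (contDiff_dY hf).diffl (contDiff_dY hg).diffl]
  abel
theorem lapl_neg : lapl (fun z => - f z) = fun z => - lapl f z := by
  funext z
  simp only [lapl, dX_neg, dY_neg]; abel
theorem lapl_const (c : E) : lapl (fun _ => c) = fun _ => 0 := by
  funext z; simp [lapl, dX_const, dY_const]

variable {A : Type*} [NormedRing A] [NormedAlgebra ℝ A] {p q : ℂ → A}

theorem dX_mul (hf : Differentiable ℝ p) (hg : Differentiable ℝ q) :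
    dX (fun z => p z * q z) = fun z => p z * dX q z + dX p z * q z := by
  funext z; simp [dX, fderiv_fun_mul' (hf z) (hg z)]
theorem dY_mul (hf : Differentiable ℝ p) (hg : Differentiable ℝ q) :
    dY (fun z => p z * q z) = fun z => p z * dY q z + dY p z * q z := by
  funext z; simp [dY, fderiv_fun_mul' (hf z) (hg z)]

theorem lapl_mul (hf : ContDiff ℝ ∞ p) (hg : ContDiff ℝ ∞ q) :
    lapl (fun z => p z * q z) = fun z => p z * lapl q z + 2 * (dX p z * dX q z + dY p z * dY q z)
      + lapl p z * q z := by
  funext z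
  have h1 := (contDiff_dX hf).diffl
  have h2 := (contDiff_dX hg).diffl
  have h3 := (contDiff_dY hf).diffl
  have h4 := (contDiff_dY hg).diffl
  have h5 := hf.diffl
  have h6 := hg.diffl
  simp only [lapl, dX_mul h5 h6, dY_mul h5 h6,
    dX_add (h5.fun_mul h2) (h1.fun_mul h6), dY_add (h5.fun_mul h4) (h3.fun_mul h6), dX_mul h5 h2, dX_mul h1 h6,
    dY_mul h5 h4, dY_mul h3 h6]
  noncomm_ring

theorem lapl_const_mul (c : A) (hg : ContDiff ℝ ∞ q) :
    lapl (fun z => c * q z) = fun z => c * lapl q z := by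
  rw [lapl_mul contDiff_const hg]
  simp [dX_const, dY_const, lapl_const]

theorem dX_const_mul (c : A) (hg : Differentiable ℝ q) :
    dX (fun z => c * q z) = fun z => c * dX q z := by
  rw [dX_mul (differentiable_const c) hg]; simp [dX_const]
theorem dY_const_mul (c : A) (hg : Differentiable ℝ q) :
    dY (fun z => c * q z) = fun z => c * dY q z := by
  rw [dY_mul (differentiable_const c) hg]; simp [dY_const]

end algebra

theorem dX_re : dX Complex.re = fun _ => 1 := by
  funext z; change fderiv ℝ (fun z => Complex.reCLM z) z 1 = 1
  rw [Complex.reCLM.fderiv]; simp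
theorem dY_re : dY Complex.re = fun _ => 0 := by
  funext z; change fderiv ℝ (fun z => Complex.reCLM z) z _ = 0
  rw [Complex.reCLM.fderiv]; simp
theorem dX_im : dX Complex.im = fun _ => 0 := by
  funext z; change fderiv ℝ (fun z => Complex.imCLM z) z 1 = 0
  rw [Complex.imCLM.fderiv]; simp
theorem dY_im : dY Complex.im = fun _ => 1 := by
  funext z; change fderiv ℝ (fun z => Complex.imCLM z) z _ = 1
  rw [Complex.imCLM.fderiv]; simp
theorem contDiff_re : ContDiff ℝ ∞ Complex.re := Complex.reCLM.contDiff
theorem contDiff_im : ContDiff ℝ ∞ Complex.im := Complex.imCLM.contDiff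

/-- Chain rule for the partial derivatives, one-variable outer function. -/
theorem dX_comp {g g' : ℝ → E} {p : ℂ → ℝ} (hp : Differentiable ℝ p)
    (hg : ∀ z, HasDerivAt g (g' (p z)) (p z)) :
    dX (fun z => g (p z)) = fun z => dX p z • g' (p z) := by
  funext z
  have := ((hg z).hasFDerivAt.comp z (hp z).hasFDerivAt).fderiv
  change fderiv ℝ (g ∘ p) z 1 = _
  rw [this]; simp [dX]
theorem dY_comp {g g' : ℝ → E} {p : ℂ → ℝ} (hp : Differentiable ℝ p)
    (hg : ∀ z, HasDerivAt g (g' (p z)) (p z)) :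
    dY (fun z => g (p z)) = fun z => dY p z • g' (p z) := by
  funext z
  have := ((hg z).hasFDerivAt.comp z (hp z).hasFDerivAt).fderiv
  change fderiv ℝ (g ∘ p) z _ = _
  rw [this]; simp [dY]

theorem contDiff_normSq_sub (w : ℂ) : ContDiff ℝ ∞ (fun z : ℂ => Complex.normSq (z - w)) := by
  have := (contDiff_id (𝕜 := ℝ) (n := ∞) (E := ℂ)).sub (contDiff_const (c := w))
  have := this.norm_sq ℝ
  simpa [Complex.normSq_eq_norm_sq] using this

theorem dX_normSq_sub (w : ℂ) :
    dX (fun z : ℂ => Complex.normSq (z - w)) = fun z => 2 * (z.re - w.re) := by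
  have h : (fun z : ℂ => Complex.normSq (z - w)) =
    fun z => (z.re - w.re) * (z.re - w.re) + (z.im - w.im) * (z.im - w.im) := by
    funext z; simp [Complex.normSq_apply]
  have hr := contDiff_re.diffl
  have hi := contDiff_im.diffl
  have h1 : Differentiable ℝ fun z : ℂ => z.re - w.re := hr.sub_const _
  have h2 : Differentiable ℝ fun z : ℂ => z.im - w.im := hi.sub_const _
  rw [h, dX_add (h1.fun_mul h1) (h2.fun_mul h2), dX_mul h1 h1, dX_mul h2 h2,
    dX_sub hr (differentiable_const _), dX_sub hi (differentiable_const _), dX_re, dX_im]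
  simp only [dX_const]; funext z; ring
theorem dY_normSq_sub (w : ℂ) :
    dY (fun z : ℂ => Complex.normSq (z - w)) = fun z => 2 * (z.im - w.im) := by
  have h : (fun z : ℂ => Complex.normSq (z - w)) =
    fun z => (z.re - w.re) * (z.re - w.re) + (z.im - w.im) * (z.im - w.im) := by
    funext z; simp [Complex.normSq_apply]
  have hr := contDiff_re.diffl
  have hi := contDiff_im.diffl
  have h1 : Differentiable ℝ fun z : ℂ => z.re - w.re := hr.sub_const _
  have h2 : Differentiable ℝ fun z : ℂ => z.im - w.im := hi.sub_const _
  rw [h, dY_add (h1.fun_mul h1) (h2.fun_mul h2), dY_mul h1 h1, dY_mul h2 h2,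
    dY_sub hr (differentiable_const _), dY_sub hi (differentiable_const _), dY_re, dY_im]
  simp only [dY_const]; funext z; ring

/-- Laplacian of a radial function. -/
theorem lapl_radial {g g' g'' : ℝ → ℝ} (w : ℂ)
    (hg : ∀ s, 0 ≤ s → HasDerivAt g (g' s) s) (hg' : ∀ s, 0 ≤ s → HasDerivAt g' (g'' s) s) :
    lapl (fun z => g (Complex.normSq (z - w))) = fun z =>
      4 * g' (Complex.normSq (z - w)) + 4 * Complex.normSq (z - w) * g'' (Complex.normSq (z - w)) := by
  have hp := (contDiff_normSq_sub w).diffl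
  have h1 := dX_comp hp (fun z => hg _ (Complex.normSq_nonneg (z - w)))
  have h2 := dY_comp hp (fun z => hg _ (Complex.normSq_nonneg (z - w)))
  have h1' := dX_comp hp (fun z => hg' _ (Complex.normSq_nonneg (z - w)))
  have h2' := dY_comp hp (fun z => hg' _ (Complex.normSq_nonneg (z - w)))
  have hd : Differentiable ℝ (fun z : ℂ => g' (Complex.normSq (z - w))) := fun z =>
    ((hg' _ (Complex.normSq_nonneg (z - w))).differentiableAt).comp z (hp z)
  have hr := contDiff_re.diffl
  have hi := contDiff_im.diffl
  have h3 : Differentiable ℝ fun z : ℂ => z.re - w.re := hr.sub_const _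
  have h4 : Differentiable ℝ fun z : ℂ => z.im - w.im := hi.sub_const _
  funext z
  simp only [lapl, h1, h2, dX_normSq_sub, dY_normSq_sub, smul_eq_mul]
  rw [dX_mul (h3.const_mul 2) hd, dY_mul (h4.const_mul 2) hd, h1', h2', dX_normSq_sub, dY_normSq_sub, dX_const_mul _ h3,
    dY_const_mul _ h4, dX_sub hr (differentiable_const _), dY_sub hi (differentiable_const _),
    dX_re, dY_im]
  simp only [dX_const, dY_const, smul_eq_mul, Complex.normSq_apply,
    Complex.sub_re, Complex.sub_im]
  ring

end

theorem hasDerivAt_line {E : Type*} [NormedAddCommGroup E] [NormedSpace ℝ E] {f : ℂ → E}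
    (hf : ContDiff ℝ ∞ f) (z w : ℂ) (t : ℝ) :
    HasDerivAt (fun t : ℝ => f (z + t * w)) (fderiv ℝ f (z + t * w) w) t := by
  have h1 : HasDerivAt (fun t : ℝ => z + t * w) w t := by
    simpa using ((Complex.ofRealCLM.hasDerivAt (x := t)).mul_const w).const_add z
  exact (hf.diffl (z + t * w)).hasFDerivAt.comp_hasDerivAt t h1

theorem second_deriv_nonneg_of_isLocalMin {g g' : ℝ → ℝ} {g'' t : ℝ} (h : IsLocalMin g t)
    (h1 : ∀ s, HasDerivAt g (g' s) s) (h2 : HasDerivAt g' g'' t) : 0 ≤ g'' := by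
  by_contra! hneg
  have e1 : deriv g = g' := funext fun s => (h1 s).deriv
  have e0 : g' t = 0 := h.hasDerivAt_eq_zero (h1 t)
  have hmax : IsLocalMax g t := by
    apply isLocalMax_of_deriv_deriv_neg
    · rw [e1, h2.deriv]; exact hneg
    · rw [e1, e0]
    · exact (h1 t).continuousAt
  have hc : ∀ᶠ s in 𝓝 t, g s = g t := by
    filter_upwards [h, hmax] with s a b using le_antisymm b a
  have hc' : ∀ᶠ s in 𝓝 t, g' s = 0 := by
    filter_upwards [hc.eventually_nhds] with s hs
    have : HasDerivAt g 0 s := (hasDerivAt_const s (g t)).congr_of_eventuallyEq hs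
    exact (h1 s).unique this
  have : HasDerivAt g' 0 t := (hasDerivAt_const t (0 : ℝ)).congr_of_eventuallyEq hc'
  linarith [h2.unique this]

theorem lapl_nonneg_of_isLocalMin {f : ℂ → ℝ} (hf : ContDiff ℝ ∞ f) {z : ℂ}
    (h : IsLocalMin f z) : 0 ≤ lapl f z := by
  have key : ∀ w : ℂ, 0 ≤ fderiv ℝ (fun y => fderiv ℝ f y w) z w := by
    intro w
    have hc : ContDiff ℝ ∞ (fun y => fderiv ℝ f y w) :=
      (hf.fderiv_right (m := ∞) (by simp)).clm_apply contDiff_const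
    have h2 := hasDerivAt_line hc z w 0
    simp only [Complex.ofReal_zero, zero_mul, add_zero] at h2
    refine second_deriv_nonneg_of_isLocalMin (g := fun t : ℝ => f (z + t * w)) (t := 0) ?_
      (fun s => hasDerivAt_line hf z w s) h2
    have hcont : ContinuousAt (fun t : ℝ => z + t * w) 0 := by fun_prop
    have := hcont.tendsto
    simp only [Complex.ofReal_zero, zero_mul, add_zero] at this
    have h3 := this.eventually h
    simpa [IsLocalMin, IsMinFilter] using h3
  exact add_nonneg (key 1) (key Complex.I)

/-- Minimum principle. -/
theorem min_principle {f : ℂ → ℝ} (hf : ContDiff ℝ ∞ f) {K U : Set ℂ} (hK : IsCompact K)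
    (hU : IsOpen U) (hUK : U ⊆ K) (hbd : ∀ z ∈ K, z ∉ U → 0 ≤ f z)
    (hl : ∀ z ∈ U, f z < 0 → lapl f z < 0) : ∀ z ∈ K, 0 ≤ f z := by
  intro z hz
  obtain ⟨x, hx, hmin⟩ := hK.exists_isMinOn ⟨z, hz⟩ hf.continuous.continuousOn
  refine le_trans ?_ (hmin hz)
  by_contra! hneg
  by_cases hxU : x ∈ U
  · have h1 := hl x hxU hneg
    have h2 : IsLocalMin f x := (hmin.on_subset hUK).isLocalMin (hU.mem_nhds hxU)
    linarith [lapl_nonneg_of_isLocalMin hf h2]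
  · linarith [hbd x hx hxU]


section affine
variable {E : Type*} [NormedAddCommGroup E] [NormedSpace ℝ E]

theorem contDiff_comp_affine {v : ℂ → E} (hv : ContDiff ℝ ∞ v) (A : ℂ →L[ℝ] ℂ) (z0 : ℂ) :
    ContDiff ℝ ∞ (fun z => v (z0 + A z)) :=
  hv.comp (contDiff_const.add A.contDiff)

theorem fderiv_comp_affine {v : ℂ → E} (hv : Differentiable ℝ v) (A : ℂ →L[ℝ] ℂ) (z0 z w : ℂ) :
    fderiv ℝ (fun z => v (z0 + A z)) z w
      = (A w).re • dX v (z0 + A z) + (A w).im • dY v (z0 + A z) := by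
  have h := (hv (z0 + A z)).hasFDerivAt.comp z (A.hasFDerivAt.const_add z0)
  rw [← fderiv_eq_dX_dY]
  change fderiv ℝ (v ∘ fun z => z0 + A z) z w = _
  rw [h.fderiv]; rfl

theorem lapl_comp_affine {v : ℂ → E} (hv : ContDiff ℝ ∞ v) (A : ℂ →L[ℝ] ℂ) (z0 : ℂ) {s : ℝ}
    (h1 : (A 1).re ^ 2 + (A Complex.I).re ^ 2 = s) (h2 : (A 1).im ^ 2 + (A Complex.I).im ^ 2 = s)
    (h3 : (A 1).re * (A 1).im + (A Complex.I).re * (A Complex.I).im = 0) (z : ℂ) :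
    lapl (fun z => v (z0 + A z)) z = s • lapl v (z0 + A z) := by
  have hX := contDiff_dX hv
  have hY := contDiff_dY hv
  have key : ∀ w z, fderiv ℝ (fun z => fderiv ℝ (fun z => v (z0 + A z)) z w) z w =
      (A w).re ^ 2 • dX (dX v) (z0 + A z) + (A w).im ^ 2 • dY (dY v) (z0 + A z) +
        (2 * ((A w).re * (A w).im)) • dX (dY v) (z0 + A z) := by
    intro w z
    have e : (fun z => fderiv ℝ (fun z => v (z0 + A z)) z w) =
      fun z => (A w).re • dX v (z0 + A z) + (A w).im • dY v (z0 + A z) := by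
      funext z; exact fderiv_comp_affine hv.diffl A z0 z w
    have d1 := (contDiff_comp_affine hX A z0).diffl z
    have d2 := (contDiff_comp_affine hY A z0).diffl z
    rw [e, fderiv_fun_add (d1.fun_const_smul _) (d2.fun_const_smul _), fderiv_fun_const_smul d1,
      fderiv_fun_const_smul d2]
    simp only [add_apply, smul_apply]
    rw [fderiv_comp_affine hX.diffl, fderiv_comp_affine hY.diffl, ← dX_comm_dY hv]
    module
  change fderiv ℝ (fun z' => fderiv ℝ (fun z => v (z0 + A z)) z' 1) z 1 +
    fderiv ℝ (fun z' => fderiv ℝ (fun z => v (z0 + A z)) z' Complex.I) z Complex.I = _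
  rw [key, key]
  simp only [lapl]
  have h2' : (A Complex.I).im ^ 2 = s - (A 1).im ^ 2 := by linarith
  have h1' : (A Complex.I).re ^ 2 = s - (A 1).re ^ 2 := by linarith
  have h3' : (A Complex.I).re * (A Complex.I).im = - ((A 1).re * (A 1).im) := by linarith
  rw [h1', h2', h3']
  module

end affine

theorem deriv_le_of_le_mul {g : ℝ → ℝ} {g' c d : ℝ} (hd : 0 < d) (h0 : g 0 = 0)
    (h : ∀ y ∈ Ioo 0 d, g y ≤ c * y) (hg : HasDerivAt g g' 0) : g' ≤ c := by
  have h1 := hg.tendsto_slope.mono_left (nhdsWithin_mono 0 (s := Ioi 0) (fun x hx => ne_of_gt hx))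
  refine le_of_tendsto h1 ?_
  filter_upwards [Ioo_mem_nhdsGT hd] with y hy
  rw [slope_def_field, h0, sub_zero, sub_zero, div_le_iff₀ hy.1]
  exact h y hy

theorem dY_zero_le {v : ℂ → ℝ} (hv : ContDiff ℝ ∞ v) {d M F : ℝ} (hd : 0 < d)
    (hF : 0 < F) (hM : ∀ z, ‖z‖ ≤ 2 * d → |v z| ≤ M) (hL : ∀ z, ‖z‖ ≤ 2 * d → |lapl v z| ≤ F) :
    dY v 0 ≤ 2 * M / d + d * F := by
  have hM0 : 0 ≤ M := (abs_nonneg _).trans (hM 0 (by simp; positivity))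
  set B : ℂ →L[ℝ] ℂ := (Complex.conjCLE : ℂ →L[ℝ] ℂ)
  have hB : ∀ z, B z = conj z := fun z => rfl
  have hc : ContDiff ℝ ∞ (fun z => v (0 + B z)) := contDiff_comp_affine hv B 0
  have hre := contDiff_re
  have him := contDiff_im
  let p : ℂ → ℝ := fun z => M / d ^ 2 * (z.re * z.re + z.im * (2 * d - z.im))
    + F * (z.im * (d - z.im))
  let w : ℂ → ℝ := fun z => (1 / 2) * (v z - v (0 + B z))
  have hw : ContDiff ℝ ∞ w := contDiff_const.mul (hv.sub hc)
  have c1 : ContDiff ℝ ∞ fun z : ℂ => z.re * z.re := hre.mul hre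
  have c2' : ContDiff ℝ ∞ fun z : ℂ => 2 * d - z.im := contDiff_const.sub him
  have c3' : ContDiff ℝ ∞ fun z : ℂ => d - z.im := contDiff_const.sub him
  have c2 : ContDiff ℝ ∞ fun z : ℂ => z.im * (2 * d - z.im) := him.mul c2'
  have c3 : ContDiff ℝ ∞ fun z : ℂ => z.im * (d - z.im) := him.mul c3'
  have hp : ContDiff ℝ ∞ p := (contDiff_const.mul (c1.add c2)).add (contDiff_const.mul c3)
  have lre : lapl Complex.re = fun _ => 0 := by
    funext z; simp [lapl, dX_re, dY_re, dX_const, dY_const]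
  have lim : lapl Complex.im = fun _ => 0 := by
    funext z; simp [lapl, dX_im, dY_im, dX_const, dY_const]
  have lp : lapl p = fun _ => - 2 * F := by
    simp only [p]
    rw [lapl_add (contDiff_const.mul (c1.add c2)) (contDiff_const.mul c3),
      lapl_const_mul _ (c1.add c2), lapl_const_mul _ c3, lapl_add c1 c2, lapl_mul hre hre,
      lapl_mul him c2', lapl_mul him c3', lapl_sub contDiff_const him,
      lapl_sub contDiff_const him, dX_sub (differentiable_const _) him.diffl,
      dY_sub (differentiable_const _) him.diffl, dX_sub (differentiable_const _) him.diffl,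
      dY_sub (differentiable_const _) him.diffl]
    simp only [lapl_const, lre, lim, dX_re, dY_re, dX_im, dY_im, dX_const, dY_const]
    funext z; ring
  have lw : ∀ z, lapl w z = 1 / 2 * (lapl v z - lapl v (conj z)) := by
    intro z
    have := lapl_comp_affine hv B 0 (s := 1) (by simp [hB]) (by simp [hB]) (by simp [hB]) z
    simp only [w]
    rw [lapl_const_mul _ (hv.sub hc), lapl_sub hv hc]
    simp only [this]
    simp only [hB, zero_add, one_smul]
  let K : Set ℂ := Icc (-d) d ×ℂ Icc 0 d
  let U : Set ℂ := Ioo (-d) d ×ℂ Ioo 0 d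
  have hKn : ∀ z ∈ K, ‖z‖ ≤ 2 * d := by
    rintro z ⟨⟨h1, h2⟩, h3, h4⟩
    have := Complex.norm_le_abs_re_add_abs_im z
    have a1 : |z.re| ≤ d := abs_le.2 ⟨h1, h2⟩
    have a2 : |z.im| ≤ d := abs_le.2 ⟨by linarith [show (0:ℝ) ≤ z.im from h3], h4⟩
    linarith
  have hKc : ∀ z ∈ K, ‖conj z‖ ≤ 2 * d := fun z hz => by simpa using hKn z hz
  have main : ∀ z ∈ K, 0 ≤ p z - w z := by
    have hUK : U ⊆ K := fun z hz => ⟨Ioo_subset_Icc_self hz.1, Ioo_subset_Icc_self hz.2⟩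
    refine min_principle (hp.sub hw) (isCompact_Icc.reProdIm isCompact_Icc)
      (isOpen_Ioo.reProdIm isOpen_Ioo) hUK ?_ ?_
    · intro z hz hzU
      have hb1 := hM z (hKn z hz)
      have hb2 := hM _ (hKc z hz)
      have hwle : w z ≤ M := by
        simp only [w, hB, zero_add]; linarith [abs_le.1 hb1, abs_le.1 hb2]
      obtain ⟨⟨h1, h2⟩, h3 : 0 ≤ z.im, h4 : z.im ≤ d⟩ := hz
      rcases eq_or_lt_of_le h3 with h0 | h0
      · have : conj z = z := by apply Complex.ext <;> simp [← h0]
        have hw0 : w z = 0 := by simp [w, hB, this]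
        rw [hw0, sub_zero]
        simp only [p, ← h0]
        have := mul_self_nonneg z.re
        have : 0 ≤ M / d ^ 2 := by positivity
        simp; positivity
      · have hMd : M = M / d ^ 2 * d ^ 2 := by field_simp
        have hq : 0 ≤ F * (z.im * (d - z.im)) := by
          have := sub_nonneg.2 h4; positivity
        have hr : d ^ 2 ≤ z.re * z.re + z.im * (2 * d - z.im) := by
          by_contra! hlt
          apply hzU
          refine ⟨⟨?_, ?_⟩, h0, ?_⟩
          · refine lt_of_le_of_ne h1 (fun h => ?_); nlinarith
          · refine lt_of_le_of_ne h2 (fun h => ?_); nlinarith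
          · refine lt_of_le_of_ne h4 (fun h => ?_); nlinarith [mul_self_nonneg z.re]
        have : M ≤ M / d ^ 2 * (z.re * z.re + z.im * (2 * d - z.im)) := by
          conv_lhs => rw [hMd]
          gcongr
        simp only [p]; linarith
    · intro z hz _
      have b1 := hL z (hKn z (hUK hz))
      have b2 := hL _ (hKc z (hUK hz))
      rw [lapl_sub hp hw]
      simp only [lp, lw]
      linarith [abs_le.1 b1, abs_le.1 b2]
  have hder : HasDerivAt (fun t : ℝ => w (0 + t * Complex.I)) (dY w (0 + (0:ℝ) * Complex.I)) 0 :=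
    hasDerivAt_line hw 0 Complex.I 0
  have e : dY w 0 = dY v 0 := by
    have := fderiv_comp_affine hv.diffl B 0 0 Complex.I
    have h2 : dY (fun z => v (0 + B z)) 0 = - dY v 0 := by
      simp only [dY] at this ⊢; rw [this]; simp [hB]
    simp only [w]
    rw [dY_const_mul _ (hv.sub hc).diffl, dY_sub hv.diffl hc.diffl]
    simp only [h2]; ring
  rw [← e]
  simp only [Complex.ofReal_zero, zero_mul, add_zero] at hder
  refine deriv_le_of_le_mul hd (by simp [w]) ?_ hder
  intro y hy
  have hyK : (0 + (y : ℂ) * Complex.I) ∈ K := by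
    constructor
    · simp [hd.le]
    · simp [hy.1.le, hy.2.le]
  have := main _ hyK
  simp only [p] at this
  simp at this
  have h2 : M / d ^ 2 * (y * (2 * d - y)) ≤ 2 * M / d * y := by
    have : 2 * M / d * y = M / d ^ 2 * (y * (2 * d)) := by field_simp
    rw [this]
    have := hy.1
    gcongr; linarith
  have h3 : F * (y * (d - y)) ≤ d * F * y := by nlinarith [hy.1, mul_pos hF hy.1]
  simp only [zero_add] at this ⊢
  linarith

/-- Interior gradient estimate. -/
theorem abs_dX_dY_le {v : ℂ → ℝ} (hv : ContDiff ℝ ∞ v) {d M F : ℝ} (hd : 0 < d) (hF : 0 < F)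
    (z0 : ℂ) (hM : ∀ z ∈ closedBall z0 (2 * d), |v z| ≤ M)
    (hL : ∀ z ∈ closedBall z0 (2 * d), |lapl v z| ≤ F) :
    |dX v z0| ≤ 2 * M / d + d * F ∧ |dY v z0| ≤ 2 * M / d + d * F := by
  have key : ∀ A : ℂ →L[ℝ] ℂ, (∀ z, ‖A z‖ = ‖z‖) →
      (A 1).re ^ 2 + (A Complex.I).re ^ 2 = 1 → (A 1).im ^ 2 + (A Complex.I).im ^ 2 = 1 →
      (A 1).re * (A 1).im + (A Complex.I).re * (A Complex.I).im = 0 →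
      (A Complex.I).re * dX v z0 + (A Complex.I).im * dY v z0 ≤ 2 * M / d + d * F := by
    intro A hA h1 h2 h3
    have hin : ∀ z, ‖z‖ ≤ 2 * d → z0 + A z ∈ closedBall z0 (2 * d) := fun z hz => by
      simpa [hA] using hz
    have := dY_zero_le (contDiff_comp_affine hv A z0) hd hF (fun z hz => hM _ (hin z hz))
      (fun z hz => by
        rw [lapl_comp_affine hv A z0 h1 h2 h3, one_smul]; exact hL _ (hin z hz))
    have e := fderiv_comp_affine hv.diffl A z0 0 Complex.I
    simp only [map_zero, add_zero, smul_eq_mul] at e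
    rw [← e]; exact this
  have mulA : ∀ c : ℂ, ‖c‖ = 1 → ∀ z, ‖(ContinuousLinearMap.mul ℝ ℂ c) z‖ = ‖z‖ := by
    intro c hc z; simp [hc]
  have k1 := key (ContinuousLinearMap.mul ℝ ℂ 1) (mulA 1 (by simp)) (by simp) (by simp) (by simp)
  have k2 := key (ContinuousLinearMap.mul ℝ ℂ (-1)) (mulA (-1) (by simp)) (by simp) (by simp)
    (by simp)
  have k3 := key (ContinuousLinearMap.mul ℝ ℂ Complex.I) (mulA Complex.I (by simp)) (by simp)
    (by simp) (by simp)
  have k4 := key (ContinuousLinearMap.mul ℝ ℂ (-Complex.I)) (mulA (-Complex.I) (by simp))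
    (by simp) (by simp) (by simp)
  simp at k1 k2 k3 k4
  exact ⟨abs_le.2 ⟨by linarith, k4⟩, abs_le.2 ⟨by linarith, k1⟩⟩

theorem norm_fderiv_le_dX_dY {E : Type*} [NormedAddCommGroup E] [NormedSpace ℝ E]
    (f : ℂ → E) (z : ℂ) : ‖fderiv ℝ f z‖ ≤ ‖dX f z‖ + ‖dY f z‖ := by
  refine ContinuousLinearMap.opNorm_le_bound _ (by positivity) fun w => ?_
  rw [fderiv_eq_dX_dY]
  refine (norm_add_le _ _).trans ?_
  rw [norm_smul, norm_smul, add_mul, mul_comm, mul_comm ‖w.im‖]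
  have h1 := Complex.abs_re_le_norm w
  have h2 := Complex.abs_im_le_norm w
  simp only [Real.norm_eq_abs]
  gcongr

theorem norm_sub_le_of_partial {E : Type*} [NormedAddCommGroup E] [NormedSpace ℝ E]
    {f : ℂ → E} (hf : Differentiable ℝ f) {s : Set ℂ} (hs : Convex ℝ s) {G : ℝ}
    (h : ∀ z ∈ s, ‖dX f z‖ ≤ G ∧ ‖dY f z‖ ≤ G) {x y : ℂ} (hx : x ∈ s) (hy : y ∈ s) :
    ‖f y - f x‖ ≤ 2 * G * ‖y - x‖ :=
  hs.norm_image_sub_le_of_norm_fderiv_le (fun z _ => hf z)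
    (fun z hz => (norm_fderiv_le_dX_dY f z).trans (by linarith [h z hz])) hx hy

theorem contDiff_inv_normSq (w : ℂ) {τ : ℝ} (hτ : 0 < τ) :
    ContDiff ℝ ∞ (fun z : ℂ => (Complex.normSq (z - w) + τ)⁻¹) :=
  ((contDiff_normSq_sub w).add contDiff_const).inv
    (fun _ => (add_pos_of_nonneg_of_pos (Complex.normSq_nonneg _) hτ).ne')

theorem lapl_inv_normSq (w : ℂ) {τ : ℝ} (hτ : 0 < τ) :
    lapl (fun z : ℂ => (Complex.normSq (z - w) + τ)⁻¹) = fun z =>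
      4 * (Complex.normSq (z - w) - τ) / (Complex.normSq (z - w) + τ) ^ 3 := by
  have h1 : ∀ s : ℝ, 0 ≤ s → HasDerivAt (fun s => (s + τ)⁻¹) (-((s + τ) ^ 2)⁻¹) s := by
    intro s hs
    have := ((hasDerivAt_id s).add_const τ).fun_inv (by simp; positivity)
    exact this.congr_deriv (by simp [neg_div])
  have h2 : ∀ s : ℝ, 0 ≤ s →
      HasDerivAt (fun s => -((s + τ) ^ 2)⁻¹) (2 / (s + τ) ^ 3) s := by
    intro s hs
    have := ((((hasDerivAt_id s).add_const τ).pow 2).fun_inv (by simp; positivity)).fun_neg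
    refine this.congr_deriv ?_
    simp
    field_simp
  rw [lapl_radial w h1 h2]
  funext z
  have := Complex.normSq_nonneg (z - w)
  have : Complex.normSq (z - w) + τ ≠ 0 := by positivity
  field_simp
  ring

/-- Harnack's inequality for positive functions with small relative Laplacian. -/
theorem harnack {v : ℂ → ℝ} (hv : ContDiff ℝ ∞ v) {z0 : ℂ}
    (hpos : ∀ z ∈ closedBall z0 100, 0 < v z)
    (hl : ∀ z ∈ closedBall z0 100, |lapl v z| ≤ 1 / 5000 * v z)
    {x y : ℂ} (hx : x ∈ closedBall z0 12) (hy : y ∈ closedBall z0 12) :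
    v x ≤ 10 ^ 7 * v y := by
  obtain ⟨x0, hx0, hmax⟩ := (isCompact_closedBall z0 20).exists_isMaxOn
    ⟨z0, by simp⟩ (f := fun z => (20 - dist z z0) ^ 2 * v z)
    (by have := hv.continuous; fun_prop)
  have hmax' : ∀ z ∈ closedBall z0 20,
    (20 - dist z z0) ^ 2 * v z ≤ (20 - dist x0 z0) ^ 2 * v x0 := fun z hz => hmax hz
  rw [mem_closedBall] at hx hy
  set d := 20 - dist x0 z0 with hd
  have hx0' : dist x0 z0 ≤ 20 := hx0
  have hd20 : d ≤ 20 := by linarith [dist_nonneg (x := x0) (y := z0)]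
  have hvx : 0 < v x := hpos _ (by rw [mem_closedBall]; linarith)
  have hvx0 : 0 < v x0 := hpos _ (by rw [mem_closedBall]; linarith)
  have hm1 : 64 * v x ≤ d ^ 2 * v x0 := by
    refine le_trans ?_ (hmax' x (by rw [mem_closedBall]; linarith))
    gcongr; nlinarith
  have hd0 : 0 < d := by
    refine lt_of_le_of_ne (by linarith) fun h => ?_
    rw [← h] at hm1; nlinarith
  have hb1 : ∀ z ∈ closedBall x0 (d / 2), v z ≤ 4 * v x0 := by
    intro z hz
    rw [mem_closedBall] at hz
    have ht := dist_triangle z x0 z0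
    have hz20 : dist z z0 ≤ 20 := by linarith
    have h1 := hmax' z hz20
    have hvz : 0 < v z := hpos _ (by rw [mem_closedBall]; linarith)
    have h2 : (d / 2) ^ 2 * v z ≤ (20 - dist z z0) ^ 2 * v z := by
      gcongr; linarith
    have h3 : d ^ 2 * v z ≤ d ^ 2 * (4 * v x0) := by nlinarith
    exact le_of_mul_le_mul_left h3 (by positivity)
  have hsub : ∀ z ∈ closedBall x0 70, z ∈ closedBall z0 100 := by
    intro z hz
    rw [mem_closedBall] at hz ⊢
    linarith [dist_triangle z x0 z0]
  have hgrad : ∀ z ∈ closedBall x0 (d / 4), |dX v z| ≤ 65 * v x0 / d ∧ |dY v z| ≤ 65 * v x0 / d := by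
    intro z hz
    rw [mem_closedBall] at hz
    have hin : ∀ w ∈ closedBall z (2 * (d / 8)), w ∈ closedBall x0 (d / 2) := by
      intro w hw
      rw [mem_closedBall] at hw ⊢
      linarith [dist_triangle w z x0]
    have hin2 : ∀ w ∈ closedBall x0 (d / 2), w ∈ closedBall z0 100 := by
      intro w hw
      apply hsub
      rw [mem_closedBall] at hw ⊢; linarith
    have hg := abs_dX_dY_le hv (d := d / 8) (M := 4 * v x0) (F := v x0 / 1000) (by positivity)
      (by positivity) z (fun w hw => by
        rw [abs_of_pos (hpos _ (hin2 _ (hin w hw)))]; exact hb1 _ (hin w hw))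
      (fun w hw => by
        have h1 := hl _ (hin2 _ (hin w hw))
        have h2 := hb1 _ (hin w hw)
        linarith)
    have hc : 2 * (4 * v x0) / (d / 8) + d / 8 * (v x0 / 1000) ≤ 65 * v x0 / d := by
      have e : 2 * (4 * v x0) / (d / 8) + d / 8 * (v x0 / 1000) =
        (64 * v x0 + d ^ 2 / 8000 * v x0) / d := by field_simp; ring
      rw [e]; gcongr
      have : d ^ 2 / 8000 ≤ 1 := by nlinarith
      nlinarith
    exact ⟨hg.1.trans hc, hg.2.trans hc⟩
  have hhalf : ∀ z ∈ closedBall x0 (d / 260), v x0 / 2 ≤ v z := by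
    intro z hz
    have h1 := norm_sub_le_of_partial hv.diffl (convex_closedBall x0 (d / 4)) hgrad
      (mem_closedBall_self (by positivity)) (closedBall_subset_closedBall (by linarith) hz)
    rw [mem_closedBall, dist_eq_norm] at hz
    have h2 : 2 * (65 * v x0 / d) * ‖z - x0‖ ≤ v x0 / 2 := by
      calc 2 * (65 * v x0 / d) * ‖z - x0‖ ≤ 2 * (65 * v x0 / d) * (d / 260) := by gcongr
        _ = v x0 / 2 := by field_simp; norm_num
    rw [Real.norm_eq_abs] at h1
    linarith [abs_le.1 (h1.trans h2)]
  set τ := (d / 260) ^ 2 / 2 with hτ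
  have hτ0 : 0 < τ := by positivity
  set η := τ * v x0 / 2 with hη
  have hη0 : 0 < η := by positivity
  have hbar := contDiff_inv_normSq x0 hτ0
  have hbs : ContDiff ℝ ∞ fun z => (Complex.normSq (z - x0) + τ)⁻¹ - 1 / 4900 :=
    hbar.sub contDiff_const
  have hns : ∀ z, Complex.normSq (z - x0) = dist z x0 ^ 2 := by
    intro z; rw [Complex.normSq_eq_norm_sq, dist_eq_norm]
  have hU : IsOpen (ball x0 70 \ closedBall x0 (d / 260)) := isOpen_ball.sdiff isClosed_closedBall
  have main := min_principle (hv.sub (contDiff_const.mul hbs : ContDiff ℝ ∞ fun z => η * _))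
    (isCompact_closedBall x0 70) hU (fun z hz => ball_subset_closedBall hz.1) ?_ ?_ y ?_
  · have hyx : dist y x0 ≤ 32 := by linarith [dist_triangle y z0 x0, dist_comm z0 x0]
    have h1 : 1 / 1100 ≤ (Complex.normSq (y - x0) + τ)⁻¹ := by
      rw [one_div]
      have : Complex.normSq (y - x0) + τ ≤ 1100 := by
        rw [hns]
        have := dist_nonneg (x := y) (y := x0)
        nlinarith
      have h0 := Complex.normSq_nonneg (y - x0)
      gcongr
    have h2 : η * (1 / 2000) ≤ η * ((Complex.normSq (y - x0) + τ)⁻¹ - 1 / 4900) := by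
      gcongr; linarith
    have h3 : η * (1 / 2000) = d ^ 2 * v x0 / (260 ^ 2 * 8000) := by
      rw [hη, hτ]; ring
    have h4 : 64 * v x / (260 ^ 2 * 8000) ≤ v y := by
      calc _ ≤ d ^ 2 * v x0 / (260 ^ 2 * 8000) := by gcongr
        _ ≤ v y := by linarith
    rw [div_le_iff₀ (by norm_num)] at h4
    linarith
  · intro z hz hzU
    by_cases h70 : dist z x0 < 70
    · have hz' : z ∈ closedBall x0 (d / 260) := by
        by_contra h; exact hzU ⟨h70, h⟩
      have h1 := hhalf z hz'
      have h2 : (Complex.normSq (z - x0) + τ)⁻¹ ≤ τ⁻¹ := by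
        have := Complex.normSq_nonneg (z - x0)
        gcongr; linarith
      have h3 : η * ((Complex.normSq (z - x0) + τ)⁻¹ - 1 / 4900) ≤ η * τ⁻¹ := by
        gcongr; linarith
      have h4 : η * τ⁻¹ = v x0 / 2 := by rw [hη]; field_simp
      linarith
    · have h1 := hpos z (hsub z hz)
      have h2 : (Complex.normSq (z - x0) + τ)⁻¹ ≤ 1 / 4900 := by
        rw [one_div]; gcongr; rw [hns]; nlinarith
      nlinarith
  · intro z hz hneg
    rw [lapl_sub hv (contDiff_const.mul hbs), lapl_const_mul _ hbs, lapl_sub hbar contDiff_const,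
      lapl_inv_normSq x0 hτ0, lapl_const]
    have hz70 : dist z x0 < 70 := hz.1
    have hzd : d / 260 < dist z x0 := not_le.1 hz.2
    have hl' := (abs_le.1 (hl z (hsub z (ball_subset_closedBall hz.1)))).2
    have hs : 2 * τ ≤ Complex.normSq (z - x0) := by
      rw [hns, hτ]
      have : (d / 260) ^ 2 ≤ dist z x0 ^ 2 := by gcongr
      linarith
    have hs2 : Complex.normSq (z - x0) + τ < 5000 := by
      have hh : Complex.normSq (z - x0) ≤ 70 ^ 2 := by rw [hns]; gcongr
      have : τ ≤ 1 := by rw [hτ]; nlinarith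
      linarith
    set S := Complex.normSq (z - x0) with hS
    have hS0 : 0 < S + τ := by linarith
    have hv1 : v z < η * (S + τ)⁻¹ := by nlinarith
    have h5 : η / (S + τ) ^ 2 ≤ η * (4 * (S - τ) / (S + τ) ^ 3) := by
      rw [div_le_iff₀ (by positivity)]
      have : η * (4 * (S - τ) / (S + τ) ^ 3) * (S + τ) ^ 2 = η * (4 * (S - τ) / (S + τ)) := by
        field_simp
      rw [this]
      have : 1 ≤ 4 * (S - τ) / (S + τ) := by rw [le_div_iff₀ hS0]; linarith
      nlinarith
    have h6 : 1 / 5000 * (η * (S + τ)⁻¹) < η / (S + τ) ^ 2 := by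
      rw [lt_div_iff₀ (by positivity)]
      have : 1 / 5000 * (η * (S + τ)⁻¹) * (S + τ) ^ 2 = η * ((S + τ) / 5000) := by field_simp
      rw [this]
      nlinarith
    simp only [sub_zero]
    linarith
  · rw [mem_closedBall]; linarith [dist_triangle y z0 x0, dist_comm z0 x0]

theorem lapl_normSq_sub (w : ℂ) :
    lapl (fun z : ℂ => Complex.normSq (z - w)) = fun _ => 4 := by
  have := lapl_radial (g := fun s => s) (g' := fun _ => 1) (g'' := fun _ => 0) w
    (fun s _ => hasDerivAt_id s) (fun s _ => hasDerivAt_const s 1)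
  rw [this]; simp

theorem lt_center_of_lt_sphere {v V : ℂ → ℝ} (hv : ContDiff ℝ ∞ v) {l k r : ℝ} {z0 : ℂ}
    (hl : 0 < l) (hl' : l ≤ 1 / 100) (hk : 0 < k) (hV : ∀ z, |V z| ≤ l)
    (he : ∀ z, |lapl v z + V z * v z| ≤ l * k) (hr1 : 0 < r) (hr2 : r ≤ 2)
    (hs : ∀ p ∈ sphere z0 r, k < v p) : k / 4 < v z0 := by
  let n : ℂ → ℝ := fun z => Complex.normSq (z - z0)
  have hn : ContDiff ℝ ∞ n := contDiff_normSq_sub z0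
  have hnl : lapl n = fun _ => 4 := lapl_normSq_sub z0
  let A : ℂ → ℝ := fun z => 1 - l * n z
  let B : ℂ → ℝ := fun z => k / 2 * (1 - l * r ^ 2 + l * n z)
  have hA : ContDiff ℝ ∞ A := contDiff_const.sub (contDiff_const.mul hn)
  have hB' : ContDiff ℝ ∞ (fun z => 1 - l * r ^ 2 + l * n z) :=
    contDiff_const.add (contDiff_const.mul hn)
  have hB : ContDiff ℝ ∞ B := contDiff_const.mul hB'
  have lA : ∀ z, lapl A z = - 4 * l := by
    intro z
    simp only [A]
    rw [lapl_sub contDiff_const (contDiff_const.mul hn), lapl_const_mul _ hn, hnl, lapl_const]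
    ring
  have lB : ∀ z, lapl B z = 2 * k * l := by
    intro z
    simp only [B]
    rw [lapl_const_mul _ hB', lapl_add contDiff_const (contDiff_const.mul hn),
      lapl_const_mul _ hn, hnl, lapl_const]
    ring
  have hnd : ∀ z, n z = dist z z0 ^ 2 := fun z => by
    simp only [n]; rw [Complex.normSq_eq_norm_sq, dist_eq_norm]
  have hn4 : ∀ z ∈ closedBall z0 r, 0 ≤ n z ∧ n z ≤ r ^ 2 := by
    intro z hz
    rw [mem_closedBall] at hz
    rw [hnd]; exact ⟨by positivity, by gcongr⟩
  have hr4 : r ^ 2 ≤ 4 := by nlinarith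
  have hApos : ∀ z ∈ closedBall z0 r, 0 < A z := by
    intro z hz; have := hn4 z hz; simp only [A]; nlinarith
  let y : ℂ → ℝ := fun z => v z - B z
  have hy : ContDiff ℝ ∞ y := hv.sub hB
  have main : ∀ z ∈ closedBall z0 r, 0 ≤ y z := by
    obtain ⟨x, hx, hmin⟩ := (isCompact_closedBall z0 r).exists_isMinOn
      ⟨z0, by simp [hr1.le]⟩ (f := fun z => y z / A z)
      (hy.continuous.continuousOn.div hA.continuous.continuousOn fun z hz => (hApos z hz).ne')
    by_contra! hneg
    obtain ⟨z, hz, hzy⟩ := hneg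
    have h1 : y x / A x ≤ y z / A z := hmin hz
    have hneg : y x / A x < 0 := h1.trans_lt (div_neg_of_neg_of_pos hzy (hApos z hz))
    set t := -(y x / A x) with ht
    have ht0 : 0 < t := by linarith
    have hyx : y x = - t * A x := by rw [ht]; have := (hApos x hx).ne'; field_simp
    have hxb : x ∈ ball z0 r := by
      rcases (mem_closedBall.1 hx).lt_or_eq with h | h
      · exact h
      · exfalso
        have h2 := hs x h
        have : B x = k / 2 := by simp only [B, hnd, h]; ring
        have : 0 < y x := by simp only [y, this]; linarith
        have := div_pos this (hApos x hx)
        linarith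
    have hmin2 : IsLocalMin (fun z => y z + t * A z) x := by
      have : IsMinOn (fun z => y z + t * A z) (closedBall z0 r) x := by
        intro w hw
        have h2 : y x / A x ≤ y w / A w := hmin hw
        have h3 : -t * A w ≤ y w := by
          have := (le_div_iff₀ (hApos w hw)).1 (show - t ≤ y w / A w by rw [ht, neg_neg]; exact h2)
          exact this
        simp only [mem_ofPred_eq, hyx]; linarith
      exact this.isLocalMin (mem_of_superset (isOpen_ball.mem_nhds hxb) ball_subset_closedBall)
    have h4 := lapl_nonneg_of_isLocalMin (hy.add (contDiff_const.mul hA)) hmin2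
    rw [lapl_add hy (contDiff_const.mul hA), lapl_const_mul _ hA] at h4
    simp only [y] at h4
    rw [lapl_sub hv hB] at h4
    simp only [lA, lB] at h4
    have h5 := (abs_le.1 (he x)).2
    have h6 : v x = B x - t * A x := by simp only [y] at hyx; linarith
    have hVx := abs_le.1 (hV x)
    have hB1 : 0 ≤ B x ∧ B x ≤ k / 2 := by
      have := hn4 x hx
      simp only [B]; constructor
      · have : 0 ≤ 1 - l * r ^ 2 + l * n x := by nlinarith
        positivity
      · nlinarith [mul_pos hk hl]
    have hA1 : A x ≤ 1 := by have := hn4 x hx; simp only [A]; nlinarith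
    have hA0 := hApos x hx
    have h7 : - (l * (k / 2)) ≤ V x * B x := by nlinarith
    have h8 : V x * (t * A x) ≤ l * t := by
      have : t * A x ≤ t := by nlinarith
      have : 0 < t * A x := by positivity
      nlinarith
    rw [h6] at h5
    nlinarith [mul_pos hl hk, mul_pos hl ht0]
  have := main z0 (by simp [hr1.le])
  simp only [y, B, hnd, dist_self] at this
  have h9 : l * r ^ 2 ≤ 1 / 25 := by nlinarith
  nlinarith [mul_le_mul_of_nonneg_left h9 hk.le]

/-- A point where an approximate solution is tiny is surrounded by points on each small circle
where it is tiny. -/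
theorem exists_small_on_sphere {v V : ℂ → ℝ} (hv : ContDiff ℝ ∞ v) {l k r : ℝ} {z0 : ℂ}
    (hl : 0 < l) (hl' : l ≤ 1 / 100) (hk : 0 < k) (hV : ∀ z, |V z| ≤ l)
    (he : ∀ z, |lapl v z + V z * v z| ≤ l * k) (h0 : |v z0| ≤ k / 4) (hr1 : 0 < r) (hr2 : r ≤ 2) :
    ∃ p, dist p z0 = r ∧ |v p| ≤ k := by
  by_contra! hcon
  have hconn : IsPreconnected (sphere z0 r) :=
    isPreconnected_sphere (by rw [Complex.rank_real_complex]; norm_num) z0 r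
  have hdich : (∀ p ∈ sphere z0 r, 0 < v p) ∨ ∀ p ∈ sphere z0 r, v p < 0 := by
    by_contra! hc
    obtain ⟨⟨p, hp, hp'⟩, q, hq, hq'⟩ := hc
    obtain ⟨x, hx, hx0⟩ := hconn.intermediate_value hp hq hv.continuous.continuousOn
      (⟨hp', hq'⟩ : (0 : ℝ) ∈ Icc (v p) (v q))
    have := hcon x hx
    rw [hx0, abs_zero] at this; linarith
  have h0' := abs_le.1 h0
  rcases hdich with h | h
  · have := lt_center_of_lt_sphere hv hl hl' hk hV he hr1 hr2
      (fun p hp => by simpa [abs_of_pos (h p hp)] using hcon p hp)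
    linarith
  · have := lt_center_of_lt_sphere (v := fun z => - v z) (V := V) hv.neg hl hl' hk hV
      (fun z => by
        rw [lapl_neg, ← abs_neg]; convert he z using 2; ring) hr1 hr2
      (fun p hp => by simpa [abs_of_neg (h p hp)] using hcon p hp)
    linarith

/-- The Wirtinger derivative `∂/∂z̄`. -/
def dzb (f : ℂ → ℂ) (z : ℂ) : ℂ := (dX f z + Complex.I * dY f z) / 2

theorem hasCompactSupport_dX {E : Type*} [NormedAddCommGroup E] [NormedSpace ℝ E] {f : ℂ → E}
    (hf : HasCompactSupport f) : HasCompactSupport (dX f) := hf.fderiv_apply ℝ 1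
theorem hasCompactSupport_dY {E : Type*} [NormedAddCommGroup E] [NormedSpace ℝ E] {f : ℂ → E}
    (hf : HasCompactSupport f) : HasCompactSupport (dY f) := hf.fderiv_apply ℝ Complex.I

theorem hasCompactSupport_of {E F : Type*} [Zero E] [Zero F] {f : ℂ → E} {g : ℂ → F}
    (hg : HasCompactSupport g) (h : ∀ z, g z = 0 → f z = 0) : HasCompactSupport f :=
  hg.mono fun z hz h0 => hz (h z h0)

theorem integral_fderiv_eq_zero {f : ℂ → ℝ} (hf : ContDiff ℝ ∞ f) (hc : HasCompactSupport f)
    (w : ℂ) : ∫ z, fderiv ℝ f z w = 0 := by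
  have hi : Integrable (fun z => fderiv ℝ f z w) :=
    (((hf.fderiv_right (m := ∞) (by simp)).clm_apply contDiff_const).continuous
      ).integrable_of_hasCompactSupport (hc.fderiv_apply ℝ w)
  have := integral_mul_fderiv_eq_neg_fderiv_mul_of_integrable (μ := (volume : Measure ℂ))
    (f := f) (g := fun _ => (1 : ℝ)) (v := w) (by simpa using hi) (by simp)
    (by simpa using hf.continuous.integrable_of_hasCompactSupport hc) (fun x _ => hf.diffl x)
    (fun x _ => differentiableAt_const _)
  simp at this
  exact this

theorem dX_re_comp {F : ℂ → ℂ} (hF : Differentiable ℝ F) (z : ℂ) :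
    dX (fun z => (F z).re) z = (dX F z).re := by
  have := (Complex.reCLM.hasFDerivAt (x := F z)).comp z (hF z).hasFDerivAt
  change fderiv ℝ (Complex.reCLM ∘ F) z 1 = _
  rw [this.fderiv]; rfl
theorem dX_im_comp {F : ℂ → ℂ} (hF : Differentiable ℝ F) (z : ℂ) :
    dX (fun z => (F z).im) z = (dX F z).im := by
  have := (Complex.imCLM.hasFDerivAt (x := F z)).comp z (hF z).hasFDerivAt
  change fderiv ℝ (Complex.imCLM ∘ F) z 1 = _
  rw [this.fderiv]; rfl
theorem dY_re_comp {F : ℂ → ℂ} (hF : Differentiable ℝ F) (z : ℂ) :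
    dY (fun z => (F z).re) z = (dY F z).re := by
  have := (Complex.reCLM.hasFDerivAt (x := F z)).comp z (hF z).hasFDerivAt
  change fderiv ℝ (Complex.reCLM ∘ F) z _ = _
  rw [this.fderiv]; rfl
theorem dY_im_comp {F : ℂ → ℂ} (hF : Differentiable ℝ F) (z : ℂ) :
    dY (fun z => (F z).im) z = (dY F z).im := by
  have := (Complex.imCLM.hasFDerivAt (x := F z)).comp z (hF z).hasFDerivAt
  change fderiv ℝ (Complex.imCLM ∘ F) z _ = _
  rw [this.fderiv]; rfl
theorem contDiff_re_comp {F : ℂ → ℂ} (hF : ContDiff ℝ ∞ F) : ContDiff ℝ ∞ (fun z => (F z).re) :=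
  contDiff_re.comp hF
theorem contDiff_im_comp {F : ℂ → ℂ} (hF : ContDiff ℝ ∞ F) : ContDiff ℝ ∞ (fun z => (F z).im) :=
  contDiff_im.comp hF

/-- Carleman identity, in real form. -/
theorem carleman_real {g h Φ : ℂ → ℝ} (hg : ContDiff ℝ ∞ g) (hh : ContDiff ℝ ∞ h)
    (hΦ : ContDiff ℝ ∞ Φ) (cg : HasCompactSupport g) (ch : HasCompactSupport h) :
    1 / 2 * ∫ z, lapl Φ z * (g z ^ 2 + h z ^ 2) ≤
      1 / 4 * ∫ z, ((dX g z - dY h z - dX Φ z * g z + dY Φ z * h z) ^ 2 +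
        (dX h z + dY g z - dX Φ z * h z - dY Φ z * g z) ^ 2) := by
  have gx := contDiff_dX hg
  have gy := contDiff_dY hg
  have hx := contDiff_dX hh
  have hy := contDiff_dY hh
  have px := contDiff_dX hΦ
  have py := contDiff_dY hΦ
  let N : ℂ → ℝ := fun z => g z * g z + h z * h z
  have hN : ContDiff ℝ ∞ N := (hg.mul hg).add (hh.mul hh)
  have cN : HasCompactSupport N := (cg.mul_right).add ch.mul_right
  let P : ℂ → ℝ := fun z => h z * dY g z - (1 / 2 * dX Φ z) * N z
  let Q : ℂ → ℝ := fun z => - h z * dX g z - (1 / 2 * dY Φ z) * N z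
  have hP : ContDiff ℝ ∞ P := (hh.mul gy).sub ((contDiff_const.mul px).mul hN)
  have hQ : ContDiff ℝ ∞ Q := (hh.neg.mul gx).sub ((contDiff_const.mul py).mul hN)
  have cP : HasCompactSupport P := ch.mul_right.sub cN.mul_left
  have cQ : HasCompactSupport Q := (ch.neg.mul_right).sub cN.mul_left
  have iP : ∫ z, dX P z = 0 := integral_fderiv_eq_zero hP cP 1
  have iQ : ∫ z, dY Q z = 0 := integral_fderiv_eq_zero hQ cQ Complex.I
  have eNx : dX N = fun z => 2 * (g z * dX g z + h z * dX h z) := by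
    simp only [N]
    rw [dX_add (hg.mul hg).diffl (hh.mul hh).diffl, dX_mul hg.diffl hg.diffl,
      dX_mul hh.diffl hh.diffl]
    funext z; ring
  have eNy : dY N = fun z => 2 * (g z * dY g z + h z * dY h z) := by
    simp only [N]
    rw [dY_add (hg.mul hg).diffl (hh.mul hh).diffl, dY_mul hg.diffl hg.diffl,
      dY_mul hh.diffl hh.diffl]
    funext z; ring
  have eP : ∀ z, dX P z = h z * dX (dY g) z + dX h z * dY g z - (1 / 2 * dX Φ z * dX N z
      + 1 / 2 * dX (dX Φ) z * N z) := by
    intro z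
    simp only [P]
    rw [dX_sub (hh.mul gy).diffl ((contDiff_const.mul px).mul hN).diffl, dX_mul hh.diffl gy.diffl,
      dX_mul (contDiff_const.mul px).diffl hN.diffl, dX_const_mul _ px.diffl]
  have eQ : ∀ z, dY Q z = - h z * dX (dY g) z - dY h z * dX g z - (1 / 2 * dY Φ z * dY N z
      + 1 / 2 * dY (dY Φ) z * N z) := by
    intro z
    simp only [Q]
    rw [dY_sub (hh.neg.mul gx).diffl ((contDiff_const.mul py).mul hN).diffl,
      dY_mul hh.neg.diffl gx.diffl, dY_neg,
      dY_mul (contDiff_const.mul py).diffl hN.diffl, dY_const_mul _ py.diffl, dX_comm_dY hg]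
    ring
  have i1 : Integrable (fun z => lapl Φ z * (g z ^ 2 + h z ^ 2)) := by
    refine ((contDiff_lapl hΦ).continuous.mul (by
      have := hg.continuous; have := hh.continuous; fun_prop)).integrable_of_hasCompactSupport ?_
    refine hasCompactSupport_of cN fun z hz => ?_
    have : g z ^ 2 + h z ^ 2 = N z := by simp only [N]; ring
    change lapl Φ z * (g z ^ 2 + h z ^ 2) = 0
    rw [this, hz, mul_zero]
  have iPi : Integrable (fun z => dX P z) :=
    (contDiff_dX hP).continuous.integrable_of_hasCompactSupport (hasCompactSupport_dX cP)
  have iQi : Integrable (fun z => dY Q z) :=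
    (contDiff_dY hQ).continuous.integrable_of_hasCompactSupport (hasCompactSupport_dY cQ)
  have hR : ∀ z, 1 / 4 * ((dX g z - dY h z - dX Φ z * g z + dY Φ z * h z) ^ 2 +
        (dX h z + dY g z - dX Φ z * h z - dY Φ z * g z) ^ 2) =
      1 / 4 * ((dX g z + dY h z + dX Φ z * g z + dY Φ z * h z) ^ 2 +
        (dX h z - dY g z + dX Φ z * h z - dY Φ z * g z) ^ 2) +
      (1 / 2 * (lapl Φ z * (g z ^ 2 + h z ^ 2)) + (dX P z + dY Q z)) := by
    intro z
    rw [eP, eQ, eNx, eNy]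
    simp only [N, lapl]
    ring
  rw [← integral_const_mul, ← integral_const_mul]
  have e0 : ∫ z, 1 / 2 * (lapl Φ z * (g z ^ 2 + h z ^ 2)) =
      ∫ z, (1 / 2 * (lapl Φ z * (g z ^ 2 + h z ^ 2)) + (dX P z + dY Q z)) := by
    rw [integral_add (i1.const_mul _) (iPi.fun_add iQi), integral_add iPi iQi, iP, iQ]; ring
  rw [e0]
  refine integral_mono ((i1.const_mul _).add (iPi.add iQi)) ?_ (fun z => ?_)
  · have c1 : HasCompactSupport (fun z => dX g z - dY h z - dX Φ z * g z + dY Φ z * h z) :=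
      (((hasCompactSupport_dX cg).sub (hasCompactSupport_dY ch)).sub cg.mul_left).add ch.mul_left
    have c2 : HasCompactSupport (fun z => dX h z + dY g z - dX Φ z * h z - dY Φ z * g z) :=
      (((hasCompactSupport_dX ch).add (hasCompactSupport_dY cg)).sub ch.mul_left).sub cg.mul_left
    refine Continuous.integrable_of_hasCompactSupport ?_ ?_
    · have := hg.continuous; have := hh.continuous; have := gx.continuous; have := gy.continuous
      have := hx.continuous; have := hy.continuous; have := px.continuous; have := py.continuous
      fun_prop
    · refine HasCompactSupport.intro (c1.isCompact.union c2.isCompact) fun z hz => ?_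
      rw [mem_union, not_or] at hz
      have e1 := image_eq_zero_of_notMem_tsupport hz.1
      have e2 := image_eq_zero_of_notMem_tsupport hz.2
      rw [e1, e2]; ring
  · change _ ≤ 1 / 4 * _
    rw [hR]
    have : 0 ≤ 1 / 4 * ((dX g z + dY h z + dX Φ z * g z + dY Φ z * h z) ^ 2 +
        (dX h z - dY g z + dX Φ z * h z - dY Φ z * g z) ^ 2) := by positivity
    linarith

/-- Carleman inequality for `∂/∂z̄`. -/
theorem carleman {F : ℂ → ℂ} {Φ : ℂ → ℝ} (hF : ContDiff ℝ ∞ F) (cF : HasCompactSupport F)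
    (hΦ : ContDiff ℝ ∞ Φ) :
    1 / 2 * ∫ z, lapl Φ z * (‖F z‖ ^ 2 * Real.exp (2 * Φ z)) ≤
      ∫ z, ‖dzb F z‖ ^ 2 * Real.exp (2 * Φ z) := by
  have hp := contDiff_re_comp hF
  have hq := contDiff_im_comp hF
  have he : ContDiff ℝ ∞ (fun z => Real.exp (Φ z)) := hΦ.exp
  have cp : HasCompactSupport (fun z => (F z).re) := cF.comp_left (g := Complex.re) rfl
  have cq : HasCompactSupport (fun z => (F z).im) := cF.comp_left (g := Complex.im) rfl
  have ex : dX (fun z => Real.exp (Φ z)) = fun z => dX Φ z * Real.exp (Φ z) :=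
    dX_comp hΦ.diffl (fun z => Real.hasDerivAt_exp _)
  have ey : dY (fun z => Real.exp (Φ z)) = fun z => dY Φ z * Real.exp (Φ z) :=
    dY_comp hΦ.diffl (fun z => Real.hasDerivAt_exp _)
  have := carleman_real (hp.mul he) (hq.mul he) hΦ cp.mul_right cq.mul_right
  rw [dX_mul hp.diffl he.diffl, dX_mul hq.diffl he.diffl, dY_mul hp.diffl he.diffl,
    dY_mul hq.diffl he.diffl, ex, ey, ← integral_const_mul (1 / 4)] at this
  have e2 : ∀ z, Real.exp (2 * Φ z) = Real.exp (Φ z) ^ 2 := by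
    intro z; rw [← Real.exp_nat_mul]; norm_num
  convert this using 1
  · congr 2
    funext z
    rw [← Complex.normSq_eq_norm_sq, Complex.normSq_apply, e2]; ring
  · congr 1
    funext z
    simp only []
    rw [← Complex.normSq_eq_norm_sq, Complex.normSq_apply, e2, dX_re_comp hF.diffl,
      dX_im_comp hF.diffl, dY_re_comp hF.diffl, dY_im_comp hF.diffl]
    simp [dzb]
    ring

/-- Convolution of a density `ρ` with a kernel `L`. -/
def cv {𝕜 E : Type} [RCLike 𝕜] [NormedAddCommGroup E] [NormedSpace ℝ E] [NormedSpace 𝕜 E]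
    (ρ : ℂ → 𝕜) (L : ℂ → E) (z : ℂ) : E := ∫ ξ, ρ ξ • L (z - ξ)

section cv
variable {𝕜 E : Type} [RCLike 𝕜] [NormedAddCommGroup E] [NormedSpace 𝕜 E]
  {ρ : ℂ → 𝕜} {L : ℂ → E}

theorem cv_integrable (hρ : Integrable ρ) (cρ : HasCompactSupport ρ) (hL : Continuous L) (z : ℂ) :
    Integrable (fun ξ => ρ ξ • L (z - ξ)) := by
  have hK : IsCompact (tsupport ρ) := cρ
  obtain ⟨C, hC⟩ := hK.exists_bound_of_continuousOn
    (f := fun ξ => L (z - ξ)) (by fun_prop)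
  refine (hρ.norm.mul_const C).mono' (hρ.aestronglyMeasurable.smul
    (by fun_prop : Continuous fun ξ => L (z - ξ)).aestronglyMeasurable)
    (Eventually.of_forall fun ξ => ?_)
  rw [norm_smul]
  by_cases h : ξ ∈ tsupport ρ
  · exact mul_le_mul_of_nonneg_left (hC ξ h) (norm_nonneg _)
  · simp [image_eq_zero_of_notMem_tsupport h]

variable [NormedSpace ℝ E] [SMulCommClass ℝ 𝕜 E]

theorem cv_hasFDerivAt (hρ : Integrable ρ) (cρ : HasCompactSupport ρ) (hL : ContDiff ℝ ∞ L)
    (z : ℂ) : HasFDerivAt (cv ρ L) (cv ρ (fderiv ℝ L) z) z := by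
  have hL' : Continuous (fderiv ℝ L) := hL.continuous_fderiv (by simp)
  have hK : IsCompact (tsupport ρ) := cρ
  obtain ⟨C, hC⟩ := ((isCompact_closedBall z 1).prod hK).exists_bound_of_continuousOn
    (f := fun p : ℂ × ℂ => fderiv ℝ L (p.1 - p.2)) (by fun_prop)
  refine hasFDerivAt_integral_of_dominated_of_fderiv_le (s := closedBall z 1)
    (F := fun z ξ => ρ ξ • L (z - ξ))
    (F' := fun z ξ => ρ ξ • fderiv ℝ L (z - ξ)) (bound := fun ξ => ‖ρ ξ‖ * C)
    (closedBall_mem_nhds z one_pos) (Eventually.of_forall fun y =>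
      (cv_integrable hρ cρ hL.continuous y).aestronglyMeasurable)
    (cv_integrable hρ cρ hL.continuous z)
    (cv_integrable hρ cρ hL' z).aestronglyMeasurable (Eventually.of_forall fun ξ y hy => ?_)
    (hρ.norm.mul_const C) (Eventually.of_forall fun ξ y _ => ?_)
  · rw [norm_smul]
    by_cases h : ξ ∈ tsupport ρ
    · exact mul_le_mul_of_nonneg_left (hC (y, ξ) ⟨hy, h⟩) (norm_nonneg _)
    · simp [image_eq_zero_of_notMem_tsupport h]
  · have h1 : HasFDerivAt (fun y => L (y - ξ)) (fderiv ℝ L (y - ξ)) y := by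
      have := (hL.diffl (y - ξ)).hasFDerivAt.comp y ((hasFDerivAt_id y).sub_const ξ)
      rw [ContinuousLinearMap.comp_id] at this
      exact this
    exact h1.const_smul (ρ ξ)

end cv

theorem cv_contDiff_nat {𝕜 : Type} [RCLike 𝕜] {ρ : ℂ → 𝕜} (hρ : Integrable ρ)
    (cρ : HasCompactSupport ρ) (n : ℕ) :
    ∀ {E : Type} [NormedAddCommGroup E] [NormedSpace ℝ E] [NormedSpace 𝕜 E] [SMulCommClass ℝ 𝕜 E]
    {L : ℂ → E}, ContDiff ℝ ∞ L → ContDiff ℝ n (cv ρ L) := by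
  induction n with
  | zero =>
    intro E _ _ _ _ L hL
    exact contDiff_zero.2 (continuous_iff_continuousAt.2 fun z =>
      (cv_hasFDerivAt hρ cρ hL z).continuousAt)
  | succ n ih =>
    intro E _ _ _ _ L hL
    have e : fderiv ℝ (cv ρ L) = cv ρ (fderiv ℝ L) := funext fun z => (cv_hasFDerivAt hρ cρ hL z).fderiv
    rw [show ((n + 1 : ℕ) : WithTop ℕ∞) = (n : WithTop ℕ∞) + 1 by norm_cast, contDiff_succ_iff_fderiv]
    refine ⟨fun z => (cv_hasFDerivAt hρ cρ hL z).differentiableAt, by simp, ?_⟩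
    rw [e]
    exact ih (hL.fderiv_right (by simp))

section cv2
variable {𝕜 E : Type} [RCLike 𝕜] [NormedAddCommGroup E] [NormedSpace ℝ E] [NormedSpace 𝕜 E]
  {ρ : ℂ → 𝕜} {L : ℂ → E} [SMulCommClass ℝ 𝕜 E]

theorem cv_contDiff (hρ : Integrable ρ) (cρ : HasCompactSupport ρ) (hL : ContDiff ℝ ∞ L) :
    ContDiff ℝ ∞ (cv ρ L) := contDiff_infty.2 fun n => cv_contDiff_nat hρ cρ n hL

theorem cv_fderiv_apply (hρ : Integrable ρ) (cρ : HasCompactSupport ρ) (hL : ContDiff ℝ ∞ L)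
    (z w : ℂ) : fderiv ℝ (cv ρ L) z w = cv ρ (fun ξ => fderiv ℝ L ξ w) z := by
  rw [(cv_hasFDerivAt hρ cρ hL z).fderiv]
  exact ContinuousLinearMap.integral_apply
    (cv_integrable hρ cρ (hL.continuous_fderiv (by simp)) z) w

theorem cv_dX (hρ : Integrable ρ) (cρ : HasCompactSupport ρ) (hL : ContDiff ℝ ∞ L) :
    dX (cv ρ L) = cv ρ (dX L) := funext fun z => cv_fderiv_apply hρ cρ hL z 1

theorem cv_dY (hρ : Integrable ρ) (cρ : HasCompactSupport ρ) (hL : ContDiff ℝ ∞ L) :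
    dY (cv ρ L) = cv ρ (dY L) := funext fun z => cv_fderiv_apply hρ cρ hL z Complex.I

theorem cv_lapl (hρ : Integrable ρ) (cρ : HasCompactSupport ρ) (hL : ContDiff ℝ ∞ L) (z : ℂ) :
    lapl (cv ρ L) z = cv ρ (lapl L) z := by
  unfold lapl
  rw [cv_dX hρ cρ hL, cv_dY hρ cρ hL, cv_dX hρ cρ (contDiff_dX hL), cv_dY hρ cρ (contDiff_dY hL)]
  have h1 := cv_integrable hρ cρ (contDiff_dX (contDiff_dX hL)).continuous z
  have h2 := cv_integrable hρ cρ (contDiff_dY (contDiff_dY hL)).continuous z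
  unfold cv
  rw [← integral_add h1 h2]
  simp only [smul_add]

end cv2

theorem dX_comp_sub {E : Type*} [NormedAddCommGroup E] [NormedSpace ℝ E] (f : ℂ → E) (p z : ℂ) :
    dX (fun z => f (z - p)) z = dX f (z - p) := by
  unfold dX; rw [fderiv_comp_sub]
theorem dY_comp_sub {E : Type*} [NormedAddCommGroup E] [NormedSpace ℝ E] (f : ℂ → E) (p z : ℂ) :
    dY (fun z => f (z - p)) z = dY f (z - p) := by
  unfold dY; rw [fderiv_comp_sub]
theorem lapl_comp_sub {E : Type*} [NormedAddCommGroup E] [NormedSpace ℝ E] (f : ℂ → E) (p z : ℂ) :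
    lapl (fun z => f (z - p)) z = lapl f (z - p) := by
  unfold lapl
  rw [funext (dX_comp_sub f p), funext (dY_comp_sub f p), dX_comp_sub (dX f), dY_comp_sub (dY f)]

theorem dX_ofReal {f : ℂ → ℝ} (hf : Differentiable ℝ f) :
    dX (fun z => (f z : ℂ)) = fun z => ((dX f z : ℝ) : ℂ) := by
  funext z
  have := (Complex.ofRealCLM.hasFDerivAt (x := f z)).comp z (hf z).hasFDerivAt
  change fderiv ℝ (Complex.ofRealCLM ∘ f) z _ = _
  rw [this.fderiv]; rfl
theorem dY_ofReal {f : ℂ → ℝ} (hf : Differentiable ℝ f) :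
    dY (fun z => (f z : ℂ)) = fun z => ((dY f z : ℝ) : ℂ) := by
  funext z
  have := (Complex.ofRealCLM.hasFDerivAt (x := f z)).comp z (hf z).hasFDerivAt
  change fderiv ℝ (Complex.ofRealCLM ∘ f) z _ = _
  rw [this.fderiv]; rfl
theorem contDiff_ofReal {f : ℂ → ℝ} (hf : ContDiff ℝ ∞ f) : ContDiff ℝ ∞ (fun z => (f z : ℂ)) :=
  Complex.ofRealCLM.contDiff.comp hf

/-- Regularised logarithmic kernel. -/
def ell (δ : ℝ) (z : ℂ) : ℝ := 1 / 2 * Real.log (Complex.normSq z + δ ^ 2)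

/-- The mass distribution of the regularised logarithm (up to a factor `π`). -/
def qk (δ : ℝ) (z : ℂ) : ℝ := δ ^ 2 / (Complex.normSq z + δ ^ 2) ^ 2

/-- Regularised Cauchy kernel. -/
def kk (δ : ℝ) (z : ℂ) : ℂ := conj z / (Complex.normSq z + δ ^ 2 : ℝ)

theorem contDiff_normSq : ContDiff ℝ ∞ (fun z : ℂ => Complex.normSq z) := by
  simpa using contDiff_normSq_sub 0

section
variable {δ : ℝ} (hδ : 0 < δ)
include hδ

theorem ns_pos (z : ℂ) : 0 < Complex.normSq z + δ ^ 2 := by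
  have := Complex.normSq_nonneg z; positivity

theorem contDiff_ell : ContDiff ℝ ∞ (ell δ) :=
  contDiff_const.mul (((contDiff_normSq).add contDiff_const).log fun z => (ns_pos hδ z).ne')

theorem contDiff_qk : ContDiff ℝ ∞ (qk δ) :=
  contDiff_const.div (((contDiff_normSq).add contDiff_const).pow 2)
    fun z => (pow_pos (ns_pos hδ z) 2).ne'

theorem qk_nonneg (z : ℂ) : 0 ≤ qk δ z := by unfold qk; positivity

theorem hasDerivAt_ell_aux {s : ℝ} (hs : 0 ≤ s) :
    HasDerivAt (fun s => 1 / 2 * Real.log (s + δ ^ 2)) (1 / 2 * (s + δ ^ 2)⁻¹) s := by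
  have h : s + δ ^ 2 ≠ 0 := by positivity
  have := (((hasDerivAt_id s).add_const (δ ^ 2)).log h).const_mul (1 / 2)
  simpa using this

theorem dX_ell : dX (ell δ) = fun z => z.re / (Complex.normSq z + δ ^ 2) := by
  have := dX_comp (g := fun s => 1 / 2 * Real.log (s + δ ^ 2))
    (g' := fun s => 1 / 2 * (s + δ ^ 2)⁻¹) (contDiff_normSq_sub 0).diffl
    (fun z => hasDerivAt_ell_aux hδ (Complex.normSq_nonneg (z - 0)))
  rw [dX_normSq_sub] at this
  simp only [sub_zero] at this
  change dX (fun z => 1 / 2 * Real.log (Complex.normSq z + δ ^ 2)) = _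
  rw [this]; funext z; simp; ring
theorem dY_ell : dY (ell δ) = fun z => z.im / (Complex.normSq z + δ ^ 2) := by
  have := dY_comp (g := fun s => 1 / 2 * Real.log (s + δ ^ 2))
    (g' := fun s => 1 / 2 * (s + δ ^ 2)⁻¹) (contDiff_normSq_sub 0).diffl
    (fun z => hasDerivAt_ell_aux hδ (Complex.normSq_nonneg (z - 0)))
  rw [dY_normSq_sub] at this
  simp only [sub_zero] at this
  change dY (fun z => 1 / 2 * Real.log (Complex.normSq z + δ ^ 2)) = _
  rw [this]; funext z; simp; ring

theorem lapl_ell : lapl (ell δ) = fun z => 2 * qk δ z := by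
  have := lapl_radial (g := fun s => 1 / 2 * Real.log (s + δ ^ 2))
    (g' := fun s => 1 / 2 * (s + δ ^ 2)⁻¹) (g'' := fun s => - (1 / 2 * ((s + δ ^ 2) ^ 2)⁻¹)) 0
    (fun s hs => hasDerivAt_ell_aux hδ hs) (fun s hs => by
      have h : s + δ ^ 2 ≠ 0 := by positivity
      have := ((((hasDerivAt_id s).add_const (δ ^ 2)).inv h)).const_mul (1 / 2)
      refine this.congr_deriv ?_
      simp; field_simp)
  simp only [sub_zero] at this
  change lapl (fun z => 1 / 2 * Real.log (Complex.normSq z + δ ^ 2)) = _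
  rw [this]; funext z
  have := (ns_pos hδ z).ne'
  unfold qk
  field_simp
  ring

theorem kk_eq (z : ℂ) : kk δ z = dX (ell δ) z - Complex.I * dY (ell δ) z := by
  rw [dX_ell hδ, dY_ell hδ]
  have := (ns_pos hδ z).ne'
  have h2 : ((Complex.normSq z + δ ^ 2 : ℝ) : ℂ) ≠ 0 := by exact_mod_cast this
  unfold kk
  rw [Complex.ofReal_div, Complex.ofReal_div]
  field_simp
  apply Complex.ext <;> simp

omit hδ in
theorem add_mul_le_ns (δ : ℝ) (z : ℂ) : (‖z‖ + δ) ^ 2 ≤ 2 * (Complex.normSq z + δ ^ 2) := by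
  rw [Complex.normSq_eq_norm_sq]; nlinarith [sq_nonneg (‖z‖ - δ)]

theorem abs_dX_ell_le (z : ℂ) : |dX (ell δ) z| ≤ 2 / (‖z‖ + δ) := by
  have h := add_mul_le_ns δ z
  have hn := norm_nonneg z
  rw [dX_ell hδ, abs_div, abs_of_pos (ns_pos hδ z), div_le_div_iff₀ (ns_pos hδ z) (by positivity)]
  have := Complex.abs_re_le_norm z
  nlinarith [abs_nonneg z.re]
theorem abs_dY_ell_le (z : ℂ) : |dY (ell δ) z| ≤ 2 / (‖z‖ + δ) := by
  have h := add_mul_le_ns δ z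
  have hn := norm_nonneg z
  rw [dY_ell hδ, abs_div, abs_of_pos (ns_pos hδ z), div_le_div_iff₀ (ns_pos hδ z) (by positivity)]
  have := Complex.abs_im_le_norm z
  nlinarith [abs_nonneg z.im]

theorem qk_le (z : ℂ) : qk δ z ≤ 4 * δ ^ 2 / (‖z‖ + δ) ^ 4 := by
  have h := add_mul_le_ns δ z
  have hn := norm_nonneg z
  have := ns_pos hδ z
  unfold qk
  rw [div_le_div_iff₀ (by positivity) (by positivity)]
  have h2 : ((‖z‖ + δ) ^ 2) ^ 2 ≤ (2 * (Complex.normSq z + δ ^ 2)) ^ 2 := by gcongr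
  nlinarith [sq_nonneg δ]

theorem qk_le_far (z : ℂ) (h0 : z ≠ 0) : qk δ z ≤ δ ^ 2 / ‖z‖ ^ 4 := by
  have hp : 0 < ‖z‖ := norm_pos_iff.2 h0
  unfold qk
  rw [Complex.normSq_eq_norm_sq, show ‖z‖ ^ 4 = (‖z‖ ^ 2) ^ 2 by ring]
  gcongr
  linarith [sq_nonneg δ]

theorem norm_kk_le (z : ℂ) : ‖kk δ z‖ ≤ ‖z‖⁻¹ := by
  rcases eq_or_ne z 0 with rfl | h0
  · simp [kk]
  have hp : 0 < ‖z‖ := norm_pos_iff.2 h0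
  unfold kk
  rw [norm_div, RCLike.norm_conj, Complex.norm_real, Real.norm_of_nonneg (ns_pos hδ z).le,
    div_le_iff₀ (ns_pos hδ z), Complex.normSq_eq_norm_sq]
  field_simp
  nlinarith [sq_nonneg δ]

theorem norm_kk_sub_le (a b : ℂ) (ha : a ≠ 0) (hb : b ≠ 0) :
    ‖kk δ a - kk δ b‖ ≤ ‖a - b‖ / (‖a‖ * ‖b‖) := by
  have pa : 0 < ‖a‖ := norm_pos_iff.2 ha
  have pb : 0 < ‖b‖ := norm_pos_iff.2 hb
  have hA := ns_pos hδ a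
  have hB := ns_pos hδ b
  refine abs_le_of_sq_le_sq' ?_ (by positivity) |>.2
  have key : ‖kk δ a - kk δ b‖ ^ 2 + δ ^ 2 * ((Complex.normSq a + δ ^ 2)⁻¹
      - (Complex.normSq b + δ ^ 2)⁻¹) ^ 2 = ‖a - b‖ ^ 2 /
      ((Complex.normSq a + δ ^ 2) * (Complex.normSq b + δ ^ 2)) := by
    rw [← Complex.normSq_eq_norm_sq, ← Complex.normSq_eq_norm_sq, Complex.normSq_apply,
      Complex.normSq_apply (a - b)]
    simp only [kk, Complex.sub_re, Complex.sub_im, Complex.div_ofReal_re, Complex.div_ofReal_im,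
      Complex.conj_re, Complex.conj_im]
    field_simp
    simp only [Complex.normSq_apply]
    ring
  calc ‖kk δ a - kk δ b‖ ^ 2 ≤ ‖a - b‖ ^ 2 /
      ((Complex.normSq a + δ ^ 2) * (Complex.normSq b + δ ^ 2)) := by
        rw [← key]; have : 0 ≤ δ ^ 2 * ((Complex.normSq a + δ ^ 2)⁻¹
          - (Complex.normSq b + δ ^ 2)⁻¹) ^ 2 := by positivity
        linarith
    _ ≤ (‖a - b‖ / (‖a‖ * ‖b‖)) ^ 2 := by
        rw [div_pow, mul_pow, Complex.normSq_eq_norm_sq, Complex.normSq_eq_norm_sq]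
        gcongr <;> nlinarith [sq_nonneg δ]

theorem abs_ell_sub_log_le (z : ℂ) (hz : z ≠ 0) :
    |ell δ z - Real.log ‖z‖| ≤ δ ^ 2 / (2 * ‖z‖ ^ 2) := by
  have hp : 0 < ‖z‖ := norm_pos_iff.2 hz
  have e : ell δ z - Real.log ‖z‖ = 1 / 2 * Real.log (1 + δ ^ 2 / ‖z‖ ^ 2) := by
    have : 1 + δ ^ 2 / ‖z‖ ^ 2 = (Complex.normSq z + δ ^ 2) / ‖z‖ ^ 2 := by
      rw [Complex.normSq_eq_norm_sq]; field_simp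
    rw [this, Real.log_div (ns_pos hδ z).ne' (by positivity), Real.log_pow]
    unfold ell; push_cast; ring
  have h1 : 0 ≤ Real.log (1 + δ ^ 2 / ‖z‖ ^ 2) := Real.log_nonneg (by
    have : 0 ≤ δ ^ 2 / ‖z‖ ^ 2 := by positivity
    linarith)
  have h2 := Real.log_le_sub_one_of_pos (x := 1 + δ ^ 2 / ‖z‖ ^ 2) (by positivity)
  rw [e, abs_of_nonneg (by positivity)]
  calc _ ≤ 1 / 2 * (δ ^ 2 / ‖z‖ ^ 2) := by linarith
    _ = _ := by field_simp

theorem abs_ell_le (h1 : δ ≤ 1) (z : ℂ) : |ell δ z| ≤ 4 / √(‖z‖ + δ) + ‖z‖ + 1 := by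
  have hn := norm_nonneg z
  have h := add_mul_le_ns δ z
  have hs : 0 < √(‖z‖ + δ) := Real.sqrt_pos.2 (by positivity)
  have hss : √(‖z‖ + δ) ^ 2 = ‖z‖ + δ := Real.sq_sqrt (by positivity)
  have hp := ns_pos hδ z
  have h4 : 0 ≤ 4 / √(‖z‖ + δ) := by positivity
  rw [abs_le]
  constructor
  · have a1 : Real.log (√(‖z‖ + δ) ^ 4 / 2) ≤ Real.log (Complex.normSq z + δ ^ 2) :=
      Real.log_le_log (by positivity) (by
        rw [show √(‖z‖ + δ) ^ 4 = (√(‖z‖ + δ) ^ 2) ^ 2 by ring, hss]; linarith)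
    rw [Real.log_div (by positivity) (by norm_num), Real.log_pow] at a1
    have a2 := Real.log_le_sub_one_of_pos (x := 1 / √(‖z‖ + δ)) (by positivity)
    rw [one_div, Real.log_inv, ← one_div] at a2
    have a3 : Real.log 2 ≤ 1 := by linarith [Real.log_two_lt_d9]
    unfold ell
    push_cast at a1
    have e4 : 4 / √(‖z‖ + δ) = 4 * (1 / √(‖z‖ + δ)) := by ring
    have h5 : 0 ≤ 1 / √(‖z‖ + δ) := by positivity
    rw [e4]
    linarith
  · have a1 : Real.log (Complex.normSq z + δ ^ 2) ≤ Real.log ((‖z‖ + 1) ^ 2) :=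
      Real.log_le_log hp (by rw [Complex.normSq_eq_norm_sq]; nlinarith)
    rw [Real.log_pow] at a1
    have a2 := Real.log_le_sub_one_of_pos (x := ‖z‖ + 1) (by positivity)
    unfold ell
    push_cast at a1
    linarith
end

theorem volume_real_ball (c : ℂ) {R : ℝ} (hR : 0 ≤ R) : volume.real (ball c R) = Real.pi * R ^ 2 := by
  rw [measureReal_def, Complex.volume_ball]
  simp [ENNReal.toReal_ofReal hR]; ring

theorem volume_real_closedBall (c : ℂ) {R : ℝ} (hR : 0 ≤ R) :
    volume.real (closedBall c R) = Real.pi * R ^ 2 := by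
  rw [measureReal_def, Complex.volume_closedBall]
  simp [ENNReal.toReal_ofReal hR]; ring

theorem integral_radial (f : ℝ → ℝ) :
    ∫ x : ℂ, f ‖x‖ = 2 * Real.pi * ∫ y in Ioi (0 : ℝ), y * f y := by
  have := integral_fun_norm_addHaar (volume : Measure ℂ) f
  rw [volume_real_ball 0 zero_le_one] at this
  rw [this]
  simp [Complex.finrank_real_complex]; ring

/-- Integrals of a singular power over balls of fixed radius are uniformly bounded. -/
theorem exists_integral_rpow_le (R : ℝ) : ∃ C > 0, ∀ z c : ℂ,
    IntegrableOn (fun ζ => ‖ζ - z‖ ^ (-(7 / 4) : ℝ)) (closedBall c R) ∧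
    ∫ ζ in closedBall c R, ‖ζ - z‖ ^ (-(7 / 4) : ℝ) ≤ C := by
  let g : ℂ → ℝ := (ball 0 1).indicator fun w => ‖w‖ ^ (-(7 / 4) : ℝ)
  have hg : Integrable g := by
    refine (integrable_indicator_iff measurableSet_ball).2 ?_
    refine (integrableOn_fun_norm_addHaar (μ := (volume : Measure ℂ))
      (f := fun r => r ^ (-(7 / 4) : ℝ))).2 ?_
    have := (intervalIntegral.integrableOn_Ioo_rpow_iff (s := -(3 / 4)) (t := 1) one_pos).2 (by norm_num)
    refine this.congr_fun (fun r hr => ?_) measurableSet_Ioo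
    simp only [Complex.finrank_real_complex, smul_eq_mul]
    rw [show (2 - 1 : ℕ) = 1 from rfl, pow_one]
    nth_rw 2 [← Real.rpow_one r]
    rw [← Real.rpow_add hr.1]; norm_num
  have g0 : ∀ w, 0 ≤ g w := fun w => indicator_nonneg (fun w _ => by positivity) w
  have hle : ∀ w : ℂ, ‖w‖ ^ (-(7 / 4) : ℝ) ≤ 1 + g w := by
    intro w
    by_cases hw : w ∈ ball (0 : ℂ) 1
    · simp [g, hw]
    · have : 1 ≤ ‖w‖ := by simpa using hw
      have := Real.rpow_le_one_of_one_le_of_nonpos this (z := -(7 / 4)) (by norm_num)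
      linarith [g0 w]
  refine ⟨volume.real (closedBall (0 : ℂ) R) + (∫ w, g w) + 1, ?_, fun z c => ?_⟩
  · have := integral_nonneg (μ := volume) (f := g) g0
    positivity
  have : IsFiniteMeasure (volume.restrict (closedBall c R)) :=
    ⟨by rw [Measure.restrict_apply_univ]; exact measure_closedBall_lt_top⟩
  have h1 : Integrable (fun ζ => g (ζ - z)) := hg.comp_sub_right z
  have h2 : IntegrableOn (fun ζ => 1 + g (ζ - z)) (closedBall c R) :=
    (integrableOn_const measure_closedBall_lt_top.ne).add h1.integrableOn
  have h3 : IntegrableOn (fun ζ => ‖ζ - z‖ ^ (-(7 / 4) : ℝ)) (closedBall c R) := by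
    refine h2.mono' ?_ (Eventually.of_forall fun ζ => ?_)
    · exact Measurable.aestronglyMeasurable (by fun_prop)
    · rw [Real.norm_of_nonneg (by positivity)]; exact hle _
  refine ⟨h3, ?_⟩
  calc _ ≤ ∫ ζ in closedBall c R, (1 + g (ζ - z)) := integral_mono h3 h2 fun ζ => hle _
    _ = volume.real (closedBall c R) + ∫ ζ in closedBall c R, g (ζ - z) := by
      rw [integral_add (integrable_const _) h1.integrableOn]; simp
    _ ≤ volume.real (closedBall c R) + ∫ ζ, g (ζ - z) := by
      refine add_le_add le_rfl ?_
      exact setIntegral_le_integral h1 (Eventually.of_forall fun ζ => g0 (ζ - z))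
    _ ≤ _ := by
      rw [integral_sub_right_eq_self g z, measureReal_def, measureReal_def,
        Measure.addHaar_closedBall_center]
      linarith

theorem inv_norm_le_rpow (w : ℂ) : ‖w‖⁻¹ ≤ 1 + ‖w‖ ^ (-(7 / 4) : ℝ) := by
  rcases eq_or_ne w 0 with rfl | h
  · simp
  have hp : 0 < ‖w‖ := norm_pos_iff.2 h
  rcases le_total 1 ‖w‖ with h1 | h1
  · have := inv_le_one_of_one_le₀ h1
    have : 0 ≤ ‖w‖ ^ (-(7 / 4) : ℝ) := by positivity
    linarith
  · have : ‖w‖ ^ (-1 : ℝ) ≤ ‖w‖ ^ (-(7 / 4) : ℝ) :=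
      Real.rpow_le_rpow_of_exponent_ge hp h1 (by norm_num)
    rw [Real.rpow_neg_one] at this
    linarith

theorem integral_qk_one_aux : IntegrableOn (fun r : ℝ => r * (1 / (1 + r ^ 2) ^ 2)) (Ioi 0) ∧
    ∫ r in Ioi (0 : ℝ), r * (1 / (1 + r ^ 2) ^ 2) = 1 / 2 := by
  have hd : ∀ x ∈ Ici (0 : ℝ), HasDerivAt (fun r : ℝ => - (1 / 2) * (1 + r ^ 2)⁻¹)
      (x * (1 / (1 + x ^ 2) ^ 2)) x := by
    intro x _
    have h : 1 + x ^ 2 ≠ 0 := by positivity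
    have := ((((hasDerivAt_pow 2 x)).const_add 1).fun_inv h).const_mul (-(1 / 2))
    refine this.congr_deriv ?_
    field_simp; ring
  have ht : Tendsto (fun r : ℝ => - (1 / 2) * (1 + r ^ 2)⁻¹) atTop (𝓝 (- (1 / 2) * 0)) := by
    refine Tendsto.const_mul _ (tendsto_inv_atTop_zero.comp ?_)
    exact tendsto_atTop_add_const_left _ _ (tendsto_pow_atTop (by norm_num))
  have hi := integrableOn_Ioi_deriv_of_nonneg' hd (fun x (hx : 0 < x) => by positivity) ht
  refine ⟨hi, ?_⟩
  rw [integral_Ioi_of_hasDerivAt_of_tendsto' hd hi ht]; norm_num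

theorem qk_one (w : ℂ) : qk 1 w = 1 / (1 + ‖w‖ ^ 2) ^ 2 := by
  simp [qk, Complex.normSq_eq_norm_sq, add_comm]

theorem integrable_qk_one : Integrable (qk 1) := by
  have : qk 1 = fun w => (fun r : ℝ => 1 / (1 + r ^ 2) ^ 2) ‖w‖ := funext qk_one
  rw [this, integrable_fun_norm_addHaar (volume : Measure ℂ) (f := fun r : ℝ => 1 / (1 + r ^ 2) ^ 2)]
  simpa [Complex.finrank_real_complex] using integral_qk_one_aux.1

theorem integral_qk_one : ∫ w, qk 1 w = Real.pi := by
  simp only [qk_one]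
  rw [integral_radial (fun r : ℝ => 1 / (1 + r ^ 2) ^ 2), integral_qk_one_aux.2]; ring

theorem integrable_norm_mul_qk_one : Integrable (fun w => ‖w‖ * qk 1 w) := by
  have h := integrable_one_add_norm (E := ℂ) (μ := volume) (r := 3)
    (by rw [Complex.finrank_real_complex]; norm_num)
  refine (h.const_mul 4).mono' (continuous_norm.mul (contDiff_qk one_pos).continuous
    ).aestronglyMeasurable (Eventually.of_forall fun w => ?_)
  have hn := norm_nonneg w
  rw [norm_mul, norm_norm, Real.norm_of_nonneg (qk_nonneg one_pos w),
    Real.rpow_neg (by positivity), show (3 : ℝ) = (3 : ℕ) by norm_num, Real.rpow_natCast]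
  refine (mul_le_mul_of_nonneg_left (qk_le one_pos w) hn).trans ?_
  rw [← div_eq_mul_inv, mul_div_assoc', div_le_div_iff₀ (by positivity) (by positivity), add_comm ‖w‖ 1]
  have : (1 + ‖w‖) ^ 4 = (1 + ‖w‖) ^ 3 * (1 + ‖w‖) := by ring
  rw [this]
  have := pow_pos (show 0 < 1 + ‖w‖ by positivity) 3
  nlinarith

theorem qk_scale {δ : ℝ} (hδ : 0 < δ) (w : ℂ) : δ ^ 2 * qk δ (δ * w) = qk 1 w := by
  unfold qk
  rw [Complex.normSq_mul, Complex.normSq_ofReal]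
  have := ns_pos one_pos w
  have h2 : δ * δ * Complex.normSq w + δ ^ 2 = δ ^ 2 * (Complex.normSq w + 1 ^ 2) := by ring
  rw [h2]
  field_simp

/-- `qk δ / π` is an approximate identity on Lipschitz functions. -/
theorem exists_qk_approx : ∃ C > 0, ∀ {E : Type} [NormedAddCommGroup E] [NormedSpace ℝ E]
    [CompleteSpace E] (ρ : ℂ → E) (K δ : ℝ), Continuous ρ →
    (∃ M, ∀ z, ‖ρ z‖ ≤ M) → 0 < δ → (∀ z w, ‖ρ z - ρ w‖ ≤ K * ‖z - w‖) → ∀ z,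
    ‖(∫ ξ, qk δ (z - ξ) • ρ ξ) - Real.pi • ρ z‖ ≤ C * K * δ := by
  refine ⟨(∫ w, ‖w‖ * qk 1 w) + 1, ?_, ?_⟩
  · have : 0 ≤ ∫ w, ‖w‖ * qk 1 w := integral_nonneg fun w =>
      mul_nonneg (norm_nonneg w) (qk_nonneg one_pos w)
    positivity
  intro E _ _ _ ρ K δ hρ ⟨M, hM⟩ hδ hK z
  have hK0 : 0 ≤ K := by
    have := hK 1 0
    simp at this
    exact (norm_nonneg _).trans this
  have e1 : ∫ ξ, qk δ (z - ξ) • ρ ξ = ∫ w, qk 1 w • ρ (z - δ * w) := by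
    have a1 := integral_sub_left_eq_self (fun w => qk δ w • ρ (z - w)) volume z
    simp only [sub_sub_cancel] at a1
    rw [a1]
    have a2 := Measure.integral_comp_smul (volume : Measure ℂ) (fun w => qk δ w • ρ (z - w)) δ
    rw [Complex.finrank_real_complex, abs_of_pos (by positivity)] at a2
    have a3 : ∫ w, qk δ w • ρ (z - w) = δ ^ 2 • ∫ w, qk δ (δ • w) • ρ (z - δ • w) := by
      rw [a2, smul_smul, mul_inv_cancel₀ (by positivity), one_smul]
    rw [a3, ← integral_smul]
    congr 1; funext w
    rw [smul_smul, Complex.real_smul, qk_scale hδ]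
  have i1 : Integrable (fun w => qk 1 w • ρ (z - δ * w)) := by
    refine (integrable_qk_one.mul_const M).mono' ?_ (Eventually.of_forall fun w => ?_)
    · exact ((contDiff_qk one_pos).continuous.smul (hρ.comp (by fun_prop))).aestronglyMeasurable
    · rw [norm_smul, Real.norm_of_nonneg (qk_nonneg one_pos w)]
      exact mul_le_mul_of_nonneg_left (hM _) (qk_nonneg one_pos w)
  have i2 : Integrable (fun w => qk 1 w • ρ z) := integrable_qk_one.smul_const _
  have e2 : Real.pi • ρ z = ∫ w, qk 1 w • ρ z := by
    rw [integral_smul_const, integral_qk_one]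
  rw [e1, e2, ← integral_sub i1 i2]
  have i3 : Integrable (fun w => K * δ * (‖w‖ * qk 1 w)) := integrable_norm_mul_qk_one.const_mul _
  calc _ ≤ ∫ w, K * δ * (‖w‖ * qk 1 w) := by
        refine norm_integral_le_of_norm_le i3 (Eventually.of_forall fun w => ?_)
        rw [← smul_sub, norm_smul, Real.norm_of_nonneg (qk_nonneg one_pos w)]
        have := hK (z - δ * w) z
        rw [show z - δ * w - z = - (δ * w) by ring, norm_neg, norm_mul, Complex.norm_real,
          Real.norm_of_nonneg hδ.le] at this
        have := mul_le_mul_of_nonneg_left this (qk_nonneg one_pos w)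
        linarith
    _ ≤ _ := by
        rw [integral_const_mul]
        have : 0 ≤ K * δ := by positivity
        nlinarith

/-- Logarithmic growth of `∫ 1 / (1 + |w|²)` over balls. -/
theorem integral_inv_one_add_sq {R : ℝ} (hR : 0 ≤ R) :
    ∫ w in ball (0 : ℂ) R, 1 / (1 + ‖w‖ ^ 2) = Real.pi * Real.log (1 + R ^ 2) := by
  have e : ∀ w : ℂ, (ball (0 : ℂ) R).indicator (fun w => 1 / (1 + ‖w‖ ^ 2)) w =
      (fun r : ℝ => (Iio R).indicator (fun r => 1 / (1 + r ^ 2)) r) ‖w‖ := by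
    intro w
    by_cases h : ‖w‖ < R <;> simp [h]
  rw [← integral_indicator measurableSet_ball]
  simp only [e]
  rw [integral_radial (fun r : ℝ => (Iio R).indicator (fun r => 1 / (1 + r ^ 2)) r)]
  have e2 : ∀ y : ℝ, y * (Iio R).indicator (fun r => 1 / (1 + r ^ 2)) y =
      (Iio R).indicator (fun y => y * (1 / (1 + y ^ 2))) y := by
    intro y; by_cases h : y < R <;> simp [h]
  simp only [e2]
  rw [setIntegral_indicator measurableSet_Iio, Ioi_inter_Iio, ← integral_Ioc_eq_integral_Ioo,
    ← intervalIntegral.integral_of_le hR]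
  have hd : ∀ x ∈ uIcc 0 R, HasDerivAt (fun r : ℝ => (1 / 2) * Real.log (1 + r ^ 2))
      (x * (1 / (1 + x ^ 2))) x := by
    intro x _
    have h : 1 + x ^ 2 ≠ 0 := by positivity
    have := ((((hasDerivAt_pow 2 x)).const_add 1).log h).const_mul (1 / 2)
    refine this.congr_deriv ?_
    field_simp; ring
  rw [intervalIntegral.integral_eq_sub_of_hasDerivAt hd]
  · simp; ring
  · apply Continuous.intervalIntegrable
    have : ∀ x : ℝ, 1 + x ^ 2 ≠ 0 := fun x => by positivity
    fun_prop (disch := assumption)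

/-- A potential `L` of a unit mass with barycentre `b`, spread out near `z₀`; `N` controls its
gradient near `z₀`. -/
structure Site (C : ℝ) (z₀ : ℂ) (L : ℂ → ℝ) (b : ℂ) (N : ℂ → ℝ) : Prop where
  smooth : ContDiff ℝ ∞ L
  bary : ‖b - z₀‖ ≤ 102
  near : ∀ z, ‖z - z₀‖ ≤ 8000 → |L z| ≤ C
  far : ∀ z ζ, 5000 ≤ ‖z - z₀‖ → ‖ζ - z₀‖ ≤ 1500 →
    |L z - Real.log ‖z - ζ‖ + ((b - ζ) / (z - ζ)).re| ≤ C / ‖z - ζ‖ ^ 2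
  lapl_far : ∀ z, 5000 ≤ ‖z - z₀‖ → |lapl L z| ≤ C / ‖z - z₀‖ ^ 4
  gradX : ∀ z, ‖z - z₀‖ ≤ 8000 → |dX L z| ≤ N z
  gradY : ∀ z, ‖z - z₀‖ ≤ 8000 → |dY L z| ≤ N z
  cont : Continuous N
  one_le : ∀ z, 1 ≤ N z
  cauchy : ∀ z, ∫ ζ in closedBall z₀ 8000, N ζ * ‖ζ - z‖⁻¹ ≤ C

theorem log_far {z ζ p : ℂ} (h : 2 * ‖p - ζ‖ ≤ ‖z - ζ‖) (h0 : z ≠ ζ) :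
    |Real.log ‖z - p‖ - Real.log ‖z - ζ‖ + ((p - ζ) / (z - ζ)).re| ≤ (‖p - ζ‖ / ‖z - ζ‖) ^ 2 := by
  have hp : 0 < ‖z - ζ‖ := norm_pos_iff.2 (sub_ne_zero.2 h0)
  set t : ℂ := - ((p - ζ) / (z - ζ)) with ht
  have htn : ‖t‖ = ‖p - ζ‖ / ‖z - ζ‖ := by rw [ht, norm_neg, norm_div]
  have ht2 : ‖t‖ ≤ 1 / 2 := by rw [htn, div_le_iff₀ hp]; linarith
  have h1 : z - p = (z - ζ) * (1 + t) := by
    rw [ht]; field_simp [sub_ne_zero.2 h0]; ring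
  have hne : 1 + t ≠ 0 := by
    intro h
    have : t = -1 := by linear_combination h
    rw [this] at ht2; norm_num at ht2
  have h2 : Real.log ‖z - p‖ - Real.log ‖z - ζ‖ + ((p - ζ) / (z - ζ)).re =
      (Complex.log (1 + t) - t).re := by
    rw [h1, norm_mul, Real.log_mul hp.ne' (norm_ne_zero_iff.2 hne), Complex.sub_re,
      Complex.log_re, ht, Complex.neg_re]; ring
  rw [h2, ← htn]
  refine (Complex.abs_re_le_norm _).trans
    ((Complex.norm_log_one_add_sub_self_le (by linarith)).trans ?_)
  have : (1 - ‖t‖)⁻¹ ≤ 2 := by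
    rw [inv_le_comm₀ (by linarith) (by norm_num)]; linarith
  nlinarith [sq_nonneg ‖t‖]

theorem ell_far {δ : ℝ} (hδ : 0 < δ) (h1 : δ ≤ 1) {z ζ p : ℂ} (hp : ‖p - ζ‖ ≤ 1700)
    (hz : 3400 ≤ ‖z - ζ‖) :
    |ell δ (z - p) - Real.log ‖z - ζ‖ + ((p - ζ) / (z - ζ)).re| ≤ 3000000 / ‖z - ζ‖ ^ 2 := by
  have hz0 : z ≠ ζ := by
    rintro rfl; simp at hz; linarith
  have h2 := log_far (by linarith) hz0 (p := p)
  have hzp : ‖z - ζ‖ / 2 ≤ ‖z - p‖ := by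
    have := norm_sub_norm_le (z - ζ) (p - ζ)
    rw [sub_sub_sub_cancel_right] at this; linarith
  have h3 := abs_ell_sub_log_le hδ (z - p) (norm_pos_iff.1 (by linarith))
  have h4 : δ ^ 2 / (2 * ‖z - p‖ ^ 2) ≤ 2 / ‖z - ζ‖ ^ 2 := by
    rw [div_le_div_iff₀ (by nlinarith) (by nlinarith)]
    have : δ ^ 2 ≤ 1 := by nlinarith
    have : ‖z - ζ‖ ^ 2 ≤ 4 * ‖z - p‖ ^ 2 := by nlinarith
    nlinarith [sq_nonneg ‖z - ζ‖]
  have h5 : (‖p - ζ‖ / ‖z - ζ‖) ^ 2 ≤ 2890000 / ‖z - ζ‖ ^ 2 := by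
    rw [div_pow]; gcongr; nlinarith [norm_nonneg (p - ζ)]
  have h6 : 3000000 / ‖z - ζ‖ ^ 2 = 2 / ‖z - ζ‖ ^ 2 + 2890000 / ‖z - ζ‖ ^ 2
    + 109998 / ‖z - ζ‖ ^ 2 := by ring
  have h7 : 0 ≤ 109998 / ‖z - ζ‖ ^ 2 := by positivity
  rw [abs_le] at *
  constructor <;> linarith

/-- `G x = 2 sgn(x) √|x|`. -/
def sgnSqrt (x : ℝ) : ℝ := 2 * (√x - √(-x))

theorem inv_sqrt_le (x : ℝ) : 1 / √(|x| + 1) ≤ sgnSqrt (x + 1) - sgnSqrt x := by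
  have key : ∀ y : ℝ, 0 ≤ y → 1 / √(y + 1) ≤ 2 * (√(y + 1) - √y) := by
    intro y hy
    have h1 : 0 < √(y + 1) := Real.sqrt_pos.2 (by linarith)
    have h2 := Real.sq_sqrt (show 0 ≤ y + 1 by linarith)
    have h3 := Real.sq_sqrt hy
    rw [div_le_iff₀ h1]
    nlinarith [sq_nonneg (√(y + 1) - √y)]
  unfold sgnSqrt
  rcases le_or_gt 0 x with h | h
  · rw [abs_of_nonneg h, Real.sqrt_eq_zero_of_nonpos (show -(x + 1) ≤ 0 by linarith),
      Real.sqrt_eq_zero_of_nonpos (show -x ≤ 0 by linarith)]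
    have := key x h
    linarith
  · rw [abs_of_neg h, Real.sqrt_eq_zero_of_nonpos h.le]
    rcases le_or_gt x (-1) with h1 | h1
    · rw [Real.sqrt_eq_zero_of_nonpos (show x + 1 ≤ 0 by linarith)]
      have := key (-x - 1) (by linarith)
      rw [show -x - 1 + 1 = -x by ring, show -x - 1 = -(x + 1) by ring] at this
      have h2 : 1 / √(-x + 1) ≤ 1 / √(-x) :=
        one_div_le_one_div_of_le (Real.sqrt_pos.2 (by linarith)) (Real.sqrt_le_sqrt (by linarith))
      linarith
    · rw [Real.sqrt_eq_zero_of_nonpos (show -(x + 1) ≤ 0 by linarith)]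
      have h2 : 1 / √(-x + 1) ≤ 1 := by
        rw [div_le_one (Real.sqrt_pos.2 (by linarith))]
        exact Real.one_le_sqrt.2 (by linarith)
      have h3 : x + 1 ≤ √(x + 1) := Real.le_sqrt_of_sq_le (by nlinarith)
      have h4 : -x ≤ √(-x) := Real.le_sqrt_of_sq_le (by nlinarith)
      linarith

theorem sgnSqrt_sub_le (a m : ℝ) (hm : 0 ≤ m) : sgnSqrt (a + m) - sgnSqrt a ≤ 4 * √m := by
  unfold sgnSqrt
  have key : ∀ y, 0 ≤ y → √(y + m) ≤ √y + √m := fun y hy =>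
    Real.sqrt_le_iff.2 ⟨by positivity, by
      nlinarith [Real.sq_sqrt hy, Real.sq_sqrt hm, mul_nonneg (Real.sqrt_nonneg y) (Real.sqrt_nonneg m)]⟩
  have hs := Real.sqrt_nonneg m
  rcases le_or_gt 0 a with h | h
  · rw [Real.sqrt_eq_zero_of_nonpos (show -(a + m) ≤ 0 by linarith),
      Real.sqrt_eq_zero_of_nonpos (show -a ≤ 0 by linarith)]
    have := key a h
    linarith
  · rw [Real.sqrt_eq_zero_of_nonpos h.le]
    rcases le_or_gt (a + m) 0 with h1 | h1
    · rw [Real.sqrt_eq_zero_of_nonpos h1]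
      have := key (-(a + m)) (by linarith)
      rw [show -(a + m) + m = -a by ring] at this
      linarith
    · rw [Real.sqrt_eq_zero_of_nonpos (show -(a + m) ≤ 0 by linarith)]
      have h2 : √(a + m) ≤ √m := Real.sqrt_le_sqrt (by linarith)
      have h3 : √(-a) ≤ √m := Real.sqrt_le_sqrt (by linarith)
      linarith

theorem sum_inv_sqrt_le (n : ℕ) (T : ℝ) :
    ∑ j ∈ Finset.range n, 1 / √(|(j : ℝ) - T| + 1) ≤ 4 * √n := by
  calc _ ≤ ∑ j ∈ Finset.range n, (sgnSqrt (((j + 1 : ℕ) : ℝ) - T) - sgnSqrt ((j : ℝ) - T)) := by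
        refine Finset.sum_le_sum fun j _ => ?_
        have := inv_sqrt_le (j - T)
        rw [show ((j + 1 : ℕ) : ℝ) - T = j - T + 1 by push_cast; ring]
        exact this
    _ = sgnSqrt (-T + n) - sgnSqrt (-T) := by
        rw [Finset.sum_range_sub (fun j : ℕ => sgnSqrt ((j : ℝ) - T))]; simp [sub_eq_neg_add, add_comm]
    _ ≤ _ := sgnSqrt_sub_le _ _ (Nat.cast_nonneg n)

/-- Points on circles of equidistributed radii satisfy a Frostman condition of order `1/2`. -/
theorem frostman {n : ℕ} (hn : 0 < n) {w₀ : ℂ} {p : ℕ → ℂ}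
    (hp : ∀ j < n, ‖p j - w₀‖ = 1 + j / n) (z : ℂ) :
    (1 / n : ℝ) * ∑ j ∈ Finset.range n, 1 / √(‖z - p j‖ + 1 / n) ≤ 4 := by
  have hn' : (0 : ℝ) < n := by exact_mod_cast hn
  have hs : 0 < √(n : ℝ) := Real.sqrt_pos.2 hn'
  have hss := Real.sq_sqrt hn'.le
  set T : ℝ := n * (‖z - w₀‖ - 1)
  have h1 : ∀ j ∈ Finset.range n, 1 / √(‖z - p j‖ + 1 / n) ≤ √n * (1 / √(|(j : ℝ) - T| + 1)) := by
    intro j hj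
    have hj := hp j (Finset.mem_range.1 hj)
    have a1 : |(1 + j / n) - ‖z - w₀‖| ≤ ‖z - p j‖ := by
      rw [← hj]
      refine (abs_norm_sub_norm_le _ _).trans (le_of_eq ?_)
      rw [sub_sub_sub_cancel_right, norm_sub_rev]
    have a2 : (|(j : ℝ) - T| + 1) = n * (|(1 + j / n) - ‖z - w₀‖| + 1 / n) := by
      rw [mul_add, ← abs_of_pos hn', ← abs_mul, abs_of_pos hn']
      congr 1
      · congr 1; simp only [T]; field_simp; ring
      · field_simp
    rw [a2, Real.sqrt_mul hn'.le]
    have : √(n : ℝ) * (1 / (√n * √(|1 + (j : ℝ) / n - ‖z - w₀‖| + 1 / n))) =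
      1 / √(|1 + (j : ℝ) / n - ‖z - w₀‖| + 1 / n) := by field_simp
    rw [this]
    refine one_div_le_one_div_of_le (Real.sqrt_pos.2 (by positivity)) (Real.sqrt_le_sqrt ?_)
    linarith
  calc _ ≤ (1 / n : ℝ) * ∑ j ∈ Finset.range n, √n * (1 / √(|(j : ℝ) - T| + 1)) := by
        gcongr with j hj; exact h1 j hj
    _ ≤ (1 / n : ℝ) * (√n * (4 * √n)) := by
        rw [← Finset.mul_sum]; gcongr; exact sum_inv_sqrt_le n T
    _ = 4 := by
        rw [show √(n : ℝ) * (4 * √n) = 4 * √(n : ℝ) ^ 2 by ring, hss]; field_simp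

theorem contDiff_comp_sub {E : Type*} [NormedAddCommGroup E] [NormedSpace ℝ E] {f : ℂ → E}
    (hf : ContDiff ℝ ∞ f) (p : ℂ) : ContDiff ℝ ∞ (fun z => f (z - p)) :=
  hf.comp (contDiff_id.sub contDiff_const)

section sums
variable {E : Type*} [NormedAddCommGroup E] [NormedSpace ℝ E] {ι : Type*} {s : Finset ι}
  {f : ι → ℂ → E}

theorem dX_sum (hf : ∀ i ∈ s, Differentiable ℝ (f i)) :
    dX (fun z => ∑ i ∈ s, f i z) = fun z => ∑ i ∈ s, dX (f i) z := by
  ext z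
  unfold dX
  rw [fderiv_fun_sum fun i hi => hf i hi z, sum_apply]

theorem dY_sum (hf : ∀ i ∈ s, Differentiable ℝ (f i)) :
    dY (fun z => ∑ i ∈ s, f i z) = fun z => ∑ i ∈ s, dY (f i) z := by
  ext z
  unfold dY
  rw [fderiv_fun_sum fun i hi => hf i hi z, sum_apply]

theorem lapl_sum (hf : ∀ i ∈ s, ContDiff ℝ ∞ (f i)) :
    lapl (fun z => ∑ i ∈ s, f i z) = fun z => ∑ i ∈ s, lapl (f i) z := by
  ext z
  unfold lapl
  rw [dX_sum fun i hi => (hf i hi).diffl, dY_sum fun i hi => (hf i hi).diffl,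
    dX_sum fun i hi => (contDiff_dX (hf i hi)).diffl,
    dY_sum fun i hi => (contDiff_dY (hf i hi)).diffl, Finset.sum_add_distrib]
end sums

/-- The potential of equal point masses at `p 0, …, p (n - 1)`, regularised at scale `1 / n`. -/
def zeroL (n : ℕ) (p : ℕ → ℂ) (z : ℂ) : ℝ :=
  (1 / n : ℝ) * ∑ j ∈ Finset.range n, ell (1 / n) (z - p j)

/-- A majorant of the gradient of `zeroL n p`. -/
def zeroN (n : ℕ) (p : ℕ → ℂ) (z : ℂ) : ℝ :=
  1 + (1 / n : ℝ) * ∑ j ∈ Finset.range n, 2 / (‖z - p j‖ + 1 / n)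

/-- The mean of `p 0, …, p (n - 1)`. -/
def zeroB (n : ℕ) (p : ℕ → ℂ) : ℂ := (1 / n : ℝ) * ∑ j ∈ Finset.range n, p j

section zero
variable {n : ℕ} (hn : 0 < n) (p : ℕ → ℂ)
include hn

theorem contDiff_zeroL : ContDiff ℝ ∞ (zeroL n p) := by
  have hd : (0 : ℝ) < 1 / n := by positivity
  exact contDiff_const.mul (ContDiff.sum fun j _ => contDiff_comp_sub (contDiff_ell hd) _)

theorem dX_zeroL : dX (zeroL n p) =
    fun z => (1 / n : ℝ) * ∑ j ∈ Finset.range n, dX (ell (1 / n)) (z - p j) := by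
  have hd : (0 : ℝ) < 1 / n := by positivity
  have h := fun j (_ : j ∈ Finset.range n) => contDiff_comp_sub (contDiff_ell hd) (p j)
  have := dX_const_mul (1 / n : ℝ) (ContDiff.sum h).diffl
  rw [dX_sum fun i hi => (h i hi).diffl] at this
  refine this.trans ?_
  ext z
  simp only [dX_comp_sub]

theorem dY_zeroL : dY (zeroL n p) =
    fun z => (1 / n : ℝ) * ∑ j ∈ Finset.range n, dY (ell (1 / n)) (z - p j) := by
  have hd : (0 : ℝ) < 1 / n := by positivity
  have h := fun j (_ : j ∈ Finset.range n) => contDiff_comp_sub (contDiff_ell hd) (p j)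
  have := dY_const_mul (1 / n : ℝ) (ContDiff.sum h).diffl
  rw [dY_sum fun i hi => (h i hi).diffl] at this
  refine this.trans ?_
  ext z
  simp only [dY_comp_sub]

theorem lapl_zeroL : lapl (zeroL n p) =
    fun z => (1 / n : ℝ) * ∑ j ∈ Finset.range n, 2 * qk (1 / n) (z - p j) := by
  have hd : (0 : ℝ) < 1 / n := by positivity
  have h := fun j (_ : j ∈ Finset.range n) => contDiff_comp_sub (contDiff_ell hd) (p j)
  have := lapl_const_mul (1 / n : ℝ) (ContDiff.sum h)
  rw [lapl_sum h] at this
  refine this.trans ?_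
  ext z
  simp only [lapl_comp_sub, lapl_ell hd]

theorem sum_avg_le {f : ℕ → ℝ} {M : ℝ} (h : ∀ j < n, f j ≤ M) :
    (1 / n : ℝ) * ∑ j ∈ Finset.range n, f j ≤ M := by
  have hn' : (0 : ℝ) < n := by exact_mod_cast hn
  calc _ ≤ (1 / n : ℝ) * ∑ j ∈ Finset.range n, M := by
        gcongr with j hj; exact h j (Finset.mem_range.1 hj)
    _ = M := by simp; field_simp

theorem abs_avg_le {f : ℕ → ℝ} {M : ℝ} (h : ∀ j < n, |f j| ≤ M) :
    |(1 / n : ℝ) * ∑ j ∈ Finset.range n, f j| ≤ M := by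
  rw [abs_mul, abs_of_nonneg (by positivity)]
  exact (mul_le_mul_of_nonneg_left (Finset.abs_sum_le_sum_abs _ _) (by positivity)).trans
    (sum_avg_le hn h)

theorem avg_const (x : ℂ) : (1 / n : ℝ) * ∑ _j ∈ Finset.range n, x = x := by
  have hn' : (n : ℂ) ≠ 0 := by exact_mod_cast hn.ne'
  simp; field_simp
end zero

theorem one_div_mul_le_rpow {a b c : ℝ} (ha : 0 < a) (hb : 0 < b) (hc : 0 < c) (h : c ≤ a + b) :
    a⁻¹ * b⁻¹ ≤ (1 + 2 / √c) * (a ^ (-(7 / 4) : ℝ) + b ^ (-(7 / 4) : ℝ)) := by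
  have h1 : (c / 2) ^ (-(1 / 4) : ℝ) ≤ 1 + 2 / √c := by
    rcases le_or_gt 2 c with h2 | h2
    · have := Real.rpow_le_one_of_one_le_of_nonpos (show 1 ≤ c / 2 by linarith)
        (show (-(1 / 4) : ℝ) ≤ 0 by norm_num)
      have : 0 ≤ 2 / √c := by positivity
      linarith
    · have h3 := Real.rpow_le_rpow_of_exponent_ge (show 0 < c / 2 by linarith)
        (show c / 2 ≤ 1 by linarith) (show (-(1 / 2) : ℝ) ≤ -(1 / 4) by norm_num)
      rw [Real.rpow_neg (by linarith) (1 / 2), ← Real.sqrt_eq_rpow] at h3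
      have h4 : (√(c / 2))⁻¹ ≤ 2 / √c := by
        rw [inv_eq_one_div, div_le_div_iff₀ (Real.sqrt_pos.2 (by linarith)) (Real.sqrt_pos.2 hc), one_mul,
          show (2 : ℝ) * √(c / 2) = √(2 ^ 2 * (c / 2)) by
            rw [Real.sqrt_mul (by norm_num), Real.sqrt_sq (by norm_num)]]
        exact Real.sqrt_le_sqrt (by linarith)
      linarith
  have key : ∀ x y : ℝ, 0 < x → 0 < y → y ≤ x → c ≤ x + y →
      x⁻¹ * y⁻¹ ≤ (1 + 2 / √c) * y ^ (-(7 / 4) : ℝ) := by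
    intro x y hx hy hyx hh
    have e1 : x⁻¹ = x ^ (-(1 / 4) : ℝ) * x ^ (-(3 / 4) : ℝ) := by
      rw [← Real.rpow_add hx, ← Real.rpow_neg_one]; norm_num
    have e2 : y ^ (-(7 / 4) : ℝ) = y ^ (-(3 / 4) : ℝ) * y⁻¹ := by
      rw [← Real.rpow_neg_one, ← Real.rpow_add hy]; norm_num
    have e3 : x ^ (-(1 / 4) : ℝ) ≤ (c / 2) ^ (-(1 / 4) : ℝ) :=
      Real.rpow_le_rpow_of_nonpos (by linarith) (by linarith) (by norm_num)
    have e4 : x ^ (-(3 / 4) : ℝ) ≤ y ^ (-(3 / 4) : ℝ) :=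
      Real.rpow_le_rpow_of_nonpos hy hyx (by norm_num)
    rw [e1, e2]
    calc _ ≤ (1 + 2 / √c) * y ^ (-(3 / 4) : ℝ) * y⁻¹ := by
          gcongr; exact e3.trans h1
      _ = _ := by ring
  have p1 : 0 ≤ (1 + 2 / √c) := by positivity
  rcases le_total b a with h' | h'
  · refine (key a b ha hb h' h).trans ?_
    gcongr; exact le_add_of_nonneg_left (by positivity)
  · rw [mul_comm]
    refine (key b a hb ha h' (by linarith)).trans ?_
    gcongr; exact le_add_of_nonneg_right (by positivity)

theorem exists_zero_cauchy : ∃ C > 0, ∀ (n : ℕ) (p : ℕ → ℂ) (w₀ : ℂ), 0 < n →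
    (∀ j < n, ‖p j - w₀‖ = 1 + j / n) → ∀ z₀ z,
    ∫ ζ in closedBall z₀ 8000, zeroN n p ζ * ‖ζ - z‖⁻¹ ≤ C := by
  obtain ⟨K, hK, h⟩ := exists_integral_rpow_le 8000
  refine ⟨Real.pi * 8000 ^ 2 + K + 36 * K * 1, by positivity, fun n p w₀ hn hp z₀ z => ?_⟩
  have hn' : (0 : ℝ) < n := by exact_mod_cast hn
  have hd : (0 : ℝ) < 1 / n := by positivity
  have : IsFiniteMeasure (volume.restrict (closedBall z₀ 8000)) :=
    ⟨by rw [Measure.restrict_apply_univ]; exact measure_closedBall_lt_top⟩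
  set k : ℂ → ℂ → ℝ := fun w ζ => ‖ζ - w‖ ^ (-(7 / 4) : ℝ) with hk
  have ik : ∀ w, IntegrableOn (k w) (closedBall z₀ 8000) := fun w => (h w z₀).1
  have hKw : ∀ w, ∫ ζ in closedBall z₀ 8000, k w ζ ≤ K := fun w => (h w z₀).2
  set D : ℕ → ℝ := fun j => 1 + 2 / √(‖z - p j‖ + 1 / n)
  have hs := frostman hn hp z
  have hD0 : ∀ j, 0 ≤ D j := fun j => by positivity
  have hD : (1 / n : ℝ) * ∑ j ∈ Finset.range n, 2 * D j ≤ 18 := by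
    have : (1 / n : ℝ) * ∑ j ∈ Finset.range n, 2 * D j =
        2 + 4 * ((1 / n : ℝ) * ∑ j ∈ Finset.range n, 1 / √(‖z - p j‖ + 1 / n)) := by
      simp only [D, mul_add, Finset.sum_add_distrib, Finset.mul_sum]
      simp
      rw [mul_inv_cancel_left₀ hn'.ne']
      congr 1
      refine Finset.sum_congr rfl fun j _ => ?_
      ring
    rw [this]; linarith
  have i1 : IntegrableOn (fun ζ => 1 + k z ζ) (closedBall z₀ 8000) :=
    (integrable_const _).add (ik z)
  have i2 : ∀ j ∈ Finset.range n,
      IntegrableOn (fun ζ => 2 * D j * (k (p j) ζ + k z ζ)) (closedBall z₀ 8000) :=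
    fun j _ => ((ik (p j)).add (ik z)).const_mul _
  have i3 : IntegrableOn (fun ζ => ∑ j ∈ Finset.range n, 2 * D j * (k (p j) ζ + k z ζ))
      (closedBall z₀ 8000) := integrable_finsetSum _ i2
  calc _ ≤ ∫ ζ in closedBall z₀ 8000, ((1 + k z ζ) +
        (1 / n : ℝ) * ∑ j ∈ Finset.range n, 2 * D j * (k (p j) ζ + k z ζ)) := by
        refine integral_mono_of_nonneg (.of_forall fun ζ => ?_) (i1.add (i3.const_mul _)) ?_
        · unfold zeroN; positivity
        · have hae : ∀ᵐ ζ : ℂ ∂(volume.restrict (closedBall z₀ 8000)),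
              ∀ w ∈ (insert z ((Finset.range n).image p) : Finset ℂ), ζ ≠ w := by
            refine ae_restrict_of_ae ?_
            rw [Finset.eventually_all]
            exact fun w _ => Measure.ae_ne volume w
          filter_upwards [hae] with ζ hζ
          have hz : 0 < ‖ζ - z‖ := norm_pos_iff.2 (sub_ne_zero.2 (hζ z (by simp)))
          unfold zeroN
          rw [add_mul, one_mul, mul_assoc, Finset.sum_mul]
          refine add_le_add (inv_norm_le_rpow _) ?_
          refine mul_le_mul_of_nonneg_left (Finset.sum_le_sum fun j hj => ?_) (by positivity)
          have hpj : 0 < ‖ζ - p j‖ :=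
            norm_pos_iff.2 (sub_ne_zero.2 (hζ (p j) (by
              simp only [Finset.mem_insert, Finset.mem_image]; exact Or.inr ⟨j, hj, rfl⟩)))
          have := one_div_mul_le_rpow (a := ‖ζ - p j‖ + 1 / n) (b := ‖ζ - z‖)
            (c := ‖z - p j‖ + 1 / n) (by positivity) hz (by positivity) (by
              have := norm_sub_le_norm_sub_add_norm_sub z ζ (p j)
              rw [norm_sub_rev z ζ] at this; linarith)
          rw [div_eq_mul_inv, mul_assoc, mul_assoc]
          refine mul_le_mul_of_nonneg_left (this.trans ?_) (by norm_num)
          refine mul_le_mul_of_nonneg_left ?_ (hD0 j)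
          refine add_le_add_left (Real.rpow_le_rpow_of_nonpos hpj (by linarith) (by norm_num)) _
    _ = (Real.pi * 8000 ^ 2 + ∫ ζ in closedBall z₀ 8000, k z ζ) + (1 / n : ℝ) *
        ∑ j ∈ Finset.range n, 2 * D j * ((∫ ζ in closedBall z₀ 8000, k (p j) ζ) +
          ∫ ζ in closedBall z₀ 8000, k z ζ) := by
        rw [integral_add i1 (i3.const_mul _), integral_add (integrable_const _) (ik z),
          integral_const_mul, integral_finsetSum _ i2]
        congr 1
        · congr 1
          simp [Measure.real]
          have := volume_real_closedBall z₀ (R := 8000) (by norm_num)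
          simp only [Measure.real] at this
          norm_num at this ⊢
          try exact this
        · congr 1
          refine Finset.sum_congr rfl fun j _ => ?_
          rw [integral_const_mul, integral_add (ik _) (ik _)]
    _ ≤ (Real.pi * 8000 ^ 2 + K) + (1 / n : ℝ) * ∑ j ∈ Finset.range n, 2 * D j * (K + K) := by
        gcongr with j hj
        · exact hKw z
        · exact hKw (p j)
        · exact hKw z
    _ = (Real.pi * 8000 ^ 2 + K) + ((1 / n : ℝ) * ∑ j ∈ Finset.range n, 2 * D j) * (2 * K) := by
        rw [← Finset.sum_mul]; ring
    _ ≤ _ := by nlinarith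

theorem Site.mono {C C' : ℝ} {z₀ b : ℂ} {L : ℂ → ℝ} {N : ℂ → ℝ} (h : Site C z₀ L b N)
    (hC : C ≤ C') : Site C' z₀ L b N where
  smooth := h.smooth
  bary := h.bary
  near z hz := (h.near z hz).trans hC
  far z ζ hz hζ := (h.far z ζ hz hζ).trans (by gcongr)
  lapl_far z hz := (h.lapl_far z hz).trans (by gcongr)
  gradX := h.gradX
  gradY := h.gradY
  cont := h.cont
  one_le := h.one_le
  cauchy z := (h.cauchy z).trans hC

theorem exists_site_zero : ∃ C > 0, ∀ (n : ℕ) (p : ℕ → ℂ) (w₀ z₀ : ℂ), 0 < n → ‖w₀ - z₀‖ ≤ 100 →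
    (∀ j < n, ‖p j - w₀‖ = 1 + j / n) → Site C z₀ (zeroL n p) (zeroB n p) (zeroN n p) := by
  obtain ⟨K, hK, hc⟩ := exists_zero_cauchy
  refine ⟨K + 3000000, by positivity, fun n p w₀ z₀ hn hw hp => ?_⟩
  have hn' : (0 : ℝ) < n := by exact_mod_cast hn
  have hd : (0 : ℝ) < 1 / n := by positivity
  have hd1 : (1 / n : ℝ) ≤ 1 := by
    rw [div_le_one hn']; exact_mod_cast hn
  have hpz : ∀ j < n, ‖p j - z₀‖ ≤ 102 := fun j hj => by
    have h1 := hp j hj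
    have h2 : (j / n : ℝ) ≤ 1 := by rw [div_le_one hn']; exact_mod_cast hj.le
    have := norm_sub_le_norm_sub_add_norm_sub (p j) w₀ z₀
    linarith
  constructor
  · exact contDiff_zeroL hn p
  · rw [← avg_const hn z₀, zeroB, ← mul_sub, ← Finset.sum_sub_distrib, norm_mul, Complex.norm_real,
      Real.norm_of_nonneg hd.le]
    exact (mul_le_mul_of_nonneg_left (norm_sum_le _ _) hd.le).trans (sum_avg_le hn hpz)
  · intro z hz
    have hf := frostman hn hp z
    calc |zeroL n p z| ≤ (1 / n : ℝ) * ∑ j ∈ Finset.range n, |ell (1 / n) (z - p j)| := by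
          rw [zeroL, abs_mul, abs_of_pos hd]
          gcongr; exact Finset.abs_sum_le_sum_abs _ _
      _ ≤ (1 / n : ℝ) * ∑ j ∈ Finset.range n, (4 * (1 / √(‖z - p j‖ + 1 / n)) + 8103) := by
          gcongr with j hj
          refine (abs_ell_le hd hd1 _).trans ?_
          have := norm_sub_le_norm_sub_add_norm_sub z z₀ (p j)
          have := hpz j (Finset.mem_range.1 hj)
          rw [norm_sub_rev] at this
          rw [mul_one_div]; linarith
      _ = 4 * ((1 / n : ℝ) * ∑ j ∈ Finset.range n, 1 / √(‖z - p j‖ + 1 / n)) + 8103 := by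
          rw [Finset.sum_add_distrib, ← Finset.mul_sum]; simp
          field_simp
      _ ≤ _ := by linarith
  · intro z ζ hz hζ
    have hzζ : 3500 ≤ ‖z - ζ‖ := by
      have := norm_sub_le_norm_sub_add_norm_sub z ζ z₀
      linarith
    have e : zeroL n p z - Real.log ‖z - ζ‖ + ((zeroB n p - ζ) / (z - ζ)).re =
        (1 / n : ℝ) * ∑ j ∈ Finset.range n,
          (ell (1 / n) (z - p j) - Real.log ‖z - ζ‖ + ((p j - ζ) / (z - ζ)).re) := by
      have e1 : zeroB n p - ζ = (1 / n : ℝ) * ∑ j ∈ Finset.range n, (p j - ζ) := by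
        conv_lhs => rw [← avg_const hn ζ]
        rw [zeroB, ← mul_sub, ← Finset.sum_sub_distrib]
      rw [e1, mul_div_assoc, Complex.re_ofReal_mul, Finset.sum_div, Complex.re_sum,
        Finset.sum_add_distrib, Finset.sum_sub_distrib, zeroL]
      simp
      field_simp
    rw [e]
    have h2 : 3000000 / ‖z - ζ‖ ^ 2 ≤ (K + 3000000) / ‖z - ζ‖ ^ 2 := by gcongr; linarith
    refine (abs_avg_le hn fun j hj => ?_).trans h2
    refine ell_far hd hd1 ?_ (by linarith)
    have := norm_sub_le_norm_sub_add_norm_sub (p j) z₀ ζ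
    have := hpz j hj
    rw [norm_sub_rev z₀] at *
    linarith
  · intro z hz
    rw [lapl_zeroL hn]
    refine abs_avg_le hn fun j hj => ?_
    have h1 : ‖z - z₀‖ / 2 ≤ ‖z - p j‖ := by
      have := norm_sub_le_norm_sub_add_norm_sub z (p j) z₀
      have := hpz j hj
      linarith
    have h2 := qk_le_far hd (z - p j) (norm_pos_iff.1 (by linarith))
    rw [abs_of_nonneg (by have := qk_nonneg hd (z - p j); positivity)]
    calc _ ≤ 2 * ((1 / n : ℝ) ^ 2 / ‖z - p j‖ ^ 4) := by gcongr
      _ ≤ 2 * (1 ^ 2 / (‖z - z₀‖ / 2) ^ 4) := by gcongr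
      _ = 32 / ‖z - z₀‖ ^ 4 := by field_simp; norm_num
      _ ≤ _ := by gcongr; linarith
  · intro z _
    rw [dX_zeroL hn, abs_mul, abs_of_pos hd, zeroN]
    refine (mul_le_mul_of_nonneg_left ((Finset.abs_sum_le_sum_abs _ _).trans
      (Finset.sum_le_sum fun j _ => abs_dX_ell_le hd (z - p j))) hd.le).trans ?_
    linarith
  · intro z _
    rw [dY_zeroL hn, abs_mul, abs_of_pos hd, zeroN]
    refine (mul_le_mul_of_nonneg_left ((Finset.abs_sum_le_sum_abs _ _).trans
      (Finset.sum_le_sum fun j _ => abs_dY_ell_le hd (z - p j))) hd.le).trans ?_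
    linarith
  · unfold zeroN
    refine continuous_const.add (continuous_const.mul (continuous_finsetSum _ fun j _ => ?_))
    exact continuous_const.div (by fun_prop) fun z => by positivity
  · intro z; unfold zeroN
    have : 0 ≤ (1 / n : ℝ) * ∑ j ∈ Finset.range n, 2 / (‖z - p j‖ + 1 / n) := by positivity
    linarith
  · intro z
    exact (hc n p w₀ hn hp z₀ z).trans (by linarith)

/-- A smooth modification of `log √s` for `s < 1`. -/
def cutLogAux (s : ℝ) : ℝ := Real.smoothTransition (2 * s - 1) * (1 / 2 * Real.log s)

theorem contDiff_cutLogAux : ContDiff ℝ ∞ cutLogAux := by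
  rw [contDiff_iff_contDiffAt]
  intro s
  rcases eq_or_ne s 0 with rfl | h
  · have : cutLogAux =ᶠ[𝓝 0] fun _ => 0 := by
      filter_upwards [eventually_lt_nhds (show (0 : ℝ) < 1 / 2 by norm_num)] with s hs
      rw [cutLogAux, Real.smoothTransition.zero_of_nonpos (by linarith), zero_mul]
    exact contDiffAt_const.congr_of_eventuallyEq this
  · refine ContDiffAt.mul ?_ (contDiffAt_const.mul (contDiffAt_id.log h))
    exact (Real.smoothTransition.contDiff.comp
      ((contDiff_const.mul contDiff_id).sub contDiff_const)).contDiffAt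

/-- A smooth modification of `log |z|` in the unit disc. -/
def cutLog (z : ℂ) : ℝ := cutLogAux (Complex.normSq z)

theorem contDiff_cutLog : ContDiff ℝ ∞ cutLog := contDiff_cutLogAux.comp contDiff_normSq

theorem cutLog_of_one_le {z : ℂ} (h : 1 ≤ ‖z‖) : cutLog z = Real.log ‖z‖ := by
  rw [cutLog, cutLogAux, Complex.normSq_eq_norm_sq, Real.smoothTransition.one_of_one_le (by nlinarith),
    Real.log_pow]
  push_cast; ring

theorem lapl_congr {E : Type*} [NormedAddCommGroup E] [NormedSpace ℝ E] {f g : ℂ → E} {z : ℂ}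
    (h : f =ᶠ[𝓝 z] g) : lapl f z = lapl g z := by
  have h1 : dX f =ᶠ[𝓝 z] dX g := by
    filter_upwards [h.eventuallyEq_nhds] with w hw
    unfold dX; rw [hw.fderiv_eq]
  have h2 : dY f =ᶠ[𝓝 z] dY g := by
    filter_upwards [h.eventuallyEq_nhds] with w hw
    unfold dY; rw [hw.fderiv_eq]
  unfold lapl
  conv_lhs => unfold dX dY
  conv_rhs => unfold dX dY
  have h3 := h1.fderiv_eq (𝕜 := ℝ)
  have h4 := h2.fderiv_eq (𝕜 := ℝ)
  change fderiv ℝ (dX f) z 1 + fderiv ℝ (dY f) z Complex.I =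
    fderiv ℝ (dX g) z 1 + fderiv ℝ (dY g) z Complex.I
  rw [h3, h4]

theorem lapl_cutLog {z : ℂ} (h : 1 < ‖z‖) : lapl cutLog z = 0 := by
  have hc := contDiff_infty_iff_deriv.1 contDiff_cutLogAux
  have hc' := contDiff_infty_iff_deriv.1 hc.2
  have hl := lapl_radial (g := cutLogAux) (g' := deriv cutLogAux) (g'' := deriv (deriv cutLogAux)) 0
    (fun s _ => (hc.1 s).hasDerivAt) (fun s _ => (hc'.1 s).hasDerivAt)
  simp only [sub_zero] at hl
  have e : ∀ s > 1, cutLogAux =ᶠ[𝓝 s] fun s => 1 / 2 * Real.log s := by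
    intro s hs
    filter_upwards [eventually_gt_nhds hs] with t ht
    rw [cutLogAux, Real.smoothTransition.one_of_one_le (by linarith), one_mul]
  have e1 : ∀ s > 1, deriv cutLogAux s = 1 / 2 * s⁻¹ := by
    intro s hs
    rw [(e s hs).deriv_eq, deriv_const_mul _ (Real.differentiableAt_log (by linarith)),
      Real.deriv_log]
  have e2 : ∀ s > 1, deriv (deriv cutLogAux) s = 1 / 2 * (-(s ^ 2)⁻¹) := by
    intro s hs
    have : deriv cutLogAux =ᶠ[𝓝 s] fun s => 1 / 2 * s⁻¹ := by
      filter_upwards [eventually_gt_nhds hs] with t ht using e1 t ht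
    rw [this.deriv_eq, deriv_const_mul _ (differentiableAt_inv (by linarith)), deriv_inv]
  have hs : 1 < Complex.normSq z := by rw [Complex.normSq_eq_norm_sq]; nlinarith
  change lapl (fun z => cutLogAux (Complex.normSq z)) z = 0
  rw [hl]
  simp only [e1 _ hs, e2 _ hs]
  field_simp
  ring

theorem exists_site_hole : ∃ C > 0, ∃ M, ∀ z₀ : ℂ,
    Site C z₀ (fun z => cutLog (z - z₀)) z₀ (fun _ => M) ∧
    (∀ z, |lapl (fun z => cutLog (z - z₀)) z| ≤ C) ∧
    ∀ z, 1 < ‖z - z₀‖ → lapl (fun z => cutLog (z - z₀)) z = 0 := by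
  have bdd : ∀ f : ℂ → ℝ, Continuous f → ∃ M, 0 ≤ M ∧ ∀ z ∈ closedBall (0 : ℂ) 8000, |f z| ≤ M := by
    intro f hf
    obtain ⟨M, hM⟩ := (isCompact_closedBall (0 : ℂ) 8000).exists_bound_of_continuousOn hf.continuousOn
    exact ⟨|M|, abs_nonneg _, fun z hz => (hM z hz).trans (le_abs_self M)⟩
  obtain ⟨M0, p0, h0⟩ := bdd _ contDiff_cutLog.continuous
  obtain ⟨M1, p1, h1⟩ := bdd _ (contDiff_dX contDiff_cutLog).continuous
  obtain ⟨M2, p2, h2⟩ := bdd _ (contDiff_dY contDiff_cutLog).continuous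
  obtain ⟨M3, p3, h3⟩ := bdd _ (contDiff_lapl contDiff_cutLog).continuous
  obtain ⟨K, hK, hc⟩ := exists_integral_rpow_le 8000
  have hmem : ∀ z z₀ : ℂ, ‖z - z₀‖ ≤ 8000 → z - z₀ ∈ closedBall (0 : ℂ) 8000 := by simp
  refine ⟨M0 + M3 + 2250000 + (M1 + M2 + 1) * (Real.pi * 8000 ^ 2 + K), by positivity, M1 + M2 + 1,
    fun z₀ => ⟨?_, fun z => ?_, fun z hz => ?_⟩⟩
  · have hpos : 0 ≤ (M1 + M2 + 1) * (Real.pi * 8000 ^ 2 + K) := by positivity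
    constructor
    · exact contDiff_comp_sub contDiff_cutLog _
    · simp
    · intro z hz
      linarith [h0 _ (hmem z z₀ hz)]
    · intro z ζ hz hζ
      have hzζ : 3500 ≤ ‖z - ζ‖ := by
        have := norm_sub_le_norm_sub_add_norm_sub z ζ z₀
        linarith
      rw [norm_sub_rev] at hζ
      have hne : z ≠ ζ := by
        rintro rfl; simp at hzζ; linarith
      rw [cutLog_of_one_le (by linarith)]
      refine (log_far (by linarith) hne).trans ?_
      rw [div_pow]
      gcongr
      nlinarith [norm_nonneg (z₀ - ζ)]
    · intro z hz
      rw [lapl_comp_sub, lapl_cutLog (by linarith), abs_zero]; positivity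
    · intro z hz
      rw [dX_comp_sub]; linarith [h1 _ (hmem z z₀ hz)]
    · intro z hz
      rw [dY_comp_sub]; linarith [h2 _ (hmem z z₀ hz)]
    · exact continuous_const
    · intro z; linarith
    · intro z
      have : IsFiniteMeasure (volume.restrict (closedBall z₀ 8000)) :=
        ⟨by rw [Measure.restrict_apply_univ]; exact measure_closedBall_lt_top⟩
      have hv := volume_real_closedBall z₀ (R := 8000) (by norm_num)
      rw [integral_const_mul]
      have : ∫ ζ in closedBall z₀ 8000, ‖ζ - z‖⁻¹ ≤ Real.pi * 8000 ^ 2 + K := by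
        calc _ ≤ ∫ ζ in closedBall z₀ 8000, (1 + ‖ζ - z‖ ^ (-(7 / 4) : ℝ)) :=
              integral_mono_of_nonneg (.of_forall fun ζ => by positivity)
                ((integrable_const _).add (hc z z₀).1) (.of_forall fun ζ => inv_norm_le_rpow _)
          _ = volume.real (closedBall z₀ 8000) +
              ∫ ζ in closedBall z₀ 8000, ‖ζ - z‖ ^ (-(7 / 4) : ℝ) := by
            rw [integral_add (integrable_const _) (hc z z₀).1]; simp
          _ ≤ _ := by rw [hv]; linarith [(hc z z₀).2]
      nlinarith
  · rw [lapl_comp_sub]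
    have hpos : 0 ≤ (M1 + M2 + 1) * (Real.pi * 8000 ^ 2 + K) := by positivity
    rcases le_or_gt ‖z - z₀‖ 8000 with h | h
    · linarith [h3 _ (hmem z z₀ h)]
    · rw [lapl_cutLog (by linarith), abs_zero]; positivity
  · rw [lapl_comp_sub, lapl_cutLog hz]

/-- The lattice `1000 ℤ[i]`. -/
def zq (q : ℤ × ℤ) : ℂ := ⟨1000 * q.1, 1000 * q.2⟩

@[simp] theorem zq_re (q : ℤ × ℤ) : (zq q).re = 1000 * q.1 := rfl
@[simp] theorem zq_im (q : ℤ × ℤ) : (zq q).im = 1000 * q.2 := rfl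

theorem dist_zq {p q : ℤ × ℤ} (h : p ≠ q) : 1000 ≤ ‖zq p - zq q‖ := by
  have key : ∀ a b : ℤ, a ≠ b → (1000 : ℝ) ≤ |1000 * (a : ℝ) - 1000 * b| := by
    intro a b hab
    have : (1 : ℝ) ≤ |((a - b : ℤ) : ℝ)| := by
      rw [← Int.cast_abs]
      exact_mod_cast Int.one_le_abs (sub_ne_zero.2 hab)
    rw [← mul_sub, abs_mul]
    push_cast at this
    norm_num
    linarith
  by_cases h1 : p.1 = q.1
  · have h2 : p.2 ≠ q.2 := fun h2 => h (Prod.ext h1 h2)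
    refine (key _ _ h2).trans ?_
    have := Complex.abs_im_le_norm (zq p - zq q)
    simpa using this
  · refine (key _ _ h1).trans ?_
    have := Complex.abs_re_le_norm (zq p - zq q)
    simpa using this

theorem lattice_sum_le {h : ℂ → ℝ} {A : ℝ} (h0 : ∀ w, 0 ≤ h w)
    (hA : ∀ u w, ‖u - w‖ ≤ 1 → h u ≤ A * h w) (I : Finset (ℤ × ℤ)) (z : ℂ) {U : Set ℂ}
    (hU : ∀ q ∈ I, ball (z - zq q) 1 ⊆ U) (hi : IntegrableOn h U) :
    ∑ q ∈ I, h (z - zq q) ≤ A / Real.pi * ∫ w in U, h w := by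
  have hpi := Real.pi_pos
  have hAn : 0 ≤ A ∨ ∀ w, h w = 0 := by
    by_contra! hc
    obtain ⟨hA0, w, hw⟩ := hc
    have := hA w w (by simp)
    have := h0 w
    have : 0 < h w := lt_of_le_of_ne (h0 w) hw.symm
    nlinarith
  rcases hAn with hA0 | hz
  swap
  · simp [hz]
  have hb : ∀ q ∈ I, h (z - zq q) ≤ A / Real.pi * ∫ w in ball (z - zq q) 1, h w := by
    intro q hq
    have h1 : ∫ _w in ball (z - zq q) 1, h (z - zq q) ≤ ∫ w in ball (z - zq q) 1, A * h w := by
      refine setIntegral_mono_on (integrableOn_const measure_ball_lt_top.ne)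
        ((hi.mono_set (hU q hq)).const_mul A) measurableSet_ball fun w hw => hA _ _ ?_
      rw [mem_ball, dist_eq_norm, norm_sub_rev] at hw
      exact hw.le
    rw [setIntegral_const, volume_real_ball _ zero_le_one, integral_const_mul] at h1
    simp only [one_pow, mul_one, smul_eq_mul] at h1
    rw [div_mul_eq_mul_div, le_div_iff₀ hpi]
    linarith
  have hd : (↑I : Set (ℤ × ℤ)).PairwiseDisjoint fun q => ball (z - zq q) 1 := by
    intro p _ q _ hpq
    refine ball_disjoint_ball ?_
    have := dist_zq hpq
    rw [dist_eq_norm, sub_sub_sub_cancel_left, norm_sub_rev]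
    linarith
  calc _ ≤ ∑ q ∈ I, A / Real.pi * ∫ w in ball (z - zq q) 1, h w := Finset.sum_le_sum hb
    _ = A / Real.pi * ∫ w in ⋃ q ∈ I, ball (z - zq q) 1, h w := by
      rw [← Finset.mul_sum, integral_biUnion_finset I (fun _ _ => measurableSet_ball) hd
        fun q hq => hi.mono_set (hU q hq)]
    _ ≤ _ := by
      refine mul_le_mul_of_nonneg_left ?_ (by positivity)
      exact setIntegral_mono_set hi (.of_forall h0) (LE.le.eventuallyLE
        (iUnion₂_subset hU))

theorem lattice_log {R : ℝ} (hR : 1 ≤ R) {I : Finset (ℤ × ℤ)} (hI : ∀ q ∈ I, ‖zq q‖ ≤ R) (z : ℂ) :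
    ∑ q ∈ I, 1 / (1 + ‖z - zq q‖ ^ 2) ≤ 12 * (1 + Real.log R) := by
  have hA : ∀ u w : ℂ, ‖u - w‖ ≤ 1 → 1 / (1 + ‖u‖ ^ 2) ≤ 3 * (1 / (1 + ‖w‖ ^ 2)) := by
    intro u w h
    have := norm_sub_le_norm_sub_add_norm_sub w u 0
    rw [norm_sub_rev w u] at this
    simp only [sub_zero] at this
    rw [mul_one_div, div_le_div_iff₀ (by positivity) (by positivity)]
    nlinarith [norm_nonneg u, norm_nonneg w, sq_nonneg (‖u‖ - 1)]
  have key : ∀ z : ℂ, ‖z‖ ≤ 2 * R → ∑ q ∈ I, 1 / (1 + ‖z - zq q‖ ^ 2) ≤ 12 * (1 + Real.log R) := by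
    intro z hz
    have hc : Continuous fun w : ℂ => 1 / (1 + ‖w‖ ^ 2) :=
      continuous_const.div (by fun_prop) fun w => by positivity
    have := lattice_sum_le (h := fun w => 1 / (1 + ‖w‖ ^ 2)) (fun w => by positivity) hA I z
      (U := ball 0 (4 * R)) (fun q hq w hw => by
        have h1 := hI q hq
        rw [mem_ball, dist_eq_norm] at hw
        rw [mem_ball_zero_iff]
        have h2 := norm_sub_le_norm_sub_add_norm_sub w (z - zq q) 0
        have h3 := norm_sub_le z (zq q)
        simp only [sub_zero] at h2
        linarith) ((hc.continuousOn.integrableOn_compact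
          (isCompact_closedBall 0 (4 * R))).mono_set ball_subset_closedBall)
    rw [integral_inv_one_add_sq (by linarith), ← mul_assoc, div_mul_cancel₀ _ Real.pi_pos.ne'] at this
    refine this.trans ?_
    have h1 : Real.log (1 + (4 * R) ^ 2) ≤ Real.log (17 * R ^ 2) :=
      Real.log_le_log (by positivity) (by nlinarith)
    rw [Real.log_mul (by norm_num) (by positivity), Real.log_pow] at h1
    have h2 : Real.log 17 ≤ 4 := by
      rw [Real.log_le_iff_le_exp (by norm_num)]
      have := Real.exp_one_gt_d9
      have e : Real.exp 4 = Real.exp 1 ^ 4 := by rw [← Real.exp_nat_mul]; norm_num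
      rw [e]
      have : (2.7 : ℝ) ^ 4 ≤ Real.exp 1 ^ 4 := by gcongr; linarith
      norm_num at this ⊢; linarith
    have h3 := Real.log_nonneg hR
    push_cast at h1
    linarith
  rcases le_or_gt ‖z‖ (2 * R) with hz | hz
  · exact key z hz
  · refine le_trans (Finset.sum_le_sum fun q hq => ?_) (key 0 (by simp; linarith))
    have h1 := hI q hq
    have h2 := norm_sub_norm_le z (zq q)
    have h3 : ‖zq q‖ ≤ ‖z - zq q‖ := by linarith
    rw [zero_sub, norm_neg]
    gcongr

theorem exists_lattice_cube : ∃ C > 0, ∀ (I : Finset (ℤ × ℤ)) (z : ℂ),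
    ∑ q ∈ I, 1 / (1 + ‖z - zq q‖) ^ 3 ≤ C := by
  have hi : Integrable (fun w : ℂ => 1 / (1 + ‖w‖) ^ 3) := by
    have := integrable_one_add_norm (E := ℂ) (μ := volume) (r := 3) (by simp; norm_num)
    refine this.congr (.of_forall fun w => ?_)
    simp only
    rw [Real.rpow_neg (by positivity), one_div]
    norm_cast
  refine ⟨8 / Real.pi * (∫ w : ℂ, 1 / (1 + ‖w‖) ^ 3) + 1, ?_, fun I z => ?_⟩
  · have : 0 ≤ ∫ w : ℂ, 1 / (1 + ‖w‖) ^ 3 := integral_nonneg fun w => by positivity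
    have := Real.pi_pos
    positivity
  · have hA : ∀ u w : ℂ, ‖u - w‖ ≤ 1 → 1 / (1 + ‖u‖) ^ 3 ≤ 8 * (1 / (1 + ‖w‖) ^ 3) := by
      intro u w h
      have := norm_sub_le_norm_sub_add_norm_sub w u 0
      rw [norm_sub_rev w u] at this
      simp only [sub_zero] at this
      rw [mul_one_div, div_le_div_iff₀ (by positivity) (by positivity)]
      have : (1 + ‖w‖) ^ 3 ≤ (2 * (1 + ‖u‖)) ^ 3 := by
        gcongr; linarith [norm_nonneg u]
      linarith
    have := lattice_sum_le (h := fun w => 1 / (1 + ‖w‖) ^ 3) (fun w => by positivity) hA I z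
      (U := univ) (fun _ _ => subset_univ _) hi.integrableOn
    rw [setIntegral_univ] at this
    linarith

/-- The cell of the lattice with lower left corner `zq Q`. -/
def cell (Q : ℤ × ℤ) : Set ℂ := {ζ | ⌊ζ.re / 1000⌋ = Q.1 ∧ ⌊ζ.im / 1000⌋ = Q.2}

theorem measurableSet_cell (Q : ℤ × ℤ) : MeasurableSet (cell Q) := by
  have h1 : Measurable fun ζ : ℂ => ⌊ζ.re / 1000⌋ := (Complex.measurable_re.div_const _).floor
  have h2 : Measurable fun ζ : ℂ => ⌊ζ.im / 1000⌋ := (Complex.measurable_im.div_const _).floor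
  exact (h1 (measurableSet_singleton Q.1)).inter (h2 (measurableSet_singleton Q.2))

/-- The vertices `0`, `e₁`, `e₂`. -/
def vtx : Fin 3 → ℤ × ℤ := ![(0, 0), (1, 0), (0, 1)]

theorem norm_sub_zq_le {Q : ℤ × ℤ} {ζ : ℂ} (h : ζ ∈ cell Q) (j : Fin 3) :
    ‖ζ - zq (Q + vtx j)‖ ≤ 1500 := by
  obtain ⟨h1, h2⟩ := h
  have a1 := Int.floor_le (ζ.re / 1000)
  have a2 := Int.lt_floor_add_one (ζ.re / 1000)
  have a3 := Int.floor_le (ζ.im / 1000)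
  have a4 := Int.lt_floor_add_one (ζ.im / 1000)
  rw [h1] at a1 a2
  rw [h2] at a3 a4
  rw [le_div_iff₀ (by norm_num)] at a1 a3
  rw [div_lt_iff₀ (by norm_num)] at a2 a4
  have hb : |(ζ - zq (Q + vtx j)).re| ≤ 1000 ∧ |(ζ - zq (Q + vtx j)).im| ≤ 1000 := by
    rw [abs_le, abs_le]
    fin_cases j <;> simp [vtx] <;> refine ⟨⟨?_, ?_⟩, ?_, ?_⟩ <;> linarith
  rw [← abs_of_nonneg (norm_nonneg (ζ - zq (Q + vtx j))), ← abs_of_nonneg (show (0:ℝ) ≤ 1500 by norm_num),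
    ← sq_le_sq, ← Complex.normSq_eq_norm_sq, Complex.normSq_apply]
  have := sq_le_sq' (abs_le.1 hb.1).1 (abs_le.1 hb.1).2
  have := sq_le_sq' (abs_le.1 hb.2).1 (abs_le.1 hb.2).2
  nlinarith

theorem norm_zq_vtx_le (Q : ℤ × ℤ) (j : Fin 3) : ‖zq (Q + vtx j) - zq Q‖ ≤ 1000 := by
  fin_cases j
  · have : Q + vtx 0 = Q := by simp [vtx]
    change ‖zq (Q + vtx 0) - zq Q‖ ≤ 1000
    rw [this]; simp
  · have : zq (Q + vtx 1) - zq Q = 1000 := by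
      apply Complex.ext <;> simp [vtx]; ring
    change ‖zq (Q + vtx 1) - zq Q‖ ≤ 1000
    rw [this]; simp
  · have : zq (Q + vtx 2) - zq Q = 1000 * Complex.I := by
      apply Complex.ext <;> simp [vtx]; ring
    change ‖zq (Q + vtx 2) - zq Q‖ ≤ 1000
    rw [this]; simp

/-- Barycentric coordinates with respect to three points. -/
def bcoef (b : Fin 3 → ℂ) (ζ : ℂ) : Fin 3 → ℝ :=
  let u := b 1 - b 0
  let w := b 2 - b 0
  let d := u.re * w.im - u.im * w.re
  let c1 := ((ζ - b 0).re * w.im - (ζ - b 0).im * w.re) / d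
  let c2 := (u.re * (ζ - b 0).im - u.im * (ζ - b 0).re) / d
  ![1 - c1 - c2, c1, c2]

theorem continuous_bcoef (b : Fin 3 → ℂ) (j : Fin 3) : Continuous fun ζ => bcoef b ζ j := by
  have h1 := Complex.continuous_re
  have h2 := Complex.continuous_im
  have h3 : Continuous fun ζ : ℂ => (ζ - b 0).re := h1.comp (continuous_id.sub continuous_const)
  have h4 : Continuous fun ζ : ℂ => (ζ - b 0).im := h2.comp (continuous_id.sub continuous_const)
  fin_cases j
  · exact (continuous_const.sub (((h3.mul_const _).sub (h4.mul_const _)).div_const _)).sub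
      (((h4.const_mul _).sub (h3.const_mul _)).div_const _)
  · exact ((h3.mul_const _).sub (h4.mul_const _)).div_const _
  · exact ((h4.const_mul _).sub (h3.const_mul _)).div_const _

theorem bcoef_spec {Q : ℤ × ℤ} {b : Fin 3 → ℂ} (hb : ∀ j, ‖b j - zq (Q + vtx j)‖ ≤ 102) {ζ : ℂ}
    (hζ : ζ ∈ cell Q) : ∑ j, bcoef b ζ j = 1 ∧ ∑ j, (bcoef b ζ j : ℂ) * (b j - ζ) = 0 ∧
      ∀ j, |bcoef b ζ j| ≤ 10 := by
  have hre := fun j => (Complex.abs_re_le_norm _).trans (hb j)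
  have him := fun j => (Complex.abs_im_le_norm _).trans (hb j)
  have r0 := hre 0
  have r1 := hre 1
  have r2 := hre 2
  have i0 := him 0
  have i1 := him 1
  have i2 := him 2
  have hz := norm_sub_zq_le hζ 0
  have hzr := (Complex.abs_re_le_norm _).trans hz
  have hzi := (Complex.abs_im_le_norm _).trans hz
  simp [vtx, abs_le] at r0 r1 r2 i0 i1 i2 hzr hzi
  obtain ⟨u1, hu1⟩ : ∃ x, x = (b 1 - b 0).re := ⟨_, rfl⟩
  obtain ⟨u2, hu2⟩ : ∃ x, x = (b 1 - b 0).im := ⟨_, rfl⟩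
  obtain ⟨w1, hw1⟩ : ∃ x, x = (b 2 - b 0).re := ⟨_, rfl⟩
  obtain ⟨w2, hw2⟩ : ∃ x, x = (b 2 - b 0).im := ⟨_, rfl⟩
  obtain ⟨x, hx⟩ : ∃ x, x = (ζ - b 0).re := ⟨_, rfl⟩
  obtain ⟨y, hy⟩ : ∃ x, x = (ζ - b 0).im := ⟨_, rfl⟩
  have e : bcoef b ζ = ![1 - (x * w2 - y * w1) / (u1 * w2 - u2 * w1) -
      (u1 * y - u2 * x) / (u1 * w2 - u2 * w1),
      (x * w2 - y * w1) / (u1 * w2 - u2 * w1), (u1 * y - u2 * x) / (u1 * w2 - u2 * w1)] := by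
    simp only [bcoef, hu1, hu2, hw1, hw2, hx, hy]
  have bu1 : 796 ≤ u1 ∧ u1 ≤ 1204 := by rw [hu1, Complex.sub_re]; constructor <;> linarith
  have bu2 : |u2| ≤ 204 := by rw [hu2, Complex.sub_im, abs_le]; constructor <;> linarith
  have bw1 : |w1| ≤ 204 := by rw [hw1, Complex.sub_re, abs_le]; constructor <;> linarith
  have bw2 : 796 ≤ w2 ∧ w2 ≤ 1204 := by rw [hw2, Complex.sub_im]; constructor <;> linarith
  have bx : |x| ≤ 1602 := by rw [hx, Complex.sub_re, abs_le]; constructor <;> linarith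
  have bY : |y| ≤ 1602 := by rw [hy, Complex.sub_im, abs_le]; constructor <;> linarith
  have p1 : |u2 * w1| ≤ 204 * 204 := by rw [abs_mul]; gcongr
  have hd : 592000 ≤ u1 * w2 - u2 * w1 := by nlinarith [(abs_le.1 p1).2]
  have hd0 : u1 * w2 - u2 * w1 ≠ 0 := by linarith
  have c1 : |(x * w2 - y * w1) / (u1 * w2 - u2 * w1)| ≤ 4 := by
    rw [abs_div, abs_of_pos (show 0 < u1 * w2 - u2 * w1 by linarith), div_le_iff₀ (by linarith)]
    have q1 : |x * w2| ≤ 1602 * 1204 := by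
      rw [abs_mul, abs_of_pos (show 0 < w2 by linarith)]
      exact mul_le_mul bx bw2.2 (by linarith) (by norm_num)
    have q2 : |y * w1| ≤ 1602 * 204 := by rw [abs_mul]; gcongr
    have := abs_sub (x * w2) (y * w1)
    linarith
  have c2 : |(u1 * y - u2 * x) / (u1 * w2 - u2 * w1)| ≤ 4 := by
    rw [abs_div, abs_of_pos (show 0 < u1 * w2 - u2 * w1 by linarith), div_le_iff₀ (by linarith)]
    have q1 : |u1 * y| ≤ 1204 * 1602 := by
      rw [abs_mul, abs_of_pos (show 0 < u1 by linarith)]; gcongr; exact bu1.2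
    have q2 : |u2 * x| ≤ 204 * 1602 := by rw [abs_mul]; gcongr
    have := abs_sub (u1 * y) (u2 * x)
    linarith
  obtain ⟨α, hα⟩ : ∃ α, α = (x * w2 - y * w1) / (u1 * w2 - u2 * w1) := ⟨_, rfl⟩
  obtain ⟨β, hβ⟩ : ∃ β, β = (u1 * y - u2 * x) / (u1 * w2 - u2 * w1) := ⟨_, rfl⟩
  have hα' := (eq_div_iff hd0).1 hα
  have hβ' := (eq_div_iff hd0).1 hβ
  have g1 : α * u1 + β * w1 = x :=
    mul_right_cancel₀ hd0 (by linear_combination u1 * hα' + w1 * hβ')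
  have g2 : α * u2 + β * w2 = y :=
    mul_right_cancel₀ hd0 (by linear_combination u2 * hα' + w2 * hβ')
  rw [← hα] at c1 e
  rw [← hβ] at c2 e
  refine ⟨?_, ?_, ?_⟩
  · rw [e, Fin.sum_univ_three]; simp; ring
  · have f0 : b 0 - ζ = - ⟨x, y⟩ := by
      apply Complex.ext <;> simp [hx, hy]
    have f1 : b 1 - ζ = (⟨u1, u2⟩ : ℂ) - ⟨x, y⟩ := by
      apply Complex.ext <;> simp [hx, hy, hu1, hu2]
    have f2 : b 2 - ζ = (⟨w1, w2⟩ : ℂ) - ⟨x, y⟩ := by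
      apply Complex.ext <;> simp [hx, hy, hw1, hw2]
    rw [e, Fin.sum_univ_three, f0, f1, f2]
    apply Complex.ext
    · simp; linear_combination g1
    · simp; linear_combination g2
  · intro j
    rw [e]
    rw [abs_le] at c1 c2
    fin_cases j <;> simp only [abs_le] <;> simp <;> constructor <;> linarith

theorem mem_closedBall_of_mem_cell {Q : ℤ × ℤ} {ζ : ℂ} (hζ : ζ ∈ cell Q) : ζ ∈ closedBall (zq Q) 1500 := by
  have := norm_sub_zq_le hζ 0
  have e : Q + vtx 0 = Q := by simp [vtx]
  rw [e] at this
  rwa [mem_closedBall, dist_eq_norm]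

/-- A bounded density carried by a cell of the lattice. -/
structure CellDensity (Q : ℤ × ℤ) (S : ℝ) (σ : ℂ → ℝ) : Prop where
  meas : Measurable σ
  bound : ∀ ζ, |σ ζ| ≤ S
  supp : ∀ ζ, ζ ∉ cell Q → σ ζ = 0

section
variable {Q : ℤ × ℤ} {S : ℝ} {σ : ℂ → ℝ} (h : CellDensity Q S σ)
include h

theorem CellDensity.nonneg : 0 ≤ S := (abs_nonneg _).trans (h.bound 0)

theorem CellDensity.compact : HasCompactSupport σ :=
  HasCompactSupport.intro (isCompact_closedBall (zq Q) 1500) fun ζ hζ =>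
    h.supp ζ fun hc => hζ (mem_closedBall_of_mem_cell hc)

theorem CellDensity.integrable : Integrable σ := by
  have h1 : IntegrableOn σ (closedBall (zq Q) 1500) :=
    Measure.integrableOn_of_bounded (M := S) measure_closedBall_lt_top.ne
      h.meas.aestronglyMeasurable (.of_forall fun ζ => h.bound ζ)
  refine (integrableOn_iff_integrable_of_support_subset fun ζ hζ => ?_).1 h1
  by_contra hc
  exact hζ (h.supp ζ fun hh => hc (mem_closedBall_of_mem_cell hh))

theorem CellDensity.integrable_mul {k : ℂ → ℝ} (hk : Continuous k) :
    Integrable fun ζ => σ ζ * k ζ := by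
  obtain ⟨C, hC⟩ := (isCompact_closedBall (zq Q) 1500).exists_bound_of_continuousOn hk.continuousOn
  refine (h.integrable.norm.mul_const C).mono'
    (h.integrable.aestronglyMeasurable.mul hk.aestronglyMeasurable) (.of_forall fun ζ => ?_)
  rw [norm_mul]
  by_cases hζ : ζ ∈ cell Q
  · gcongr; exact hC ζ (mem_closedBall_of_mem_cell hζ)
  · simp [h.supp ζ hζ]

theorem CellDensity.abs_integral_le {k : ℂ → ℝ} {M : ℝ} (hk : ∀ ζ ∈ cell Q, |k ζ| ≤ M) :
    |∫ ζ, σ ζ * k ζ| ≤ S * M * (Real.pi * 1500 ^ 2) := by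
  have e : ∫ ζ, σ ζ * k ζ = ∫ ζ in closedBall (zq Q) 1500, σ ζ * k ζ := by
    refine (setIntegral_eq_integral_of_forall_compl_eq_zero fun ζ hζ => ?_).symm
    rw [h.supp ζ fun hh => hζ (mem_closedBall_of_mem_cell hh), zero_mul]
  have hS := h.nonneg
  rw [e, ← volume_real_closedBall (zq Q) (by norm_num), ← Real.norm_eq_abs]
  by_cases hM : 0 ≤ M
  · refine norm_setIntegral_le_of_norm_le_const measure_closedBall_lt_top fun ζ _ => ?_
    rw [norm_mul]
    by_cases hζ : ζ ∈ cell Q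
    · exact mul_le_mul (h.bound ζ) (hk ζ hζ) (norm_nonneg _) hS
    · rw [h.supp ζ hζ]; simp; positivity
  · have : zq Q ∈ cell Q := by simp [cell]
    exact absurd ((abs_nonneg _).trans (hk _ this)) hM

theorem CellDensity.abs_integral_le_rpow {K : ℝ} (hK : ∀ z c : ℂ,
    IntegrableOn (fun ζ => ‖ζ - z‖ ^ (-(7 / 4) : ℝ)) (closedBall c 1500) ∧
    ∫ ζ in closedBall c 1500, ‖ζ - z‖ ^ (-(7 / 4) : ℝ) ≤ K) {k : ℂ → ℝ} {A B : ℝ} (z : ℂ)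
    (hA : 0 ≤ A) (hB : 0 ≤ B)
    (hk : ∀ ζ ∈ cell Q, ζ ≠ z → |k ζ| ≤ A + B * ‖ζ - z‖ ^ (-(7 / 4) : ℝ)) :
    |∫ ζ, σ ζ * k ζ| ≤ S * (A * (Real.pi * 1500 ^ 2) + B * K) := by
  have : IsFiniteMeasure (volume.restrict (closedBall (zq Q) 1500)) :=
    ⟨by rw [Measure.restrict_apply_univ]; exact measure_closedBall_lt_top⟩
  have e : ∫ ζ, σ ζ * k ζ = ∫ ζ in closedBall (zq Q) 1500, σ ζ * k ζ := by
    refine (setIntegral_eq_integral_of_forall_compl_eq_zero fun ζ hζ => ?_).symm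
    rw [h.supp ζ fun hh => hζ (mem_closedBall_of_mem_cell hh), zero_mul]
  have hS := h.nonneg
  have hi := (hK z (zq Q)).1
  have hg : IntegrableOn (fun ζ => S * (A + B * ‖ζ - z‖ ^ (-(7 / 4) : ℝ))) (closedBall (zq Q) 1500) :=
    ((integrable_const A).add (hi.const_mul B)).const_mul S
  rw [e, ← Real.norm_eq_abs]
  calc _ ≤ ∫ ζ in closedBall (zq Q) 1500, S * (A + B * ‖ζ - z‖ ^ (-(7 / 4) : ℝ)) := by
        refine norm_integral_le_of_norm_le hg ?_
        filter_upwards [ae_restrict_of_ae (Measure.ae_ne volume z)] with ζ hζ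
        rw [norm_mul]
        by_cases hc : ζ ∈ cell Q
        · exact mul_le_mul (h.bound ζ) (hk ζ hc hζ) (norm_nonneg _) hS
        · rw [h.supp ζ hc]; simp; positivity
    _ = S * (A * (Real.pi * 1500 ^ 2) +
        B * ∫ ζ in closedBall (zq Q) 1500, ‖ζ - z‖ ^ (-(7 / 4) : ℝ)) := by
        rw [integral_const_mul, integral_add (integrable_const _) (hi.const_mul B),
          integral_const_mul, ← volume_real_closedBall (zq Q) (by norm_num)]
        simp; left; ring
    _ ≤ _ := by
        gcongr; exact (hK z (zq Q)).2
end

/-- The mass assigned to the `j`-th vertex of the cell `Q`. -/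
def cellC (b : ℤ × ℤ → ℂ) (Q : ℤ × ℤ) (σ : ℂ → ℝ) (j : Fin 3) : ℝ :=
  ∫ ζ, σ ζ * bcoef (fun j => b (Q + vtx j)) ζ j

/-- The potential of `σ` with its mass and first moments swept to the vertices of `Q`. -/
def cellT (δ : ℝ) (b : ℤ × ℤ → ℂ) (L : ℤ × ℤ → ℂ → ℝ) (Q : ℤ × ℤ) (σ : ℂ → ℝ) (z : ℂ) : ℝ :=
  cv σ (ell δ) z - ∑ j, cellC b Q σ j * L (Q + vtx j) z

section
variable {δ Cs : ℝ} (hδ : 0 < δ) {b : ℤ × ℤ → ℂ} {L N : ℤ × ℤ → ℂ → ℝ}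
  (hs : ∀ q, Site Cs (zq q) (L q) (b q) (N q)) {Q : ℤ × ℤ} {S : ℝ} {σ : ℂ → ℝ}
  (h : CellDensity Q S σ)
include hs h

theorem abs_cellC_le (j : Fin 3) : |cellC b Q σ j| ≤ S * 10 * (Real.pi * 1500 ^ 2) :=
  h.abs_integral_le fun _ hζ => (bcoef_spec (fun j => (hs (Q + vtx j)).bary) hζ).2.2 j

include hδ

theorem contDiff_cellT : ContDiff ℝ ∞ (cellT δ b L Q σ) :=
  (cv_contDiff h.integrable h.compact (contDiff_ell hδ)).sub
    (ContDiff.sum fun j _ => contDiff_const.mul (hs (Q + vtx j)).smooth)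

theorem dX_cellT : dX (cellT δ b L Q σ) = fun z =>
    cv σ (dX (ell δ)) z - ∑ j, cellC b Q σ j * dX (L (Q + vtx j)) z := by
  have h1 := cv_contDiff h.integrable h.compact (contDiff_ell hδ)
  have h2 : ∀ j ∈ Finset.univ, ContDiff ℝ ∞ fun z => cellC b Q σ j * L (Q + vtx j) z :=
    fun j _ => contDiff_const.mul (hs (Q + vtx j)).smooth
  have := dX_sub h1.diffl (ContDiff.sum h2).diffl
  rw [dX_sum fun j hj => (h2 j hj).diffl, cv_dX h.integrable h.compact (contDiff_ell hδ)] at this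
  refine this.trans (funext fun z => ?_)
  congr 1
  refine Finset.sum_congr rfl fun j _ => ?_
  rw [dX_const_mul _ (hs (Q + vtx j)).smooth.diffl]

theorem dY_cellT : dY (cellT δ b L Q σ) = fun z =>
    cv σ (dY (ell δ)) z - ∑ j, cellC b Q σ j * dY (L (Q + vtx j)) z := by
  have h1 := cv_contDiff h.integrable h.compact (contDiff_ell hδ)
  have h2 : ∀ j ∈ Finset.univ, ContDiff ℝ ∞ fun z => cellC b Q σ j * L (Q + vtx j) z :=
    fun j _ => contDiff_const.mul (hs (Q + vtx j)).smooth
  have := dY_sub h1.diffl (ContDiff.sum h2).diffl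
  rw [dY_sum fun j hj => (h2 j hj).diffl, cv_dY h.integrable h.compact (contDiff_ell hδ)] at this
  refine this.trans (funext fun z => ?_)
  congr 1
  refine Finset.sum_congr rfl fun j _ => ?_
  rw [dY_const_mul _ (hs (Q + vtx j)).smooth.diffl]

theorem lapl_cellT : lapl (cellT δ b L Q σ) = fun z =>
    2 * cv σ (qk δ) z - ∑ j, cellC b Q σ j * lapl (L (Q + vtx j)) z := by
  have h1 := cv_contDiff h.integrable h.compact (contDiff_ell hδ)
  have h2 : ∀ j ∈ Finset.univ, ContDiff ℝ ∞ fun z => cellC b Q σ j * L (Q + vtx j) z :=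
    fun j _ => contDiff_const.mul (hs (Q + vtx j)).smooth
  have := lapl_sub h1 (ContDiff.sum h2)
  rw [lapl_sum h2] at this
  refine this.trans (funext fun z => ?_)
  simp only
  rw [cv_lapl h.integrable h.compact (contDiff_ell hδ), lapl_ell hδ]
  congr 1
  · unfold cv
    rw [← integral_const_mul]
    congr 1; ext ζ; simp; ring
  · refine Finset.sum_congr rfl fun j _ => ?_
    rw [lapl_const_mul _ (hs (Q + vtx j)).smooth]

omit h in
theorem cellT_kernel_far (hδ1 : δ ≤ 1) {z ζ : ℂ} (hz : 6500 ≤ ‖z - zq Q‖) (hζ : ζ ∈ cell Q) :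
    |ell δ (z - ζ) - ∑ j, bcoef (fun j => b (Q + vtx j)) ζ j * L (Q + vtx j) z| ≤
      4 * (1 + 30 * Cs) / ‖z - zq Q‖ ^ 2 := by
  obtain ⟨h1, h2, h3⟩ := bcoef_spec (fun j => (hs (Q + vtx j)).bary) hζ
  have hζ0 : ‖ζ - zq Q‖ ≤ 1500 := by
    have := norm_sub_zq_le hζ 0
    rwa [show Q + vtx 0 = Q by simp [vtx]] at this
  have hr : ‖z - zq Q‖ / 2 ≤ ‖z - ζ‖ := by
    have := norm_sub_le_norm_sub_add_norm_sub z ζ (zq Q)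
    linarith
  have hr0 : 0 < ‖z - ζ‖ := by linarith
  have hL : ∀ j, |L (Q + vtx j) z - Real.log ‖z - ζ‖ + ((b (Q + vtx j) - ζ) / (z - ζ)).re| ≤
      Cs / ‖z - ζ‖ ^ 2 := fun j => (hs (Q + vtx j)).far z ζ (by
        have := norm_sub_le_norm_sub_add_norm_sub z (zq (Q + vtx j)) (zq Q)
        have := norm_zq_vtx_le Q j
        linarith) (norm_sub_zq_le hζ j)
  have hell := abs_ell_sub_log_le hδ (z - ζ) (norm_pos_iff.1 hr0)
  set c := bcoef (fun j => b (Q + vtx j)) ζ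
  have e0 : ∑ j, c j * ((b (Q + vtx j) - ζ) / (z - ζ)).re = 0 := by
    have : ((∑ j, (c j : ℂ) * (b (Q + vtx j) - ζ)) / (z - ζ)).re = 0 := by rw [h2]; simp
    rw [Finset.sum_div, Complex.re_sum] at this
    rw [← this]
    refine Finset.sum_congr rfl fun j _ => ?_
    rw [mul_div_assoc, Complex.re_ofReal_mul]
  have e : ell δ (z - ζ) - ∑ j, c j * L (Q + vtx j) z = (ell δ (z - ζ) - Real.log ‖z - ζ‖) -
      ∑ j, c j * (L (Q + vtx j) z - Real.log ‖z - ζ‖ + ((b (Q + vtx j) - ζ) / (z - ζ)).re) := by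
    simp only [mul_add, mul_sub, Finset.sum_add_distrib, Finset.sum_sub_distrib, e0,
      ← Finset.sum_mul, h1]
    ring
  rw [e]
  have hCs : 0 ≤ Cs / ‖z - ζ‖ ^ 2 := (abs_nonneg _).trans (hL 0)
  have hCs' : 0 ≤ Cs := by
    by_contra hc
    have := div_neg_of_neg_of_pos (not_le.1 hc) (pow_pos hr0 2)
    linarith
  have t1 : |∑ j, c j * (L (Q + vtx j) z - Real.log ‖z - ζ‖ +
      ((b (Q + vtx j) - ζ) / (z - ζ)).re)| ≤ ∑ _j : Fin 3, 10 * (Cs / ‖z - ζ‖ ^ 2) := by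
    refine (Finset.abs_sum_le_sum_abs _ _).trans (Finset.sum_le_sum fun j _ => ?_)
    rw [abs_mul]
    exact mul_le_mul (h3 j) (hL j) (abs_nonneg _) (by norm_num)
  have t2 : δ ^ 2 / (2 * ‖z - ζ‖ ^ 2) ≤ 1 / ‖z - ζ‖ ^ 2 := by
    rw [div_le_div_iff₀ (by positivity) (by positivity)]
    have : δ ^ 2 ≤ 1 := by nlinarith
    nlinarith [sq_nonneg ‖z - ζ‖]
  have t3 : (1 + 30 * Cs) / ‖z - ζ‖ ^ 2 ≤ 4 * (1 + 30 * Cs) / ‖z - zq Q‖ ^ 2 := by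
    rw [div_le_div_iff₀ (by positivity) (by nlinarith)]
    have : ‖z - zq Q‖ ^ 2 ≤ 4 * ‖z - ζ‖ ^ 2 := by nlinarith [norm_nonneg (z - zq Q)]
    nlinarith
  have t4 : (1 + 30 * Cs) / ‖z - ζ‖ ^ 2 = 1 / ‖z - ζ‖ ^ 2 + 3 * (10 * (Cs / ‖z - ζ‖ ^ 2)) := by ring
  simp at t1
  refine (abs_sub _ _).trans ?_
  linarith

theorem abs_cellT_far (hδ1 : δ ≤ 1) {z : ℂ} (hz : 6500 ≤ ‖z - zq Q‖) :
    |cellT δ b L Q σ z| ≤ S * (4 * (1 + 30 * Cs) / ‖z - zq Q‖ ^ 2) * (Real.pi * 1500 ^ 2) := by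
  have e : cellT δ b L Q σ z = ∫ ζ, σ ζ *
      (ell δ (z - ζ) - ∑ j, bcoef (fun j => b (Q + vtx j)) ζ j * L (Q + vtx j) z) := by
    have i1 := cv_integrable h.integrable h.compact (contDiff_ell hδ).continuous z
    have i2 : ∀ j ∈ Finset.univ, Integrable fun ζ => σ ζ * bcoef (fun j => b (Q + vtx j)) ζ j *
      L (Q + vtx j) z := fun j _ => (h.integrable_mul (continuous_bcoef _ j)).mul_const _
    simp only [smul_eq_mul] at i1
    simp only [mul_sub, Finset.mul_sum, ← mul_assoc]
    rw [integral_sub i1 (integrable_finsetSum _ i2), integral_finsetSum _ i2]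
    simp only [integral_mul_const]
    rfl
  rw [e]
  exact h.abs_integral_le fun ζ hζ => cellT_kernel_far hδ hs hδ1 hz hζ

end

section
variable {δ Cs : ℝ} (hδ : 0 < δ) (hδ1 : δ ≤ 1) {b : ℤ × ℤ → ℂ} {L N : ℤ × ℤ → ℂ → ℝ}
  (hs : ∀ q, Site Cs (zq q) (L q) (b q) (N q)) {Q : ℤ × ℤ} {S : ℝ} {σ : ℂ → ℝ}
  (h : CellDensity Q S σ)
include hs

omit hs in
theorem norm_sub_zq_vtx_le (z : ℂ) (Q : ℤ × ℤ) (j : Fin 3) :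
    ‖z - zq (Q + vtx j)‖ ≤ ‖z - zq Q‖ + 1000 ∧ ‖z - zq Q‖ ≤ ‖z - zq (Q + vtx j)‖ + 1000 := by
  have h1 := norm_zq_vtx_le Q j
  have h2 := norm_sub_le_norm_sub_add_norm_sub z (zq Q) (zq (Q + vtx j))
  have h3 := norm_sub_le_norm_sub_add_norm_sub z (zq (Q + vtx j)) (zq Q)
  have h4 := norm_sub_rev (zq (Q + vtx j)) (zq Q)
  constructor <;> linarith

omit hs in
theorem norm_sub_cell_le {ζ : ℂ} (hζ : ζ ∈ cell Q) : ‖ζ - zq Q‖ ≤ 1500 := by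
  have := norm_sub_zq_le hζ 0
  rwa [show Q + vtx 0 = Q by simp [vtx]] at this

omit hs in
theorem Site.const_nonneg {C : ℝ} {z₀ b : ℂ} {L N : ℂ → ℝ} (h : Site C z₀ L b N) : 0 ≤ C :=
  (abs_nonneg _).trans (h.near z₀ (by simp))

omit hs in
theorem abs_sum_cellC_le (h : CellDensity Q S σ) {g : Fin 3 → ℝ} {G : Fin 3 → ℝ}
    (hs : ∀ q, Site Cs (zq q) (L q) (b q) (N q)) (hg : ∀ j, |g j| ≤ G j) :
    |∑ j, cellC b Q σ j * g j| ≤ S * 10 * (Real.pi * 1500 ^ 2) * ∑ j, G j := by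
  rw [Finset.mul_sum]
  refine (Finset.abs_sum_le_sum_abs _ _).trans (Finset.sum_le_sum fun j _ => ?_)
  rw [abs_mul]
  have := h.nonneg
  exact mul_le_mul (abs_cellC_le hs h j) (hg j) (abs_nonneg _) (by positivity)

include hδ h in
include hδ1 in
theorem abs_cellT_near {K : ℝ} (hK : ∀ z c : ℂ,
    IntegrableOn (fun ζ => ‖ζ - z‖ ^ (-(7 / 4) : ℝ)) (closedBall c 1500) ∧
    ∫ ζ in closedBall c 1500, ‖ζ - z‖ ^ (-(7 / 4) : ℝ) ≤ K) {z : ℂ} (hz : ‖z - zq Q‖ ≤ 7000) :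
    |cellT δ b L Q σ z| ≤
      S * (8009 * (Real.pi * 1500 ^ 2) + 4 * K + 30 * (Real.pi * 1500 ^ 2) * Cs) := by
  have h1 : |cv σ (ell δ) z| ≤ S * (8009 * (Real.pi * 1500 ^ 2) + 4 * K) := by
    refine h.abs_integral_le_rpow (k := fun ζ => ell δ (z - ζ)) hK z (by norm_num) (by norm_num)
      fun ζ hζ hne => ?_
    have hr : 0 < ‖z - ζ‖ := norm_pos_iff.2 (sub_ne_zero.2 hne.symm)
    have hr8 : ‖z - ζ‖ ≤ 8500 := by
      have := norm_sub_le_norm_sub_add_norm_sub z (zq Q) ζ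
      have h5 := norm_sub_cell_le hζ
      rw [norm_sub_rev] at h5
      linarith
    have e := abs_ell_le hδ hδ1 (z - ζ)
    have e2 := inv_norm_le_rpow (z - ζ)
    have e3 : 1 / √(‖z - ζ‖ + δ) ≤ 1 / √‖z - ζ‖ :=
      one_div_le_one_div_of_le (by positivity) (Real.sqrt_le_sqrt (by linarith))
    have e4 : 1 / √‖z - ζ‖ ≤ (1 + ‖z - ζ‖⁻¹) / 2 := by
      have := sq_nonneg (1 / √‖z - ζ‖ - 1)
      have h7 : (1 / √‖z - ζ‖) ^ 2 = ‖z - ζ‖⁻¹ := by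
        rw [div_pow, Real.sq_sqrt hr.le]; simp
      nlinarith
    have e5 : 0 ≤ ‖z - ζ‖ ^ (-(7 / 4) : ℝ) := by positivity
    rw [norm_sub_rev ζ z]
    have e6 : 4 / √(‖z - ζ‖ + δ) = 4 * (1 / √(‖z - ζ‖ + δ)) := by ring
    rw [e6] at e
    by_cases hc : ‖z - ζ‖ ≤ 8000
    · linarith
    · have : 1 / √(‖z - ζ‖ + δ) ≤ 1 := by
        rw [div_le_one (by positivity)]
        exact Real.one_le_sqrt.2 (by linarith)
      have hh := e
      have : Real.log 1 = 0 := Real.log_one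
      have : |ell δ (z - ζ)| ≤ 8009 := by
        have e7 := abs_ell_sub_log_le hδ (z - ζ) (norm_pos_iff.1 hr)
        have e8 : δ ^ 2 / (2 * ‖z - ζ‖ ^ 2) ≤ 1 := by
          rw [div_le_one (by positivity)]; nlinarith
        have e9 : |Real.log ‖z - ζ‖| ≤ 8000 := by
          rw [abs_of_nonneg (Real.log_nonneg (by linarith))]
          have := Real.log_le_sub_one_of_pos (x := ‖z - ζ‖ / 8) (by positivity)
          rw [Real.log_div hr.ne' (by norm_num)] at this
          have := Real.log_le_sub_one_of_pos (x := (8 : ℝ)) (by norm_num)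
          linarith
        have := abs_sub_abs_le_abs_sub (ell δ (z - ζ)) (Real.log ‖z - ζ‖)
        linarith
      linarith
  have h2 := abs_sum_cellC_le h hs (g := fun j => L (Q + vtx j) z) (G := fun _ => Cs) fun j =>
    (hs _).near z (by linarith [(norm_sub_zq_vtx_le z Q j).1])
  simp only [Finset.sum_const, Finset.card_univ, Fintype.card_fin, nsmul_eq_mul] at h2
  have := abs_sub (cv σ (ell δ) z) (∑ j, cellC b Q σ j * L (Q + vtx j) z)
  simp only [cellT]
  push_cast at h2
  linarith

include hδ h in
include hδ1 in
theorem abs_lapl_cellT_far {z : ℂ} (hz : 6500 ≤ ‖z - zq Q‖) :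
    |lapl (cellT δ b L Q σ) z| ≤
      S * (Real.pi * 1500 ^ 2) * (32 + 480 * Cs) / ‖z - zq Q‖ ^ 4 := by
  set r := ‖z - zq Q‖
  have hr : 0 < r := by linarith
  have h1 : |cv σ (qk δ) z| ≤ S * (16 / r ^ 4) * (Real.pi * 1500 ^ 2) := by
    refine h.abs_integral_le (k := fun ζ => qk δ (z - ζ)) fun ζ hζ => ?_
    have hr2 : r / 2 ≤ ‖z - ζ‖ := by
      have := norm_sub_le_norm_sub_add_norm_sub z ζ (zq Q)
      have := norm_sub_cell_le hζ
      linarith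
    have hp : 0 < ‖z - ζ‖ := by linarith
    rw [abs_of_nonneg (qk_nonneg hδ _)]
    refine (qk_le_far hδ _ (norm_pos_iff.1 hp)).trans ?_
    calc δ ^ 2 / ‖z - ζ‖ ^ 4 ≤ 1 / (r / 2) ^ 4 := by
          gcongr
          nlinarith
      _ = 16 / r ^ 4 := by field_simp; norm_num
  have h2 := abs_sum_cellC_le h hs (g := fun j => lapl (L (Q + vtx j)) z)
    (G := fun _ => 16 * Cs / r ^ 4) fun j => by
      have e := (norm_sub_zq_vtx_le z Q j).2
      refine ((hs _).lapl_far z (by linarith)).trans ?_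
      have := (hs Q).const_nonneg
      calc Cs / ‖z - zq (Q + vtx j)‖ ^ 4 ≤ Cs / (r / 2) ^ 4 := by
            gcongr
            linarith
        _ = 16 * Cs / r ^ 4 := by field_simp; norm_num
  simp only [Finset.sum_const, Finset.card_univ, Fintype.card_fin, nsmul_eq_mul] at h2
  have := abs_sub (2 * cv σ (qk δ) z) (∑ j, cellC b Q σ j * lapl (L (Q + vtx j)) z)
  rw [abs_mul, abs_two] at this
  rw [lapl_cellT hδ hs h]
  calc _ ≤ _ := this
    _ ≤ 2 * (S * (16 / r ^ 4) * (Real.pi * 1500 ^ 2)) +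
        S * 10 * (Real.pi * 1500 ^ 2) * (((3 : ℕ) : ℝ) * (16 * Cs / r ^ 4)) := by linarith
    _ = _ := by push_cast; ring

include hδ h in
theorem abs_dX_dY_cellT_near {K : ℝ} (hK : ∀ z c : ℂ,
    IntegrableOn (fun ζ => ‖ζ - z‖ ^ (-(7 / 4) : ℝ)) (closedBall c 1500) ∧
    ∫ ζ in closedBall c 1500, ‖ζ - z‖ ^ (-(7 / 4) : ℝ) ≤ K) {z : ℂ} (hz : ‖z - zq Q‖ ≤ 7000) :
    |dX (cellT δ b L Q σ) z| ≤ S * (2 * (Real.pi * 1500 ^ 2) + 2 * K) +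
      S * 10 * (Real.pi * 1500 ^ 2) * ∑ j, N (Q + vtx j) z ∧
    |dY (cellT δ b L Q σ) z| ≤ S * (2 * (Real.pi * 1500 ^ 2) + 2 * K) +
      S * 10 * (Real.pi * 1500 ^ 2) * ∑ j, N (Q + vtx j) z := by
  have aux : ∀ w : ℂ, ∀ t : ℝ, |t| ≤ 2 / (‖w‖ + δ) → w ≠ 0 →
      |t| ≤ 2 + 2 * ‖w‖ ^ (-(7 / 4) : ℝ) := by
    intro w t ht hw
    have hr : 0 < ‖w‖ := norm_pos_iff.2 hw
    have e2 := inv_norm_le_rpow w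
    have : 2 / (‖w‖ + δ) ≤ 2 / ‖w‖ := by gcongr; linarith
    have e3 : 2 / ‖w‖ = 2 * ‖w‖⁻¹ := by ring
    linarith
  have key : ∀ j, ‖z - zq (Q + vtx j)‖ ≤ 8000 := fun j => by
    linarith [(norm_sub_zq_vtx_le z Q j).1]
  constructor
  · rw [dX_cellT hδ hs h]
    refine (abs_sub _ _).trans (add_le_add ?_ ?_)
    · refine h.abs_integral_le_rpow (k := fun ζ => dX (ell δ) (z - ζ)) hK z (by norm_num)
        (by norm_num) fun ζ hζ hne => ?_
      rw [norm_sub_rev ζ z]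
      exact aux _ _ (abs_dX_ell_le hδ _) (sub_ne_zero.2 hne.symm)
    · exact abs_sum_cellC_le h hs fun j => (hs _).gradX z (key j)
  · rw [dY_cellT hδ hs h]
    refine (abs_sub _ _).trans (add_le_add ?_ ?_)
    · refine h.abs_integral_le_rpow (k := fun ζ => dY (ell δ) (z - ζ)) hK z (by norm_num)
        (by norm_num) fun ζ hζ hne => ?_
      rw [norm_sub_rev ζ z]
      exact aux _ _ (abs_dY_ell_le hδ _) (sub_ne_zero.2 hne.symm)
    · exact abs_sum_cellC_le h hs fun j => (hs _).gradY z (key j)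

include hδ h in
include hδ1 in
theorem abs_dX_dY_cellT_far (hS : 0 < S) {z : ℂ} (hz : 7000 ≤ ‖z - zq Q‖) :
    |dX (cellT δ b L Q σ) z| ≤ S * ((Real.pi * 1500 ^ 2) * (500 * (1 + 32 * Cs))) / ‖z - zq Q‖ ^ 3 ∧
    |dY (cellT δ b L Q σ) z| ≤ S * ((Real.pi * 1500 ^ 2) * (500 * (1 + 32 * Cs))) / ‖z - zq Q‖ ^ 3 := by
  set r := ‖z - zq Q‖ with hrd
  have hr : 0 < r := by linarith
  have hC := (hs Q).const_nonneg
  have hball : ∀ w ∈ closedBall z (2 * (r / 28)), 13 / 14 * r ≤ ‖w - zq Q‖ := by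
    intro w hw
    rw [mem_closedBall, dist_eq_norm, norm_sub_rev] at hw
    have := norm_sub_le_norm_sub_add_norm_sub z w (zq Q)
    linarith
  have e := abs_dX_dY_le (contDiff_cellT hδ hs h) (d := r / 28)
    (M := S * (8 * (1 + 30 * Cs) / r ^ 2) * (Real.pi * 1500 ^ 2))
    (F := S * (Real.pi * 1500 ^ 2) * (2 * (32 + 480 * Cs)) / r ^ 4) (by positivity)
    (by positivity) z
    (fun w hw => by
      have h1 := hball w hw
      refine (abs_cellT_far hδ hs h hδ1 (by linarith)).trans ?_
      have : 4 * (1 + 30 * Cs) / ‖w - zq Q‖ ^ 2 ≤ 8 * (1 + 30 * Cs) / r ^ 2 := by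
        calc 4 * (1 + 30 * Cs) / ‖w - zq Q‖ ^ 2 ≤ 4 * (1 + 30 * Cs) / (13 / 14 * r) ^ 2 := by
              gcongr
          _ = 4 * 196 / 169 * ((1 + 30 * Cs) / r ^ 2) := by field_simp; norm_num
          _ ≤ 8 * ((1 + 30 * Cs) / r ^ 2) := by gcongr; norm_num
          _ = _ := by ring
      gcongr)
    (fun w hw => by
      have h1 := hball w hw
      refine (abs_lapl_cellT_far hδ hδ1 hs h (by linarith)).trans ?_
      calc S * (Real.pi * 1500 ^ 2) * (32 + 480 * Cs) / ‖w - zq Q‖ ^ 4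
          ≤ S * (Real.pi * 1500 ^ 2) * (32 + 480 * Cs) / (13 / 14 * r) ^ 4 := by
            gcongr
        _ = 14 ^ 4 / 13 ^ 4 * (S * (Real.pi * 1500 ^ 2) * (32 + 480 * Cs) / r ^ 4) := by
            field_simp
        _ ≤ 2 * (S * (Real.pi * 1500 ^ 2) * (32 + 480 * Cs) / r ^ 4) := by
            gcongr; norm_num
        _ = _ := by ring)
  have hle : 2 * (S * (8 * (1 + 30 * Cs) / r ^ 2) * (Real.pi * 1500 ^ 2)) / (r / 28) +
      r / 28 * (S * (Real.pi * 1500 ^ 2) * (2 * (32 + 480 * Cs)) / r ^ 4) ≤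
      S * ((Real.pi * 1500 ^ 2) * (500 * (1 + 32 * Cs))) / r ^ 3 := by
    have e1 : 2 * (S * (8 * (1 + 30 * Cs) / r ^ 2) * (Real.pi * 1500 ^ 2)) / (r / 28) +
      r / 28 * (S * (Real.pi * 1500 ^ 2) * (2 * (32 + 480 * Cs)) / r ^ 4) =
      (448 * (1 + 30 * Cs) + (32 + 480 * Cs) / 14) * (S * (Real.pi * 1500 ^ 2) / r ^ 3) := by
      field_simp; ring
    have e2 : S * ((Real.pi * 1500 ^ 2) * (500 * (1 + 32 * Cs))) / r ^ 3 =
      (500 * (1 + 32 * Cs)) * (S * (Real.pi * 1500 ^ 2) / r ^ 3) := by ring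
    rw [e1, e2]
    refine mul_le_mul_of_nonneg_right ?_ (by positivity)
    linarith
  exact ⟨e.1.trans hle, e.2.trans hle⟩

end

theorem exists_cellT_bounds (Cs : ℝ) : ∃ C > 0, ∀ (δ : ℝ) (b : ℤ × ℤ → ℂ) (L N : ℤ × ℤ → ℂ → ℝ)
    (Q : ℤ × ℤ) (S : ℝ) (σ : ℂ → ℝ), 0 < δ → δ ≤ 1 → 0 < S →
    (∀ q, Site Cs (zq q) (L q) (b q) (N q)) → CellDensity Q S σ →
    (∀ z, |cellT δ b L Q σ z| ≤ C * S * (1 / (1 + ‖z - zq Q‖ ^ 2))) ∧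
    (∀ z, ‖z - zq Q‖ ≤ 7000 → |dX (cellT δ b L Q σ) z| ≤ C * S * ∑ j, N (Q + vtx j) z ∧
      |dY (cellT δ b L Q σ) z| ≤ C * S * ∑ j, N (Q + vtx j) z) ∧
    (∀ z, 7000 < ‖z - zq Q‖ → |dX (cellT δ b L Q σ) z| ≤ C * S * (1 / (1 + ‖z - zq Q‖) ^ 3) ∧
      |dY (cellT δ b L Q σ) z| ≤ C * S * (1 / (1 + ‖z - zq Q‖) ^ 3)) := by
  obtain ⟨K, hK0, hK⟩ := exists_integral_rpow_le 1500
  set P := Real.pi * 1500 ^ 2 with hP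
  have hP0 : 0 < P := by positivity
  set D := |Cs|
  have hD : 0 ≤ D := abs_nonneg _
  have hCs : Cs ≤ D := le_abs_self _
  set A1 := (8009 * P + 4 * K + 30 * P * D) * (1 + 7000 ^ 2)
  set A2 := 2 * (4 * (1 + 30 * D)) * P
  set A3 := (2 * P + 2 * K) + 10 * P
  set A4 := 8 * (P * (500 * (1 + 32 * D)))
  have hA1 : 0 ≤ A1 := by positivity
  have hA2 : 0 ≤ A2 := by positivity
  have hA3 : 0 < A3 := by positivity
  have hA4 : 0 ≤ A4 := by positivity
  refine ⟨A1 + A2 + A3 + A4, by positivity, fun δ b L N Q S σ hδ hδ1 hS hs h => ⟨fun z => ?_,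
    fun z hz => ?_, fun z hz => ?_⟩⟩
  · have hC0 := (hs Q).const_nonneg
    by_cases hz : ‖z - zq Q‖ ≤ 7000
    · refine (abs_cellT_near hδ hδ1 hs h hK hz).trans ?_
      have h1 : 1 / (1 + (7000 : ℝ) ^ 2) ≤ 1 / (1 + ‖z - zq Q‖ ^ 2) := by gcongr
      calc S * (8009 * P + 4 * K + 30 * P * Cs) ≤ S * (8009 * P + 4 * K + 30 * P * D) := by gcongr
        _ = A1 * S * (1 / (1 + 7000 ^ 2)) := by simp only [A1]; field_simp
        _ ≤ (A1 + A2 + A3 + A4) * S * (1 / (1 + ‖z - zq Q‖ ^ 2)) := by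
            refine mul_le_mul (mul_le_mul_of_nonneg_right (by linarith) hS.le) h1 (by positivity)
              (by positivity)
    · push Not at hz
      refine (abs_cellT_far hδ hs h hδ1 (by linarith)).trans ?_
      have h1 : 1 / ‖z - zq Q‖ ^ 2 ≤ 2 * (1 / (1 + ‖z - zq Q‖ ^ 2)) := by
        rw [mul_one_div, div_le_div_iff₀ (by positivity) (by positivity)]
        nlinarith
      calc S * (4 * (1 + 30 * Cs) / ‖z - zq Q‖ ^ 2) * P
          = (4 * (1 + 30 * Cs)) * P * S * (1 / ‖z - zq Q‖ ^ 2) := by ring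
        _ ≤ (4 * (1 + 30 * D)) * P * S * (2 * (1 / (1 + ‖z - zq Q‖ ^ 2))) := by gcongr
        _ = A2 * S * (1 / (1 + ‖z - zq Q‖ ^ 2)) := by simp only [A2]; ring
        _ ≤ _ := by
          refine mul_le_mul_of_nonneg_right (mul_le_mul_of_nonneg_right (by linarith) hS.le)
            (by positivity)
  · have hN : 1 ≤ ∑ j, N (Q + vtx j) z := by
      rw [Fin.sum_univ_three]
      have h0 := (hs (Q + vtx 0)).one_le z
      have h1 := (hs (Q + vtx 1)).one_le z
      have h2 := (hs (Q + vtx 2)).one_le z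
      linarith
    have e := abs_dX_dY_cellT_near hδ hs h hK hz
    have hle : S * (2 * P + 2 * K) + S * 10 * P * ∑ j, N (Q + vtx j) z ≤
        (A1 + A2 + A3 + A4) * S * ∑ j, N (Q + vtx j) z := by
      have h5 : S * (2 * P + 2 * K) ≤ S * (2 * P + 2 * K) * ∑ j, N (Q + vtx j) z :=
        le_mul_of_one_le_right (by positivity) hN
      have h6 : A3 * S * ∑ j, N (Q + vtx j) z ≤ (A1 + A2 + A3 + A4) * S * ∑ j, N (Q + vtx j) z :=
        mul_le_mul_of_nonneg_right (mul_le_mul_of_nonneg_right (by linarith) hS.le) (by linarith)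
      refine le_trans ?_ h6
      simp only [A3]
      linarith
    exact ⟨e.1.trans hle, e.2.trans hle⟩
  · have e := abs_dX_dY_cellT_far hδ hδ1 hs h hS hz.le
    have hle : S * (P * (500 * (1 + 32 * Cs))) / ‖z - zq Q‖ ^ 3 ≤
        (A1 + A2 + A3 + A4) * S * (1 / (1 + ‖z - zq Q‖) ^ 3) := by
      have hr : 0 < ‖z - zq Q‖ := by linarith
      calc S * (P * (500 * (1 + 32 * Cs))) / ‖z - zq Q‖ ^ 3
          ≤ S * (P * (500 * (1 + 32 * D))) / ((1 + ‖z - zq Q‖) / 2) ^ 3 := by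
            gcongr
            linarith
        _ = A4 * S * (1 / (1 + ‖z - zq Q‖) ^ 3) := by simp only [A4]; field_simp; norm_num
        _ ≤ _ := by
          refine mul_le_mul_of_nonneg_right (mul_le_mul_of_nonneg_right (by linarith) hS.le)
            (by positivity)
    exact ⟨e.1.trans hle, e.2.trans hle⟩

/-- The swept logarithmic potential of a density `ρ` over the cells in `J`. -/
def pot (δ : ℝ) (b : ℤ × ℤ → ℂ) (L : ℤ × ℤ → ℂ → ℝ) (J : Finset (ℤ × ℤ)) (ρ : ℂ → ℝ) (z : ℂ) : ℝ :=
  -(1 / (2 * Real.pi)) * ∑ Q ∈ J, cellT δ b L Q ((cell Q).indicator ρ) z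

/-- The mass that `pot` assigns to the lattice point `q`. -/
def potC (b : ℤ × ℤ → ℂ) (J : Finset (ℤ × ℤ)) (ρ : ℂ → ℝ) (q : ℤ × ℤ) : ℝ :=
  ∑ j, if q - vtx j ∈ J then
    1 / (2 * Real.pi) * cellC b (q - vtx j) ((cell (q - vtx j)).indicator ρ) j else 0

theorem cellDensity_indicator {ρ : ℂ → ℝ} (hρ : Measurable ρ) {S : ℝ} (hS : ∀ z, |ρ z| ≤ S)
    (Q : ℤ × ℤ) : CellDensity Q S ((cell Q).indicator ρ) where
  meas := hρ.indicator (measurableSet_cell Q)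
  bound ζ := by
    by_cases h : ζ ∈ cell Q
    · rw [indicator_of_mem h]; exact hS ζ
    · rw [indicator_of_notMem h, abs_zero]; exact (abs_nonneg _).trans (hS ζ)
  supp ζ h := indicator_of_notMem h ρ

theorem sum_indicator_cell {J : Finset (ℤ × ℤ)} {ρ : ℂ → ℝ}
    (hJ : ∀ z, ρ z ≠ 0 → ∃ Q ∈ J, z ∈ cell Q) (z : ℂ) :
    ∑ Q ∈ J, (cell Q).indicator ρ z = ρ z := by
  by_cases h : ρ z = 0
  · rw [h]
    refine Finset.sum_eq_zero fun Q _ => ?_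
    by_cases hz : z ∈ cell Q
    · rw [indicator_of_mem hz, h]
    · rw [indicator_of_notMem hz]
  · obtain ⟨Q, hQ, hz⟩ := hJ z h
    rw [Finset.sum_eq_single_of_mem Q hQ fun P _ hP => ?_, indicator_of_mem hz]
    refine indicator_of_notMem (fun hz' => hP ?_) ρ
    obtain ⟨h1, h2⟩ := hz
    obtain ⟨h3, h4⟩ := hz'
    exact Prod.ext (h3.symm.trans h1) (h4.symm.trans h2)

theorem sum_vtx_le {J I : Finset (ℤ × ℤ)} (hI : ∀ Q ∈ J, ∀ j, Q + vtx j ∈ I) {g : ℤ × ℤ → ℝ}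
    (hg : ∀ q, 0 ≤ g q) : ∑ Q ∈ J, ∑ j, g (Q + vtx j) ≤ 3 * ∑ q ∈ I, g q := by
  rw [Finset.sum_comm]
  have : ∀ j ∈ (Finset.univ : Finset (Fin 3)), ∑ Q ∈ J, g (Q + vtx j) ≤ ∑ q ∈ I, g q := by
    intro j _
    rw [← Finset.sum_image (g := fun Q => Q + vtx j) (f := g) fun x _ y _ h =>
      add_right_cancel h]
    refine Finset.sum_le_sum_of_subset_of_nonneg (fun q hq => ?_) fun q _ _ => hg q
    obtain ⟨Q, hQ, rfl⟩ := Finset.mem_image.1 hq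
    exact hI Q hQ j
  refine (Finset.sum_le_sum this).trans ?_
  simp

theorem sum_potC {J I : Finset (ℤ × ℤ)} (hI : ∀ Q ∈ J, ∀ j, Q + vtx j ∈ I) (b : ℤ × ℤ → ℂ)
    (ρ : ℂ → ℝ) (g : ℤ × ℤ → ℝ) : ∑ q ∈ I, potC b J ρ q * g q =
      1 / (2 * Real.pi) * ∑ Q ∈ J, ∑ j, cellC b Q ((cell Q).indicator ρ) j * g (Q + vtx j) := by
  simp only [potC, Finset.sum_mul, Finset.mul_sum]
  rw [Finset.sum_comm, Finset.sum_comm (s := J)]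
  refine Finset.sum_congr rfl fun j _ => ?_
  simp only [ite_mul, zero_mul]
  rw [← Finset.sum_filter]
  refine Finset.sum_nbij' (fun q => q - vtx j) (fun Q => Q + vtx j) ?_ ?_ ?_ ?_ ?_
  · intro q hq; exact (Finset.mem_filter.1 hq).2
  · intro Q hQ; exact Finset.mem_filter.2 ⟨hI Q hQ j, by simpa using hQ⟩
  · intro q _; simp
  · intro q _; simp
  · intro q _; simp [mul_assoc]

section
variable {δ Cs : ℝ} (hδ : 0 < δ) {b : ℤ × ℤ → ℂ} {L N : ℤ × ℤ → ℂ → ℝ}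
  (hs : ∀ q, Site Cs (zq q) (L q) (b q) (N q)) {S : ℝ} {ρ : ℂ → ℝ} (hρ : Measurable ρ)
  (hS : ∀ z, |ρ z| ≤ S) (J : Finset (ℤ × ℤ))
include hs hρ hS

theorem abs_potC_le (q : ℤ × ℤ) : |potC b J ρ q| ≤ S * (15 * 1500 ^ 2) := by
  have hS0 : 0 ≤ S := (abs_nonneg _).trans (hS 0)
  have h : ∀ j ∈ (Finset.univ : Finset (Fin 3)), |if q - vtx j ∈ J then
    1 / (2 * Real.pi) * cellC b (q - vtx j) ((cell (q - vtx j)).indicator ρ) j else 0| ≤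
      S * (5 * 1500 ^ 2) := by
    intro j _
    split_ifs
    · rw [abs_mul, abs_of_pos (by positivity)]
      have := abs_cellC_le hs (cellDensity_indicator hρ hS (q - vtx j)) j
      calc _ ≤ 1 / (2 * Real.pi) * (S * 10 * (Real.pi * 1500 ^ 2)) := by gcongr
        _ = _ := by field_simp; ring
    · simp; positivity
  refine (Finset.abs_sum_le_sum_abs _ _).trans ((Finset.sum_le_sum h).trans ?_)
  simp
  linarith

include hδ

theorem contDiff_pot : ContDiff ℝ ∞ (pot δ b L J ρ) :=
  contDiff_const.mul (ContDiff.sum fun Q _ =>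
    contDiff_cellT hδ hs (cellDensity_indicator hρ hS Q))

theorem dX_pot : dX (pot δ b L J ρ) = fun z =>
    -(1 / (2 * Real.pi)) * ∑ Q ∈ J, dX (cellT δ b L Q ((cell Q).indicator ρ)) z := by
  have h : ∀ Q ∈ J, ContDiff ℝ ∞ (cellT δ b L Q ((cell Q).indicator ρ)) := fun Q _ =>
    contDiff_cellT hδ hs (cellDensity_indicator hρ hS Q)
  have := dX_const_mul (-(1 / (2 * Real.pi))) (ContDiff.sum h).diffl
  rw [dX_sum fun Q hQ => (h Q hQ).diffl] at this
  exact this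

theorem dY_pot : dY (pot δ b L J ρ) = fun z =>
    -(1 / (2 * Real.pi)) * ∑ Q ∈ J, dY (cellT δ b L Q ((cell Q).indicator ρ)) z := by
  have h : ∀ Q ∈ J, ContDiff ℝ ∞ (cellT δ b L Q ((cell Q).indicator ρ)) := fun Q _ =>
    contDiff_cellT hδ hs (cellDensity_indicator hρ hS Q)
  have := dY_const_mul (-(1 / (2 * Real.pi))) (ContDiff.sum h).diffl
  rw [dY_sum fun Q hQ => (h Q hQ).diffl] at this
  exact this

theorem lapl_pot {I : Finset (ℤ × ℤ)} (hI : ∀ Q ∈ J, ∀ j, Q + vtx j ∈ I)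
    (hJ : ∀ z, ρ z ≠ 0 → ∃ Q ∈ J, z ∈ cell Q) (z : ℂ) :
    lapl (pot δ b L J ρ) z = -(1 / Real.pi) * (∫ ξ, qk δ (z - ξ) • ρ ξ) +
      ∑ q ∈ I, potC b J ρ q * lapl (L q) z := by
  have hd := cellDensity_indicator hρ hS
  have h : ∀ Q ∈ J, ContDiff ℝ ∞ (cellT δ b L Q ((cell Q).indicator ρ)) := fun Q _ =>
    contDiff_cellT hδ hs (hd Q)
  have h1 := lapl_const_mul (-(1 / (2 * Real.pi))) (ContDiff.sum h)
  rw [lapl_sum h] at h1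
  have h2 := congrFun h1 z
  change lapl (pot δ b L J ρ) z = _ at h2
  rw [h2, sum_potC hI b ρ fun q => lapl (L q) z]
  have h3 : ∑ Q ∈ J, cv ((cell Q).indicator ρ) (qk δ) z = ∫ ξ, qk δ (z - ξ) • ρ ξ := by
    unfold cv
    rw [← integral_finsetSum]
    · refine integral_congr_ae (.of_forall fun ξ => ?_)
      simp only [smul_eq_mul]
      rw [← Finset.sum_mul, sum_indicator_cell hJ, mul_comm]
    · intro Q _
      exact cv_integrable (hd Q).integrable (hd Q).compact (contDiff_qk hδ).continuous z
  rw [← h3]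
  have h4 : ∀ Q ∈ J, lapl (cellT δ b L Q ((cell Q).indicator ρ)) z =
      2 * cv ((cell Q).indicator ρ) (qk δ) z -
        ∑ j, cellC b Q ((cell Q).indicator ρ) j * lapl (L (Q + vtx j)) z := fun Q _ => by
    rw [lapl_cellT hδ hs (hd Q)]
  simp only
  rw [Finset.sum_congr rfl h4, Finset.sum_sub_distrib, ← Finset.mul_sum]
  field_simp
  ring

omit hs in
theorem pot_sub {ρ' : ℂ → ℝ} (hρ' : Measurable ρ') {S' : ℝ} (hS' : ∀ z, |ρ' z| ≤ S') (z : ℂ) :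
    pot δ b L J (fun z => ρ z - ρ' z) z = pot δ b L J ρ z - pot δ b L J ρ' z := by
  unfold pot
  rw [← mul_sub, ← Finset.sum_sub_distrib]
  congr 1
  refine Finset.sum_congr rfl fun Q _ => ?_
  have hd := cellDensity_indicator hρ hS Q
  have hd' := cellDensity_indicator hρ' hS' Q
  have hi : (cell Q).indicator (fun z => ρ z - ρ' z) =
      fun z => (cell Q).indicator ρ z - (cell Q).indicator ρ' z := by
    ext z
    by_cases hz : z ∈ cell Q <;> simp [hz]
  rw [hi]
  have h1 : cv (fun z => (cell Q).indicator ρ z - (cell Q).indicator ρ' z) (ell δ) z =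
      cv ((cell Q).indicator ρ) (ell δ) z - cv ((cell Q).indicator ρ') (ell δ) z := by
    unfold cv
    rw [← integral_sub
      (cv_integrable hd.integrable hd.compact (contDiff_ell hδ).continuous z)
      (cv_integrable hd'.integrable hd'.compact (contDiff_ell hδ).continuous z)]
    simp only [sub_smul]
  have h2 : ∀ j, cellC b Q (fun z => (cell Q).indicator ρ z - (cell Q).indicator ρ' z) j =
      cellC b Q ((cell Q).indicator ρ) j - cellC b Q ((cell Q).indicator ρ') j := fun j => by
    unfold cellC
    rw [← integral_sub (hd.integrable_mul (continuous_bcoef _ j))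
      (hd'.integrable_mul (continuous_bcoef _ j))]
    simp only [sub_mul]
  unfold cellT
  simp only [h1, h2, sub_mul, Finset.sum_sub_distrib]
  ring

end

/-- The total size near `z` of the gradients attached to the sites in `I`. -/
def nearN (N : ℤ × ℤ → ℂ → ℝ) (I : Finset (ℤ × ℤ)) (z : ℂ) : ℝ :=
  ∑ q ∈ I, if ‖z - zq q‖ ≤ 8000 then N q z else 0

theorem exists_pot_bounds (Cs : ℝ) : ∃ C > 0, ∀ (δ : ℝ) (b : ℤ × ℤ → ℂ) (L N : ℤ × ℤ → ℂ → ℝ)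
    (J I : Finset (ℤ × ℤ)) (S R : ℝ) (ρ : ℂ → ℝ), 0 < δ → δ ≤ 1 → 0 < S → 1 ≤ R →
    (∀ q, Site Cs (zq q) (L q) (b q) (N q)) → (∀ Q ∈ J, ‖zq Q‖ ≤ R) →
    (∀ Q ∈ J, ∀ j, Q + vtx j ∈ I) → Measurable ρ → (∀ z, |ρ z| ≤ S) →
    (∀ z, |pot δ b L J ρ z| ≤ C * S * (1 + Real.log R)) ∧
    ∀ z, |dX (pot δ b L J ρ) z| ≤ C * S * (1 + nearN N I z) ∧
      |dY (pot δ b L J ρ) z| ≤ C * S * (1 + nearN N I z) := by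
  obtain ⟨C1, hC1, H⟩ := exists_cellT_bounds Cs
  obtain ⟨C3, hC3, H3⟩ := exists_lattice_cube
  refine ⟨C1 * (12 + C3 + 3), by positivity, fun δ b L N J I S R ρ hδ hδ1 hS hR hs hJ hI hρ hρS =>
    ?_⟩
  have hpi : |-(1 / (2 * Real.pi))| ≤ 1 := by
    rw [abs_neg, abs_of_pos (by positivity), div_le_one (by positivity)]
    linarith [Real.pi_gt_three]
  have hB := fun Q => H δ b L N Q S _ hδ hδ1 hS hs (cellDensity_indicator hρ hρS Q)
  have hlog := Real.log_nonneg hR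
  have hterm0 : ∀ z q, 0 ≤ if ‖z - zq q‖ ≤ 8000 then N q z else 0 := by
    intro z q
    split_ifs
    · exact zero_le_one.trans ((hs q).one_le z)
    · exact le_rfl
  have hG : ∀ (g : ℤ × ℤ → ℝ) (z : ℂ),
      (∀ Q, ‖z - zq Q‖ ≤ 7000 → |g Q| ≤ C1 * S * ∑ j, N (Q + vtx j) z) →
      (∀ Q, 7000 < ‖z - zq Q‖ → |g Q| ≤ C1 * S * (1 / (1 + ‖z - zq Q‖) ^ 3)) →
      |-(1 / (2 * Real.pi)) * ∑ Q ∈ J, g Q| ≤ C1 * (12 + C3 + 3) * S * (1 + nearN N I z) := by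
    intro g z h1 h2
    rw [abs_mul]
    have h3 : ∀ Q ∈ J, |g Q| ≤ C1 * S * (1 / (1 + ‖z - zq Q‖) ^ 3) +
        C1 * S * ∑ j, if ‖z - zq (Q + vtx j)‖ ≤ 8000 then N (Q + vtx j) z else 0 := by
      intro Q _
      by_cases h : ‖z - zq Q‖ ≤ 7000
      · have : ∀ j, ‖z - zq (Q + vtx j)‖ ≤ 8000 := fun j => by
          linarith [(norm_sub_zq_vtx_le z Q j).1]
        simp only [this, if_true]
        refine (h1 Q h).trans (le_add_of_nonneg_left (by positivity))
      · refine (h2 Q (not_le.1 h)).trans (le_add_of_nonneg_right ?_)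
        exact mul_nonneg (by positivity) (Finset.sum_nonneg fun j _ => hterm0 z _)
    have h4 : ∑ Q ∈ J, |g Q| ≤ C1 * S * C3 + C1 * S * (3 * nearN N I z) := by
      refine (Finset.sum_le_sum h3).trans ?_
      rw [Finset.sum_add_distrib, ← Finset.mul_sum, ← Finset.mul_sum]
      exact add_le_add (mul_le_mul_of_nonneg_left (H3 J z) (by positivity))
        (mul_le_mul_of_nonneg_left (sum_vtx_le hI (hterm0 z)) (by positivity))
    have h5 : 0 ≤ nearN N I z := Finset.sum_nonneg fun q _ => hterm0 z q
    have h6 : |∑ Q ∈ J, g Q| ≤ C1 * S * C3 + C1 * S * (3 * nearN N I z) :=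
      (Finset.abs_sum_le_sum_abs _ _).trans h4
    calc _ ≤ 1 * |∑ Q ∈ J, g Q| := by gcongr
      _ ≤ C1 * S * C3 + C1 * S * (3 * nearN N I z) := by linarith
      _ ≤ _ := by
        have h7 : 0 ≤ C1 * S := by positivity
        have h8 : 0 ≤ C1 * S * nearN N I z := by positivity
        have h9 : 0 ≤ C1 * S * C3 * nearN N I z := by positivity
        nlinarith
  refine ⟨fun z => ?_, fun z => ⟨?_, ?_⟩⟩
  · have h1 : ∑ Q ∈ J, |cellT δ b L Q ((cell Q).indicator ρ) z| ≤
        C1 * S * (12 * (1 + Real.log R)) := by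
      refine (Finset.sum_le_sum fun Q _ => (hB Q).1 z).trans ?_
      rw [← Finset.mul_sum]
      exact mul_le_mul_of_nonneg_left (lattice_log hR hJ z) (by positivity)
    unfold pot
    rw [abs_mul]
    calc _ ≤ 1 * |∑ Q ∈ J, cellT δ b L Q ((cell Q).indicator ρ) z| := by gcongr
      _ ≤ C1 * S * (12 * (1 + Real.log R)) := by
        rw [one_mul]; exact (Finset.abs_sum_le_sum_abs _ _).trans h1
      _ = C1 * 12 * S * (1 + Real.log R) := by ring
      _ ≤ _ := by gcongr; linarith
  · rw [dX_pot hδ hs hρ hρS]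
    exact hG _ z (fun Q h => ((hB Q).2.1 z h).1) fun Q h => ((hB Q).2.2 z h).1
  · rw [dY_pot hδ hs hρ hρS]
    exact hG _ z (fun Q h => ((hB Q).2.1 z h).2) fun Q h => ((hB Q).2.2 z h).2

/-- Picard iterates for the multiplier. -/
def mulSeq (δ : ℝ) (b : ℤ × ℤ → ℂ) (L : ℤ × ℤ → ℂ → ℝ) (J : Finset (ℤ × ℤ)) (V : ℂ → ℝ) :
    ℕ → ℂ → ℝ
  | 0 => fun _ => 1
  | m + 1 => fun z => 1 + pot δ b L J (fun z => V z * mulSeq δ b L J V m z) z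

theorem exists_lipschitz {E : Type*} [NormedAddCommGroup E] [NormedSpace ℝ E] {f : ℂ → E}
    (hf : ContDiff ℝ ∞ f) (cf : HasCompactSupport f) :
    ∃ K, 0 ≤ K ∧ ∀ z w, ‖f z - f w‖ ≤ K * ‖z - w‖ := by
  obtain ⟨C, hC⟩ := (cf.fderiv (𝕜 := ℝ)).exists_bound_of_continuous
    (hf.continuous_fderiv (by simp))
  exact ⟨C, (norm_nonneg _).trans (hC 0), fun z w =>
    convex_univ.norm_image_sub_le_of_norm_fderiv_le (fun z _ => hf.diffl z) (fun z _ => hC z)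
      (mem_univ w) (mem_univ z)⟩

theorem nearN_bound {Cs : ℝ} {b : ℤ × ℤ → ℂ} {L N : ℤ × ℤ → ℂ → ℝ}
    (hs : ∀ q, Site Cs (zq q) (L q) (b q) (N q)) (I : Finset (ℤ × ℤ)) :
    ∃ G, 0 ≤ G ∧ ∀ z, nearN N I z ≤ G := by
  have h : ∀ q, ∃ G, 0 ≤ G ∧ ∀ z, (if ‖z - zq q‖ ≤ 8000 then N q z else 0) ≤ G := by
    intro q
    obtain ⟨C, hC⟩ := (isCompact_closedBall (zq q) 8000).exists_bound_of_continuousOn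
      (hs q).cont.continuousOn
    refine ⟨C, (norm_nonneg _).trans (hC (zq q) (by simp)), fun z => ?_⟩
    split_ifs with hz
    · exact (le_abs_self _).trans (hC z (by rwa [mem_closedBall, dist_eq_norm]))
    · exact (norm_nonneg _).trans (hC (zq q) (by simp))
  choose G hG0 hG using h
  exact ⟨∑ q ∈ I, G q, Finset.sum_nonneg fun q _ => hG0 q, fun z =>
    Finset.sum_le_sum fun q _ => hG q z⟩

theorem exists_multiplier (Cs : ℝ) : ∃ C > 0, ∃ c > 0, ∀ (b : ℤ × ℤ → ℂ)
    (L N : ℤ × ℤ → ℂ → ℝ) (J I : Finset (ℤ × ℤ)) (l R : ℝ) (V : ℂ → ℝ), 0 < l → 1 ≤ R →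
    l * (1 + Real.log R) ≤ c →
    (∀ q, Site Cs (zq q) (L q) (b q) (N q)) → (∀ Q ∈ J, ‖zq Q‖ ≤ R) →
    (∀ Q ∈ J, ∀ j, Q + vtx j ∈ I) → ContDiff ℝ ∞ V → HasCompactSupport V → (∀ z, |V z| ≤ l) →
    (∀ z, V z ≠ 0 → ∃ Q ∈ J, z ∈ cell Q) → ∀ η > 0, ∃ (φ : ℂ → ℝ) (a : ℤ × ℤ → ℝ),
    ContDiff ℝ ∞ φ ∧ (∀ z, 1 / 2 ≤ φ z ∧ φ z ≤ 3 / 2) ∧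
    (∀ z, |dX φ z| ≤ C * l * (1 + nearN N I z) ∧ |dY φ z| ≤ C * l * (1 + nearN N I z)) ∧
    (∀ q, |a q| ≤ C * l) ∧
    ∀ z, |lapl φ z + V z * φ z - ∑ q ∈ I, a q * lapl (L q) z| ≤ η := by
  obtain ⟨C, hC, H⟩ := exists_pot_bounds Cs
  obtain ⟨Cq, hCq, Hq⟩ := exists_qk_approx
  refine ⟨2 * C + 30 * 1500 ^ 2, by positivity, 1 / (4 * C), by positivity, ?_⟩
  intro b L N J I l R V hl hR hc hs hJ hI hV cV hVl hVJ η hη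
  have hlog := Real.log_nonneg hR
  have hc' : C * l * (1 + Real.log R) ≤ 1 / 4 := by
    have := mul_le_mul_of_nonneg_left hc hC.le
    calc _ = C * (l * (1 + Real.log R)) := by ring
      _ ≤ _ := this
      _ = _ := by field_simp
  obtain ⟨Kv, hKv0, hKv⟩ := exists_lipschitz hV cV
  obtain ⟨G, hG0, hG⟩ := nearN_bound hs I
  set K := Kv * 2 + l * (2 * (C * (2 * l) * (1 + G)))
  have hK : 0 ≤ K := by positivity
  obtain ⟨m, hm⟩ := exists_pow_lt_of_lt_one (show 0 < η / (2 * l) by positivity)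
    (show (1 / 4 : ℝ) < 1 by norm_num)
  set δ := min 1 (η / (2 * (Cq * K + 1)))
  have hδ : 0 < δ := by positivity
  have hδ1 : δ ≤ 1 := min_le_left _ _
  have hδη : Cq * K * δ ≤ η / 2 := by
    have : δ ≤ η / (2 * (Cq * K + 1)) := min_le_right _ _
    rw [le_div_iff₀ (by positivity)] at this
    nlinarith
  set f := mulSeq δ b L J V
  have hf1 : ∀ m, f (m + 1) = fun z => 1 + pot δ b L J (fun z => V z * f m z) z := fun m => rfl
  have hVf : ∀ {g : ℂ → ℝ} {B : ℝ}, (∀ z, |g z| ≤ B) → ∀ z, |V z * g z| ≤ l * B := by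
    intro g B h z
    rw [abs_mul]
    exact mul_le_mul (hVl z) (h z) (abs_nonneg _) hl.le
  have hstep : ∀ m, ContDiff ℝ ∞ (f m) → (∀ z, |f m z - 1| ≤ 1 / 2) →
      ContDiff ℝ ∞ (f (m + 1)) := by
    intro m h1 h2
    rw [hf1]
    refine contDiff_const.add (contDiff_pot hδ hs (hV.mul h1).continuous.measurable
      (hVf (B := 2) fun z => ?_) J)
    have := h2 z
    rw [abs_le] at this ⊢
    constructor <;> linarith
  have main : ∀ m, ContDiff ℝ ∞ (f m) ∧ ContDiff ℝ ∞ (f (m + 1)) ∧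
      (∀ z, |f m z - 1| ≤ (1 - (1 / 4) ^ m) / 3) ∧
      ∀ z, |f (m + 1) z - f m z| ≤ (1 / 4) ^ (m + 1) := by
    intro m
    induction m with
    | zero =>
      have h0 : ContDiff ℝ ∞ (f 0) := contDiff_const
      refine ⟨h0, hstep 0 h0 fun z => by simp [f, mulSeq], fun z => by simp [f, mulSeq],
        fun z => ?_⟩
      have := (H δ b L N J I (l * 1) R (fun z => V z * f 0 z) hδ hδ1 (by positivity) hR hs hJ hI
        (hV.mul h0).continuous.measurable (hVf fun z => by simp [f, mulSeq])).1 z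
      rw [hf1]
      simp only [mul_one] at this
      simpa [f, mulSeq] using this.trans hc'
    | succ m ih =>
      obtain ⟨h1, h2, h3, h4⟩ := ih
      have hp : ∀ k : ℕ, (0 : ℝ) < (1 / 4) ^ k := fun k => by positivity
      have h5 : ∀ z, |f (m + 1) z - 1| ≤ (1 - (1 / 4) ^ (m + 1)) / 3 := fun z => by
        have e1 := abs_sub_le (f (m + 1) z) (f m z) 1
        have e2 := h3 z
        have e3 := h4 z
        rw [pow_succ] at e3 ⊢
        linarith
      have hb : ∀ k, (∀ z, |f k z - 1| ≤ (1 - (1 / 4) ^ k) / 3) → ∀ z, |f k z| ≤ 2 := by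
        intro k hk z
        have e1 := hk z
        have e2 := hp k
        rw [abs_le] at e1 ⊢
        constructor <;> linarith
      refine ⟨h2, hstep _ h2 fun z => ?_, h5, fun z => ?_⟩
      · linarith [h5 z, hp (m + 1)]
      · have g1 := congrFun (hf1 (m + 1)) z
        have g0 := congrFun (hf1 m) z
        have e1 := pot_sub hδ (b := b) (L := L) (hV.mul h2).continuous.measurable
          (hVf (hb _ h5)) J (hV.mul h1).continuous.measurable (hVf (hb _ h3)) z
        have e2 := (H δ b L N J I (l * (1 / 4) ^ (m + 1)) R
          (fun z => V z * f (m + 1) z - V z * f m z) hδ hδ1 (by positivity) hR hs hJ hI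
          ((hV.mul h2).sub (hV.mul h1)).continuous.measurable (fun z => by
            rw [← mul_sub]; exact hVf h4 z)).1 z
        rw [e1] at e2
        have e3 : C * (l * (1 / 4) ^ (m + 1)) * (1 + Real.log R) ≤
            1 / 4 * (1 / 4) ^ (m + 1) := by
          calc _ = C * l * (1 + Real.log R) * (1 / 4) ^ (m + 1) := by ring
            _ ≤ _ := by gcongr
        calc _ = |pot δ b L J (fun z => V z * f (m + 1) z) z -
            pot δ b L J (fun z => V z * f m z) z| := by
              congr 1; linarith
          _ ≤ _ := e2.trans (e3.trans (by rw [pow_succ (1 / 4 : ℝ) (m + 1)]; linarith))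
  have hclose : ∀ m z, |f m z - 1| ≤ 1 / 2 := fun m z => by
    have := (main m).2.2.1 z
    have : (0 : ℝ) < (1 / 4) ^ m := by positivity
    linarith
  have hb : ∀ m z, |f m z| ≤ 2 := fun m z => by
    have := hclose m z
    rw [abs_le] at this ⊢
    constructor <;> linarith
  have hgrad : ∀ m z, |dX (f (m + 1)) z| ≤ C * (2 * l) * (1 + nearN N I z) ∧
      |dY (f (m + 1)) z| ≤ C * (2 * l) * (1 + nearN N I z) := by
    intro m z
    have := (H δ b L N J I (l * 2) R (fun z => V z * f m z) hδ hδ1 (by positivity) hR hs hJ hI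
        (hV.mul (main m).1).continuous.measurable (hVf (hb m))).2 z
    rw [mul_comm 2 l]
    rw [hf1]
    simpa only [dX, dY, fderiv_const_add] using this
  have hlip : ∀ m z w, |f m z - f m w| ≤ 2 * (C * (2 * l) * (1 + G)) * ‖z - w‖ := by
    intro m z w
    cases m with
    | zero => simp [f, mulSeq]; positivity
    | succ m =>
      refine norm_sub_le_of_partial (main (m + 1)).1.diffl convex_univ (fun z _ => ?_)
        (mem_univ w) (mem_univ z)
      have := hgrad m z
      have e : C * (2 * l) * (1 + nearN N I z) ≤ C * (2 * l) * (1 + G) := by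
        have := hG z
        gcongr
      exact ⟨this.1.trans e, this.2.trans e⟩
  refine ⟨f (m + 1), potC b J fun z => V z * f m z, (main m).2.1, fun z => ?_, fun z => ?_,
    fun q => ?_, fun z => ?_⟩
  · have := hclose (m + 1) z
    rw [abs_le] at this
    constructor <;> linarith
  · have := hgrad m z
    have h0 : 0 ≤ nearN N I z := Finset.sum_nonneg fun q _ => by
      split_ifs
      · exact zero_le_one.trans ((hs q).one_le z)
      · exact le_rfl
    have e : C * (2 * l) * (1 + nearN N I z) ≤
        (2 * C + 30 * 1500 ^ 2) * l * (1 + nearN N I z) := by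
      refine mul_le_mul_of_nonneg_right ?_ (by positivity)
      nlinarith
    exact ⟨this.1.trans e, this.2.trans e⟩
  · refine (abs_potC_le hs (hV.mul (main m).1).continuous.measurable (hVf (hb m)) J q).trans ?_
    nlinarith
  · have e1 := lapl_pot hδ hs (hV.mul (main m).1).continuous.measurable (hVf (hb m)) J hI
      (fun z hz => hVJ z (left_ne_zero_of_mul hz)) z
    have e2 : lapl (f (m + 1)) z = lapl (pot δ b L J fun z => V z * f m z) z := by
      rw [hf1]
      have hX : dX (fun z => 1 + pot δ b L J (fun z => V z * f m z) z) =
          dX (pot δ b L J fun z => V z * f m z) := funext fun z => by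
        simp only [dX, fderiv_const_add]
      have hY : dY (fun z => 1 + pot δ b L J (fun z => V z * f m z) z) =
          dY (pot δ b L J fun z => V z * f m z) := funext fun z => by
        simp only [dY, fderiv_const_add]
      unfold lapl
      rw [hX, hY]
    have e3 := Hq (fun z => V z * f m z) K δ (hV.mul (main m).1).continuous
      ⟨_, hVf (hb m)⟩ hδ (fun z w => by
        have : V z * f m z - V w * f m w = (V z - V w) * f m z + V w * (f m z - f m w) := by ring
        rw [this, Real.norm_eq_abs]
        refine (abs_add_le _ _).trans ?_
        rw [abs_mul, abs_mul]
        have t1 : |V z - V w| * |f m z| ≤ Kv * ‖z - w‖ * 2 :=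
          mul_le_mul (hKv z w) (hb m z) (abs_nonneg _) (by positivity)
        have t2 : |V w| * |f m z - f m w| ≤ l * (2 * (C * (2 * l) * (1 + G)) * ‖z - w‖) :=
          mul_le_mul (hVl w) (hlip m z w) (abs_nonneg _) hl.le
        simp only [K]
        linarith) z
    set A := ∫ ξ, qk δ (z - ξ) • (V ξ * f m ξ)
    rw [e2, e1]
    simp only [smul_eq_mul, Real.norm_eq_abs] at e3
    have e4 : |-(1 / Real.pi) * (A - Real.pi * (V z * f m z))| ≤ η / 2 := by
      rw [abs_mul, abs_neg, abs_of_pos (by positivity)]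
      have : 1 / Real.pi ≤ 1 := by
        rw [div_le_one (by positivity)]; linarith [Real.pi_gt_three]
      calc _ ≤ 1 * (Cq * K * δ) := by gcongr
        _ ≤ _ := by linarith
    have e5 : |V z * (f (m + 1) z - f m z)| ≤ η / 2 := by
      refine (hVf (main m).2.2.2 z).trans ?_
      rw [lt_div_iff₀ (by positivity)] at hm
      rw [pow_succ]
      nlinarith [show (0 : ℝ) < (1 / 4) ^ m by positivity]
    have e6 : -(1 / Real.pi) * A + ∑ q ∈ I, potC b J (fun z => V z * f m z) q * lapl (L q) z +
        V z * f (m + 1) z - ∑ q ∈ I, potC b J (fun z => V z * f m z) q * lapl (L q) z =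
        -(1 / Real.pi) * (A - Real.pi * (V z * f m z)) + V z * (f (m + 1) z - f m z) := by
      generalize ∑ q ∈ I, potC b J (fun z => V z * f m z) q * lapl (L q) z = B
      field_simp
      ring
    rw [e6]
    exact (abs_add_le _ _).trans (by linarith)

theorem contDiff_kk {δ : ℝ} (hδ : 0 < δ) : ContDiff ℝ ∞ (kk δ) := by
  rw [funext fun z => kk_eq hδ z]
  exact (contDiff_ofReal (contDiff_dX (contDiff_ell hδ))).sub
    (contDiff_const.mul (contDiff_ofReal (contDiff_dY (contDiff_ell hδ))))

theorem dzb_kk {δ : ℝ} (hδ : 0 < δ) (z : ℂ) : dzb (kk δ) z = (qk δ z : ℂ) := by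
  have he := contDiff_ell hδ
  have h1 := contDiff_ofReal (contDiff_dX he)
  have h2 := contDiff_ofReal (contDiff_dY he)
  have h3 : ContDiff ℝ ∞ fun z => Complex.I * ((dY (ell δ) z : ℝ) : ℂ) := contDiff_const.mul h2
  rw [funext fun z => kk_eq hδ z]
  unfold dzb
  rw [dX_sub h1.diffl h3.diffl, dY_sub h1.diffl h3.diffl, dX_const_mul _ h2.diffl,
    dY_const_mul _ h2.diffl, dX_ofReal (contDiff_dX he).diffl, dX_ofReal (contDiff_dY he).diffl,
    dY_ofReal (contDiff_dX he).diffl, dY_ofReal (contDiff_dY he).diffl, dX_comm_dY he]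
  have := congrFun (lapl_ell hδ) z
  have h5 : (qk δ z : ℂ) = ((dX (dX (ell δ)) z + dY (dY (ell δ)) z : ℝ) : ℂ) / 2 := by
    rw [show dX (dX (ell δ)) z + dY (dY (ell δ)) z = 2 * qk δ z from this]
    push_cast; ring
  rw [h5]
  push_cast
  linear_combination (-((dY (dY (ell δ)) z : ℝ) : ℂ) / 2) * Complex.I_mul_I

theorem dzb_cv_kk {δ : ℝ} (hδ : 0 < δ) {α : ℂ → ℂ} (hα : Integrable α) (cα : HasCompactSupport α)
    (z : ℂ) : dzb (cv α (kk δ)) z = ∫ ξ, qk δ (z - ξ) • α ξ := by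
  have hk := contDiff_kk hδ
  unfold dzb
  rw [cv_dX hα cα hk, cv_dY hα cα hk]
  unfold cv
  rw [← integral_const_mul, ← integral_add (cv_integrable hα cα (contDiff_dX hk).continuous z)
    ((cv_integrable hα cα (contDiff_dY hk).continuous z).const_mul _), ← integral_div]
  refine integral_congr_ae (.of_forall fun ξ => ?_)
  have := dzb_kk hδ (z - ξ)
  unfold dzb at this
  simp only [smul_eq_mul, Complex.real_smul]
  rw [← this]
  ring

/-- The conjugate gradient of `v / φ`, multiplied by `φ ^ 2`. -/
def wr (φ v : ℂ → ℝ) (z : ℂ) : ℂ :=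
  ((φ z * dX v z - v z * dX φ z : ℝ) : ℂ) - Complex.I * ((φ z * dY v z - v z * dY φ z : ℝ) : ℂ)

section
variable {φ v : ℂ → ℝ} (hφ : ContDiff ℝ ∞ φ) (hv : ContDiff ℝ ∞ v)
include hφ hv

theorem contDiff_wr : ContDiff ℝ ∞ (wr φ v) :=
  (contDiff_ofReal ((hφ.mul (contDiff_dX hv)).sub (hv.mul (contDiff_dX hφ)))).sub
    (contDiff_const.mul
      (contDiff_ofReal ((hφ.mul (contDiff_dY hv)).sub (hv.mul (contDiff_dY hφ)))))

omit hφ hv in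
theorem norm_wr_sq (z : ℂ) : ‖wr φ v z‖ ^ 2 =
    (φ z * dX v z - v z * dX φ z) ^ 2 + (φ z * dY v z - v z * dY φ z) ^ 2 := by
  rw [← Complex.normSq_eq_norm_sq, Complex.normSq_apply]
  simp [wr]
  ring

theorem dzb_wr (z : ℂ) : dzb (wr φ v) z = ((1 / 2 * (φ z * lapl v z - v z * lapl φ z) : ℝ) : ℂ) +
    Complex.I * ((dY φ z * dX v z - dX φ z * dY v z : ℝ) : ℂ) := by
  have hA : ContDiff ℝ ∞ fun z => φ z * dX v z - v z * dX φ z :=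
    (hφ.mul (contDiff_dX hv)).sub (hv.mul (contDiff_dX hφ))
  have hB : ContDiff ℝ ∞ fun z => φ z * dY v z - v z * dY φ z :=
    (hφ.mul (contDiff_dY hv)).sub (hv.mul (contDiff_dY hφ))
  have h1 := contDiff_ofReal hA
  have h2 := contDiff_ofReal hB
  have h3 : ContDiff ℝ ∞ fun z => Complex.I * ((φ z * dY v z - v z * dY φ z : ℝ) : ℂ) :=
    contDiff_const.mul h2
  have e : wr φ v = fun z => ((φ z * dX v z - v z * dX φ z : ℝ) : ℂ) -
      Complex.I * ((φ z * dY v z - v z * dY φ z : ℝ) : ℂ) := rfl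
  unfold dzb
  rw [e, dX_sub h1.diffl h3.diffl, dY_sub h1.diffl h3.diffl, dX_const_mul _ h2.diffl,
    dY_const_mul _ h2.diffl, dX_ofReal hA.diffl, dX_ofReal hB.diffl, dY_ofReal hA.diffl,
    dY_ofReal hB.diffl]
  have hvX := (contDiff_dX hv).diffl
  have hvY := (contDiff_dY hv).diffl
  have hφX := (contDiff_dX hφ).diffl
  have hφY := (contDiff_dY hφ).diffl
  rw [dX_sub (hφ.diffl.fun_mul hvX) (hv.diffl.fun_mul hφX),
    dX_sub (hφ.diffl.fun_mul hvY) (hv.diffl.fun_mul hφY),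
    dY_sub (hφ.diffl.fun_mul hvX) (hv.diffl.fun_mul hφX),
    dY_sub (hφ.diffl.fun_mul hvY) (hv.diffl.fun_mul hφY),
    dX_mul hφ.diffl hvX, dX_mul hv.diffl hφX, dX_mul hφ.diffl hvY, dX_mul hv.diffl hφY,
    dY_mul hφ.diffl hvX, dY_mul hv.diffl hφX, dY_mul hφ.diffl hvY, dY_mul hv.diffl hφY,
    dX_comm_dY hv, dX_comm_dY hφ]
  unfold lapl
  push_cast
  linear_combination (-((φ z * dY (dY v) z + dY φ z * dY v z - (v z * dY (dY φ) z + dY v z * dY φ z)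
    : ℂ)) / 2) * Complex.I_mul_I

omit hφ hv in
theorem wr_eq_zero {z : ℂ} (hz : z ∉ tsupport v) : wr φ v z = 0 := by
  have h1 : v z = 0 := image_eq_zero_of_notMem_tsupport hz
  have h2 : fderiv ℝ v z = 0 := by
    have := image_eq_zero_of_notMem_tsupport (f := fderiv ℝ v)
      (fun h => hz (tsupport_fderiv_subset ℝ h))
    exact this
  simp [wr, h1, dX, dY, h2]

/-- Removal of the zeroth-order term in the Beltrami-type equation satisfied by `wr φ v`. -/
theorem exists_similarity (cv' : HasCompactSupport v) (hφ2 : ∀ z, 1 / 2 ≤ φ z) {G : ℂ → ℝ}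
    (hG : ∀ z, |dX φ z| ≤ G z ∧ |dY φ z| ≤ G z) {G₀ : ℝ} (hG0 : ∀ z, G z ≤ G₀) {η : ℝ} (hη : 0 < η) :
    ∃ (α : ℂ → ℂ) (δ : ℝ), 0 < δ ∧ Continuous α ∧ HasCompactSupport α ∧ (∀ z, ‖α z‖ ≤ 4 * G z) ∧
      (∀ z, z ∉ tsupport v → α z = 0) ∧ ∃ s : ℂ → ℂ,
      (s = fun z => ((1 / Real.pi : ℝ) : ℂ) * cv α (kk δ) z) ∧ ContDiff ℝ ∞ s ∧
      ∀ z, ‖dzb (wr φ v) z - ((1 / 2 * (φ z * lapl v z - v z * lapl φ z) : ℝ) : ℂ) -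
        dzb s z * wr φ v z‖ ≤ η := by
  obtain ⟨Cq, hCq, Hq⟩ := exists_qk_approx
  have hW := contDiff_wr hφ hv
  set W := wr φ v with hWd
  have cW : HasCompactSupport W := HasCompactSupport.intro cv' fun z hz => wr_eq_zero hz
  obtain ⟨B, hB⟩ := cW.exists_bound_of_continuous hW.continuous
  have hB0 : 0 ≤ B := (norm_nonneg _).trans (hB 0)
  have hGn : ∀ z, 0 ≤ G z := fun z => (abs_nonneg _).trans (hG z).1
  have hG00 : 0 ≤ G₀ := (hGn 0).trans (hG0 0)
  set τ := η / (4 * (G₀ + 1)) with hτd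
  have hτ : 0 < τ := by positivity
  set μ : ℂ → ℝ := fun z => dY φ z * dX v z - dX φ z * dY v z with hμd
  have hμ : ContDiff ℝ ∞ μ := ((contDiff_dY hφ).mul (contDiff_dX hv)).sub
    ((contDiff_dX hφ).mul (contDiff_dY hv))
  have hden : ∀ z, 0 < Complex.normSq (W z) + τ ^ 2 := fun z => by
    have := Complex.normSq_nonneg (W z)
    positivity
  have hμG : ∀ z, |μ z| ≤ 4 * G z * ‖W z‖ := by
    intro z
    have hp : 0 < φ z := by linarith [hφ2 z]
    have e : φ z * μ z = dY φ z * (φ z * dX v z - v z * dX φ z) -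
        dX φ z * (φ z * dY v z - v z * dY φ z) := by simp only [μ]; ring
    have n := norm_wr_sq (φ := φ) (v := v) z
    have nA : |φ z * dX v z - v z * dX φ z| ≤ ‖W z‖ :=
      abs_le_of_sq_le_sq (by rw [hWd, n]; nlinarith [sq_nonneg (φ z * dY v z - v z * dY φ z)])
        (norm_nonneg _)
    have nB : |φ z * dY v z - v z * dY φ z| ≤ ‖W z‖ :=
      abs_le_of_sq_le_sq (by rw [hWd, n]; nlinarith [sq_nonneg (φ z * dX v z - v z * dX φ z)])
        (norm_nonneg _)
    have h1 : φ z * |μ z| ≤ 2 * G z * ‖W z‖ := by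
      have e0 : φ z * |μ z| = |φ z * μ z| := by rw [abs_mul, abs_of_pos hp]
      rw [e0, e]
      refine (abs_sub _ _).trans ?_
      rw [abs_mul, abs_mul]
      have a1 := mul_le_mul (hG z).2 nA (abs_nonneg _) (hGn z)
      have a2 := mul_le_mul (hG z).1 nB (abs_nonneg _) (hGn z)
      linarith
    have := mul_le_mul_of_nonneg_right (hφ2 z) (abs_nonneg (μ z))
    linarith
  set α : ℂ → ℂ := fun z => Complex.I * (μ z : ℂ) * conj (W z) *
    (((Complex.normSq (W z) + τ ^ 2)⁻¹ : ℝ) : ℂ) with hαd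
  have hα : ContDiff ℝ ∞ α := by
    have h1 : ContDiff ℝ ∞ fun z => conj (W z) := Complex.conjCLE.contDiff.comp hW
    have h2 : ContDiff ℝ ∞ fun z => (Complex.normSq (W z) + τ ^ 2)⁻¹ :=
      ((contDiff_normSq.comp hW).add contDiff_const).inv fun z => (hden z).ne'
    exact ((contDiff_const.mul (contDiff_ofReal hμ)).mul h1).mul (contDiff_ofReal h2)
  have cα : HasCompactSupport α := hasCompactSupport_of cW fun z hz => by simp [α, hz]
  have nα : ∀ z, ‖α z‖ = |μ z| * ‖W z‖ / (‖W z‖ ^ 2 + τ ^ 2) := by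
    intro z
    have := hden z
    simp only [α, norm_mul, Complex.norm_I, one_mul, Complex.norm_real, RCLike.norm_conj,
      Real.norm_eq_abs]
    rw [abs_of_pos (inv_pos.2 this), Complex.normSq_eq_norm_sq, div_eq_mul_inv]
  have hαG : ∀ z, ‖α z‖ ≤ 4 * G z := by
    intro z
    rw [nα, div_le_iff₀ (by positivity)]
    have h1 := mul_le_mul_of_nonneg_right (hμG z) (norm_nonneg (W z))
    have h2 : 0 ≤ 4 * G z * τ ^ 2 := by have := hGn z; positivity
    nlinarith
  have hαW : ∀ z, ‖Complex.I * (μ z : ℂ) - α z * W z‖ ≤ η / 2 := by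
    intro z
    have hd := hden z
    have e : Complex.I * (μ z : ℂ) - α z * W z =
        Complex.I * (μ z : ℂ) * ((τ ^ 2 / (Complex.normSq (W z) + τ ^ 2) : ℝ) : ℂ) := by
      have h1 : ((Complex.normSq (W z) + τ ^ 2 : ℝ) : ℂ) ≠ 0 := by exact_mod_cast hd.ne'
      have h2 : (Complex.normSq (W z) : ℂ) = conj (W z) * W z := by
        rw [mul_comm, Complex.mul_conj]
      simp only [α]
      push_cast at h1 ⊢
      field_simp
      rw [h2]
      ring
    rw [e, norm_mul, norm_mul, Complex.norm_I, one_mul, Complex.norm_real, Complex.norm_real,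
      Real.norm_eq_abs, Real.norm_eq_abs, abs_of_pos (a := τ ^ 2 / _) (by positivity),
      Complex.normSq_eq_norm_sq, mul_div_assoc', div_le_iff₀ (by positivity)]
    have h1 := mul_le_mul_of_nonneg_right (hμG z) (sq_nonneg τ)
    have h2 : 2 * ‖W z‖ * τ ≤ ‖W z‖ ^ 2 + τ ^ 2 := by nlinarith [sq_nonneg (‖W z‖ - τ)]
    have h3 : 4 * G z * τ ≤ η := by
      have : 4 * (G₀ + 1) * τ = η := by rw [hτd]; field_simp
      nlinarith [hG0 z]
    calc |μ z| * τ ^ 2 ≤ 4 * G z * ‖W z‖ * τ ^ 2 := h1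
      _ = (4 * G z * τ) * (‖W z‖ * τ) := by ring
      _ ≤ η * (‖W z‖ * τ) := by gcongr
      _ ≤ η * ((‖W z‖ ^ 2 + τ ^ 2) / 2) := by gcongr; linarith
      _ = _ := by ring
  obtain ⟨K, hK0, hK⟩ := exists_lipschitz hα cα
  set δ := η / (2 * (Cq * K + 1) * (B + 1)) with hδd
  have hδ : 0 < δ := by positivity
  have hαi := hα.continuous.integrable_of_hasCompactSupport cα (μ := volume)
  have hs := cv_contDiff hαi cα (contDiff_kk hδ)
  refine ⟨α, δ, hδ, hα.continuous, cα, hαG, fun z hz => ?_, _, rfl, contDiff_const.mul hs,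
    fun z => ?_⟩
  · have : W z = 0 := wr_eq_zero hz
    simp [α, this]
  · have e1 : dzb (fun z => ((1 / Real.pi : ℝ) : ℂ) * cv α (kk δ) z) z =
        ((1 / Real.pi : ℝ) : ℂ) * ∫ ξ, qk δ (z - ξ) • α ξ := by
      rw [← dzb_cv_kk hδ hαi cα]
      unfold dzb
      rw [dX_const_mul _ hs.diffl, dY_const_mul _ hs.diffl]
      ring
    have e2 := Hq α K δ hα.continuous ⟨4 * G₀, fun z => (hαG z).trans (by linarith [hG0 z])⟩ hδ hK z
    rw [hWd, dzb_wr hφ hv, add_sub_cancel_left, ← hWd, e1]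
    set X := ∫ ξ, qk δ (z - ξ) • α ξ
    have hpi : (Real.pi : ℂ) ≠ 0 := by exact_mod_cast Real.pi_ne_zero
    have e3 : Complex.I * (μ z : ℂ) - ((1 / Real.pi : ℝ) : ℂ) * X * W z =
        (Complex.I * (μ z : ℂ) - α z * W z) -
          ((1 / Real.pi : ℝ) : ℂ) * (X - Real.pi • α z) * W z := by
      rw [Complex.real_smul]
      push_cast
      field_simp
      ring
    change ‖Complex.I * (μ z : ℂ) - _‖ ≤ η
    rw [e3]
    refine (norm_sub_le _ _).trans ?_
    have e4 : ‖((1 / Real.pi : ℝ) : ℂ) * (X - Real.pi • α z) * W z‖ ≤ η / 2 := by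
      rw [norm_mul, norm_mul, Complex.norm_real, Real.norm_eq_abs, abs_of_pos (by positivity)]
      have h1 : 1 / Real.pi ≤ 1 := by
        rw [div_le_one (by positivity)]; linarith [Real.pi_gt_three]
      calc _ ≤ 1 * (Cq * K * δ) * B := by gcongr; exact hB z
        _ ≤ (Cq * K + 1) * (B + 1) * δ := by nlinarith [mul_nonneg hCq.le hK0]
        _ = η / 2 := by rw [hδd]; field_simp
    linarith [hαW z]

end

theorem integrableOn_inv_norm_sub (z c : ℂ) (R : ℝ) :
    IntegrableOn (fun ζ => ‖ζ - z‖⁻¹) (closedBall c R) := by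
  obtain ⟨K, _, h⟩ := exists_integral_rpow_le R
  have : IsFiniteMeasure (volume.restrict (closedBall c R)) :=
    ⟨by rw [Measure.restrict_apply_univ]; exact measure_closedBall_lt_top⟩
  refine Integrable.mono' ((integrable_const (1 : ℝ)).add (h z c).1)
    (by fun_prop) (.of_forall fun ζ => ?_)
  rw [Real.norm_eq_abs, abs_of_nonneg (by positivity)]
  exact inv_norm_le_rpow _

section
variable {C : ℝ} {z₀ : ℂ} {L : ℂ → ℝ} {b : ℂ} {N : ℂ → ℝ} (hs : Site C z₀ L b N)
include hs

theorem Site.integrableOn (z : ℂ) :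
    IntegrableOn (fun ζ => N ζ * ‖ζ - z‖⁻¹) (closedBall z₀ 8000) :=
  (integrableOn_inv_norm_sub z z₀ 8000).continuousOn_mul hs.cont.continuousOn
    (isCompact_closedBall _ _)

theorem Site.integrableOn_kk {δ : ℝ} (hδ : 0 < δ) (z z' : ℂ) :
    IntegrableOn (fun ζ => N ζ * ‖kk δ (z - ζ) - kk δ (z' - ζ)‖) (closedBall z₀ 8000) := by
  have h1 := hs.cont
  have h2 := (contDiff_kk hδ).continuous
  exact (by fun_prop : Continuous fun ζ => N ζ * ‖kk δ (z - ζ) - kk δ (z' - ζ)‖).continuousOn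
    |>.integrableOn_compact (isCompact_closedBall _ _)

theorem Site.kk_osc {δ : ℝ} (hδ : 0 < δ) {z z' : ℂ} (hz : ‖z - z'‖ ≤ 3000) :
    ∫ ζ in closedBall z₀ 8000, N ζ * ‖kk δ (z - ζ) - kk δ (z' - ζ)‖ ≤
      10 ^ 10 * C * (1 / (1 + ‖z - z₀‖ ^ 2)) := by
  have hC : 0 ≤ C := hs.const_nonneg
  have hN : ∀ ζ, 0 ≤ N ζ := fun ζ => zero_le_one.trans (hs.one_le ζ)
  set D := ‖z - z₀‖ with hD
  rcases le_or_gt D 20000 with h | h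
  · have h1 : ∫ ζ in closedBall z₀ 8000, N ζ * ‖kk δ (z - ζ) - kk δ (z' - ζ)‖ ≤
        ∫ ζ in closedBall z₀ 8000, (N ζ * ‖ζ - z‖⁻¹ + N ζ * ‖ζ - z'‖⁻¹) := by
      refine setIntegral_mono (hs.integrableOn_kk hδ z z')
        ((hs.integrableOn z).add (hs.integrableOn z')) fun ζ => ?_
      have a1 := norm_kk_le hδ (z - ζ)
      have a2 := norm_kk_le hδ (z' - ζ)
      rw [norm_sub_rev] at a1 a2
      rw [← mul_add]
      exact mul_le_mul_of_nonneg_left ((norm_sub_le _ _).trans (add_le_add a1 a2)) (hN ζ)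
    rw [integral_add (hs.integrableOn z) (hs.integrableOn z')] at h1
    have h2 := hs.cauchy z
    have h3 := hs.cauchy z'
    have h4 : 1 / (1 + 20000 ^ 2) ≤ 1 / (1 + D ^ 2) := by
      have := norm_nonneg (z - z₀)
      gcongr
    have h5 : 2 * C ≤ 10 ^ 10 * C * (1 / (1 + 20000 ^ 2)) := by
      norm_num; linarith
    have := mul_le_mul_of_nonneg_left h4 (by positivity : 0 ≤ 10 ^ 10 * C)
    linarith
  · have hDp : 0 < D := by linarith
    have h1 : ∫ ζ in closedBall z₀ 8000, N ζ * ‖kk δ (z - ζ) - kk δ (z' - ζ)‖ ≤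
        ∫ ζ in closedBall z₀ 8000, (N ζ * ‖ζ - z₀‖⁻¹) * (8000 * (12000 / D ^ 2)) := by
      refine setIntegral_mono_on_ae (hs.integrableOn_kk hδ z z')
        ((hs.integrableOn z₀).mul_const _) measurableSet_closedBall ?_
      filter_upwards [Measure.ae_ne volume z₀] with ζ hne hζ
      rw [mem_closedBall, dist_eq_norm] at hζ
      have hp : 0 < ‖ζ - z₀‖ := norm_pos_iff.2 (sub_ne_zero.2 hne)
      have a1 : 3 / 5 * D ≤ ‖z - ζ‖ := by
        have := norm_sub_le_norm_sub_add_norm_sub z ζ z₀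
        linarith
      have a2 : 9 / 20 * D ≤ ‖z' - ζ‖ := by
        have := norm_sub_le_norm_sub_add_norm_sub z z' z₀
        have := norm_sub_le_norm_sub_add_norm_sub z' ζ z₀
        linarith
      have a3 := norm_kk_sub_le hδ (z - ζ) (z' - ζ) (norm_pos_iff.1 (by linarith))
        (norm_pos_iff.1 (by linarith))
      rw [sub_sub_sub_cancel_right] at a3
      have a4 : ‖kk δ (z - ζ) - kk δ (z' - ζ)‖ ≤ 12000 / D ^ 2 := by
        refine a3.trans ?_
        calc _ ≤ 3000 / ((3 / 5 * D) * (9 / 20 * D)) := by gcongr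
          _ ≤ _ := by
            rw [div_le_div_iff₀ (by positivity) (by positivity)]
            nlinarith
      have a5 : 1 ≤ ‖ζ - z₀‖⁻¹ * 8000 := by
        rw [inv_mul_eq_div, le_div_iff₀ hp]; linarith
      calc _ ≤ N ζ * (1 * (12000 / D ^ 2)) := by
            rw [one_mul]; exact mul_le_mul_of_nonneg_left a4 (hN ζ)
        _ ≤ N ζ * ((‖ζ - z₀‖⁻¹ * 8000) * (12000 / D ^ 2)) := by
            have := hN ζ
            gcongr
        _ = _ := by ring
    rw [integral_mul_const] at h1
    have h2 := hs.cauchy z₀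
    have h3 : (8000 : ℝ) * (12000 / D ^ 2) ≤ 10 ^ 10 * (1 / (1 + D ^ 2)) := by
      rw [mul_div_assoc', mul_one_div, div_le_div_iff₀ (by positivity) (by positivity)]
      nlinarith
    refine h1.trans ((mul_le_mul h2 h3 (by positivity) hC).trans (le_of_eq ?_))
    ring

end

/-- The regularised Cauchy transform of a density controlled by `nearN` has logarithmically bounded
oscillation at unit scale. -/
theorem cv_kk_osc {Cs : ℝ} {b : ℤ × ℤ → ℂ} {L N : ℤ × ℤ → ℂ → ℝ}
    (hs : ∀ q, Site Cs (zq q) (L q) (b q) (N q)) {I : Finset (ℤ × ℤ)} {R : ℝ} (hR : 1 ≤ R)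
    (hI : ∀ q ∈ I, ‖zq q‖ ≤ R) {δ B : ℝ} (hδ : 0 < δ) (hB : 0 ≤ B) {α : ℂ → ℂ} (hα : Continuous α)
    (cα : HasCompactSupport α) (hαB : ∀ z, ‖α z‖ ≤ B * nearN N I z) {z z' : ℂ}
    (hz : ‖z - z'‖ ≤ 3000) :
    ‖cv α (kk δ) z - cv α (kk δ) z'‖ ≤ 12 * 10 ^ 10 * Cs * B * (1 + Real.log R) := by
  have hC : 0 ≤ Cs := (hs 0).const_nonneg
  have hi := hα.integrable_of_hasCompactSupport cα (μ := volume)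
  have hk := (contDiff_kk hδ).continuous
  set g : ℤ × ℤ → ℂ → ℝ := fun q => (closedBall (zq q) 8000).indicator
    fun ζ => N q ζ * ‖kk δ (z - ζ) - kk δ (z' - ζ)‖ with hg
  have gi : ∀ q ∈ I, Integrable (g q) := fun q _ =>
    (integrable_indicator_iff measurableSet_closedBall).2 ((hs q).integrableOn_kk hδ z z')
  have hb : ∀ ζ, ‖α ζ • kk δ (z - ζ) - α ζ • kk δ (z' - ζ)‖ ≤ B * ∑ q ∈ I, g q ζ := by
    intro ζ
    rw [← smul_sub, norm_smul]
    refine (mul_le_mul_of_nonneg_right (hαB ζ) (norm_nonneg _)).trans (le_of_eq ?_)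
    rw [nearN, mul_assoc, Finset.sum_mul]
    congr 1
    refine Finset.sum_congr rfl fun q _ => ?_
    simp only [g, indicator, mem_closedBall, dist_eq_norm]
    split_ifs <;> simp
  unfold cv
  rw [← integral_sub (cv_integrable hi cα hk z) (cv_integrable hi cα hk z')]
  refine (norm_integral_le_of_norm_le ((integrable_finsetSum _ gi).const_mul B)
    (.of_forall hb)).trans ?_
  rw [integral_const_mul, integral_finsetSum _ gi]
  have h1 : ∑ q ∈ I, ∫ ζ, g q ζ ≤ 10 ^ 10 * Cs * ∑ q ∈ I, 1 / (1 + ‖z - zq q‖ ^ 2) := by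
    rw [Finset.mul_sum]
    refine Finset.sum_le_sum fun q _ => ?_
    rw [hg]
    simp only
    rw [integral_indicator measurableSet_closedBall]
    exact (hs q).kk_osc hδ hz
  have h2 := mul_le_mul_of_nonneg_left (lattice_log hR hI z) (by positivity : 0 ≤ 10 ^ 10 * Cs)
  refine (mul_le_mul_of_nonneg_left (h1.trans h2) hB).trans (le_of_eq ?_)
  ring

/-- A function with bounded oscillation at scale `3000` grows at most linearly. -/
theorem norm_sub_le_of_osc {s : ℂ → ℂ} {K : ℝ} (hK : 0 ≤ K)
    (h : ∀ z z', ‖z - z'‖ ≤ 3000 → ‖s z - s z'‖ ≤ K) {z : ℂ} {N : ℝ} (hz : ‖z‖ ≤ N) :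
    ‖s z - s 0‖ ≤ K * (N + 1) := by
  have hN : 0 ≤ N := (norm_nonneg z).trans hz
  have key : ∀ (m : ℕ) (w : ℂ), ‖w‖ ≤ m → ‖s w - s 0‖ ≤ K * m := by
    intro m
    induction m with
    | zero =>
      intro w hw
      have : w = 0 := by simpa using hw
      simp [this]
    | succ m ih =>
      intro w hw
      have h0 : (0 : ℝ) < (m + 1 : ℕ) := by positivity
      set w' : ℂ := ((m / (m + 1 : ℕ) : ℝ) : ℂ) * w
      have h1 : ‖w'‖ ≤ m := by
        rw [norm_mul, Complex.norm_real, Real.norm_eq_abs, abs_of_nonneg (by positivity)]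
        calc _ ≤ (m / (m + 1 : ℕ) : ℝ) * (m + 1 : ℕ) := by gcongr
          _ = m := by field_simp
      have h2 : ‖w - w'‖ ≤ 3000 := by
        have : w - w' = ((1 / (m + 1 : ℕ) : ℝ) : ℂ) * w := by
          have h5 : ((m : ℂ) + 1) ≠ 0 := by exact_mod_cast h0.ne'
          simp only [w']
          push_cast
          field_simp
          ring
        rw [this, norm_mul, Complex.norm_real, Real.norm_eq_abs, abs_of_nonneg (by positivity)]
        calc _ ≤ (1 / (m + 1 : ℕ) : ℝ) * (m + 1 : ℕ) := by gcongr
          _ = 1 := by field_simp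
          _ ≤ _ := by norm_num
      have h3 := h w w' h2
      have h4 := ih w' h1
      have := norm_sub_le_norm_sub_add_norm_sub (s w) (s w') (s 0)
      push_cast
      linarith
  refine (key ⌈N⌉₊ z (hz.trans (Nat.le_ceil N))).trans ?_
  have := (Nat.ceil_lt_add_one hN).le
  gcongr

theorem sq_sub_le_integral {g g' : ℝ → ℝ} (hg : ∀ t, HasDerivAt g (g' t) t) (hc : Continuous g')
    {a b s t : ℝ} (hs : s ∈ Icc a b) (ht : t ∈ Icc a b) :
    (g t - g s) ^ 2 ≤ (b - a) * ∫ x in a..b, g' x ^ 2 := by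
  wlog h : s ≤ t generalizing s t
  · rw [show (g t - g s) ^ 2 = (g s - g t) ^ 2 by ring]
    exact this ht hs (le_of_not_ge h)
  have hab : a ≤ b := hs.1.trans hs.2
  have i1 : ∀ x y, IntervalIntegrable g' volume x y := fun x y => hc.intervalIntegrable x y
  have i2 : ∀ x y, IntervalIntegrable (fun x => g' x ^ 2) volume x y :=
    fun x y => (hc.pow 2).intervalIntegrable x y
  have e : ∫ x in s..t, g' x = g t - g s :=
    intervalIntegral.integral_eq_sub_of_hasDerivAt (fun x _ => hg x) (i1 s t)
  have m : ∫ x in s..t, g' x ^ 2 ≤ ∫ x in a..b, g' x ^ 2 :=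
    intervalIntegral.integral_mono_interval hs.1 h ht.2
      (.of_forall fun x => sq_nonneg (g' x)) (i2 a b)
  have m0 : 0 ≤ ∫ x in s..t, g' x ^ 2 :=
    intervalIntegral.integral_nonneg h fun x _ => sq_nonneg _
  set D := g t - g s with hD
  have key : ∀ c : ℝ, 0 ≤ (∫ x in s..t, g' x ^ 2) - 2 * c * D + c ^ 2 * (t - s) := by
    intro c
    have h0 : 0 ≤ ∫ x in s..t, (g' x - c) ^ 2 :=
      intervalIntegral.integral_nonneg h fun x _ => sq_nonneg _
    have h1 : ∫ x in s..t, (g' x - c) ^ 2 =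
        ∫ x in s..t, ((g' x ^ 2 - (2 * c) * g' x) + c ^ 2) := by
      congr 1; funext x; ring
    rw [h1, intervalIntegral.integral_add ((i2 s t).sub ((i1 s t).const_mul _)) (by simp),
      intervalIntegral.integral_sub (i2 s t) ((i1 s t).const_mul _),
      intervalIntegral.integral_const_mul, e, intervalIntegral.integral_const, smul_eq_mul] at h0
    linarith
  rcases eq_or_lt_of_le h with h' | h'
  · subst h'
    have : D = 0 := by simp [hD]
    rw [this]
    have : 0 ≤ (b - a) * ∫ x in a..b, g' x ^ 2 := mul_nonneg (by linarith) (m0.trans m)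
    simpa using this
  have hp : 0 < t - s := by linarith
  have k := key (D / (t - s))
  have k2 : D ^ 2 ≤ (t - s) * ∫ x in s..t, g' x ^ 2 := by
    have : (∫ x in s..t, g' x ^ 2) - 2 * (D / (t - s)) * D + (D / (t - s)) ^ 2 * (t - s) =
        (∫ x in s..t, g' x ^ 2) - D ^ 2 / (t - s) := by
      field_simp; ring
    rw [this, sub_nonneg, div_le_iff₀ hp] at k
    linarith
  calc D ^ 2 ≤ (t - s) * ∫ x in s..t, g' x ^ 2 := k2
    _ ≤ (b - a) * ∫ x in a..b, g' x ^ 2 := by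
      have := hs.1; have := ht.2
      exact mul_le_mul (by linarith) m m0 (by linarith)

/-- The squared length of the gradient. -/
def gs (f : ℂ → ℝ) (z : ℂ) : ℝ := dX f z ^ 2 + dY f z ^ 2

theorem gs_nonneg (f : ℂ → ℝ) (z : ℂ) : 0 ≤ gs f z := by unfold gs; positivity

theorem continuous_gs {f : ℂ → ℝ} (hf : ContDiff ℝ ∞ f) : Continuous (gs f) :=
  ((contDiff_dX hf).continuous.pow 2).add ((contDiff_dY hf).continuous.pow 2)

theorem fderiv_sq_le (f : ℂ → ℝ) (z w : ℂ) : fderiv ℝ f z w ^ 2 ≤ ‖w‖ ^ 2 * gs f z := by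
  rw [fderiv_eq_dX_dY, ← Complex.normSq_eq_norm_sq, Complex.normSq_apply, gs]
  simp only [smul_eq_mul]
  nlinarith [sq_nonneg (w.re * dY f z - w.im * dX f z)]

section
variable {f : ℂ → ℝ} (hf : ContDiff ℝ ∞ f)
include hf

/-- The one-dimensional Poincaré inequality along a curve. -/
theorem sq_sub_le_curve {γ γ' : ℝ → ℂ} (hγ : ∀ t, HasDerivAt γ (γ' t) t) (hc : Continuous γ')
    {ρ : ℝ} (hρ : ∀ t, ‖γ' t‖ ≤ ρ) {a b s t : ℝ} (hs : s ∈ Icc a b) (ht : t ∈ Icc a b) :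
    (f (γ t) - f (γ s)) ^ 2 ≤ (b - a) * ∫ x in a..b, ρ ^ 2 * gs f (γ x) := by
  have hab : a ≤ b := hs.1.trans hs.2
  have cγ : Continuous γ := continuous_iff_continuousAt.2 fun t => (hγ t).continuousAt
  have cf : Continuous (fun t => fderiv ℝ f (γ t) (γ' t)) :=
    ((hf.continuous_fderiv (by simp)).comp cγ).clm_apply hc
  have h1 : ∀ t, HasDerivAt (fun t => f (γ t)) (fderiv ℝ f (γ t) (γ' t)) t := fun t =>
    (hf.diffl (γ t)).hasFDerivAt.comp_hasDerivAt t (hγ t)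
  refine (sq_sub_le_integral h1 cf hs ht).trans ?_
  refine mul_le_mul_of_nonneg_left ?_ (by linarith)
  refine intervalIntegral.integral_mono_on hab ((cf.pow 2).intervalIntegrable _ _)
    ((continuous_const.mul ((continuous_gs hf).comp cγ)).intervalIntegrable _ _) fun x _ => ?_
  refine (fderiv_sq_le f _ _).trans ?_
  exact mul_le_mul_of_nonneg_right (pow_le_pow_left₀ (norm_nonneg _) (hρ x) 2) (gs_nonneg f _)

theorem integral_sq_sub_translate {c : ℂ} {r : ℝ} {T : Set ℂ} (hT : MeasurableSet T)
    (hi : IntegrableOn (gs f) T) {τ : ℂ}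
    (hBT : ∀ a ∈ closedBall c r, ∀ t ∈ Icc (0 : ℝ) 1, a + t * τ ∈ T) :
    ∫ a in closedBall c r, (f (a + τ) - f a) ^ 2 ≤ ‖τ‖ ^ 2 * ∫ a in T, gs f a := by
  have cf := hf.continuous
  have cg := continuous_gs hf
  have hK := isCompact_closedBall c r
  have h1 : ∀ a, (f (a + τ) - f a) ^ 2 ≤ ∫ t in Icc (0 : ℝ) 1, ‖τ‖ ^ 2 * gs f (a + t * τ) := by
    intro a
    have hd : ∀ t : ℝ, HasDerivAt (fun t : ℝ => a + t * τ) τ t := fun t => by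
      have := ((Complex.ofRealCLM.hasDerivAt (x := t)).mul_const τ).const_add a
      simpa using this
    have := sq_sub_le_curve hf hd continuous_const (ρ := ‖τ‖) (fun _ => le_rfl)
      (left_mem_Icc.2 zero_le_one) (right_mem_Icc.2 zero_le_one)
    rw [intervalIntegral.integral_of_le zero_le_one, ← integral_Icc_eq_integral_Ioc] at this
    simpa using this
  have hprod : Integrable (Function.uncurry fun (a : ℂ) (t : ℝ) => ‖τ‖ ^ 2 * gs f (a + t * τ))
      ((volume.restrict (closedBall c r)).prod (volume.restrict (Icc (0 : ℝ) 1))) := by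
    rw [Measure.prod_restrict]
    exact (by fun_prop : Continuous (Function.uncurry fun (a : ℂ) (t : ℝ) =>
      ‖τ‖ ^ 2 * gs f (a + t * τ))).continuousOn.integrableOn_compact (hK.prod isCompact_Icc)
  have h2 : ∀ t ∈ Icc (0 : ℝ) 1, ∫ a in closedBall c r, ‖τ‖ ^ 2 * gs f (a + t * τ) ≤
      ‖τ‖ ^ 2 * ∫ a in T, gs f a := by
    intro t ht
    rw [integral_const_mul]
    refine mul_le_mul_of_nonneg_left ?_ (sq_nonneg _)
    rw [← integral_indicator hT, ← integral_add_right_eq_self (T.indicator (gs f)) ((t : ℂ) * τ),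
      ← integral_indicator measurableSet_closedBall]
    refine integral_mono_of_nonneg (.of_forall fun a => indicator_nonneg
      (fun x _ => gs_nonneg f _) a) ?_ (.of_forall fun a => ?_)
    · exact ((integrable_indicator_iff hT).2 hi).comp_add_right ((t : ℂ) * τ)
    · simp only [indicator]
      split_ifs with ha hb hb
      · exact le_rfl
      · exact absurd (hBT a ha t ht) hb
      · exact gs_nonneg f _
      · exact le_rfl
  calc _ ≤ ∫ a in closedBall c r, ∫ t in Icc (0 : ℝ) 1, ‖τ‖ ^ 2 * gs f (a + t * τ) := by
        refine integral_mono_of_nonneg (.of_forall fun a => sq_nonneg _) hprod.integral_prod_left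
          (.of_forall h1)
    _ = ∫ t in Icc (0 : ℝ) 1, ∫ a in closedBall c r, ‖τ‖ ^ 2 * gs f (a + t * τ) :=
        integral_integral_swap hprod
    _ ≤ ∫ t in Icc (0 : ℝ) 1, ‖τ‖ ^ 2 * ∫ a in T, gs f a := by
        refine setIntegral_mono_on hprod.integral_prod_right (integrableOn_const (by simp))
          measurableSet_Icc h2
    _ = _ := by simp

theorem sq_le_translate {c : ℂ} {T : Set ℂ} (hT : MeasurableSet T)
    (hi : IntegrableOn (gs f) T) {τ : ℂ}
    (hBT : ∀ a ∈ closedBall c (2 / 5), ∀ t ∈ Icc (0 : ℝ) 1, a + t * τ ∈ T) {m : ℝ}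
    (hm : ∀ a ∈ closedBall c (2 / 5), m ≤ f a ^ 2) :
    m ≤ 4 * ‖τ‖ ^ 2 * (∫ a in T, gs f a) + 4 * ∫ a in closedBall (c + τ) (2 / 5), f a ^ 2 := by
  have cf := hf.continuous
  have hK := isCompact_closedBall c (2 / 5)
  have hI := integral_sq_sub_translate hf hT hi hBT
  have i0 := (cf.fun_pow 2).continuousOn.integrableOn_compact (μ := volume) hK
  have i1 : IntegrableOn (fun a => (f (a + τ) - f a) ^ 2) (closedBall c (2 / 5)) :=
    (by fun_prop : Continuous fun a => (f (a + τ) - f a) ^ 2).continuousOn.integrableOn_compact hK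
  have i2 : IntegrableOn (fun a => f (a + τ) ^ 2) (closedBall c (2 / 5)) :=
    (by fun_prop : Continuous fun a => f (a + τ) ^ 2).continuousOn.integrableOn_compact hK
  have e2 : ∫ a in closedBall c (2 / 5), f (a + τ) ^ 2 =
      ∫ a in closedBall (c + τ) (2 / 5), f a ^ 2 := by
    rw [← integral_indicator measurableSet_closedBall, ← integral_indicator measurableSet_closedBall,
      ← integral_add_right_eq_self ((closedBall (c + τ) (2 / 5)).indicator _) τ]
    congr 1
    funext a
    simp [indicator, dist_eq_norm]
  have h1 : ∫ a in closedBall c (2 / 5), f a ^ 2 ≤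
      ∫ a in closedBall c (2 / 5), (2 * (f (a + τ) - f a) ^ 2 + 2 * f (a + τ) ^ 2) := by
    refine setIntegral_mono i0 ((i1.const_mul 2).add (i2.const_mul 2)) fun a => ?_
    nlinarith [sq_nonneg (f (a + τ) - f a + f (a + τ))]
  rw [integral_add (i1.const_mul 2) (i2.const_mul 2), integral_const_mul, integral_const_mul,
    e2] at h1
  rcases le_or_gt m 0 with hm0 | hm0
  · have h3 : 0 ≤ ∫ a in T, gs f a := integral_nonneg fun a => gs_nonneg f a
    have h4 : 0 ≤ ∫ a in closedBall (c + τ) (2 / 5), f a ^ 2 :=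
      integral_nonneg fun a => sq_nonneg _
    exact hm0.trans (by positivity)
  have h2 : Real.pi * (2 / 5) ^ 2 * m ≤ ∫ a in closedBall c (2 / 5), f a ^ 2 := by
    have : ∫ _ in closedBall c (2 / 5), m ≤ ∫ a in closedBall c (2 / 5), f a ^ 2 :=
      setIntegral_mono_on (integrableOn_const measure_closedBall_lt_top.ne) i0
        measurableSet_closedBall hm
    rwa [setIntegral_const, volume_real_closedBall _ (by norm_num), smul_eq_mul] at this
  have h3 : m / 2 ≤ Real.pi * (2 / 5) ^ 2 * m := by
    nlinarith [Real.pi_gt_d2]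
  linarith

end

theorem integral_annulus {h : ℂ → ℝ} (hh : Continuous h) :
    ∫ z in {z : ℂ | 1 < ‖z‖ ∧ ‖z‖ < 2}, h z =
      ∫ r in Ioo (1 : ℝ) 2, ∫ θ in Ioo (-Real.pi) Real.pi,
        r * h (r * (Real.cos θ + Real.sin θ * Complex.I)) := by
  set A := {z : ℂ | 1 < ‖z‖ ∧ ‖z‖ < 2} with hA
  have mA : MeasurableSet A :=
    ((isOpen_lt continuous_const continuous_norm).inter
      (isOpen_lt continuous_norm continuous_const)).measurableSet
  rw [← integral_indicator mA, ← Complex.integral_comp_polarCoord_symm]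
  have e : ∀ p ∈ polarCoord.target, p.1 • A.indicator h (Complex.polarCoord.symm p) =
      (Ioo (1 : ℝ) 2 ×ˢ Ioo (-Real.pi) Real.pi).indicator
        (fun p => p.1 * h (p.1 * (Real.cos p.2 + Real.sin p.2 * Complex.I))) p := by
    rintro p ⟨hp1, hp2⟩
    rw [Set.mem_Ioi] at hp1
    have : Complex.polarCoord.symm p ∈ A ↔ p ∈ Ioo (1 : ℝ) 2 ×ˢ Ioo (-Real.pi) Real.pi := by
      simp only [hA, Set.mem_ofPred_eq, Complex.norm_polarCoord_symm, abs_of_pos hp1, mem_prod,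
        hp2, and_true, Set.mem_Ioo]
    by_cases hm : Complex.polarCoord.symm p ∈ A
    · rw [indicator_of_mem hm, indicator_of_mem (this.1 hm), Complex.polarCoord_symm_apply,
        smul_eq_mul]
    · rw [indicator_of_notMem hm, indicator_of_notMem (fun h => hm (this.2 h)), smul_zero]
  have hsub : Ioo (1 : ℝ) 2 ×ˢ Ioo (-Real.pi) Real.pi ⊆ polarCoord.target := by
    rintro p ⟨h1, h2⟩
    exact ⟨zero_lt_one.trans h1.1, h2⟩
  rw [setIntegral_congr_fun polarCoord.open_target.measurableSet e,
    setIntegral_indicator (measurableSet_Ioo.prod measurableSet_Ioo),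
    inter_eq_right.2 hsub, Measure.volume_eq_prod, setIntegral_prod]
  refine IntegrableOn.mono_set (ContinuousOn.integrableOn_compact
    (isCompact_Icc.prod isCompact_Icc) (Continuous.continuousOn (by fun_prop)))
    (prod_mono Ioo_subset_Icc_self Ioo_subset_Icc_self)

/-- The Poincaré inequality on an annulus for a function which is small at one point of every
circle. -/
theorem integral_sq_annulus_le {f : ℂ → ℝ} (hf : ContDiff ℝ ∞ f) {ε : ℝ}
    (hp : ∀ r ∈ Icc (1 : ℝ) 2, ∃ p : ℂ, ‖p‖ = r ∧ |f p| ≤ ε) :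
    ∫ z in {z : ℂ | 1 < ‖z‖ ∧ ‖z‖ < 2}, f z ^ 2 ≤
      100 * ε ^ 2 + 400 * ∫ z in {z : ℂ | 1 < ‖z‖ ∧ ‖z‖ < 2}, gs f z := by
  have cf := hf.continuous
  have cg := continuous_gs hf
  have hpi := Real.pi_pos
  have hpi4 := Real.pi_lt_d2
  have hε : 0 ≤ ε := by
    obtain ⟨p, _, h⟩ := hp 1 (by norm_num)
    exact (abs_nonneg _).trans h
  set γ : ℝ → ℝ → ℂ := fun r θ => r * (Real.cos θ + Real.sin θ * Complex.I) with hγ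
  have cγ : Continuous (Function.uncurry γ) := by simp only [hγ, Function.uncurry_def]; fun_prop
  have cγr : ∀ r, Continuous (γ r) := fun r => cγ.comp (by fun_prop : Continuous fun θ => (r, θ))
  rw [integral_annulus (cf.fun_pow 2), integral_annulus cg]
  set U := Ioo (-Real.pi) Real.pi with hU
  have fU : IsFiniteMeasure (volume.restrict U) :=
    ⟨by rw [Measure.restrict_apply_univ]; exact measure_Ioo_lt_top⟩
  have ii : ∀ k : ℝ → ℝ, Continuous k → IntegrableOn k U := fun k hk =>
    (hk.continuousOn.integrableOn_compact isCompact_Icc).mono_set Ioo_subset_Icc_self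
  have jj : ∀ k : ℂ → ℝ, Continuous k →
      IntegrableOn (fun r => ∫ θ in U, r * k (γ r θ)) (Ioo (1 : ℝ) 2) := fun k hk => by
    have : IntegrableOn (fun p : ℝ × ℝ => p.1 * k (γ p.1 p.2)) (Ioo (1 : ℝ) 2 ×ˢ U) :=
      IntegrableOn.mono_set (ContinuousOn.integrableOn_compact
        (isCompact_Icc.prod isCompact_Icc) (Continuous.continuousOn
          (continuous_fst.mul (hk.comp cγ))))
        (prod_mono Ioo_subset_Icc_self Ioo_subset_Icc_self)
    rw [IntegrableOn, Measure.volume_eq_prod, ← Measure.prod_restrict] at this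
    exact this.integral_prod_left
  have vU : volume.real U = 2 * Real.pi := by
    rw [hU, Real.volume_real_Ioo_of_le (by linarith)]; ring
  have key : ∀ r ∈ Ioo (1 : ℝ) 2, ∫ θ in U, r * f (γ r θ) ^ 2 ≤
      100 * ε ^ 2 + 400 * ∫ θ in U, r * gs f (γ r θ) := by
    intro r hr
    have hr0 : 0 < r := by linarith [hr.1]
    obtain ⟨p, hpr, hpε⟩ := hp r (Ioo_subset_Icc_self hr)
    have hd : ∀ θ, HasDerivAt (γ r)
        (r * (-Real.sin θ + Real.cos θ * Complex.I)) θ := fun θ => by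
      have h1 := (Real.hasDerivAt_cos θ).ofReal_comp
      have h2 := (Real.hasDerivAt_sin θ).ofReal_comp
      have := (h1.fun_add (h2.mul_const Complex.I)).const_mul (r : ℂ)
      simpa [hγ] using this
    have hn : ∀ θ : ℝ, ‖(r : ℂ) * (-Real.sin θ + Real.cos θ * Complex.I)‖ ≤ 2 := fun θ => by
      rw [norm_mul, Complex.norm_real, Real.norm_eq_abs, abs_of_pos hr0]
      have : ‖(-Real.sin θ + Real.cos θ * Complex.I : ℂ)‖ = 1 := by
        have e : (-Real.sin θ + Real.cos θ * Complex.I : ℂ) =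
            ((-Real.sin θ : ℝ) : ℂ) + ((Real.cos θ : ℝ) : ℂ) * Complex.I := by push_cast; ring
        rw [e, Complex.norm_add_mul_I, neg_sq, Real.sin_sq_add_cos_sq, Real.sqrt_one]
      rw [this]; linarith [hr.2]
    have hpγ : γ r (Complex.arg p) = p := by
      simp only [hγ, ← hpr]
      rw [Complex.ofReal_cos, Complex.ofReal_sin]
      exact Complex.norm_mul_cos_add_sin_mul_I p
    have harg : Complex.arg p ∈ Icc (-Real.pi) Real.pi :=
      ⟨(Complex.neg_pi_lt_arg p).le, Complex.arg_le_pi p⟩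
    set X := ∫ θ in U, gs f (γ r θ) with hX
    have hX0 : 0 ≤ X := integral_nonneg fun _ => gs_nonneg _ _
    have h1 : ∀ θ ∈ U, f (γ r θ) ^ 2 ≤ 2 * ε ^ 2 + 16 * Real.pi * X := by
      intro θ hθ
      have := sq_sub_le_curve hf hd (by fun_prop) hn harg (Ioo_subset_Icc_self hθ)
      rw [intervalIntegral.integral_of_le (by linarith), integral_Ioc_eq_integral_Ioo,
        integral_const_mul, hpγ] at this
      have h2 : f p ^ 2 ≤ ε ^ 2 := sq_le_sq' (by linarith [(abs_le.1 hpε).1]) (abs_le.1 hpε).2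
      nlinarith [sq_nonneg (f (γ r θ) - 2 * f p)]
    rw [integral_const_mul, integral_const_mul, ← hX]
    have h2 : ∫ θ in U, f (γ r θ) ^ 2 ≤ 2 * Real.pi * (2 * ε ^ 2 + 16 * Real.pi * X) := by
      have : ∫ θ in U, f (γ r θ) ^ 2 ≤ ∫ _ in U, (2 * ε ^ 2 + 16 * Real.pi * X) :=
        setIntegral_mono_on (ii _ ((cf.comp (cγr r)).fun_pow 2)) (integrable_const _) measurableSet_Ioo
          h1
      rwa [setIntegral_const, vU, smul_eq_mul] at this
    have h3 : 0 ≤ ε ^ 2 := sq_nonneg _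
    have h4 := mul_le_mul_of_nonneg_left h2 hr0.le
    have h5 : r * (2 * Real.pi * (2 * ε ^ 2)) ≤ 100 * ε ^ 2 := by
      have : r * Real.pi ≤ 2 * 3.15 := mul_le_mul hr.2.le hpi4.le hpi.le (by norm_num)
      nlinarith
    have h6 : 2 * Real.pi * (16 * Real.pi * X) ≤ 400 * X := by
      have : Real.pi ^ 2 ≤ 3.15 ^ 2 := pow_le_pow_left₀ hpi.le hpi4.le 2
      nlinarith
    have h7 := mul_le_mul_of_nonneg_left h6 hr0.le
    nlinarith
  have ic : IntegrableOn (fun _ : ℝ => 100 * ε ^ 2) (Ioo (1 : ℝ) 2) :=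
    integrableOn_const (by simp)
  calc _ ≤ ∫ r in Ioo (1 : ℝ) 2, (100 * ε ^ 2 + 400 * ∫ θ in U, r * gs f (γ r θ)) :=
        setIntegral_mono_on (jj _ (cf.fun_pow 2)) (ic.add ((jj _ cg).const_mul 400)) measurableSet_Ioo key
    _ = _ := by
        rw [integral_add ic ((jj _ cg).const_mul 400), setIntegral_const,
          Real.volume_real_Ioo_of_le (by norm_num), integral_const_mul 400, smul_eq_mul]
        ring

theorem exists_integral_rpow_le_sq : ∃ K > 0, ∀ (N : ℝ), 1 ≤ N → ∀ z c : ℂ,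
    ∫ ζ in closedBall c N, ‖ζ - z‖ ^ (-(7 / 4) : ℝ) ≤ K * N ^ 2 := by
  obtain ⟨K, hK, h⟩ := exists_integral_rpow_le 1
  refine ⟨K + Real.pi, by positivity, fun N hN z c => ?_⟩
  have fB : IsFiniteMeasure (volume.restrict (closedBall c N)) :=
    ⟨by rw [Measure.restrict_apply_univ]; exact measure_closedBall_lt_top⟩
  set k : ℂ → ℝ := fun ζ => ‖ζ - z‖ ^ (-(7 / 4) : ℝ)
  have hk : ∀ ζ, 0 ≤ k ζ := fun ζ => by positivity
  have i1 : Integrable ((closedBall z 1).indicator k) :=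
    (integrable_indicator_iff measurableSet_closedBall).2 (h z z).1
  have h1 : ∫ ζ in closedBall c N, k ζ ≤
      ∫ ζ in closedBall c N, ((closedBall z 1).indicator k ζ + 1) := by
    refine integral_mono_of_nonneg (.of_forall hk) (i1.integrableOn.add (integrable_const _))
      (.of_forall fun ζ => ?_)
    simp only [indicator, mem_closedBall, dist_eq_norm]
    split_ifs with h2
    · linarith
    · rw [zero_add]
      exact Real.rpow_le_one_of_one_le_of_nonpos (not_le.1 h2).le (by norm_num)
  rw [integral_add i1.integrableOn (integrable_const _), setIntegral_const,
    volume_real_closedBall _ (by linarith)] at h1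
  have h2 : ∫ ζ in closedBall c N, (closedBall z 1).indicator k ζ ≤ K := by
    refine (setIntegral_le_integral i1 (.of_forall fun ζ => indicator_nonneg
      (fun _ _ => hk _) ζ)).trans ?_
    rw [integral_indicator measurableSet_closedBall]
    exact (h z z).2
  simp only [smul_eq_mul, mul_one] at h1
  have : K * 1 ≤ K * N ^ 2 := mul_le_mul_of_nonneg_left (one_le_pow₀ hN) hK.le
  linarith

theorem exists_zero_small : ∃ K > 0, ∀ (n : ℕ) (p : ℕ → ℂ) (w₀ : ℂ) (v : ℂ → ℝ), 0 < n →
    (∀ j < n, ‖p j - w₀‖ = 1 + j / n) →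
    (∀ j < n, ∀ z, |v z| ≤ 1 / n + 6 * ‖z - p j‖) → ∀ (N : ℝ), 1 ≤ N →
    ∫ z in closedBall 0 N, (v z * lapl (zeroL n p) z) ^ 2 ≤
      K * N ^ 2 * (1 / n : ℝ) ^ (1 / 4 : ℝ) := by
  obtain ⟨K, hK, H⟩ := exists_integral_rpow_le_sq
  refine ⟨192 * 48 * K, by positivity, fun n p w₀ v hn hp hvp N hN => ?_⟩
  have hn' : (0 : ℝ) < n := by exact_mod_cast hn
  set δ : ℝ := 1 / n with hδd
  have hδ : 0 < δ := by positivity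
  have fB : IsFiniteMeasure (volume.restrict (closedBall (0 : ℂ) N)) :=
    ⟨by rw [Measure.restrict_apply_univ]; exact measure_closedBall_lt_top⟩
  set x : ℕ → ℂ → ℝ := fun j z => ‖z - p j‖ + δ with hx
  have hxp : ∀ j z, 0 < x j z := fun j z => by positivity
  have e : ∀ z, |v z * lapl (zeroL n p) z| ≤
      δ * ∑ j ∈ Finset.range n, 48 * (δ ^ 2 / x j z ^ 3) := by
    intro z
    rw [lapl_zeroL hn, abs_mul, abs_of_nonneg (a := 1 / (n : ℝ) * _) (mul_nonneg hδ.le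
      (Finset.sum_nonneg fun j _ => mul_nonneg zero_le_two (qk_nonneg hδ _))), mul_left_comm]
    refine mul_le_mul_of_nonneg_left ?_ hδ.le
    rw [Finset.mul_sum]
    refine Finset.sum_le_sum fun j hj => ?_
    have h1 := qk_le hδ (z - p j)
    have h2 : |v z| ≤ 6 * x j z := by
      have := hvp j (Finset.mem_range.1 hj) z
      simp only [hx]; linarith
    calc |v z| * (2 * qk δ (z - p j)) ≤ 6 * x j z * (2 * (4 * δ ^ 2 / x j z ^ 4)) :=
          mul_le_mul h2 (mul_le_mul_of_nonneg_left h1 zero_le_two)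
            (mul_nonneg zero_le_two (qk_nonneg hδ _)) (by have := hxp j z; positivity)
      _ = _ := by
        have := (hxp j z).ne'
        field_simp; ring
  have sup : ∀ z, |v z * lapl (zeroL n p) z| ≤ 192 / √δ := by
    intro z
    have hf := frostman hn hp z
    have : ∀ j, 48 * (δ ^ 2 / x j z ^ 3) ≤ 48 / √δ * (1 / √(x j z)) := by
      intro j
      have h0 := hxp j z
      have hs := Real.sqrt_pos.2 hδ
      have hs2 := Real.sqrt_pos.2 h0
      have h1 : √δ ≤ √(x j z) := Real.sqrt_le_sqrt (by
        have := norm_nonneg (z - p j); simp only [hx]; linarith)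
      rw [div_mul_div_comm, mul_one, mul_div_assoc', div_le_div_iff₀ (by positivity)
        (by positivity)]
      have h2 : δ ^ 2 = √δ ^ 4 := by
        rw [show √δ ^ 4 = (√δ ^ 2) ^ 2 by ring, Real.sq_sqrt hδ.le]
      have h3 : x j z ^ 3 = √(x j z) ^ 6 := by
        rw [show √(x j z) ^ 6 = (√(x j z) ^ 2) ^ 3 by ring, Real.sq_sqrt h0.le]
      rw [h2, h3]
      have h4 := pow_le_pow_left₀ hs.le h1 5
      have h5 := mul_le_mul_of_nonneg_right h4 hs2.le
      nlinarith
    calc _ ≤ δ * ∑ j ∈ Finset.range n, 48 * (δ ^ 2 / x j z ^ 3) := e z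
      _ ≤ δ * ∑ j ∈ Finset.range n, 48 / √δ * (1 / √(x j z)) :=
          mul_le_mul_of_nonneg_left (Finset.sum_le_sum fun j _ => this j) hδ.le
      _ = 48 / √δ * (δ * ∑ j ∈ Finset.range n, 1 / √(x j z)) := by
          rw [← Finset.mul_sum]; ring
      _ ≤ 48 / √δ * 4 := mul_le_mul_of_nonneg_left hf (by positivity)
      _ = _ := by ring
  set k : ℕ → ℂ → ℝ := fun j ζ => ‖ζ - p j‖ ^ (-(7 / 4) : ℝ) with hk
  obtain ⟨_, _, hI⟩ := exists_integral_rpow_le N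
  have ik : ∀ j ∈ Finset.range n, IntegrableOn (fun z => 48 * (δ ^ (3 / 4 : ℝ) * k j z))
    (closedBall 0 N) := fun j _ => ((hI (p j) 0).1.const_mul _).const_mul _
  have h1 : ∀ᵐ z ∂(volume.restrict (closedBall (0 : ℂ) N)), (v z * lapl (zeroL n p) z) ^ 2 ≤
      192 / √δ * (δ * ∑ j ∈ Finset.range n, 48 * (δ ^ (3 / 4 : ℝ) * k j z)) := by
    have hae : ∀ᵐ ζ : ℂ ∂(volume.restrict (closedBall 0 N)),
        ∀ w ∈ (Finset.range n).image p, ζ ≠ w := by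
      refine ae_restrict_of_ae ?_
      rw [Finset.eventually_all]
      exact fun w _ => Measure.ae_ne volume w
    filter_upwards [hae] with z hz
    rw [← sq_abs, sq]
    refine mul_le_mul (sup z) ((e z).trans (mul_le_mul_of_nonneg_left
      (Finset.sum_le_sum fun j hj => ?_) hδ.le)) (abs_nonneg _) (by positivity)
    have hne := hz (p j) (Finset.mem_image_of_mem p hj)
    have hw : 0 < ‖z - p j‖ := norm_pos_iff.2 (sub_ne_zero.2 hne)
    refine mul_le_mul_of_nonneg_left ?_ (by norm_num)
    have h0 := hxp j z
    have h2 : δ ^ 2 / x j z ^ 3 = δ ^ (3 / 4 : ℝ) * (δ ^ (5 / 4 : ℝ) / x j z ^ 3) := by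
      rw [mul_div_assoc', ← Real.rpow_add hδ, ← Real.rpow_natCast δ 2]
      norm_num
    rw [h2]
    refine mul_le_mul_of_nonneg_left ?_ (by positivity)
    have h3 : x j z ^ 3 = x j z ^ (5 / 4 : ℝ) * x j z ^ (7 / 4 : ℝ) := by
      rw [← Real.rpow_add h0, ← Real.rpow_natCast (x j z) 3]
      norm_num
    change _ ≤ ‖z - p j‖ ^ (-(7 / 4) : ℝ)
    rw [h3, Real.rpow_neg hw.le, div_le_iff₀ (by positivity), inv_mul_eq_div,
      le_div_iff₀ (by positivity)]
    have h4 : δ ^ (5 / 4 : ℝ) ≤ x j z ^ (5 / 4 : ℝ) :=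
      Real.rpow_le_rpow hδ.le (by simp only [hx]; linarith) (by norm_num)
    have h5 : ‖z - p j‖ ^ (7 / 4 : ℝ) ≤ x j z ^ (7 / 4 : ℝ) :=
      Real.rpow_le_rpow hw.le (by simp only [hx]; linarith) (by norm_num)
    exact mul_le_mul h4 h5 (by positivity) (by positivity)
  refine (integral_mono_of_nonneg (.of_forall fun z => sq_nonneg _)
    (((integrable_finsetSum _ ik).const_mul _).const_mul _) h1).trans ?_
  rw [integral_const_mul, integral_const_mul, integral_finsetSum _ ik]
  have h2 : ∑ j ∈ Finset.range n, ∫ z in closedBall 0 N, 48 * (δ ^ (3 / 4 : ℝ) * k j z) ≤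
      n * (48 * (δ ^ (3 / 4 : ℝ) * (K * N ^ 2))) := by
    have : ∀ j ∈ Finset.range n, ∫ z in closedBall 0 N, 48 * (δ ^ (3 / 4 : ℝ) * k j z) ≤
        48 * (δ ^ (3 / 4 : ℝ) * (K * N ^ 2)) := fun j _ => by
      rw [integral_const_mul, integral_const_mul]
      have := H N hN (p j) 0
      gcongr
    refine (Finset.sum_le_sum this).trans (le_of_eq ?_)
    simp
  refine (mul_le_mul_of_nonneg_left (mul_le_mul_of_nonneg_left h2 hδ.le)
    (by positivity)).trans (le_of_eq ?_)
  have h3 : δ * n = 1 := by rw [hδd]; field_simp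
  have h4 : δ ^ (3 / 4 : ℝ) / √δ = δ ^ (1 / 4 : ℝ) := by
    rw [Real.sqrt_eq_rpow, ← Real.rpow_sub hδ]; norm_num
  calc _ = 192 * 48 * K * N ^ 2 * (δ ^ (3 / 4 : ℝ) / √δ) * (δ * n) := by ring
    _ = _ := by rw [h3, h4, mul_one]

/-- A smooth bounded function, supported in a disc of radius `N`, which solves a Schrödinger
equation with a small smooth potential up to a small error. -/
structure ApproxSol (l : ℝ) (n : ℕ) (N : ℝ) (V v : ℂ → ℝ) : Prop where
  l_pos : 0 < l
  l_le : l ≤ 1 / 25000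
  n_pos : 0 < n
  N_ge : 1 ≤ N
  smoothV : ContDiff ℝ ∞ V
  smooth : ContDiff ℝ ∞ v
  suppV : ∀ z, 2 * N < ‖z‖ → V z = 0
  supp : ∀ z, N < ‖z‖ → v z = 0
  absV : ∀ z, |V z| ≤ l
  abs_le_one : ∀ z, |v z| ≤ 1
  err : ∀ z, |lapl v z + V z * v z| ≤ l * (1 / n)

/-- The site `q` is a hole if `v` is not small anywhere near it. -/
def Hole (n : ℕ) (v : ℂ → ℝ) (q : ℤ × ℤ) : Prop :=
  ∀ z ∈ closedBall (zq q) 100, (1 / n : ℝ) / 4 < |v z|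

section
variable {l : ℝ} {n : ℕ} {N : ℝ} {V v : ℂ → ℝ} (h : ApproxSol l n N V v)
include h

theorem ApproxSol.abs_lapl_le (z : ℂ) : |lapl v z| ≤ l * |v z| + l * (1 / n) := by
  have h1 := h.err z
  have h2 : |V z * v z| ≤ l * |v z| := by
    rw [abs_mul]; exact mul_le_mul_of_nonneg_right (h.absV z) (abs_nonneg _)
  have h3 : lapl v z = (lapl v z + V z * v z) - V z * v z := by ring
  rw [h3]
  refine (abs_sub _ _).trans ?_
  linarith

theorem ApproxSol.one_div_pos : (0 : ℝ) < 1 / n := by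
  have : (0 : ℝ) < n := by exact_mod_cast h.n_pos
  positivity

theorem ApproxSol.one_div_le : (1 / n : ℝ) ≤ 1 := by
  have : (1 : ℝ) ≤ n := by exact_mod_cast h.n_pos
  rw [div_le_one (by linarith)]; exact this

theorem ApproxSol.abs_grad_le (z : ℂ) : |dX v z| ≤ 3 ∧ |dY v z| ≤ 3 := by
  have h1 : ∀ w, |lapl v w| ≤ 1 := fun w => by
    have h1 := h.abs_lapl_le w
    have h2 := mul_le_mul_of_nonneg_left (h.abs_le_one w) h.l_pos.le
    have h3 := mul_le_mul_of_nonneg_left h.one_div_le h.l_pos.le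
    linarith [h.l_le]
  have := abs_dX_dY_le h.smooth one_pos one_pos z (fun w _ => h.abs_le_one w) fun w _ => h1 w
  norm_num at this
  exact this

theorem ApproxSol.abs_sub_le (x y : ℂ) : |v y - v x| ≤ 6 * ‖y - x‖ := by
  have := norm_sub_le_of_partial h.smooth.diffl convex_univ (G := 3)
    (fun z _ => h.abs_grad_le z) (mem_univ x) (mem_univ y)
  rw [Real.norm_eq_abs] at this
  linarith

theorem ApproxSol.norm_le_of_hole {q : ℤ × ℤ} (hq : Hole n v q) : ‖zq q‖ ≤ N := by
  by_contra hc
  have h1 := hq (zq q) (by simp)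
  rw [h.supp _ (not_le.1 hc), abs_zero] at h1
  linarith [h.one_div_pos]

theorem ApproxSol.abs_lapl_le_of_hole {q : ℤ × ℤ} (hq : Hole n v q) {z : ℂ}
    (hz : z ∈ closedBall (zq q) 100) : |lapl v z| ≤ 1 / 5000 * |v z| := by
  have h1 := h.abs_lapl_le z
  have h2 := mul_le_mul_of_nonneg_left (hq z hz).le h.l_pos.le
  have h3 := mul_le_mul_of_nonneg_right h.l_le (abs_nonneg (v z))
  nlinarith

theorem ApproxSol.harnack {q : ℤ × ℤ} (hq : Hole n v q) {x y : ℂ}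
    (hx : x ∈ closedBall (zq q) 12) (hy : y ∈ closedBall (zq q) 12) :
    |v x| ≤ 10 ^ 7 * |v y| := by
  have hp := h.one_div_pos
  have h12 : closedBall (zq q) 12 ⊆ closedBall (zq q) 100 := closedBall_subset_closedBall (by norm_num)
  have hne : ∀ z ∈ closedBall (zq q) 100, v z ≠ 0 := fun z hz h0 => by
    have := hq z hz
    rw [h0, abs_zero] at this
    linarith
  have hconn : IsPreconnected (closedBall (zq q) 100) := (convex_closedBall _ _).isPreconnected
  have hdich : (∀ z ∈ closedBall (zq q) 100, 0 < v z) ∨ ∀ z ∈ closedBall (zq q) 100, v z < 0 := by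
    by_contra! hc
    obtain ⟨⟨a, ha, ha'⟩, c, hc, hc'⟩ := hc
    obtain ⟨w, hw, hw0⟩ := hconn.intermediate_value ha hc h.smooth.continuous.continuousOn
      ⟨ha', hc'⟩
    exact hne w hw hw0
  rcases hdich with hs | hs
  · rw [abs_of_pos (hs x (h12 hx)), abs_of_pos (hs y (h12 hy))]
    refine Landis.harnack h.smooth hs (fun z hz => ?_) hx hy
    have := h.abs_lapl_le_of_hole hq hz
    rwa [abs_of_pos (hs z hz)] at this
  · rw [abs_of_neg (hs x (h12 hx)), abs_of_neg (hs y (h12 hy))]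
    refine Landis.harnack (v := fun z => - v z) h.smooth.neg (fun z hz => by
      have := hs z hz; linarith) (fun z hz => ?_) hx hy
    have := h.abs_lapl_le_of_hole hq hz
    rw [abs_of_neg (hs z hz)] at this
    rw [lapl_neg]
    simpa using this

theorem ApproxSol.abs_grad_le_of_hole {q : ℤ × ℤ} (hq : Hole n v q) {z : ℂ}
    (hz : z ∈ closedBall (zq q) 2) :
    |dX v z| ≤ 3 * 10 ^ 7 * |v (zq q)| ∧ |dY v z| ≤ 3 * 10 ^ 7 * |v (zq q)| := by
  have hm : 0 < |v (zq q)| := lt_trans (by have := h.one_div_pos; positivity) (hq (zq q) (by simp))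
  have hs : ∀ w ∈ closedBall z (2 * 1), w ∈ closedBall (zq q) 12 := fun w hw => by
    rw [mem_closedBall] at *
    linarith [dist_triangle w z (zq q)]
  have h1 : ∀ w ∈ closedBall z (2 * 1), |v w| ≤ 10 ^ 7 * |v (zq q)| := fun w hw =>
    h.harnack hq (hs w hw) (by simp)
  have h2 : ∀ w ∈ closedBall z (2 * 1), |lapl v w| ≤ 10 ^ 7 * |v (zq q)| := fun w hw => by
    have a1 := h.abs_lapl_le_of_hole hq (z := w)
      (closedBall_subset_closedBall (by norm_num) (hs w hw))
    have a2 := h1 w hw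
    have a3 := abs_nonneg (v w)
    linarith
  have := abs_dX_dY_le h.smooth one_pos (by positivity) z h1 h2
  constructor <;> [refine this.1.trans ?_; refine this.2.trans ?_] <;> linarith

theorem ApproxSol.exists_zero {q : ℤ × ℤ} (hq : ¬ Hole n v q) :
    ∃ w₀ : ℂ, ‖w₀ - zq q‖ ≤ 100 ∧ ∀ r : ℝ, 0 < r → r ≤ 2 → ∃ p, ‖p - w₀‖ = r ∧ |v p| ≤ 1 / n := by
  unfold Hole at hq
  push Not at hq
  obtain ⟨w₀, hw, hv⟩ := hq
  refine ⟨w₀, by rwa [mem_closedBall, dist_eq_norm] at hw, fun r hr hr2 => ?_⟩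
  obtain ⟨p, hp, hp2⟩ := exists_small_on_sphere h.smooth h.l_pos (by linarith [h.l_le])
    h.one_div_pos h.absV h.err hv hr hr2
  exact ⟨p, by rwa [dist_eq_norm] at hp, hp2⟩

end

/-- Every lattice point carries a site adapted to the approximate solution. -/
theorem exists_sites : ∃ C > 0, ∀ {l : ℝ} {n : ℕ} {N : ℝ} {V v : ℂ → ℝ}, ApproxSol l n N V v →
    ∃ (L D : ℤ × ℤ → ℂ → ℝ) (b : ℤ × ℤ → ℂ), (∀ q, Site C (zq q) (L q) (b q) (D q)) ∧
    (∀ q z, Hole n v q ∨ 200 ≤ ‖z - zq q‖ → D q z ≤ C) ∧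
    (∀ q z, Hole n v q → |lapl (L q) z| ≤ C) ∧
    (∀ q z, Hole n v q → 1 < ‖z - zq q‖ → lapl (L q) z = 0) ∧
    ∀ q, ¬ Hole n v q → ∫ z in closedBall 0 N, (v z * lapl (L q) z) ^ 2 ≤
      C * N ^ 2 * (1 / n : ℝ) ^ (1 / 4 : ℝ) := by
  obtain ⟨C₁, hC₁, H₁⟩ := exists_site_zero
  obtain ⟨C₂, hC₂, M, H₂⟩ := exists_site_hole
  obtain ⟨K, hK, H₃⟩ := exists_zero_small
  set C := C₁ + C₂ + |M| + K + 2 with hC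
  have hM := abs_nonneg M
  have hMM := le_abs_self M
  refine ⟨C, by positivity, fun {l n N V v} h => ?_⟩
  have hn := h.n_pos
  have hn' : (0 : ℝ) < n := by exact_mod_cast hn
  have key : ∀ q, ∃ (L D : ℂ → ℝ) (b : ℂ), Site C (zq q) L b D ∧
    (∀ z, Hole n v q ∨ 200 ≤ ‖z - zq q‖ → D z ≤ C) ∧
    (∀ z, Hole n v q → |lapl L z| ≤ C) ∧
    (∀ z, Hole n v q → 1 < ‖z - zq q‖ → lapl L z = 0) ∧
    (¬ Hole n v q → ∫ z in closedBall 0 N, (v z * lapl L z) ^ 2 ≤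
      C * N ^ 2 * (1 / n : ℝ) ^ (1 / 4 : ℝ)) := by
    intro q
    by_cases hq : Hole n v q
    · obtain ⟨a1, a2, a3⟩ := H₂ (zq q)
      exact ⟨_, _, _, a1.mono (by linarith), fun z _ => by linarith,
        fun z _ => (a2 z).trans (by linarith), fun z _ => a3 z, fun hc => absurd hq hc⟩
    · obtain ⟨w₀, hw, hr⟩ := h.exists_zero hq
      have : ∀ j : ℕ, ∃ p : ℂ, j < n → ‖p - w₀‖ = 1 + j / n ∧ |v p| ≤ 1 / n := by
        intro j
        by_cases hj : j < n
        · have : (j / n : ℝ) ≤ 1 := by rw [div_le_one hn']; exact_mod_cast hj.le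
          obtain ⟨p, hp⟩ := hr (1 + j / n) (by positivity) (by linarith)
          exact ⟨p, fun _ => hp⟩
        · exact ⟨0, fun h => absurd h hj⟩
      choose p hp using this
      have hp1 : ∀ j < n, ‖p j - w₀‖ = 1 + j / n := fun j hj => (hp j hj).1
      refine ⟨zeroL n p, zeroN n p, zeroB n p, (H₁ n p w₀ _ hn hw hp1).mono (by linarith),
        fun z hz => ?_, fun z hc => absurd hc hq, fun z hc => absurd hc hq, fun _ => ?_⟩
      · have hz := hz.resolve_left hq
        have : (1 / n : ℝ) * ∑ j ∈ Finset.range n, 2 / (‖z - p j‖ + 1 / n) ≤ 1 := by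
          refine sum_avg_le hn fun j hj => ?_
          have b1 := hp1 j hj
          have b2 : (j / n : ℝ) ≤ 1 := by rw [div_le_one hn']; exact_mod_cast hj.le
          have b3 := norm_sub_le_norm_sub_add_norm_sub z (p j) (zq q)
          have b4 := norm_sub_le_norm_sub_add_norm_sub (p j) w₀ (zq q)
          have b5 : (0 : ℝ) < 1 / n := by positivity
          rw [div_le_one (by positivity)]
          linarith
        unfold zeroN
        linarith
      · refine (H₃ n p w₀ v hn hp1 (fun j hj z => ?_) N h.N_ge).trans (by gcongr; linarith)
        have b1 := h.abs_sub_le (p j) z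
        have b2 := (hp j hj).2
        have b3 : |v z| ≤ |v z - v (p j)| + |v (p j)| := by
          simpa using abs_add_le (v z - v (p j)) (v (p j))
        linarith
  choose L D b k1 k2 k3 k4 k5 using key
  exact ⟨L, D, b, k1, k2, k3, k4, k5⟩

/-- The lattice points in a disc. -/
def latt (R : ℝ) : Finset (ℤ × ℤ) :=
  {q ∈ Finset.Icc (-⌈R⌉) ⌈R⌉ ×ˢ Finset.Icc (-⌈R⌉) ⌈R⌉ | ‖zq q‖ ≤ R}

theorem mem_latt {R : ℝ} {q : ℤ × ℤ} : q ∈ latt R ↔ ‖zq q‖ ≤ R := by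
  simp only [latt, Finset.mem_filter, Finset.mem_product, Finset.mem_Icc, and_iff_right_iff_imp]
  intro h
  have h1 := (Complex.abs_re_le_norm (zq q)).trans h
  have h2 := (Complex.abs_im_le_norm (zq q)).trans h
  rw [zq_re, abs_mul] at h1
  rw [zq_im, abs_mul] at h2
  norm_num at h1 h2
  have a1 : |(q.1 : ℝ)| ≤ ⌈R⌉ := by linarith [abs_nonneg (q.1 : ℝ), Int.le_ceil R]
  have a2 : |(q.2 : ℝ)| ≤ ⌈R⌉ := by linarith [abs_nonneg (q.2 : ℝ), Int.le_ceil R]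
  rw [abs_le] at a1 a2
  exact_mod_cast And.intro a1 a2

theorem card_latt_le {R : ℝ} (hR : 1 ≤ R) : ((latt R).card : ℝ) ≤ 25 * R ^ 2 := by
  have h1 : (latt R).card ≤ (2 * ⌈R⌉ + 1).toNat * (2 * ⌈R⌉ + 1).toNat := by
    refine (Finset.card_filter_le _ _).trans ?_
    rw [Finset.card_product, Int.card_Icc]
    refine le_of_eq ?_
    congr 2 <;> ring
  have h0 : (0 : ℤ) ≤ ⌈R⌉ := Int.ceil_nonneg (by linarith)
  have h2 : ((2 * ⌈R⌉ + 1).toNat : ℝ) = 2 * ⌈R⌉ + 1 := by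
    have := Int.toNat_of_nonneg (show 0 ≤ 2 * ⌈R⌉ + 1 by omega)
    exact_mod_cast this
  have h3 : ((latt R).card : ℝ) ≤ (2 * ⌈R⌉ + 1) * (2 * ⌈R⌉ + 1) := by
    rw [← h2]; exact_mod_cast h1
  have h4 := (Int.ceil_lt_add_one R).le
  have h5 : (0 : ℝ) ≤ ⌈R⌉ := by exact_mod_cast h0
  nlinarith

theorem exists_mem_cell (z : ℂ) : ∃ Q, z ∈ cell Q := ⟨(⌊z.re / 1000⌋, ⌊z.im / 1000⌋), rfl, rfl⟩

theorem nearN_nonneg {D : ℤ × ℤ → ℂ → ℝ} (h : ∀ q z, 0 ≤ D q z) (I : Finset (ℤ × ℤ)) (z : ℂ) :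
    0 ≤ nearN D I z :=
  Finset.sum_nonneg fun q _ => by split_ifs <;> simp [h]

theorem exists_nearN_le : ∃ C > 0, ∀ (D : ℤ × ℤ → ℂ → ℝ) (I : Finset (ℤ × ℤ)) (z : ℂ) (M : ℝ),
    0 ≤ M → (∀ q, D q z ≤ M) → nearN D I z ≤ C * M := by
  obtain ⟨C, hC, H⟩ := exists_lattice_cube
  refine ⟨8001 ^ 3 * C, by positivity, fun D I z M hM h => ?_⟩
  have := mul_le_mul_of_nonneg_left (H I z) (by positivity : 0 ≤ 8001 ^ 3 * M)
  refine le_trans ?_ (this.trans (le_of_eq (by ring)))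
  rw [nearN, Finset.mul_sum]
  refine Finset.sum_le_sum fun q _ => ?_
  split_ifs with hz
  · refine (h q).trans ?_
    rw [mul_one_div, le_div_iff₀ (by positivity), mul_comm]
    gcongr
    linarith
  · positivity

theorem dist_zq_hole {q q' : ℤ × ℤ} (h : q ≠ q') {z : ℂ} (hz : ‖z - zq q‖ ≤ 1) :
    999 ≤ ‖z - zq q'‖ := by
  have h1 := dist_zq h
  have h2 := norm_sub_le_norm_sub_add_norm_sub (zq q) z (zq q')
  rw [norm_sub_rev (zq q) z] at h2
  linarith

theorem gs_div {φ v : ℂ → ℝ} (hφ : ContDiff ℝ ∞ φ) (hv : ContDiff ℝ ∞ v)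
    (hφ2 : ∀ z, 1 / 2 ≤ φ z) :
    ContDiff ℝ ∞ (fun z => v z / φ z) ∧
      ∀ z, gs (fun z => v z / φ z) z ≤ 16 * ‖wr φ v z‖ ^ 2 := by
  have hpos : ∀ z, 0 < φ z := fun z => by linarith [hφ2 z]
  have hf : ContDiff ℝ ∞ (fun z => v z / φ z) := hv.div hφ fun z => (hpos z).ne'
  refine ⟨hf, fun z => ?_⟩
  have e : v = fun z => φ z * (v z / φ z) := by
    funext z; field_simp [(hpos z).ne']
  have hX : dX v z = φ z * dX (fun z => v z / φ z) z + dX φ z * (v z / φ z) := by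
    conv_lhs => rw [e, dX_mul hφ.diffl hf.diffl]
  have hY : dY v z = φ z * dY (fun z => v z / φ z) z + dY φ z * (v z / φ z) := by
    conv_lhs => rw [e, dY_mul hφ.diffl hf.diffl]
  rw [norm_wr_sq, hX, hY, gs]
  set a := dX (fun z => v z / φ z) z
  set b := dY (fun z => v z / φ z) z
  have e1 : φ z * (φ z * a + dX φ z * (v z / φ z)) - v z * dX φ z = φ z ^ 2 * a := by
    field_simp [(hpos z).ne']; ring
  have e2 : φ z * (φ z * b + dY φ z * (v z / φ z)) - v z * dY φ z = φ z ^ 2 * b := by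
    field_simp [(hpos z).ne']; ring
  rw [e1, e2]
  have : (1 / 2 : ℝ) ^ 4 ≤ φ z ^ 4 := pow_le_pow_left₀ (by norm_num) (hφ2 z) 4
  nlinarith [sq_nonneg a, sq_nonneg b]

/-- Data attached to an approximate solution `v`: a quotient `f` of `v` by a positive function,
its rescaled conjugate gradient `W`, which satisfies a perturbed Beltrami equation with a
potential `s` of controlled growth. -/
structure Quasi (K : ℝ) (n : ℕ) (N : ℝ) (v f : ℂ → ℝ) (W s : ℂ → ℂ) (E : ℂ → ℝ) : Prop where
  smooth_f : ContDiff ℝ ∞ f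
  f_le : ∀ z, |f z| ≤ 2 * |v z|
  le_f : ∀ z, |v z| ≤ 2 * |f z|
  gs_le : ∀ z, gs f z ≤ 16 * ‖W z‖ ^ 2
  smooth_W : ContDiff ℝ ∞ W
  supp_W : ∀ z, N < ‖z‖ → W z = 0
  hole_le : ∀ q, Hole n v q → ∀ z ∈ closedBall (zq q) 1, ‖W z‖ ^ 2 ≤ K * v (zq q) ^ 2
  smooth_s : ContDiff ℝ ∞ s
  osc_s : ∀ z z', ‖z - z'‖ ≤ 3000 → ‖s z - s z'‖ ≤ K
  cont_E : Continuous E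
  E_nonneg : ∀ z, 0 ≤ E z
  int_E : ∫ z in closedBall 0 N, E z ≤ K * N ^ 6 * (1 / n : ℝ) ^ (1 / 4 : ℝ)
  dzb_le : ∀ z, ∀ H : Finset (ℤ × ℤ), (∀ q, Hole n v q → q ∈ H) → (∀ q ∈ H, Hole n v q) →
    ‖dzb W z - dzb s z * W z‖ ^ 2 ≤
      K * ∑ q ∈ H, (if ‖z - zq q‖ ≤ 1 then v (zq q) ^ 2 else 0) + E z

theorem norm_wr_sq_le {φ v : ℂ → ℝ} {z : ℂ} {m P g : ℝ} (hφ0 : 0 ≤ φ z) (hφ : φ z ≤ 3 / 2)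
    (hv : |v z| ≤ P * m) (hX : |dX v z| ≤ P * m) (hY : |dY v z| ≤ P * m)
    (hφX : |dX φ z| ≤ g) (hφY : |dY φ z| ≤ g) (hm : 0 ≤ m) (hP : 0 ≤ P) :
    ‖wr φ v z‖ ^ 2 ≤ 2 * (P * (3 / 2 + g)) ^ 2 * m ^ 2 := by
  have hg : 0 ≤ g := (abs_nonneg _).trans hφX
  have key : ∀ x y : ℝ, |x| ≤ P * m → |y| ≤ g → (φ z * x - v z * y) ^ 2 ≤
      (P * (3 / 2 + g)) ^ 2 * m ^ 2 := by
    intro x y hx hy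
    have h1 : |φ z * x - v z * y| ≤ P * (3 / 2 + g) * m := by
      refine (abs_sub _ _).trans ?_
      rw [abs_mul, abs_mul, abs_of_nonneg hφ0]
      have a1 : φ z * |x| ≤ 3 / 2 * (P * m) := by gcongr
      have a2 : |v z| * |y| ≤ P * m * g := by gcongr
      linarith
    rw [← sq_abs, ← mul_pow]
    gcongr
  rw [norm_wr_sq]
  linarith [key _ _ hX hφX, key _ _ hY hφY]

theorem sq_sum_le_of_unique {ι : Type*} {s : Finset ι} {p : ι → Prop} [DecidablePred p]
    (hp : ∀ i ∈ s, ∀ j ∈ s, p i → p j → i = j) (f : ι → ℝ) :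
    (∑ i ∈ s, if p i then f i else 0) ^ 2 ≤ ∑ i ∈ s, if p i then f i ^ 2 else 0 := by
  by_cases h : ∃ i ∈ s, p i
  · obtain ⟨i, hi, hpi⟩ := h
    rw [Finset.sum_eq_single_of_mem i hi, Finset.sum_eq_single_of_mem i hi, if_pos hpi, if_pos hpi]
    · exact fun j hj hji => if_neg fun hpj => hji (hp j hj i hi hpj hpi)
    · exact fun j hj hji => if_neg fun hpj => hji (hp j hj i hi hpj hpi)
  · push Not at h
    rw [Finset.sum_eq_zero fun i hi => if_neg (h i hi), Finset.sum_eq_zero fun i hi => if_neg (h i hi)]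
    norm_num

set_option maxHeartbeats 1000000 in
theorem exists_quasi : ∃ K > 0, ∃ c > 0, ∀ {l : ℝ} {n : ℕ} {N : ℝ} {V v : ℂ → ℝ},
    ApproxSol l n N V v → 2500 ≤ N → l * (1 + Real.log (3 * N)) ≤ c →
    ∃ (f : ℂ → ℝ) (W s : ℂ → ℂ) (E : ℂ → ℝ), Quasi K n N v f W s E := by
  classical
  obtain ⟨Cs, hCs, Hs⟩ := exists_sites
  obtain ⟨C, hC, c, hc, Hm⟩ := exists_multiplier Cs
  obtain ⟨Cn, hCn, Hn⟩ := exists_nearN_le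
  set K₁ := 12 * 10 ^ 10 * Cs * (8 * C * c) with hK₁
  set K₂ := 2 * (3 * 10 ^ 7 * (3 / 2 + C * (1 + Cn * Cs))) ^ 2 with hK₂
  set K₃ := 3 * (225 * 225 * (C ^ 2 * Cs)) + 108 with hK₃
  set K₄ := 3 * (C * (Cs * 10 ^ 7)) ^ 2 with hK₄
  have p1 : 0 < K₁ := by positivity
  have p2 : 0 < K₂ := by positivity
  have p3 : 0 < K₃ := by positivity
  have p4 : 0 < K₄ := by positivity
  refine ⟨K₁ + K₂ + K₃ + K₄, by positivity, c, hc, fun {l n N V v} h hN hlc => ?_⟩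
  obtain ⟨L, D, b, hs, hD, hLb, hL0, hLz⟩ := Hs h
  have hl := h.l_pos
  have hl1 : l ≤ 1 := by linarith [h.l_le]
  have hδ := h.one_div_pos
  have hδ1 := h.one_div_le
  have hR : (1 : ℝ) ≤ 3 * N := by linarith
  set I := latt (3 * N)
  have hI : ∀ q ∈ I, ‖zq q‖ ≤ 3 * N := fun q hq => mem_latt.1 hq
  have cV : HasCompactSupport V := by
    refine HasCompactSupport.intro (isCompact_closedBall (0 : ℂ) (2 * N)) fun z hz => h.suppV z ?_
    simpa using hz
  have cv' : HasCompactSupport v := by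
    refine HasCompactSupport.intro (isCompact_closedBall (0 : ℂ) N) fun z hz => h.supp z ?_
    simpa using hz
  have htv : tsupport v ⊆ closedBall 0 N := by
    refine closure_minimal (fun z hz => ?_) isClosed_closedBall
    by_contra hc
    exact hz (h.supp z (by simpa using hc))
  obtain ⟨φ, a, hφ, hφb, hφg, ha, hφe⟩ := Hm b L D (latt (2 * N + 1500)) I l (3 * N) V hl hR hlc hs
    (fun Q hQ => by linarith [mem_latt.1 hQ])
    (fun Q hQ j => mem_latt.2 (by
      have h1 := norm_zq_vtx_le Q j
      have h2 := norm_le_norm_add_norm_sub' (zq (Q + vtx j)) (zq Q)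
      have h3 := mem_latt.1 hQ
      linarith)) h.smoothV cV h.absV
    (fun z hz => by
      obtain ⟨Q, hQ⟩ := exists_mem_cell z
      refine ⟨Q, mem_latt.2 ?_, hQ⟩
      have h1 := norm_sub_cell_le hQ
      have h2 := norm_le_norm_add_norm_sub z (zq Q)
      have h3 : ‖z‖ ≤ 2 * N := by
        by_contra hc; exact hz (h.suppV z (not_le.1 hc))
      linarith) (1 / n) hδ
  obtain ⟨G₀, hG₀, hG⟩ := nearN_bound hs I
  have hD0 : ∀ q z, 0 ≤ D q z := fun q z => by linarith [(hs q).one_le z]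
  have hnn : ∀ z, 0 ≤ nearN D I z := nearN_nonneg hD0 I
  obtain ⟨α, δ', hδ', hα, cα, hαb, hα0, s, hsd, hsm, hse⟩ := exists_similarity hφ h.smooth cv'
    (fun z => (hφb z).1) hφg (G₀ := C * l * (1 + G₀)) (fun z => by gcongr; exact hG z) hδ
  have hαB : ∀ z, ‖α z‖ ≤ 8 * C * l * nearN D I z := by
    intro z
    by_cases hz : z ∈ tsupport v
    · have h1 : 1 ≤ nearN D I z := by
        obtain ⟨Q, hQ⟩ := exists_mem_cell z
        have hQ1 := norm_sub_cell_le hQ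
        have hQI : Q ∈ I := mem_latt.2 (by
          have h2 := norm_le_norm_add_norm_sub z (zq Q)
          have h3 : ‖z‖ ≤ N := by simpa using htv hz
          linarith)
        have := Finset.single_le_sum (f := fun q => if ‖z - zq q‖ ≤ 8000 then D q z else 0)
          (fun q _ => by split_ifs <;> simp [hD0]) hQI
        rw [if_pos (by linarith)] at this
        exact ((hs Q).one_le z).trans this
      refine (hαb z).trans ?_
      have : 0 < C * l := by positivity
      nlinarith
    · rw [hα0 z hz, norm_zero]
      have := hnn z
      positivity
  have hosc : ∀ z z', ‖z - z'‖ ≤ 3000 → ‖s z - s z'‖ ≤ K₁ := by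
    intro z z' hz
    have h1 := cv_kk_osc hs hR hI hδ' (by positivity : 0 ≤ 8 * C * l) hα cα hαB hz
    have h2 : 12 * 10 ^ 10 * Cs * (8 * C * l) * (1 + Real.log (3 * N)) ≤ K₁ := by
      calc _ = 12 * 10 ^ 10 * Cs * (8 * C) * (l * (1 + Real.log (3 * N))) := by ring
        _ ≤ 12 * 10 ^ 10 * Cs * (8 * C) * c := by gcongr
        _ = _ := by rw [hK₁]; ring
    rw [hsd]
    simp only
    rw [← mul_sub, norm_mul, Complex.norm_real, Real.norm_eq_abs, abs_of_pos (by positivity)]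
    have h3 : 1 / Real.pi ≤ 1 := by
      rw [div_le_one Real.pi_pos]; linarith [Real.pi_gt_three]
    calc _ ≤ 1 * ‖cv α (kk δ') z - cv α (kk δ') z'‖ := by gcongr
      _ ≤ _ := by linarith
  obtain ⟨hf, hgs⟩ := gs_div hφ h.smooth fun z => (hφb z).1
  set Z := I.filter fun q => ¬ Hole n v q
  set E : ℂ → ℝ := fun z => 3 * (I.card * ∑ q ∈ Z, C ^ 2 * (v z * lapl (L q) z) ^ 2 +
    9 * (1 / n : ℝ) ^ 2) with hE
  have hLc : ∀ q, Continuous (lapl (L q)) := fun q => (contDiff_lapl (hs q).smooth).continuous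
  have hvc := h.smooth.continuous
  refine ⟨fun z => v z / φ z, wr φ v, s, E, hf, fun z => ?_, fun z => ?_, hgs, contDiff_wr hφ h.smooth,
    fun z hz => wr_eq_zero fun hc => ?_, fun q hq z hz => ?_, hsm, fun z z' hz => ?_, ?_, fun z => ?_,
    ?_, fun z H hH hH' => ?_⟩
  · have := (hφb z).1
    rw [abs_div, abs_of_pos (a := φ z) (by linarith), div_le_iff₀ (by linarith)]
    nlinarith [abs_nonneg (v z)]
  · have h1 := (hφb z).1
    have h2 := (hφb z).2
    rw [abs_div, abs_of_pos (a := φ z) (by linarith), mul_div_assoc', le_div_iff₀ (by linarith)]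
    nlinarith [abs_nonneg (v z)]
  · have := htv hc
    rw [mem_closedBall_zero_iff] at this
    linarith
  · have hz1 : ‖z - zq q‖ ≤ 1 := by rwa [mem_closedBall, dist_eq_norm] at hz
    have h12 : z ∈ closedBall (zq q) 12 := closedBall_subset_closedBall (by norm_num) hz
    have h2 : z ∈ closedBall (zq q) 2 := closedBall_subset_closedBall (by norm_num) hz
    have hn1 : nearN D I z ≤ Cn * Cs := by
      refine Hn D I z Cs hCs.le fun q' => ?_
      by_cases he : q = q'
      · exact hD q' z (.inl (he ▸ hq))
      · exact hD q' z (.inr (by linarith [dist_zq_hole he hz1]))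
    have hg : C * l * (1 + nearN D I z) ≤ C * (1 + Cn * Cs) := by
      have := hnn z
      calc _ ≤ C * 1 * (1 + Cn * Cs) := by gcongr
        _ = _ := by ring
    have hv1 := h.harnack hq h12 (mem_closedBall_self (by norm_num))
    obtain ⟨g1, g2⟩ := h.abs_grad_le_of_hole hq h2
    have := norm_wr_sq_le (by linarith [(hφb z).1]) (hφb z).2 (m := |v (zq q)|) (P := 3 * 10 ^ 7)
      (hv1.trans (by linarith [abs_nonneg (v (zq q))])) g1 g2 ((hφg z).1.trans hg)
      ((hφg z).2.trans hg) (abs_nonneg _) (by norm_num)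
    rw [sq_abs] at this
    refine this.trans (mul_le_mul_of_nonneg_right ?_ (sq_nonneg _))
    linarith
  · exact (hosc z z' hz).trans (by linarith)
  · exact continuous_const.mul ((continuous_const.mul (continuous_finsetSum _ fun q _ =>
      continuous_const.mul ((hvc.mul (hLc q)).pow 2))).add continuous_const)
  · positivity
  · have hInt : ∀ q, IntegrableOn (fun z => (v z * lapl (L q) z) ^ 2) (closedBall 0 N) := fun q =>
      ((hvc.mul (hLc q)).pow 2).continuousOn.integrableOn_compact (isCompact_closedBall _ _)
    have hInt1 : IntegrableOn (fun _ : ℂ => 9 * (1 / n : ℝ) ^ 2) (closedBall 0 N) :=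
      integrableOn_const measure_closedBall_lt_top.ne
    have hInt2 : IntegrableOn (fun z => I.card * ∑ q ∈ Z, C ^ 2 * (v z * lapl (L q) z) ^ 2)
        (closedBall 0 N) :=
      (integrable_finsetSum _ fun q _ => (hInt q).const_mul _).const_mul _
    have e1 : ∫ z in closedBall 0 N, E z = 3 * (I.card * ∑ q ∈ Z, C ^ 2 *
        (∫ z in closedBall 0 N, (v z * lapl (L q) z) ^ 2) +
        Real.pi * N ^ 2 * (9 * (1 / n : ℝ) ^ 2)) := by
      rw [hE, integral_const_mul, integral_add hInt2 hInt1, integral_const_mul,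
        integral_finsetSum _ fun q _ => (hInt q).const_mul _, setIntegral_const,
        volume_real_closedBall _ (by linarith)]
      simp only [integral_const_mul, smul_eq_mul]
    have hcI : (I.card : ℝ) ≤ 225 * N ^ 2 := (card_latt_le hR).trans (le_of_eq (by ring))
    have hcZ : (Z.card : ℝ) ≤ 225 * N ^ 2 := le_trans (by exact_mod_cast Finset.card_filter_le _ _) hcI
    set ε := (1 / n : ℝ) ^ (1 / 4 : ℝ) with hε
    have hε0 : 0 < ε := by positivity
    have hεδ : (1 / n : ℝ) ^ 2 ≤ ε := by
      rw [← Real.rpow_natCast]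
      exact Real.rpow_le_rpow_of_exponent_ge hδ hδ1 (by norm_num)
    have e2 : ∑ q ∈ Z, C ^ 2 * (∫ z in closedBall 0 N, (v z * lapl (L q) z) ^ 2) ≤
        225 * N ^ 2 * (C ^ 2 * (Cs * N ^ 2 * ε)) := by
      calc _ ≤ ∑ q ∈ Z, C ^ 2 * (Cs * N ^ 2 * ε) := Finset.sum_le_sum fun q hq => by
            gcongr; exact hLz q (Finset.mem_filter.1 hq).2
        _ = Z.card * (C ^ 2 * (Cs * N ^ 2 * ε)) := by rw [Finset.sum_const, nsmul_eq_mul]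
        _ ≤ _ := by gcongr
    have hN6 : N ^ 2 ≤ N ^ 6 := pow_le_pow_right₀ (by linarith) (by norm_num)
    rw [e1]
    calc _ ≤ 3 * (225 * N ^ 2 * (225 * N ^ 2 * (C ^ 2 * (Cs * N ^ 2 * ε))) +
          4 * N ^ 2 * (9 * ε)) := by
          have hsum : 0 ≤ ∑ q ∈ Z, C ^ 2 * (∫ z in closedBall 0 N, (v z * lapl (L q) z) ^ 2) :=
            Finset.sum_nonneg fun q _ => mul_nonneg (sq_nonneg _)
              (integral_nonneg fun z => sq_nonneg _)
          have t1 := mul_le_mul hcI e2 hsum (by positivity)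
          have t2 : Real.pi * N ^ 2 * (9 * (1 / n : ℝ) ^ 2) ≤ 4 * N ^ 2 * (9 * ε) := by
            gcongr; exact Real.pi_le_four
          linarith
      _ ≤ 3 * (225 * N ^ 2 * (225 * N ^ 2 * (C ^ 2 * (Cs * N ^ 2 * ε))) +
          4 * N ^ 6 * (9 * ε)) := by gcongr
      _ = K₃ * N ^ 6 * ε := by rw [hK₃]; ring
      _ ≤ _ := by gcongr; linarith
  · have hHI : I.filter (Hole n v) = H := by
      ext q
      rw [Finset.mem_filter]
      exact ⟨fun hq => hH q hq.2, fun hq => ⟨mem_latt.2 (by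
        linarith [h.norm_le_of_hole (hH' q hq)]), hH' q hq⟩⟩
    set S := ∑ q ∈ I, a q * lapl (L q) z with hS
    set S₁ := ∑ q ∈ H, if ‖z - zq q‖ ≤ 1 then C * (Cs * 10 ^ 7) * |v (zq q)| else 0 with hS₁
    set S₂ := ∑ q ∈ Z, C * |v z * lapl (L q) z| with hS₂
    have haC : ∀ q, |a q| ≤ C := fun q => (ha q).trans (by nlinarith)
    have hvS : |v z * S| ≤ S₁ + S₂ := by
      rw [hS, Finset.mul_sum, ← Finset.sum_filter_add_sum_filter_not I (Hole n v), hHI]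
      refine (abs_add_le _ _).trans (add_le_add ?_ ?_)
      · refine (Finset.abs_sum_le_sum_abs _ _).trans (Finset.sum_le_sum fun q hq => ?_)
        have hq := hH' q hq
        split_ifs with hz
        · have hv1 := h.harnack hq (x := z) (closedBall_subset_closedBall (by norm_num)
            (by rwa [mem_closedBall, dist_eq_norm] : z ∈ closedBall (zq q) 1))
            (mem_closedBall_self (by norm_num))
          rw [abs_mul, abs_mul]
          calc _ ≤ 10 ^ 7 * |v (zq q)| * (C * Cs) := by
                gcongr
                · exact haC q
                · exact hLb q z hq
            _ = _ := by ring
        · rw [hL0 q z hq (not_le.1 hz)]; simp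
      · refine (Finset.abs_sum_le_sum_abs _ _).trans (Finset.sum_le_sum fun q _ => ?_)
        rw [show v z * (a q * lapl (L q) z) = a q * (v z * lapl (L q) z) by ring, abs_mul]
        gcongr
        exact haC q
    have hA : ‖dzb (wr φ v) z - dzb s z * wr φ v z‖ ≤ S₁ + S₂ + 3 * (1 / n : ℝ) := by
      set A := 1 / 2 * (φ z * lapl v z - v z * lapl φ z) with hA
      have eA : A = 1 / 2 * (φ z * (lapl v z + V z * v z) -
          v z * (lapl φ z + V z * φ z - S) - v z * S) := by rw [hA]; ring
      have t1 : |φ z * (lapl v z + V z * v z)| ≤ 3 / 2 * (1 / n : ℝ) := by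
        have := (hφb z).1
        rw [abs_mul, abs_of_pos (a := φ z) (by linarith)]
        have h1 : |lapl v z + V z * v z| ≤ 1 / n := (h.err z).trans (by nlinarith)
        have h2 := (hφb z).2
        gcongr
      have t2 : |v z * (lapl φ z + V z * φ z - S)| ≤ 1 * (1 / n : ℝ) := by
        rw [abs_mul]
        have h1 := h.abs_le_one z
        have h2 := hφe z
        gcongr
      have hAb : |A| ≤ S₁ + S₂ + 2 * (1 / n : ℝ) := by
        rw [eA, abs_mul, abs_of_pos (a := (1 / 2 : ℝ)) (by norm_num)]
        have t3 := abs_sub (φ z * (lapl v z + V z * v z) -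
          v z * (lapl φ z + V z * φ z - S)) (v z * S)
        have t4 := abs_sub (φ z * (lapl v z + V z * v z)) (v z * (lapl φ z + V z * φ z - S))
        have t5 := abs_nonneg (v z * S)
        linarith
      have e : dzb (wr φ v) z - dzb s z * wr φ v z =
          (dzb (wr φ v) z - (A : ℂ) - dzb s z * wr φ v z) + (A : ℂ) := by ring
      rw [e]
      refine (norm_add_le _ _).trans ?_
      rw [Complex.norm_real, Real.norm_eq_abs]
      linarith [hse z]
    have hS1 : S₁ ^ 2 ≤ (C * (Cs * 10 ^ 7)) ^ 2 *
        ∑ q ∈ H, (if ‖z - zq q‖ ≤ 1 then v (zq q) ^ 2 else 0) := by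
      refine (sq_sum_le_of_unique (fun i _ j _ hi hj => ?_) _).trans (le_of_eq ?_)
      · by_contra hij
        linarith [dist_zq_hole hij hi]
      · rw [Finset.mul_sum]
        refine Finset.sum_congr rfl fun q _ => ?_
        split_ifs
        · rw [mul_pow, sq_abs]
        · simp
    have hS2 : S₂ ^ 2 ≤ I.card * ∑ q ∈ Z, C ^ 2 * (v z * lapl (L q) z) ^ 2 := by
      refine sq_sum_le_card_mul_sum_sq.trans ?_
      simp only [mul_pow, sq_abs]
      refine mul_le_mul_of_nonneg_right ?_ (by positivity)
      exact_mod_cast Finset.card_filter_le _ _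
    have hS10 : 0 ≤ S₁ := Finset.sum_nonneg fun q _ => by split_ifs <;> positivity
    have hS20 : 0 ≤ S₂ := Finset.sum_nonneg fun q _ => by positivity
    have hH0 : 0 ≤ ∑ q ∈ H, (if ‖z - zq q‖ ≤ 1 then v (zq q) ^ 2 else 0) :=
      Finset.sum_nonneg fun q _ => by split_ifs <;> positivity
    calc _ ≤ (S₁ + S₂ + 3 * (1 / n : ℝ)) ^ 2 := by gcongr
      _ ≤ 3 * (S₁ ^ 2 + S₂ ^ 2 + 9 * (1 / n : ℝ) ^ 2) := by
        nlinarith [sq_nonneg (S₁ - S₂), sq_nonneg (S₁ - 3 * (1 / n : ℝ)),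
          sq_nonneg (S₂ - 3 * (1 / n : ℝ))]
      _ ≤ K₄ * ∑ q ∈ H, (if ‖z - zq q‖ ≤ 1 then v (zq q) ^ 2 else 0) + E z := by
        rw [hK₄, hE]; simp only; linarith
      _ ≤ _ := by gcongr; linarith

/-- The part of the disc of radius `3000` about a lattice point lying strictly to its right. -/
def rightHalf (q : ℤ × ℤ) : Set ℂ := closedBall (zq q) 3000 ∩ {z | (zq q).re + 9 ≤ z.re}

/-- The lattice point to the right of `q`. -/
def nxt (q : ℤ × ℤ) : ℤ × ℤ := (q.1 + 1, q.2)

theorem zq_nxt (q : ℤ × ℤ) : zq (nxt q) = zq q + 1000 := by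
  apply Complex.ext
  · simp [nxt]; ring
  · simp [nxt]

theorem isCompact_rightHalf (q : ℤ × ℤ) : IsCompact (rightHalf q) :=
  (isCompact_closedBall _ _).inter_right (isClosed_le continuous_const Complex.continuous_re)

theorem mem_rightHalf {q : ℤ × ℤ} {z : ℂ} (h1 : ‖z - zq q‖ ≤ 3000) (h2 : 9 ≤ (z - zq q).re) :
    z ∈ rightHalf q := by
  refine ⟨by rwa [mem_closedBall, dist_eq_norm], ?_⟩
  rw [Complex.sub_re] at h2
  change (zq q).re + 9 ≤ z.re
  linarith

theorem sq_le_sq_of_abs {a b c : ℝ} (h : |a| ≤ c * |b|) : a ^ 2 ≤ c ^ 2 * b ^ 2 := by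
  rw [← sq_abs a, ← sq_abs b, ← mul_pow]
  exact pow_le_pow_left₀ (abs_nonneg _) h 2

/-- The value of `v` at a hole is controlled by the energy to the right of the hole, up to the value
at the next hole. -/
theorem Quasi.chain {K l N : ℝ} {n : ℕ} {V v f : ℂ → ℝ} {W s : ℂ → ℂ} {E : ℂ → ℝ}
    (Q : Quasi K n N v f W s E) (h : ApproxSol l n N V v) {q : ℤ × ℤ} (hq : Hole n v q)
    {m : ℝ} (hm0 : 0 ≤ m) (hm : Hole n v (nxt q) → v (zq (nxt q)) ^ 2 ≤ m) :
    v (zq q) ^ 2 ≤ 10 ^ 30 * ((∫ z in rightHalf q, ‖W z‖ ^ 2) + m + (1 / n : ℝ) ^ 2) := by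
  have hδ := h.one_div_pos
  have hgc := continuous_gs Q.smooth_f
  have hT := (isCompact_rightHalf q).measurableSet
  have hi : IntegrableOn (gs f) (rightHalf q) :=
    hgc.continuousOn.integrableOn_compact (isCompact_rightHalf q)
  have hWi : IntegrableOn (fun z => ‖W z‖ ^ 2) (rightHalf q) :=
    (Q.smooth_W.continuous.norm.pow 2).continuousOn.integrableOn_compact (isCompact_rightHalf q)
  have hgW : ∫ z in rightHalf q, gs f z ≤ 16 * ∫ z in rightHalf q, ‖W z‖ ^ 2 := by
    rw [← integral_const_mul]
    exact integral_mono hi (hWi.const_mul _) Q.gs_le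
  have hW0 : 0 ≤ ∫ z in rightHalf q, ‖W z‖ ^ 2 := integral_nonneg fun z => sq_nonneg _
  set S := ∫ z in rightHalf q, ‖W z‖ ^ 2
  set c := zq q + 10 with hc
  have hball : ∀ a ∈ closedBall c (2 / 5), ‖a - zq q‖ ≤ 11 ∧ 9 ≤ (a - zq q).re := by
    intro a ha
    rw [mem_closedBall, dist_eq_norm] at ha
    have e : a - zq q = (a - c) + 10 := by rw [hc]; ring
    constructor
    · rw [e]
      refine (norm_add_le _ _).trans ?_
      norm_num
      linarith
    · have := (abs_le.1 ((Complex.abs_re_le_norm (a - c)).trans ha)).1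
      rw [e, Complex.add_re]
      norm_num at this ⊢
      linarith
  have hlow : ∀ a ∈ closedBall c (2 / 5), v (zq q) ^ 2 / (4 * 10 ^ 14) ≤ f a ^ 2 := by
    intro a ha
    have ha1 := (hball a ha).1
    have h1 := h.harnack hq (x := zq q) (y := a) (mem_closedBall_self (by norm_num))
      (by rw [mem_closedBall, dist_eq_norm]; linarith)
    have h2 := sq_le_sq_of_abs (a := v (zq q)) (b := f a) (c := 2 * 10 ^ 7)
      (by linarith [Q.le_f a])
    rw [div_le_iff₀ (by positivity)]
    linarith
  have hfi : ∀ B : Set ℂ, IsCompact B → IntegrableOn (fun z => f z ^ 2) B := fun B hB =>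
    (Q.smooth_f.continuous.pow 2).continuousOn.integrableOn_compact hB
  have hseg : ∀ τ : ℂ, ‖τ‖ ≤ 2000 → 0 ≤ τ.re → ∀ a ∈ closedBall c (2 / 5), ∀ t ∈ Icc (0 : ℝ) 1,
      a + t * τ ∈ rightHalf q := by
    intro τ hτ hre a ha t ht
    obtain ⟨h1, h2⟩ := hball a ha
    have e : a + t * τ - zq q = (a - zq q) + t * τ := by ring
    refine mem_rightHalf ?_ ?_
    · rw [e]
      refine (norm_add_le _ _).trans ?_
      rw [norm_mul, Complex.norm_real, Real.norm_eq_abs, abs_of_nonneg ht.1]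
      have : t * ‖τ‖ ≤ 1 * 2000 := mul_le_mul ht.2 hτ (norm_nonneg _) (by norm_num)
      linarith
    · rw [e, Complex.add_re, Complex.re_ofReal_mul]
      have := mul_nonneg ht.1 hre
      linarith
  suffices hmain : ∃ τ : ℂ, ‖τ‖ ≤ 2000 ∧ 0 ≤ τ.re ∧
      ∫ z in closedBall (c + τ) (2 / 5), f z ^ 2 ≤ 10 ^ 4 * S + 4 * 10 ^ 14 * m + 400 * (1 / n : ℝ) ^ 2 by
    obtain ⟨τ, hτ, hre, hb⟩ := hmain
    have h1 := sq_le_translate Q.smooth_f hT hi (hseg τ hτ hre) hlow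
    have h2 : 4 * ‖τ‖ ^ 2 * ∫ z in rightHalf q, gs f z ≤ 4 * 2000 ^ 2 * (16 * S) := by
      have : 0 ≤ ∫ z in rightHalf q, gs f z := integral_nonneg fun z => gs_nonneg f z
      gcongr
    rw [div_le_iff₀ (by positivity)] at h1
    nlinarith [sq_nonneg (1 / n : ℝ)]
  by_cases hq' : Hole n v (nxt q)
  · have e : c + 990 = zq (nxt q) := by rw [hc, zq_nxt]; ring
    refine ⟨990, by norm_num, by norm_num, ?_⟩
    rw [e]
    have hb : ∀ z ∈ closedBall (zq (nxt q)) (2 / 5), f z ^ 2 ≤ 4 * 10 ^ 14 * m := by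
      intro z hz
      have h1 := h.harnack hq' (x := z) (closedBall_subset_closedBall (by norm_num) hz)
        (mem_closedBall_self (by norm_num))
      have h2 := sq_le_sq_of_abs (a := f z) (b := v (zq (nxt q))) (c := 2 * 10 ^ 7)
        (by linarith [Q.f_le z])
      linarith [hm hq']
    have h3 := setIntegral_mono_on (hfi _ (isCompact_closedBall _ _))
      (integrableOn_const measure_closedBall_lt_top.ne) measurableSet_closedBall hb
    rw [setIntegral_const, volume_real_closedBall _ (by norm_num), smul_eq_mul] at h3
    have h4 : Real.pi * (2 / 5) ^ 2 * (4 * 10 ^ 14 * m) ≤ 1 * (4 * 10 ^ 14 * m) := by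
      gcongr
      linarith [Real.pi_le_four]
    have : 0 ≤ (1 / n : ℝ) ^ 2 := sq_nonneg _
    linarith
  · obtain ⟨w, hw, hz⟩ := h.exists_zero hq'
    have e : c + (w + 3 / 2 - c) = w + 3 / 2 := by ring
    have e2 : w + 3 / 2 - c = (w - zq (nxt q)) + (1983 / 2 : ℝ) := by
      rw [hc, zq_nxt]; push_cast; ring
    refine ⟨w + 3 / 2 - c, ?_, ?_, ?_⟩
    · rw [e2]
      refine (norm_add_le _ _).trans ?_
      rw [Complex.norm_real]
      norm_num
      linarith
    · have := (abs_le.1 ((Complex.abs_re_le_norm (w - zq (nxt q))).trans hw)).1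
      rw [e2, Complex.add_re, Complex.ofReal_re]
      linarith
    · rw [e]
      set A : Set ℂ := {z | 1 < ‖z‖ ∧ ‖z‖ < 2}
      set g : ℂ → ℝ := fun z => f (z - (-w)) with hg
      have hgs' : ∀ z, gs g z = gs f (z - (-w)) := fun z => by
        simp only [gs, g, dX_comp_sub, dY_comp_sub]
      have hA : MeasurableSet A :=
        (measurableSet_lt measurable_const measurable_norm).inter
          (measurableSet_lt measurable_norm measurable_const)
      have hgsm : ContDiff ℝ ∞ g := contDiff_comp_sub Q.smooth_f (-w)
      have key := integral_sq_annulus_le (f := g) (ε := 2 * (1 / n : ℝ)) hgsm fun r hr => by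
        obtain ⟨p, hp, hp2⟩ := hz r (by linarith [hr.1]) hr.2
        refine ⟨p - w, hp, ?_⟩
        simp only [g, sub_neg_eq_add, sub_add_cancel]
        linarith [Q.f_le p]
      have tr : ∀ (φ : ℂ → ℝ) (B : Set ℂ), MeasurableSet B → ∫ z in B, φ (z - (-w)) =
          ∫ z in {z | z - w ∈ B}, φ z := by
        intro φ B hB
        have hB' : MeasurableSet {z | z - w ∈ B} := measurable_id.sub_const w hB
        rw [← integral_indicator hB, ← integral_indicator hB',
          ← integral_add_right_eq_self ({z | z - w ∈ B}.indicator φ) w]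
        refine integral_congr_ae (.of_forall fun z => ?_)
        have e : z + w ∈ {z | z - w ∈ B} ↔ z ∈ B := by
          rw [mem_ofPred_eq, add_sub_cancel_right]
        beta_reduce
        by_cases hz : z ∈ B
        · rw [indicator_of_mem hz, indicator_of_mem (e.2 hz), sub_neg_eq_add]
        · rw [indicator_of_notMem hz, indicator_of_notMem fun h => hz (e.1 h)]
      have hAT : {z | z - w ∈ A} ⊆ rightHalf q := by
        intro z hz
        have h1 : ‖z - w‖ ≤ 2 := hz.2.le
        have e3 : z - zq q = (z - w) + (w - zq (nxt q)) + (1000 : ℝ) := by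
          rw [zq_nxt]; push_cast; ring
        refine mem_rightHalf ?_ ?_
        · rw [e3]
          refine (norm_add₃_le).trans ?_
          rw [Complex.norm_real]
          norm_num
          linarith
        · have a1 := (abs_le.1 ((Complex.abs_re_le_norm (w - zq (nxt q))).trans hw)).1
          have a2 := (abs_le.1 ((Complex.abs_re_le_norm (z - w)).trans h1)).1
          rw [e3, Complex.add_re, Complex.add_re, Complex.ofReal_re]
          linarith
      simp only [hgs'] at key
      rw [tr (gs f) A hA, hg, tr (fun z => f z ^ 2) A hA] at key
      have k1 : ∫ z in {z | z - w ∈ A}, gs f z ≤ ∫ z in rightHalf q, gs f z :=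
        setIntegral_mono_set hi (.of_forall fun z => gs_nonneg f z) (.of_forall hAT)
      have k2 : ∫ z in closedBall (w + 3 / 2) (2 / 5), f z ^ 2 ≤ ∫ z in {z | z - w ∈ A}, f z ^ 2 := by
        refine setIntegral_mono_set ((hfi _ (isCompact_rightHalf q)).mono_set hAT)
          (.of_forall fun z => sq_nonneg _) (.of_forall fun z hz => ?_)
        have hz : ‖z - (w + 3 / 2)‖ ≤ 2 / 5 := by
          have : z ∈ closedBall (w + 3 / 2) (2 / 5) := hz
          rwa [mem_closedBall, dist_eq_norm] at this
        have n1 : ‖(3 / 2 : ℂ)‖ = 3 / 2 := by norm_num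
        have h1 := norm_add_le (z - (w + 3 / 2)) (3 / 2)
        have h2 := norm_sub_norm_le (3 / 2 : ℂ) (-(z - (w + 3 / 2)))
        rw [norm_neg, sub_neg_eq_add] at h2
        have e4 : (z - (w + 3 / 2)) + 3 / 2 = z - w := by ring
        have e5 : 3 / 2 + (z - (w + 3 / 2)) = z - w := by ring
        rw [e4] at h1
        rw [e5] at h2
        exact ⟨by linarith, by linarith⟩
      linarith

/-- A bump centred at `p` which is subharmonic away from `p`. -/
def bmp (p z : ℂ) : ℝ := ((1 + Complex.normSq (z - p)) ^ 2)⁻¹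

theorem contDiff_bmp (p : ℂ) : ContDiff ℝ ∞ (bmp p) :=
  ((contDiff_const.add (contDiff_normSq_sub p)).pow 2).inv fun z => by
    have := Complex.normSq_nonneg (z - p)
    positivity

theorem lapl_bmp (p : ℂ) : lapl (bmp p) = fun z =>
    8 * (2 * Complex.normSq (z - p) - 1) / (1 + Complex.normSq (z - p)) ^ 4 := by
  have h1 : ∀ s : ℝ, 0 ≤ s → HasDerivAt (fun s : ℝ => ((1 + s) ^ 2)⁻¹) (-2 * ((1 + s) ^ 3)⁻¹) s := by
    intro s hs
    have hs' : 1 + s ≠ 0 := by positivity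
    have := (((hasDerivAt_id s).const_add 1).fun_pow 2).fun_inv (by simpa using hs')
    refine this.congr_deriv ?_
    simp only [id]
    field_simp
    norm_num
    ring
  have h2 : ∀ s : ℝ, 0 ≤ s →
      HasDerivAt (fun s : ℝ => -2 * ((1 + s) ^ 3)⁻¹) (6 * ((1 + s) ^ 4)⁻¹) s := by
    intro s hs
    have hs' : 1 + s ≠ 0 := by positivity
    have := ((((hasDerivAt_id s).const_add 1).fun_pow 3).fun_inv (by simpa using hs')).const_mul (-2)
    refine this.congr_deriv ?_
    simp only [id]
    field_simp
    norm_num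
    ring
  have := lapl_radial p h1 h2
  change lapl (fun z => ((1 + Complex.normSq (z - p)) ^ 2)⁻¹) = _
  rw [this]
  funext z
  have hs := Complex.normSq_nonneg (z - p)
  have hs' : 1 + Complex.normSq (z - p) ≠ 0 := by positivity
  field_simp
  ring

theorem bmp_nonneg (p z : ℂ) : 0 ≤ bmp p z := by unfold bmp; positivity

theorem bmp_le (p z : ℂ) : bmp p z ≤ 4 * (1 / (1 + ‖z - p‖) ^ 3) := by
  unfold bmp
  rw [Complex.normSq_eq_norm_sq]
  set r := ‖z - p‖
  have hr : 0 ≤ r := norm_nonneg _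
  rw [mul_one_div, inv_eq_one_div, div_le_div_iff₀ (by positivity) (by positivity)]
  have h1 : (1 + r) ^ 2 ≤ 2 * (1 + r ^ 2) := by nlinarith [sq_nonneg (1 - r)]
  have h2 : (1 + r) ^ 4 ≤ (2 * (1 + r ^ 2)) ^ 2 := by
    calc (1 + r) ^ 4 = ((1 + r) ^ 2) ^ 2 := by ring
      _ ≤ _ := by gcongr
  have h3 : (1 + r) ^ 3 ≤ (1 + r) ^ 4 := pow_le_pow_right₀ (by linarith) (by norm_num)
  nlinarith

/-- Lower bound for the Laplacian of the bump at a lattice point. -/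
theorem lapl_bmp_ge (q : ℤ × ℤ) (z : ℂ) :
    (rightHalf q).indicator (fun _ => (1 / 10 ^ 26 : ℝ)) z -
      (closedBall (zq q) 1).indicator (fun _ => (8 : ℝ)) z ≤ lapl (bmp (zq q)) z := by
  rw [lapl_bmp]
  simp only
  rw [Complex.normSq_eq_norm_sq]
  set r := ‖z - zq q‖ with hr
  have hr0 : 0 ≤ r := norm_nonneg _
  have hden : 0 < (1 + r ^ 2) ^ 4 := by positivity
  by_cases hT : z ∈ rightHalf q
  · have h1 : r ≤ 3000 := by
      have := hT.1
      rwa [mem_closedBall, dist_eq_norm] at this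
    have h2 : 9 ≤ r := by
      have h := hT.2
      have h' : (zq q).re + 9 ≤ z.re := h
      have := Complex.re_le_norm (z - zq q)
      rw [Complex.sub_re] at this
      linarith
    have hB : z ∉ closedBall (zq q) 1 := by
      rw [mem_closedBall, dist_eq_norm]; linarith
    rw [indicator_of_mem hT, indicator_of_notMem hB, sub_zero, div_le_div_iff₀ (by positivity) hden]
    have h3 : (1 + r ^ 2) ^ 4 ≤ (1 + 3000 ^ 2) ^ 4 := by gcongr
    have h4 : 81 ≤ r ^ 2 := by nlinarith
    nlinarith
  · rw [indicator_of_notMem hT]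
    by_cases hB : z ∈ closedBall (zq q) 1
    · rw [indicator_of_mem hB, le_div_iff₀ hden]
      have h1 : 1 ≤ (1 + r ^ 2) ^ 4 := one_le_pow₀ (by nlinarith)
      nlinarith [sq_nonneg r]
    · rw [indicator_of_notMem hB]
      rw [mem_closedBall, dist_eq_norm] at hB
      have : 1 < r := not_le.1 hB
      have : 0 < 2 * r ^ 2 - 1 := by nlinarith
      rw [sub_zero]
      positivity

/-- The Carleman weight. -/
def wt (k N : ℝ) (H : Finset (ℤ × ℤ)) (z : ℂ) : ℝ :=
  k * z.re + ∑ q ∈ H, bmp (zq q) z + 1 / N ^ 2 * Complex.normSq (z - 0)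

theorem contDiff_wt (k N : ℝ) (H : Finset (ℤ × ℤ)) : ContDiff ℝ ∞ (wt k N H) :=
  ((contDiff_const.mul contDiff_re).add (ContDiff.sum fun q _ => contDiff_bmp (zq q))).add
    (contDiff_const.mul (contDiff_normSq_sub 0))

theorem lapl_wt (k N : ℝ) (H : Finset (ℤ × ℤ)) (z : ℂ) :
    lapl (wt k N H) z = ∑ q ∈ H, lapl (bmp (zq q)) z + 4 / N ^ 2 := by
  have h1 : ContDiff ℝ ∞ fun z : ℂ => k * z.re := contDiff_const.mul contDiff_re
  have h2 : ContDiff ℝ ∞ fun z : ℂ => ∑ q ∈ H, bmp (zq q) z :=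
    ContDiff.sum fun q _ => contDiff_bmp (zq q)
  have h3 : ContDiff ℝ ∞ fun z : ℂ => 1 / N ^ 2 * Complex.normSq (z - 0) :=
    contDiff_const.mul (contDiff_normSq_sub 0)
  have hre : lapl Complex.re = fun _ => 0 := by
    funext z; simp [lapl, dX_re, dY_re, dX_const, dY_const]
  have e : wt k N H = fun z => (k * z.re + ∑ q ∈ H, bmp (zq q) z) +
    1 / N ^ 2 * Complex.normSq (z - 0) := rfl
  rw [e, lapl_add (h1.add h2) h3, lapl_add h1 h2, lapl_const_mul _ contDiff_re, hre,
    lapl_sum fun q _ => contDiff_bmp (zq q), lapl_const_mul _ (contDiff_normSq_sub 0),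
    lapl_normSq_sub]
  ring

theorem le_wt (k N : ℝ) (H : Finset (ℤ × ℤ)) (z : ℂ) : k * z.re ≤ wt k N H z := by
  have h1 : 0 ≤ ∑ q ∈ H, bmp (zq q) z := Finset.sum_nonneg fun q _ => bmp_nonneg _ _
  have h2 := Complex.normSq_nonneg (z - 0)
  have h3 : 0 ≤ 1 / N ^ 2 * Complex.normSq (z - 0) := by positivity
  unfold wt
  linarith

theorem exists_wt_le : ∃ C > 0, ∀ (k N : ℝ) (H : Finset (ℤ × ℤ)) (z : ℂ), ‖z‖ ≤ N → 0 < N →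
    wt k N H z ≤ k * z.re + C := by
  obtain ⟨C, hC, h⟩ := exists_lattice_cube
  refine ⟨4 * C + 1, by positivity, fun k N H z hz hN => ?_⟩
  have h1 : ∑ q ∈ H, bmp (zq q) z ≤ 4 * C := by
    have := mul_le_mul_of_nonneg_left (h H z) (by norm_num : (0 : ℝ) ≤ 4)
    rw [Finset.mul_sum] at this
    exact (Finset.sum_le_sum fun q _ => bmp_le _ _).trans this
  have h2 : 1 / N ^ 2 * Complex.normSq (z - 0) ≤ 1 := by
    rw [sub_zero, Complex.normSq_eq_norm_sq, one_div, inv_mul_le_iff₀ (by positivity), mul_one]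
    gcongr
  unfold wt
  linarith

/-- Conjugating the `∂/∂z̄` equation by an exponential. -/
theorem dzb_exp_mul {s W : ℂ → ℂ} (hs : ContDiff ℝ ∞ s) (hW : ContDiff ℝ ∞ W) (c : ℂ) :
    ContDiff ℝ ∞ (fun z => Complex.exp (c - s z) * W z) ∧ ∀ z,
      dzb (fun z => Complex.exp (c - s z) * W z) z =
        Complex.exp (c - s z) * (dzb W z - dzb s z * W z) := by
  have hcs : ContDiff ℝ ∞ fun z => c - s z := contDiff_const.sub hs
  have he : ContDiff ℝ ∞ fun z => Complex.exp (c - s z) := hcs.cexp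
  refine ⟨he.mul hW, fun z => ?_⟩
  have hd : ∀ w : ℂ, fderiv ℝ (fun z => Complex.exp (c - s z)) z w =
      - (Complex.exp (c - s z) * fderiv ℝ s z w) := by
    intro w
    have h1 := (((hs.diffl z).hasFDerivAt).const_sub c).cexp
    rw [h1.fderiv]
    simp
  unfold dzb
  rw [dX_mul he.diffl hW.diffl, dY_mul he.diffl hW.diffl]
  have e1 : dX (fun z => Complex.exp (c - s z)) z = - (Complex.exp (c - s z) * dX s z) := hd _
  have e2 : dY (fun z => Complex.exp (c - s z)) z = - (Complex.exp (c - s z) * dY s z) := hd _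
  beta_reduce
  rw [e1, e2]
  ring

/-- The exponential weight attached to the linear part of `wt` and to `s`. -/
def wgt (s : ℂ → ℂ) (k : ℝ) (z : ℂ) : ℝ := Real.exp (2 * (k * z.re) - 2 * (s z - s 0).re)

/-- The full exponential weight. -/
def fullWgt (s : ℂ → ℂ) (k N : ℝ) (H : Finset (ℤ × ℤ)) (z : ℂ) : ℝ :=
  Real.exp (2 * wt k N H z - 2 * (s z - s 0).re)

theorem wgt_pos (s : ℂ → ℂ) (k : ℝ) (z : ℂ) : 0 < wgt s k z := Real.exp_pos _

theorem fullWgt_pos (s : ℂ → ℂ) (k N : ℝ) (H : Finset (ℤ × ℤ)) (z : ℂ) :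
    0 < fullWgt s k N H z := Real.exp_pos _

theorem wgt_le_fullWgt (s : ℂ → ℂ) (k N : ℝ) (H : Finset (ℤ × ℤ)) (z : ℂ) :
    wgt s k z ≤ fullWgt s k N H z :=
  Real.exp_le_exp.2 (by linarith [le_wt k N H z])

theorem fullWgt_le {s : ℂ → ℂ} {k N : ℝ} {H : Finset (ℤ × ℤ)} {z : ℂ} {C : ℝ}
    (h : wt k N H z ≤ k * z.re + C) : fullWgt s k N H z ≤ Real.exp (2 * C) * wgt s k z := by
  unfold fullWgt wgt
  rw [← Real.exp_add]
  exact Real.exp_le_exp.2 (by linarith)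

theorem wgt_le_of_osc {s : ℂ → ℂ} {K k b : ℝ} {z z' : ℂ} (hs : ‖s z - s z'‖ ≤ K)
    (h : k * z.re ≤ k * z'.re + b) :
    wgt s k z ≤ Real.exp (2 * b + 2 * K) * wgt s k z' := by
  unfold wgt
  rw [← Real.exp_add]
  refine Real.exp_le_exp.2 ?_
  have h1 := (abs_le.1 ((Complex.abs_re_le_norm (s z - s z')).trans hs)).1
  rw [Complex.sub_re] at h1 ⊢
  rw [Complex.sub_re]
  linarith

theorem continuous_fullWgt {s : ℂ → ℂ} (hs : Continuous s) (k N : ℝ) (H : Finset (ℤ × ℤ)) :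
    Continuous (fullWgt s k N H) := by
  have := (contDiff_wt k N H).continuous
  unfold fullWgt
  fun_prop

section

variable {K l N : ℝ} {n : ℕ} {V v f : ℂ → ℝ} {W s : ℂ → ℂ} {E : ℂ → ℝ}

theorem ApproxSol.closedBall_hole_subset (h : ApproxSol l n N V v) {q : ℤ × ℤ} (hq : Hole n v q) :
    closedBall (zq q) 1 ⊆ closedBall 0 N := by
  intro z hz
  rw [mem_closedBall_zero_iff]
  by_contra hc
  have h1 := hq z (closedBall_subset_closedBall (by norm_num) hz)
  rw [h.supp z (not_le.1 hc), abs_zero] at h1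
  have := h.one_div_pos
  linarith

/-- The Carleman inequality applied to `exp (s 0 - s) * W`. -/
theorem Quasi.carleman (Q : Quasi K n N v f W s E) (k : ℝ) (H : Finset (ℤ × ℤ)) :
    1 / 2 * ∫ z, lapl (wt k N H) z * (‖W z‖ ^ 2 * fullWgt s k N H z) ≤
      ∫ z in closedBall 0 N, ‖dzb W z - dzb s z * W z‖ ^ 2 * fullWgt s k N H z := by
  obtain ⟨hF, hdz⟩ := dzb_exp_mul Q.smooth_s Q.smooth_W (s 0)
  have cW : HasCompactSupport W := HasCompactSupport.of_support_subset_isCompact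
    (isCompact_closedBall (0 : ℂ) N) fun z hz => by
      rw [mem_closedBall_zero_iff]
      by_contra hc
      exact hz (Q.supp_W z (not_le.1 hc))
  have cF : HasCompactSupport fun z => Complex.exp (s 0 - s z) * W z := cW.mul_left
  have hexp : ∀ z, ‖Complex.exp (s 0 - s z)‖ ^ 2 * Real.exp (2 * wt k N H z) =
      fullWgt s k N H z := by
    intro z
    rw [Complex.norm_exp, ← Real.exp_nat_mul, ← Real.exp_add]
    unfold fullWgt
    congr 1
    simp only [Complex.sub_re]
    push_cast
    ring
  have key := Landis.carleman hF cF (contDiff_wt k N H)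
  have e1 : ∀ z, ‖Complex.exp (s 0 - s z) * W z‖ ^ 2 * Real.exp (2 * wt k N H z) =
      ‖W z‖ ^ 2 * fullWgt s k N H z := by
    intro z; rw [← hexp, norm_mul]; ring
  have e2 : ∀ z, ‖dzb (fun z => Complex.exp (s 0 - s z) * W z) z‖ ^ 2 *
      Real.exp (2 * wt k N H z) = ‖dzb W z - dzb s z * W z‖ ^ 2 * fullWgt s k N H z := by
    intro z; rw [← hexp, hdz, norm_mul]; ring
  simp only [e1, e2] at key
  refine key.trans (le_of_eq ?_)
  symm
  refine setIntegral_eq_integral_of_forall_compl_eq_zero fun z hz => ?_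
  rw [mem_closedBall_zero_iff, not_le] at hz
  have ho : IsOpen {z : ℂ | N < ‖z‖} := isOpen_lt continuous_const continuous_norm
  have hev : W =ᶠ[𝓝 z] fun _ => 0 := by
    filter_upwards [ho.mem_nhds hz] with w hw
    exact Q.supp_W w hw
  have : dzb W z = 0 := by
    unfold dzb dX dY
    rw [hev.fderiv_eq]
    simp
  rw [this, Q.supp_W z hz]
  simp

theorem ApproxSol.fullWgt_le_of_hole (Q : Quasi K n N v f W s E) (h : ApproxSol l n N V v)
    {k C : ℝ} {H : Finset (ℤ × ℤ)} (hk : 0 ≤ k)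
    (hwt : ∀ z, ‖z‖ ≤ N → wt k N H z ≤ k * z.re + C) {q : ℤ × ℤ} (hq : Hole n v q) {z : ℂ}
    (hz : z ∈ closedBall (zq q) 1) :
    fullWgt s k N H z ≤ Real.exp (2 * (k + C + K)) * wgt s k (zq q) := by
  have hzN := h.closedBall_hole_subset hq hz
  rw [mem_closedBall_zero_iff] at hzN
  rw [mem_closedBall, dist_eq_norm] at hz
  have h1 := (Complex.re_le_norm (z - zq q)).trans hz
  rw [Complex.sub_re] at h1
  have h2 := wgt_le_of_osc (k := k) (b := k) (Q.osc_s z (zq q) (by linarith)) (by nlinarith)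
  calc fullWgt s k N H z ≤ Real.exp (2 * C) * wgt s k z := fullWgt_le (hwt z hzN)
    _ ≤ Real.exp (2 * C) * (Real.exp (2 * k + 2 * K) * wgt s k (zq q)) := by gcongr
    _ = _ := by
      rw [← mul_assoc, ← Real.exp_add]
      ring_nf

/-- The weighted `L²` energy of `W` is controlled by its values at the holes. -/
theorem Quasi.energy_le (Q : Quasi K n N v f W s E) (h : ApproxSol l n N V v) (hK : 0 < K)
    {k C : ℝ} {H : Finset (ℤ × ℤ)} (hk : 0 ≤ k) (hH : ∀ q, q ∈ H ↔ Hole n v q)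
    (hwt : ∀ z, ‖z‖ ≤ N → wt k N H z ≤ k * z.re + C) :
    1 / 2 / 10 ^ 26 * ∑ q ∈ H, (∫ z in rightHalf q, ‖W z‖ ^ 2 * fullWgt s k N H z) +
      2 / N ^ 2 * ∫ z, ‖W z‖ ^ 2 * fullWgt s k N H z ≤
    20 * K * Real.exp (2 * (k + C + K)) * ∑ q ∈ H, v (zq q) ^ 2 * wgt s k (zq q) +
      ∫ z in closedBall 0 N, E z * fullWgt s k N H z := by
  have hcP := continuous_fullWgt Q.smooth_s.continuous k N H
  set P := fullWgt s k N H with hP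
  set e := Real.exp (2 * (k + C + K)) with he
  have hP0 : ∀ z, 0 ≤ P z := fun z => (fullWgt_pos _ _ _ _ _).le
  have cW : HasCompactSupport W := HasCompactSupport.of_support_subset_isCompact
    (isCompact_closedBall (0 : ℂ) N) fun z hz => by
      rw [mem_closedBall_zero_iff]
      by_contra hc
      exact hz (Q.supp_W z (not_le.1 hc))
  set G : ℂ → ℝ := fun z => ‖W z‖ ^ 2 * P z with hG
  have hG0 : ∀ z, 0 ≤ G z := fun z => mul_nonneg (sq_nonneg _) (hP0 z)
  have hGc : Continuous G := (Q.smooth_W.continuous.norm.pow 2).mul hcP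
  have cG : HasCompactSupport G := hasCompactSupport_of cW fun z hz => by simp [hG, hz]
  have hGi : Integrable G := hGc.integrable_of_hasCompactSupport cG
  have hvol : volume.real (closedBall (0 : ℂ) 1) ≤ 4 := by
    rw [volume_real_closedBall _ (by norm_num)]
    linarith [Real.pi_le_four]
  have hvol' : ∀ q, volume.real (closedBall (zq q) 1) ≤ 4 := fun q => by
    rw [volume_real_closedBall _ (by norm_num)]
    linarith [Real.pi_le_four]
  have hPB : ∀ q ∈ H, ∀ z ∈ closedBall (zq q) 1, P z ≤ e * wgt s k (zq q) := fun q hq z hz =>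
    ApproxSol.fullWgt_le_of_hole Q h hk hwt ((hH q).1 hq) hz
  -- the right-hand side of the Carleman inequality
  have hR : ∫ z in closedBall 0 N, ‖dzb W z - dzb s z * W z‖ ^ 2 * P z ≤
      4 * K * e * ∑ q ∈ H, v (zq q) ^ 2 * wgt s k (zq q) +
        ∫ z in closedBall 0 N, E z * P z := by
    have hW' := contDiff_dX Q.smooth_W
    have hci : IntegrableOn (fun z => ‖dzb W z - dzb s z * W z‖ ^ 2 * P z) (closedBall 0 N) := by
      refine ContinuousOn.integrableOn_compact (isCompact_closedBall _ _) (Continuous.continuousOn ?_)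
      have h1 : Continuous (dzb W) := (((contDiff_dX Q.smooth_W).continuous).add
        (continuous_const.mul (contDiff_dY Q.smooth_W).continuous)).div_const 2
      have h2 : Continuous (dzb s) := (((contDiff_dX Q.smooth_s).continuous).add
        (continuous_const.mul (contDiff_dY Q.smooth_s).continuous)).div_const 2
      exact ((h1.sub (h2.mul Q.smooth_W.continuous)).norm.pow 2).mul hcP
    have hEi : IntegrableOn (fun z => E z * P z) (closedBall 0 N) :=
      (Q.cont_E.mul hcP).continuousOn.integrableOn_compact (isCompact_closedBall _ _)
    have hIi : ∀ q ∈ H, IntegrableOn ((closedBall (zq q) 1).indicator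
        fun _ => K * e * (v (zq q) ^ 2 * wgt s k (zq q))) (closedBall 0 N) := fun q _ =>
      (Integrable.indicator (integrableOn_const measure_closedBall_lt_top.ne)
        measurableSet_closedBall)
    have hle : ∀ z, ‖dzb W z - dzb s z * W z‖ ^ 2 * P z ≤
        ∑ q ∈ H, (closedBall (zq q) 1).indicator
          (fun _ => K * e * (v (zq q) ^ 2 * wgt s k (zq q))) z + E z * P z := by
      intro z
      refine (mul_le_mul_of_nonneg_right (Q.dzb_le z H (fun q => (hH q).2) fun q => (hH q).1)
        (hP0 z)).trans ?_
      rw [add_mul, Finset.mul_sum, Finset.sum_mul]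
      refine add_le_add_left (Finset.sum_le_sum fun q hq => ?_) _
      by_cases hz : z ∈ closedBall (zq q) 1
      · have hz' := hz
        rw [mem_closedBall, dist_eq_norm] at hz'
        rw [indicator_of_mem hz, if_pos hz']
        have := mul_le_mul_of_nonneg_left (hPB q hq z hz)
          (by positivity : 0 ≤ K * v (zq q) ^ 2)
        linarith
      · have hz' := hz
        rw [mem_closedBall, dist_eq_norm] at hz'
        rw [indicator_of_notMem hz, if_neg hz']
        simp
    calc ∫ z in closedBall 0 N, ‖dzb W z - dzb s z * W z‖ ^ 2 * P z
        ≤ ∫ z in closedBall 0 N, (∑ q ∈ H, (closedBall (zq q) 1).indicator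
          (fun _ => K * e * (v (zq q) ^ 2 * wgt s k (zq q))) z + E z * P z) :=
          integral_mono hci ((integrable_finsetSum _ hIi).add hEi) hle
      _ = ∑ q ∈ H, (∫ z in closedBall 0 N, (closedBall (zq q) 1).indicator
          (fun _ => K * e * (v (zq q) ^ 2 * wgt s k (zq q))) z) +
          ∫ z in closedBall 0 N, E z * P z := by
          rw [integral_add (integrable_finsetSum _ hIi) hEi, integral_finsetSum _ hIi]
      _ ≤ _ := by
          rw [Finset.mul_sum]
          refine add_le_add_left (Finset.sum_le_sum fun q hq => ?_) _
          have hw := (wgt_pos s k (zq q)).le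
          have he0 : 0 < e := Real.exp_pos _
          rw [integral_indicator measurableSet_closedBall, setIntegral_const, smul_eq_mul]
          have h1 : (volume.restrict (closedBall 0 N)).real (closedBall (zq q) 1) ≤ 4 := by
            refine le_trans ?_ (hvol' q)
            rw [measureReal_restrict_apply measurableSet_closedBall]
            exact measureReal_mono inter_subset_left measure_closedBall_lt_top.ne
          have := mul_le_mul_of_nonneg_right h1
            (by positivity : 0 ≤ K * e * (v (zq q) ^ 2 * wgt s k (zq q)))
          linarith
  -- the left-hand side
  have hL : 1 / 10 ^ 26 * ∑ q ∈ H, (∫ z in rightHalf q, G z) + 4 / N ^ 2 * (∫ z, G z) -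
      32 * K * e * ∑ q ∈ H, v (zq q) ^ 2 * wgt s k (zq q) ≤
      ∫ z, lapl (wt k N H) z * G z := by
    have hTi : ∀ q, Integrable ((rightHalf q).indicator fun z => 1 / 10 ^ 26 * G z) := fun q =>
      (hGi.const_mul _).indicator (isCompact_rightHalf q).measurableSet
    have hBi : ∀ q, Integrable ((closedBall (zq q) 1).indicator fun z => 8 * G z) := fun q =>
      (hGi.const_mul _).indicator measurableSet_closedBall
    have hle : ∀ z, ∑ q ∈ H, ((rightHalf q).indicator (fun z => 1 / 10 ^ 26 * G z) z -
        (closedBall (zq q) 1).indicator (fun z => 8 * G z) z) + 4 / N ^ 2 * G z ≤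
        lapl (wt k N H) z * G z := by
      intro z
      rw [lapl_wt, add_mul, Finset.sum_mul]
      refine add_le_add_left (Finset.sum_le_sum fun q hq => ?_) _
      have := mul_le_mul_of_nonneg_right (lapl_bmp_ge q z) (hG0 z)
      rw [sub_mul] at this
      refine le_trans (le_of_eq ?_) this
      congr 1 <;> simp only [indicator] <;> split_ifs <;> ring
    have hlc : Continuous fun z => lapl (wt k N H) z * G z :=
      (contDiff_lapl (contDiff_wt k N H)).continuous.mul hGc
    have hli : Integrable fun z => lapl (wt k N H) z * G z :=
      hlc.integrable_of_hasCompactSupport cG.mul_left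
    have hsi : Integrable fun z => ∑ q ∈ H, ((rightHalf q).indicator (fun z => 1 / 10 ^ 26 * G z) z -
        (closedBall (zq q) 1).indicator (fun z => 8 * G z) z) :=
      integrable_finsetSum _ fun q _ => (hTi q).sub (hBi q)
    have hInt := integral_mono (hsi.add (hGi.const_mul (4 / N ^ 2))) hli hle
    refine le_trans ?_ hInt
    have e1 := integral_add hsi (hGi.const_mul (4 / N ^ 2))
    have e2 := integral_finsetSum H fun q (_ : q ∈ H) => (hTi q).sub (hBi q)
    simp only [Pi.sub_apply, Pi.add_apply] at e1 e2 ⊢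
    rw [e1, e2, integral_const_mul]
    have e3 : ∀ q ∈ H, 1 / 10 ^ 26 * (∫ z in rightHalf q, G z) -
        32 * K * e * (v (zq q) ^ 2 * wgt s k (zq q)) ≤
        ∫ z, ((rightHalf q).indicator (fun z => 1 / 10 ^ 26 * G z) z -
        (closedBall (zq q) 1).indicator (fun z => 8 * G z) z) := by
      intro q hq
      rw [integral_sub (hTi q) (hBi q), integral_indicator (isCompact_rightHalf q).measurableSet,
        integral_indicator measurableSet_closedBall, integral_const_mul, integral_const_mul]
      have hb : ∫ z in closedBall (zq q) 1, G z ≤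
          ∫ z in closedBall (zq q) 1, K * v (zq q) ^ 2 * (e * wgt s k (zq q)) := by
        refine setIntegral_mono_on hGi.integrableOn
          (integrableOn_const measure_closedBall_lt_top.ne) measurableSet_closedBall
          fun z hz => ?_
        exact mul_le_mul (Q.hole_le q ((hH q).1 hq) z hz) (hPB q hq z hz) (hP0 z) (by positivity)
      rw [setIntegral_const, smul_eq_mul] at hb
      have hw := (wgt_pos s k (zq q)).le
      have he0 : 0 < e := Real.exp_pos _
      have := mul_le_mul_of_nonneg_right (hvol' q)
        (by positivity : 0 ≤ K * v (zq q) ^ 2 * (e * wgt s k (zq q)))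
      linarith
    have e4 := Finset.sum_le_sum e3
    rw [Finset.sum_sub_distrib, ← Finset.mul_sum, ← Finset.mul_sum] at e4
    linarith
  have key := Q.carleman k H
  have e5 : 2 / N ^ 2 = 1 / 2 * (4 / N ^ 2) := by ring
  rw [e5]
  have h32 : ∫ z, lapl (wt k N H) z * (‖W z‖ ^ 2 * fullWgt s k N H z) =
    ∫ z, lapl (wt k N H) z * G z := rfl
  rw [h32, ← hP] at key
  change 1 / 2 / 10 ^ 26 * ∑ q ∈ H, (∫ z in rightHalf q, G z) +
    1 / 2 * (4 / N ^ 2) * ∫ z, G z ≤ _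
  linarith

end

section

theorem nxt_injective : Function.Injective nxt := by
  rintro ⟨a, b⟩ ⟨c, d⟩ h
  simp only [nxt, Prod.mk.injEq, add_left_inj] at h
  rw [h.1, h.2]

variable {K l N : ℝ} {n : ℕ} {V v f : ℂ → ℝ} {W s : ℂ → ℂ} {E : ℂ → ℝ}

/-- The weighted values at the holes are controlled by the energy. -/
theorem Quasi.sum_hole_le (Q : Quasi K n N v f W s E) (h : ApproxSol l n N V v) 
    {k : ℝ} {H : Finset (ℤ × ℤ)} (hk : 0 ≤ k) (hH : ∀ q, q ∈ H ↔ Hole n v q) :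
    ∑ q ∈ H, v (zq q) ^ 2 * wgt s k (zq q) ≤ 10 ^ 30 *
      (Real.exp (2 * K - 18 * k) * ∑ q ∈ H, (∫ z in rightHalf q, ‖W z‖ ^ 2 * fullWgt s k N H z) +
        Real.exp (2 * K - 2000 * k) * ∑ q ∈ H, v (zq q) ^ 2 * wgt s k (zq q) +
        (1 / n : ℝ) ^ 2 * ∑ q ∈ H, wgt s k (zq q)) := by
  classical
  have hcP := continuous_fullWgt Q.smooth_s.continuous k N H
  set X : ℤ × ℤ → ℝ := fun q => v (zq q) ^ 2 * wgt s k (zq q) with hX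
  have hX0 : ∀ q, 0 ≤ X q := fun q => mul_nonneg (sq_nonneg _) (wgt_pos _ _ _).le
  have hnext : ∑ q ∈ H, (if nxt q ∈ H then X (nxt q) else 0) ≤ ∑ q ∈ H, X q := by
    rw [← Finset.sum_filter, ← Finset.sum_image (f := X) (s := H.filter fun q => nxt q ∈ H)
      nxt_injective.injOn]
    refine Finset.sum_le_sum_of_subset_of_nonneg (fun q hq => ?_) fun q _ _ => hX0 q
    obtain ⟨p, hp, rfl⟩ := Finset.mem_image.1 hq
    exact (Finset.mem_filter.1 hp).2
  have hT : ∀ q, (∫ z in rightHalf q, ‖W z‖ ^ 2) * wgt s k (zq q) ≤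
      Real.exp (2 * K - 18 * k) * ∫ z in rightHalf q, ‖W z‖ ^ 2 * fullWgt s k N H z := by
    intro q
    rw [← integral_mul_const, ← integral_const_mul]
    have hWc := Q.smooth_W.continuous.norm.pow 2
    refine setIntegral_mono_on ?_ ?_ (isCompact_rightHalf q).measurableSet fun z hz => ?_
    · exact (hWc.mul_const _).continuousOn.integrableOn_compact (isCompact_rightHalf q)
    · exact (continuous_const.mul (hWc.mul hcP)).continuousOn.integrableOn_compact
        (isCompact_rightHalf q)
    · have h1 : ‖zq q - z‖ ≤ 3000 := by
        have := hz.1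
        rwa [mem_closedBall, dist_eq_norm, norm_sub_rev] at this
      have h2 : (zq q).re + 9 ≤ z.re := hz.2
      have h3 := wgt_le_of_osc (k := k) (b := -9 * k) (Q.osc_s _ _ h1) (by nlinarith)
      have h4 := h3.trans (mul_le_mul_of_nonneg_left (wgt_le_fullWgt s k N H z)
        (Real.exp_pos _).le)
      have h5 := mul_le_mul_of_nonneg_left h4 (sq_nonneg ‖W z‖)
      refine h5.trans (le_of_eq ?_)
      rw [show 2 * (-9 * k) + 2 * K = 2 * K - 18 * k by ring]
      ring
  have hstep : ∀ q ∈ H, X q ≤ 10 ^ 30 * (Real.exp (2 * K - 18 * k) *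
      (∫ z in rightHalf q, ‖W z‖ ^ 2 * fullWgt s k N H z) +
      Real.exp (2 * K - 2000 * k) * (if nxt q ∈ H then X (nxt q) else 0) +
      (1 / n : ℝ) ^ 2 * wgt s k (zq q)) := by
    intro q hq
    have hw := wgt_pos s k (zq q)
    set m : ℝ := if nxt q ∈ H then v (zq (nxt q)) ^ 2 else 0 with hm
    have hm0 : 0 ≤ m := by rw [hm]; split_ifs <;> positivity
    have h1 := Q.chain h ((hH q).1 hq) hm0 fun hn => by rw [hm, if_pos ((hH _).2 hn)]
    have h2 : m * wgt s k (zq q) ≤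
        Real.exp (2 * K - 2000 * k) * (if nxt q ∈ H then X (nxt q) else 0) := by
      rw [hm]
      split_ifs with hn
      · have h3 : ‖zq q - zq (nxt q)‖ ≤ 3000 := by
          rw [zq_nxt, sub_add_cancel_left, norm_neg]
          norm_num
        have h4 := wgt_le_of_osc (k := k) (b := -1000 * k) (Q.osc_s _ _ h3) (by
          rw [zq_nxt, Complex.add_re]
          norm_num
          linarith)
        have h5 := mul_le_mul_of_nonneg_left h4 (sq_nonneg (v (zq (nxt q))))
        refine h5.trans (le_of_eq ?_)
        rw [show 2 * (-1000 * k) + 2 * K = 2 * K - 2000 * k by ring, hX]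
        ring
      · simp
    have h3 := mul_le_mul_of_nonneg_right h1 hw.le
    have h4 := hT q
    refine h3.trans ?_
    rw [mul_assoc, add_mul, add_mul]
    gcongr
  refine (Finset.sum_le_sum hstep).trans ?_
  rw [← Finset.mul_sum, Finset.sum_add_distrib, Finset.sum_add_distrib, ← Finset.mul_sum,
    ← Finset.mul_sum, ← Finset.mul_sum]
  gcongr

/-- Choice of the linear rate `k`. -/
theorem exists_rate (A : ℝ) : ∃ k : ℝ, 0 ≤ k ∧ A * Real.exp (-16 * k) ≤ 1 / 2 := by
  refine ⟨|A|, abs_nonneg A, ?_⟩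
  have h1 := Real.add_one_le_exp (16 * |A|)
  have h2 : Real.exp (-16 * |A|) = (Real.exp (16 * |A|))⁻¹ := by rw [← Real.exp_neg]; ring_nf
  rw [h2, ← div_eq_mul_inv, div_le_iff₀ (Real.exp_pos _)]
  linarith [le_abs_self A, abs_nonneg A]

/-- The energy of `W` is bounded by the error term and the size of the domain. -/
theorem exists_energy_bound (K : ℝ) (hK : 0 < K) : ∃ k C A : ℝ, 0 ≤ k ∧ 0 ≤ C ∧ 0 < A ∧
    ∀ {l N : ℝ} {n : ℕ} {V v f : ℂ → ℝ} {W s : ℂ → ℂ} {E : ℂ → ℝ} {H : Finset (ℤ × ℤ)},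
    Quasi K n N v f W s E → ApproxSol l n N V v → (∀ q, q ∈ H ↔ Hole n v q) →
    (∀ z, ‖z‖ ≤ N → fullWgt s k N H z ≤ Real.exp C * wgt s k z) ∧
    ∫ z, ‖W z‖ ^ 2 * fullWgt s k N H z ≤ A * N ^ 2 *
      ((∫ z in closedBall 0 N, E z * fullWgt s k N H z) +
        (1 / n : ℝ) ^ 2 * ∑ q ∈ H, wgt s k (zq q)) := by
  obtain ⟨C, hC, hwt⟩ := exists_wt_le
  set c : ℝ := 1 / 2 / 10 ^ 26 with hc
  set A0 : ℝ := 10 ^ 30 * Real.exp (2 * K) * (1 / c) * (20 * K * Real.exp (2 * (C + K))) with hA0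
  set A1 : ℝ := 10 ^ 30 * Real.exp (2 * K) with hA1
  obtain ⟨k, hk, hkA⟩ := exists_rate (A0 + A1)
  set e : ℝ := Real.exp (2 * (k + C + K)) with he
  set A3 : ℝ := 2 * (A1 * (1 / c) + 10 ^ 30) with hA3
  have hcp : 0 < c := by rw [hc]; positivity
  have hA1p : 0 < A1 := by rw [hA1]; positivity
  have hA0p : 0 < A0 := by rw [hA0]; positivity
  have hA3p : 0 < A3 := by rw [hA3]; positivity
  have hep : 0 < e := Real.exp_pos _
  refine ⟨k, 2 * C, 1 / 2 * (20 * K * e * A3 + 1), hk, by positivity, by positivity, ?_⟩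
  intro l N n V v f W s E H Q h hH
  have hN := h.N_ge
  have hN0 : 0 < N := by linarith
  have hw := fun z hz => hwt k N H z hz hN0
  refine ⟨fun z hz => fullWgt_le (hw z hz), ?_⟩
  have h1 := Q.energy_le h hK hk hH hw
  have h2 := Q.sum_hole_le h hk hH
  rw [← hc, ← he] at h1
  set X := ∑ q ∈ H, v (zq q) ^ 2 * wgt s k (zq q)
  set Y := ∑ q ∈ H, (∫ z in rightHalf q, ‖W z‖ ^ 2 * fullWgt s k N H z)
  set Z := ∫ z, ‖W z‖ ^ 2 * fullWgt s k N H z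
  set T := ∫ z in closedBall 0 N, E z * fullWgt s k N H z
  set R := (1 / n : ℝ) ^ 2 * ∑ q ∈ H, wgt s k (zq q)
  have hX : 0 ≤ X := Finset.sum_nonneg fun q _ => mul_nonneg (sq_nonneg _) (wgt_pos _ _ _).le
  have hP := fun z => (fullWgt_pos s k N H z).le
  have hY : 0 ≤ Y := Finset.sum_nonneg fun q _ => integral_nonneg fun z =>
    mul_nonneg (sq_nonneg _) (hP z)
  have hZ : 0 ≤ Z := integral_nonneg fun z => mul_nonneg (sq_nonneg _) (hP z)
  have hT : 0 ≤ T := integral_nonneg fun z => mul_nonneg (Q.E_nonneg z) (hP z)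
  have hR : 0 ≤ R := mul_nonneg (sq_nonneg _) (Finset.sum_nonneg fun q _ => (wgt_pos _ _ _).le)
  have hYle : Y ≤ 1 / c * (20 * K * e * X + T) := by
    rw [one_div, le_inv_mul_iff₀ hcp]
    have : 0 ≤ 2 / N ^ 2 * Z := by positivity
    exact (le_add_of_nonneg_right this).trans h1
  have hZle : Z ≤ N ^ 2 / 2 * (20 * K * e * X + T) := by
    have : 0 ≤ c * Y := by positivity
    have h3 : 2 / N ^ 2 * Z ≤ 20 * K * e * X + T := by linarith
    have h4 := mul_le_mul_of_nonneg_left h3 (by positivity : 0 ≤ N ^ 2 / 2)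
    refine le_trans (le_of_eq ?_) h4
    field_simp
  set x := Real.exp (-16 * k) with hx
  have hx1 : x ≤ 1 := Real.exp_le_one_iff.2 (by linarith)
  have hx0 : 0 < x := Real.exp_pos _
  have e18 : Real.exp (2 * K - 18 * k) * e = Real.exp (2 * K) * Real.exp (2 * (C + K)) * x := by
    rw [he, hx, ← Real.exp_add, ← Real.exp_add, ← Real.exp_add]; ring_nf
  have e18' : Real.exp (2 * K - 18 * k) ≤ Real.exp (2 * K) := Real.exp_le_exp.2 (by linarith)
  have e2000 : Real.exp (2 * K - 2000 * k) ≤ Real.exp (2 * K) * x := by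
    rw [hx, ← Real.exp_add]; exact Real.exp_le_exp.2 (by linarith)
  have hXle : X ≤ A3 * (T + R) := by
    have h3 : Real.exp (2 * K - 18 * k) * Y ≤
        1 / c * (20 * K * (Real.exp (2 * K) * Real.exp (2 * (C + K)) * x) * X +
          Real.exp (2 * K) * T) := by
      calc Real.exp (2 * K - 18 * k) * Y
          ≤ Real.exp (2 * K - 18 * k) * (1 / c * (20 * K * e * X + T)) := by gcongr
        _ = 1 / c * (20 * K * (Real.exp (2 * K - 18 * k) * e) * X +
          Real.exp (2 * K - 18 * k) * T) := by ring
        _ ≤ _ := by rw [e18]; gcongr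
    have h4 : Real.exp (2 * K - 2000 * k) * X ≤ Real.exp (2 * K) * x * X := by gcongr
    have h5 : X ≤ (A0 + A1) * x * X + A1 * (1 / c) * T + 10 ^ 30 * R := by
      rw [hA0, hA1]; linarith
    have h6 : (A0 + A1) * x * X ≤ 1 / 2 * X := by gcongr
    have h7 : 0 ≤ A1 * (1 / c) * R := by positivity
    have h8 : (0 : ℝ) ≤ 10 ^ 30 * T := by positivity
    rw [hA3]
    linarith
  calc Z ≤ N ^ 2 / 2 * (20 * K * e * X + T) := hZle
    _ ≤ N ^ 2 / 2 * (20 * K * e * (A3 * (T + R)) + (T + R)) := by gcongr; linarith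
    _ = _ := by ring

end

theorem wgt_bounds {s : ℂ → ℂ} {K k N : ℝ} {z : ℂ} (hk : 0 ≤ k) (hK : 0 ≤ K) (hN : 1 ≤ N)
    (hs : ‖s z - s 0‖ ≤ K * (N + 1)) (hz : ‖z‖ ≤ N) :
    Real.exp (-((2 * k + 4 * K) * N)) ≤ wgt s k z ∧
      wgt s k z ≤ Real.exp ((2 * k + 4 * K) * N) := by
  have h1 := abs_le.1 ((Complex.abs_re_le_norm (s z - s 0)).trans hs)
  have h2 := abs_le.1 ((Complex.abs_re_le_norm z).trans hz)
  have h3 : K * (N + 1) ≤ 2 * K * N := by nlinarith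
  have h4 : k * z.re ≤ k * N := mul_le_mul_of_nonneg_left h2.2 hk
  have h5 : k * -N ≤ k * z.re := mul_le_mul_of_nonneg_left h2.1 hk
  unfold wgt
  constructor <;> refine Real.exp_le_exp.2 ?_ <;> linarith

theorem le_exp_mul {D N : ℝ} (hN : 1 ≤ N) (hD : 0 ≤ D) : D ≤ Real.exp (D * N) := by
  have := Real.add_one_le_exp (D * N)
  nlinarith

theorem pow_le_exp_mul {N : ℝ} (hN : 1 ≤ N) (j : ℕ) : N ^ j ≤ Real.exp (j * N) := by
  rw [Real.exp_nat_mul]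
  have := Real.add_one_le_exp N
  exact pow_le_pow_left₀ (by linarith) (by linarith) j

/-- Bound for the energy of `W`. -/
theorem exists_integral_le (K : ℝ) (hK : 0 < K) : ∃ B > 0,
    ∀ {l N : ℝ} {n : ℕ} {V v f : ℂ → ℝ} {W s : ℂ → ℂ} {E : ℂ → ℝ},
    Quasi K n N v f W s E → ApproxSol l n N V v →
    ∫ z, ‖W z‖ ^ 2 ≤ Real.exp (B * N) * (1 / n : ℝ) ^ (1 / 4 : ℝ) := by
  classical
  obtain ⟨k, C, A, hk, hC, hA, hmain⟩ := exists_energy_bound K hK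
  set b := 2 * k + 4 * K with hb
  set D := A * (Real.exp C * K + 25) with hD
  have hDp : 0 < D := by positivity
  refine ⟨D + 8 + 3 * b, by positivity, ?_⟩
  intro l N n V v f W s E Q h
  have hN := h.N_ge
  set H := (latt N).filter (Hole n v) with hHdef
  have hH : ∀ q, q ∈ H ↔ Hole n v q := fun q => by
    rw [hHdef, Finset.mem_filter, mem_latt, and_iff_right_iff_imp]
    exact h.norm_le_of_hole
  obtain ⟨hP, hZ⟩ := hmain Q h hH
  have hδ := h.one_div_pos
  have hδ1 : (1 / n : ℝ) ≤ 1 := by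
    have : (1 : ℝ) ≤ n := by exact_mod_cast h.n_pos
    rw [div_le_one (by linarith)]
    exact this
  set δ : ℝ := 1 / n with hδdef
  have hδ2 : δ ^ 2 ≤ δ ^ (1 / 4 : ℝ) := by
    rw [← Real.rpow_natCast]
    exact Real.rpow_le_rpow_of_exponent_ge hδ hδ1 (by norm_num)
  set d := δ ^ (1 / 4 : ℝ) with hd
  have hd0 : 0 < d := Real.rpow_pos_of_pos hδ _
  have hs : ∀ z, ‖z‖ ≤ N → ‖s z - s 0‖ ≤ K * (N + 1) := fun z hz =>
    norm_sub_le_of_osc hK.le Q.osc_s hz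
  have hw := fun z (hz : ‖z‖ ≤ N) => wgt_bounds (k := k) hk hK.le hN (hs z hz) hz
  rw [← hb] at hw
  have hcP := continuous_fullWgt Q.smooth_s.continuous k N H
  set P := fullWgt s k N H with hPdef
  set e := Real.exp (b * N) with he
  have he0 : 0 < e := Real.exp_pos _
  have hT : ∫ z in closedBall 0 N, E z * P z ≤ Real.exp C * e * (K * N ^ 6 * d) := by
    calc ∫ z in closedBall 0 N, E z * P z
        ≤ ∫ z in closedBall 0 N, Real.exp C * e * E z := by
          refine setIntegral_mono_on ?_ ?_ measurableSet_closedBall fun z hz => ?_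
          · exact (Q.cont_E.mul hcP).continuousOn.integrableOn_compact (isCompact_closedBall _ _)
          · exact (continuous_const.mul Q.cont_E).continuousOn.integrableOn_compact
              (isCompact_closedBall _ _)
          · rw [mem_closedBall_zero_iff] at hz
            have h1 := (hP z hz).trans (mul_le_mul_of_nonneg_left (hw z hz).2 (Real.exp_pos C).le)
            have h2 := mul_le_mul_of_nonneg_left h1 (Q.E_nonneg z)
            linarith
      _ = Real.exp C * e * ∫ z in closedBall 0 N, E z := integral_const_mul _ _
      _ ≤ _ := mul_le_mul_of_nonneg_left Q.int_E (by positivity)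
  have hS : ∑ q ∈ H, wgt s k (zq q) ≤ 25 * N ^ 2 * e := by
    calc ∑ q ∈ H, wgt s k (zq q) ≤ ∑ q ∈ H, e := Finset.sum_le_sum fun q hq =>
          (hw _ (h.norm_le_of_hole ((hH q).1 hq))).2
      _ = (H.card : ℝ) * e := by rw [Finset.sum_const, nsmul_eq_mul]
      _ ≤ _ := by
        have h1 : (H.card : ℝ) ≤ (latt N).card := by exact_mod_cast Finset.card_filter_le _ _
        have := h1.trans (card_latt_le hN)
        gcongr
  have hS0 : 0 ≤ ∑ q ∈ H, wgt s k (zq q) := Finset.sum_nonneg fun q _ => (wgt_pos _ _ _).le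
  have cW : HasCompactSupport W := HasCompactSupport.of_support_subset_isCompact
    (isCompact_closedBall (0 : ℂ) N) fun z hz => by
      rw [mem_closedBall_zero_iff]
      by_contra hc
      exact hz (Q.supp_W z (not_le.1 hc))
  have hW : ∫ z, ‖W z‖ ^ 2 ≤ e * ∫ z, ‖W z‖ ^ 2 * P z := by
    rw [← integral_const_mul]
    have hWc := Q.smooth_W.continuous.norm.pow 2
    refine integral_mono (hWc.integrable_of_hasCompactSupport
      (hasCompactSupport_of cW fun z hz => by simp [hz]))
      ((continuous_const.mul (hWc.mul hcP)).integrable_of_hasCompactSupport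
        (hasCompactSupport_of cW fun z hz => by simp [hz])) fun z => ?_
    by_cases hz : ‖z‖ ≤ N
    · have h1 := (hw z hz).1.trans (wgt_le_fullWgt s k N H z)
      have h2 : 1 ≤ e * P z := by
        rw [Real.exp_neg, inv_le_iff_one_le_mul₀' he0] at h1
        exact h1
      have := mul_le_mul_of_nonneg_left h2 (sq_nonneg ‖W z‖)
      simp only
      linarith
    · simp [Q.supp_W z (not_le.1 hz)]
  have hN1 : N ^ 6 ≤ N ^ 6 := le_rfl
  have hNN : N ^ 2 ≤ N ^ 6 := pow_le_pow_right₀ hN (by norm_num)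
  calc ∫ z, ‖W z‖ ^ 2 ≤ e * ∫ z, ‖W z‖ ^ 2 * P z := hW
    _ ≤ e * (A * N ^ 2 * (Real.exp C * e * (K * N ^ 6 * d) + d * (25 * N ^ 6 * e))) := by
        gcongr
        refine hZ.trans ?_
        gcongr
        exact hS.trans (by gcongr)
    _ = D * N ^ 8 * (e * e) * d := by rw [hD]; ring
    _ ≤ Real.exp (D * N) * Real.exp ((8 : ℕ) * N) * (e * e * e) * d := by
        have h1 := le_exp_mul hN hDp.le
        have h2 := pow_le_exp_mul hN 8
        have h3 : 1 ≤ e := Real.one_le_exp (by positivity)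
        gcongr
        nlinarith [mul_pos he0 he0]
    _ = _ := by
        rw [he, ← Real.exp_add, ← Real.exp_add, ← Real.exp_add, ← Real.exp_add]
        congr 2
        push_cast
        ring

/-- **Quantitative unique continuation**: a compactly supported approximate solution with a very
small error is small at the origin. -/
theorem exists_core : ∃ c > 0, ∃ A > 0, ∀ {l N : ℝ} {n : ℕ} {V v : ℂ → ℝ},
    ApproxSol l n N V v → 2500 ≤ N → l * (1 + Real.log (3 * N)) ≤ c → Real.exp (A * N) ≤ n →
    |v 0| ≤ 1 / N := by
  obtain ⟨K, hK, c, hc, hquasi⟩ := exists_quasi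
  obtain ⟨B, hB, hInt⟩ := exists_integral_le K hK
  refine ⟨c, hc, 4 * (B + 400000), by positivity, ?_⟩
  intro l N n V v h hN hl hn
  obtain ⟨f, W, s, E, Q⟩ := hquasi h hN hl
  have hI := hInt Q h
  have hN0 : 0 < N := by linarith
  by_contra hcon
  have hm : 1 / N < |v 0| := not_le.1 hcon
  set m := |v 0| with hmdef
  have hm0 : 0 < m := lt_trans (by positivity) hm
  have hm1 : m ≤ 1 := h.abs_le_one 0
  set τ : ℂ := ((2 * N + 1 : ℝ) : ℂ) with hτ
  have hτn : ‖τ‖ = 2 * N + 1 := by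
    rw [hτ, Complex.norm_real, Real.norm_of_nonneg (by linarith)]
  have hgc := continuous_gs Q.smooth_f
  have key := integral_sq_sub_translate (c := 0) (r := m / 12) (τ := τ) Q.smooth_f
    (T := closedBall 0 (4 * N)) measurableSet_closedBall
    (hgc.continuousOn.integrableOn_compact (isCompact_closedBall _ _)) (by
      intro a ha t ht
      rw [mem_closedBall_zero_iff] at ha ⊢
      calc ‖a + t * τ‖ ≤ ‖a‖ + ‖(t : ℂ) * τ‖ := norm_add_le _ _
        _ = ‖a‖ + t * (2 * N + 1) := by
          rw [norm_mul, hτn, Complex.norm_real, Real.norm_of_nonneg ht.1]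
        _ ≤ m / 12 + 1 * (2 * N + 1) := by gcongr; exact ht.2
        _ ≤ 4 * N := by linarith)
  have hlow : (m / 4) ^ 2 * (Real.pi * (m / 12) ^ 2) ≤
      ∫ a in closedBall 0 (m / 12), (f (a + τ) - f a) ^ 2 := by
    rw [← volume_real_closedBall (0 : ℂ) (by positivity : 0 ≤ m / 12), mul_comm,
      ← smul_eq_mul, ← setIntegral_const]
    have hfc := Q.smooth_f.continuous
    refine setIntegral_mono_on (integrableOn_const measure_closedBall_lt_top.ne)
      (ContinuousOn.integrableOn_compact (isCompact_closedBall _ _)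
        (Continuous.continuousOn (by fun_prop))) measurableSet_closedBall fun a ha => ?_
    rw [mem_closedBall_zero_iff] at ha
    have h1 : v (a + τ) = 0 := h.supp _ (by
      have := norm_sub_norm_le τ (-a)
      rw [norm_neg, sub_neg_eq_add, add_comm τ a] at this
      linarith)
    have h2 : f (a + τ) = 0 := by
      have := Q.f_le (a + τ)
      rw [h1, abs_zero, mul_zero] at this
      exact abs_nonpos_iff.1 this
    have h3 := h.abs_sub_le a 0
    rw [zero_sub, norm_neg] at h3
    have h4 : m ≤ |v 0 - v a| + |v a| := by
      have := abs_add_le (v 0 - v a) (v a)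
      rwa [sub_add_cancel] at this
    have h5 := Q.le_f a
    rw [h2, zero_sub, neg_sq, ← sq_abs (f a)]
    exact pow_le_pow_left₀ (by positivity) (by linarith) 2
  have hgs : ∫ z in closedBall 0 (4 * N), gs f z ≤ 16 * ∫ z, ‖W z‖ ^ 2 := by
    have cW : HasCompactSupport W := HasCompactSupport.of_support_subset_isCompact
      (isCompact_closedBall (0 : ℂ) N) fun z hz => by
        rw [mem_closedBall_zero_iff]
        by_contra hc
        exact hz (Q.supp_W z (not_le.1 hc))
    have hWi : Integrable fun z => 16 * ‖W z‖ ^ 2 :=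
      (continuous_const.mul (Q.smooth_W.continuous.norm.pow 2)).integrable_of_hasCompactSupport
        (hasCompactSupport_of cW fun z hz => by simp [hz])
    rw [← integral_const_mul]
    calc ∫ z in closedBall 0 (4 * N), gs f z ≤ ∫ z in closedBall 0 (4 * N), 16 * ‖W z‖ ^ 2 :=
          integral_mono (hgc.continuousOn.integrableOn_compact (isCompact_closedBall _ _))
            hWi.integrableOn Q.gs_le
      _ ≤ _ := setIntegral_le_integral hWi (ae_of_all _ fun z => by positivity)
  have hnp : (0 : ℝ) < n := lt_of_lt_of_le (Real.exp_pos _) hn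
  have hd : (1 / n : ℝ) ^ (1 / 4 : ℝ) ≤ Real.exp (-((B + 400000) * N)) := by
    have h1 : (1 / n : ℝ) ≤ Real.exp (-(4 * (B + 400000) * N)) := by
      rw [Real.exp_neg, one_div]
      exact inv_anti₀ (Real.exp_pos _) hn
    have h2 := Real.rpow_le_rpow (by positivity) h1 (by norm_num : (0 : ℝ) ≤ 1 / 4)
    rw [← Real.exp_mul] at h2
    refine h2.trans (le_of_eq ?_)
    congr 1
    ring
  have hI2 : ∫ z, ‖W z‖ ^ 2 ≤ Real.exp (-(400000 * N)) := by
    calc ∫ z, ‖W z‖ ^ 2 ≤ Real.exp (B * N) * Real.exp (-((B + 400000) * N)) :=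
          hI.trans (by gcongr)
      _ = _ := by rw [← Real.exp_add]; congr 1; ring
  have hup : ‖τ‖ ^ 2 * ∫ z in closedBall 0 (4 * N), gs f z ≤
      144 * N ^ 2 * Real.exp (-(400000 * N)) := by
    rw [hτn]
    calc (2 * N + 1) ^ 2 * ∫ z in closedBall 0 (4 * N), gs f z
        ≤ (3 * N) ^ 2 * (16 * Real.exp (-(400000 * N))) := by
          have : 2 * N + 1 ≤ 3 * N := by linarith
          have h0 : 0 ≤ ∫ z in closedBall 0 (4 * N), gs f z :=
            integral_nonneg fun z => gs_nonneg f z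
          gcongr
          exact hgs.trans (by gcongr)
      _ = _ := by ring
  have h1 := (hlow.trans key).trans hup
  have h2 : 3 * (m ^ 4 / 2304) ≤ (m / 4) ^ 2 * (Real.pi * (m / 12) ^ 2) := by
    have := mul_le_mul_of_nonneg_right Real.pi_gt_three.le (by positivity : 0 ≤ m ^ 4 / 2304)
    refine this.trans (le_of_eq ?_)
    ring
  have h3 : (1 / N) ^ 4 < m ^ 4 := pow_lt_pow_left₀ hm (by positivity) (by norm_num)
  have h4 : 110592 * N ^ 6 ≤ Real.exp (400000 * N) := by
    calc 110592 * N ^ 6 ≤ Real.exp (110592 * N) * Real.exp ((6 : ℕ) * N) :=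
          mul_le_mul (le_exp_mul (by linarith) (by norm_num)) (pow_le_exp_mul (by linarith) 6)
            (by positivity) (Real.exp_pos _).le
      _ ≤ _ := by
        rw [← Real.exp_add]
        refine Real.exp_le_exp.2 ?_
        push_cast
        linarith
  have h5 : 110592 * N ^ 2 * Real.exp (-(400000 * N)) ≤ (1 / N) ^ 4 := by
    rw [Real.exp_neg, one_div, inv_pow, ← div_eq_mul_inv, div_le_iff₀ (Real.exp_pos _),
      le_inv_mul_iff₀ (by positivity)]
    calc N ^ 4 * (110592 * N ^ 2) = 110592 * N ^ 6 := by ring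
      _ ≤ _ := h4
  linarith

/-- A smooth nonnegative kernel of mass one supported in a small ball. -/
theorem exists_mollifier {η : ℝ} (hη : 0 < η) : ∃ φ : ℂ → ℝ, ContDiff ℝ ∞ φ ∧
    HasCompactSupport φ ∧ (∀ z, 0 ≤ φ z) ∧ (∀ z, η / 2 ≤ ‖z‖ → φ z = 0) ∧ ∫ z, φ z = 1 := by
  let b : ContDiffBump (0 : ℂ) := ⟨η / 4, η / 2, by positivity, by linarith⟩
  refine ⟨b.normed volume, b.contDiff_normed, b.hasCompactSupport_normed,
    fun z => b.nonneg_normed z, fun z hz => ?_, b.integral_normed⟩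
  have : z ∉ Function.support (b.normed volume) := by
    rw [b.support_normed_eq, mem_ball_zero_iff]
    exact not_lt.2 hz
  exact Function.notMem_support.1 this

/-- An average is bounded by a bound for the averaged function. -/
theorem abs_integral_mul_le {g h : ℂ → ℝ} {m : ℝ} (hi : Integrable h) (h0 : ∀ z, 0 ≤ h z)
    (h1 : ∫ z, h z = 1) (hg : ∀ᵐ z, h z ≠ 0 → |g z| ≤ m) : |∫ z, g z * h z| ≤ m := by
  have := norm_integral_le_of_norm_le (f := fun z => g z * h z) (hi.const_mul m) (by
    filter_upwards [hg] with z hz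
    rw [norm_mul, Real.norm_of_nonneg (h0 z), Real.norm_eq_abs]
    by_cases hh : h z = 0
    · simp [hh]
    · exact mul_le_mul_of_nonneg_right (hz hh) (h0 z))
  rwa [integral_const_mul, h1, mul_one, Real.norm_eq_abs] at this

/-- Smooth approximation of a weak solution. -/
theorem exists_mollified {U V : ℂ → ℝ} (hU : Continuous U) (hV : Measurable V)
    (hV1 : ∀ᵐ z, |V z| ≤ 1)
    (hw : ∀ h, ContDiff ℝ ∞ h → HasCompactSupport h →
      (∫ z, U z * lapl h z) + ∫ z, V z * U z * h z = 0) {e : ℝ} (he : 0 < e) (R : ℝ) :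
    ∃ U' V' : ℂ → ℝ, ContDiff ℝ ∞ U' ∧ ContDiff ℝ ∞ V' ∧ (∀ z, |V' z| ≤ 1) ∧
      ∀ z, ‖z‖ ≤ R → |U' z - U z| ≤ e ∧ |lapl U' z + V' z * U' z| ≤ e ∧
        ∀ m, (∀ w, ‖w - z‖ ≤ 1 → |U w| ≤ m) → |U' z| ≤ m ∧ |lapl U' z| ≤ m := by
  have hB : IsCompact (closedBall (0 : ℂ) (R + 1)) := isCompact_closedBall _ _
  obtain ⟨η', hη', hunif⟩ := Metric.uniformContinuousOn_iff.1
    (hB.uniformContinuousOn_of_continuous hU.continuousOn) (e / 2) (by positivity)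
  set η := min η' 1 with hη
  have hη0 : 0 < η := lt_min hη' one_pos
  obtain ⟨φ, hφ, cφ, φ0, φs, φi⟩ := exists_mollifier hη0
  set B := closedBall (0 : ℂ) (R + 1) with hBdef
  have hBm : MeasurableSet B := measurableSet_closedBall
  set U1 := B.indicator U with hU1
  set V1 := B.indicator V with hV1def
  have hV1b : ∀ᵐ z, |V1 z| ≤ 1 := by
    filter_upwards [hV1] with z hz
    rw [hV1def, indicator]
    split_ifs
    · exact hz
    · simp
  have hU1i : Integrable U1 := (hU.continuousOn.integrableOn_compact hB).integrable_indicator hBm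
  have hV1i : Integrable V1 := by
    refine Integrable.mono' (g := B.indicator fun _ => 1)
      ((integrableOn_const measure_closedBall_lt_top.ne).integrable_indicator hBm)
      (hV.indicator hBm).aestronglyMeasurable ?_
    filter_upwards [hV1] with z hz
    rw [hV1def, Real.norm_eq_abs]
    simp only [indicator]
    split_ifs
    · exact hz
    · simp
  have cs : ∀ g : ℂ → ℝ, HasCompactSupport (B.indicator g) := fun g =>
    HasCompactSupport.of_support_subset_isCompact hB fun z hz => by
      by_contra hc
      exact hz (indicator_of_notMem hc g)
  have hreg : ∀ z, ContDiff ℝ ∞ (fun ξ => φ (z - ξ)) ∧ HasCompactSupport (fun ξ => φ (z - ξ)) ∧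
      (∫ ξ, φ (z - ξ) = 1) ∧ ∀ ξ, lapl (fun ξ => φ (z - ξ)) ξ = lapl φ (z - ξ) := by
    intro z
    refine ⟨hφ.comp (contDiff_const.sub contDiff_id),
      cφ.comp_homeomorph (Homeomorph.subLeft z), ?_, fun ξ => ?_⟩
    · rw [integral_sub_left_eq_self φ volume z, φi]
    · have := lapl_comp_affine hφ (-ContinuousLinearMap.id ℝ ℂ) z (s := 1) (by simp) (by simp)
        (by simp) ξ
      simpa [sub_eq_add_neg] using this
  have hnear : ∀ z ξ, φ (z - ξ) ≠ 0 → ‖ξ - z‖ < η := by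
    intro z ξ hne
    by_contra hc
    rw [norm_sub_rev] at hc
    exact hne (φs _ (by linarith))
  have hmem : ∀ z ξ, ‖z‖ ≤ R → ‖ξ - z‖ < η → ξ ∈ B := by
    intro z ξ hz hξ
    rw [hBdef, mem_closedBall_zero_iff]
    have := norm_sub_norm_le ξ z
    have := min_le_right η' 1
    linarith
  have hInt : ∀ z, Integrable (fun ξ => φ (z - ξ)) := fun z =>
    (hreg z).1.continuous.integrable_of_hasCompactSupport (hreg z).2.1
  have hav := fun (g : ℂ → ℝ) (m : ℝ) (z : ℂ) (hg : ∀ᵐ ξ, φ (z - ξ) ≠ 0 → |g ξ| ≤ m) =>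
    abs_integral_mul_le (hInt z) (fun ξ => φ0 _) (hreg z).2.2.1 hg
  have hV'b : ∀ z, |cv V1 φ z| ≤ 1 := fun z => hav V1 1 z (by
    filter_upwards [hV1b] with ξ hξ _ using hξ)
  refine ⟨cv U1 φ, cv V1 φ, cv_contDiff hU1i (cs U) hφ, cv_contDiff hV1i (cs V) hφ, hV'b, ?_⟩
  intro z hz
  have hU1z : ∀ ξ, φ (z - ξ) ≠ 0 → U1 ξ = U ξ ∧ |U ξ - U z| ≤ e / 2 := by
    intro ξ hne
    have h1 := hnear z ξ hne
    have h2 := hmem z ξ hz h1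
    refine ⟨indicator_of_mem h2 U, ?_⟩
    have := hunif ξ h2 z (hmem z z hz (by simpa using hη0)) (by
      rw [dist_eq_norm]
      exact h1.trans_le (min_le_left _ _))
    rw [Real.dist_eq] at this
    exact this.le
  have hUφ : Integrable fun ξ => U1 ξ * φ (z - ξ) := cv_integrable hU1i (cs U) hφ.continuous z
  have hVφ : Integrable fun ξ => V1 ξ * φ (z - ξ) := cv_integrable hV1i (cs V) hφ.continuous z
  have hdiff : |cv U1 φ z - U z| ≤ e / 2 := by
    have e1 : cv U1 φ z - U z = ∫ ξ, (U1 ξ - U z) * φ (z - ξ) := by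
      simp only [sub_mul]
      rw [integral_sub hUφ ((hInt z).const_mul _), integral_const_mul, (hreg z).2.2.1, mul_one]
      rfl
    rw [e1]
    refine hav _ _ z (ae_of_all _ fun ξ hne => ?_)
    rw [(hU1z ξ hne).1]
    exact (hU1z ξ hne).2
  have hlap : lapl (cv U1 φ) z = -∫ ξ, V1 ξ * U1 ξ * φ (z - ξ) := by
    have h1 := hw _ (hreg z).1 (hreg z).2.1
    have e1 : ∫ ξ, V ξ * U ξ * φ (z - ξ) = ∫ ξ, V1 ξ * U1 ξ * φ (z - ξ) := by
      refine integral_congr_ae (ae_of_all _ fun ξ => ?_)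
      by_cases hne : φ (z - ξ) = 0
      · simp [hne]
      · have := hmem z ξ hz (hnear z ξ hne)
        simp only [hV1def, hU1, indicator_of_mem this]
    have e2 : ∫ ξ, U ξ * lapl (fun ξ => φ (z - ξ)) ξ = cv U1 (lapl φ) z := by
      unfold cv
      refine integral_congr_ae (ae_of_all _ fun ξ => ?_)
      simp only [smul_eq_mul, (hreg z).2.2.2]
      by_cases hne : ‖ξ - z‖ < η
      · simp only [hU1, indicator_of_mem (hmem z ξ hz hne)]
      · have hev : φ =ᶠ[𝓝 (z - ξ)] fun _ => 0 := by
          have ho : IsOpen {w : ℂ | η / 2 < ‖w‖} := isOpen_lt continuous_const continuous_norm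
          have : z - ξ ∈ {w : ℂ | η / 2 < ‖w‖} := by
            rw [norm_sub_rev, not_lt] at hne
            exact lt_of_lt_of_le (by linarith) hne
          filter_upwards [ho.mem_nhds this] with w hw
          exact φs w (le_of_lt hw)
        rw [lapl_congr hev, lapl_const]
        simp
    rw [cv_lapl hU1i (cs U) hφ, ← e2, ← e1]
    linarith
  have hVU : Integrable fun ξ => V1 ξ * U1 ξ * φ (z - ξ) := by
    have := hUφ.bdd_mul hV1i.aestronglyMeasurable (c := 1) (by
      filter_upwards [hV1b] with ξ hξ using hξ)
    simpa only [mul_assoc] using this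
  refine ⟨by linarith, ?_, fun m hm => ⟨?_, ?_⟩⟩
  · have e1 : lapl (cv U1 φ) z + cv V1 φ z * cv U1 φ z =
        ∫ ξ, V1 ξ * (cv U1 φ z - U1 ξ) * φ (z - ξ) := by
      have : ∀ ξ, V1 ξ * (cv U1 φ z - U1 ξ) * φ (z - ξ) =
        V1 ξ * φ (z - ξ) * cv U1 φ z - V1 ξ * U1 ξ * φ (z - ξ) := fun ξ => by ring
      simp only [this]
      rw [integral_sub (hVφ.mul_const _) hVU, integral_mul_const, hlap]
      simp only [cv, smul_eq_mul]
      ring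
    rw [e1]
    refine hav _ _ z ?_
    filter_upwards [hV1b] with ξ hξ hne
    obtain ⟨h1, h2⟩ := hU1z ξ hne
    rw [abs_mul, h1]
    have h3 : |cv U1 φ z - U ξ| ≤ e := by
      have := abs_sub_le (cv U1 φ z) (U z) (U ξ)
      rw [abs_sub_comm (U z)] at this
      linarith
    calc _ ≤ 1 * |cv U1 φ z - U ξ| := by gcongr
      _ ≤ e := by linarith
  · refine hav _ _ z (ae_of_all _ fun ξ hne => ?_)
    rw [(hU1z ξ hne).1]
    exact hm ξ ((hnear z ξ hne).le.trans (min_le_right _ _))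
  · rw [hlap, abs_neg]
    refine hav _ _ z ?_
    filter_upwards [hV1b] with ξ hξ hne
    rw [abs_mul, (hU1z ξ hne).1]
    have := hm ξ ((hnear z ξ hne).le.trans (min_le_right _ _))
    calc _ ≤ 1 * |U ξ| := by gcongr
      _ ≤ m := by linarith

/-- A smooth cutoff function of the unit disc with bounded derivatives. -/
theorem exists_cutoff : ∃ c > 0, ∃ χ : ℂ → ℝ, ContDiff ℝ ∞ χ ∧ (∀ z, 0 ≤ χ z ∧ χ z ≤ 1) ∧
    (∀ z, ‖z‖ ≤ 1 / 2 → χ z = 1) ∧ (∀ z, 1 ≤ ‖z‖ → χ z = 0) ∧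
    (∀ z, |dX χ z| ≤ c ∧ |dY χ z| ≤ c ∧ |lapl χ z| ≤ c) ∧
    ∀ z, ‖z‖ < 1 / 2 → dX χ z = 0 ∧ dY χ z = 0 ∧ lapl χ z = 0 := by
  let b : ContDiffBump (0 : ℂ) := ⟨1 / 2, 1, by positivity, by norm_num⟩
  have hb : ContDiff ℝ ∞ (b : ℂ → ℝ) := b.contDiff
  have cb : HasCompactSupport (b : ℂ → ℝ) := b.hasCompactSupport
  obtain ⟨c1, h1⟩ := (hasCompactSupport_dX cb).exists_bound_of_continuous (contDiff_dX hb).continuous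
  obtain ⟨c2, h2⟩ := (hasCompactSupport_dY cb).exists_bound_of_continuous (contDiff_dY hb).continuous
  have cl : HasCompactSupport (lapl (b : ℂ → ℝ)) :=
    (hasCompactSupport_dX (hasCompactSupport_dX cb)).add
      (hasCompactSupport_dY (hasCompactSupport_dY cb))
  obtain ⟨c3, h3⟩ := cl.exists_bound_of_continuous (contDiff_lapl hb).continuous
  have hone : ∀ z : ℂ, ‖z‖ ≤ 1 / 2 → b z = 1 := fun z hz =>
    b.one_of_mem_closedBall (by rw [mem_closedBall_zero_iff]; exact hz)
  refine ⟨|c1| + |c2| + |c3| + 1, by positivity, b, hb, fun z => ⟨b.nonneg, b.le_one⟩, hone,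
    fun z hz => b.zero_of_le_dist (by rw [dist_zero_right]; exact hz), fun z => ?_, fun z hz => ?_⟩
  · have := h1 z
    have := h2 z
    have := h3 z
    simp only [Real.norm_eq_abs] at *
    have := le_abs_self c1
    have := le_abs_self c2
    have := le_abs_self c3
    have := abs_nonneg c1
    have := abs_nonneg c2
    have := abs_nonneg c3
    refine ⟨?_, ?_, ?_⟩ <;> linarith
  · have hev : (b : ℂ → ℝ) =ᶠ[𝓝 z] fun _ => 1 := by
      have ho : IsOpen {w : ℂ | ‖w‖ < 1 / 2} := isOpen_lt continuous_norm continuous_const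
      filter_upwards [ho.mem_nhds hz] with w hw
      exact hone w (le_of_lt hw)
    refine ⟨?_, ?_, ?_⟩
    · unfold dX; rw [hev.fderiv_eq]; simp
    · unfold dY; rw [hev.fderiv_eq]; simp
    · rw [lapl_congr hev, lapl_const]

theorem comp_scale {v : ℂ → ℝ} (hv : ContDiff ℝ ∞ v) (z0 : ℂ) (t : ℝ) :
    ContDiff ℝ ∞ (fun z => v (z0 + t • z)) ∧ ∀ z,
      dX (fun z => v (z0 + t • z)) z = t * dX v (z0 + t • z) ∧
      dY (fun z => v (z0 + t • z)) z = t * dY v (z0 + t • z) ∧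
      lapl (fun z => v (z0 + t • z)) z = t ^ 2 * lapl v (z0 + t • z) := by
  refine ⟨contDiff_comp_affine hv (t • ContinuousLinearMap.id ℝ ℂ) z0, fun z => ⟨?_, ?_, ?_⟩⟩
  · have := fderiv_comp_affine hv.diffl (t • ContinuousLinearMap.id ℝ ℂ) z0 z 1
    unfold dX at this ⊢
    simpa using this
  · have := fderiv_comp_affine hv.diffl (t • ContinuousLinearMap.id ℝ ℂ) z0 z Complex.I
    unfold dY at this ⊢
    simpa using this
  · have := lapl_comp_affine hv (t • ContinuousLinearMap.id ℝ ℂ) z0 (s := t ^ 2) (by simp)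
      (by simp) (by simp) z
    simpa using this

/-- Rescaling and truncating a solution yields an approximate solution. -/
theorem exists_approxSol : ∃ c > 0, ∀ {l N M g : ℝ} {n : ℕ} {y : ℂ} {U V : ℂ → ℝ},
    0 < l → l ≤ 1 / 25000 → 0 < n → 1 ≤ N → 1 ≤ M → 0 ≤ g →
    ContDiff ℝ ∞ U → ContDiff ℝ ∞ V → (∀ z, |V z| ≤ 1) →
    (∀ z, ‖z‖ ≤ N → |U (y + √l • z)| ≤ M ∧
      |lapl U (y + √l • z) + V (y + √l • z) * U (y + √l • z)| ≤ 1 / 2 * (1 / n)) →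
    (∀ z, N / 2 ≤ ‖z‖ → ‖z‖ ≤ N → |U (y + √l • z)| ≤ g ∧ |dX U (y + √l • z)| ≤ g ∧
      |dY U (y + √l • z)| ≤ g) →
    c * g ≤ l * (1 / 2 * (1 / n)) →
    ∃ V' v : ℂ → ℝ, ApproxSol l n N V' v ∧ v 0 = M⁻¹ * U y := by
  obtain ⟨c, hc, χ, hχ, χ01, χ1, χ0, χc, χd⟩ := exists_cutoff
  refine ⟨5 * c, by positivity, ?_⟩
  intro l N M g n y U V hl hl2 hn hN hM hg hU hV hV1 hmain hann hcg
  have hN0 : 0 < N := by linarith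
  have hM0 : 0 < M := by linarith
  have hMi : M⁻¹ ≤ 1 := inv_le_one_of_one_le₀ hM
  have hMi0 : 0 ≤ M⁻¹ := by positivity
  have hNi : N⁻¹ ≤ 1 := inv_le_one_of_one_le₀ hN
  have hNi0 : 0 ≤ N⁻¹ := by positivity
  have hsq : √l ^ 2 = l := Real.sq_sqrt hl.le
  have hs1 : √l ≤ 1 := Real.sqrt_le_one.2 (by linarith)
  have hs0 := Real.sqrt_nonneg l
  obtain ⟨sχ, dχ⟩ := comp_scale hχ 0 N⁻¹
  obtain ⟨sχ2, -⟩ := comp_scale hχ 0 (2 * N)⁻¹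
  obtain ⟨sU, dU⟩ := comp_scale hU y √l
  obtain ⟨sV, -⟩ := comp_scale hV y √l
  have hnorm : ∀ z : ℂ, ‖(0 : ℂ) + N⁻¹ • z‖ = N⁻¹ * ‖z‖ := fun z => by
    rw [zero_add, norm_smul, Real.norm_of_nonneg hNi0]
  have hnorm2 : ∀ z : ℂ, ‖(0 : ℂ) + (2 * N)⁻¹ • z‖ = (2 * N)⁻¹ * ‖z‖ := fun z => by
    rw [zero_add, norm_smul, Real.norm_of_nonneg (by positivity)]
  set χN : ℂ → ℝ := fun z => χ (0 + N⁻¹ • z) with hχN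
  set u : ℂ → ℝ := fun z => M⁻¹ * U (y + √l • z) with hu
  have hus : ContDiff ℝ ∞ u := contDiff_const.mul sU
  have hχN0 : ∀ z, N ≤ ‖z‖ → χN z = 0 := fun z hz => χ0 _ (by
    rw [hnorm, le_inv_mul_iff₀ hN0]; linarith)
  have hχ2 : ∀ z : ℂ, ‖z‖ ≤ N → χ (0 + (2 * N)⁻¹ • z) = 1 := fun z hz => χ1 _ (by
    rw [hnorm2, inv_mul_le_iff₀ (by positivity)]; linarith)
  refine ⟨fun z => χ (0 + (2 * N)⁻¹ • z) * (l * V (y + √l • z)), fun z => χN z * u z,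
    ⟨hl, hl2, hn, hN, sχ2.mul (contDiff_const.mul sV), sχ.mul hus, ?_, ?_, ?_, ?_, ?_⟩, ?_⟩
  · intro z hz
    rw [χ0 _ (by rw [hnorm2, le_inv_mul_iff₀ (by positivity)]; linarith), zero_mul]
  · intro z hz
    rw [hχN0 z hz.le, zero_mul]
  · intro z
    rw [abs_mul, abs_mul, abs_of_pos hl, abs_of_nonneg (χ01 _).1]
    calc _ ≤ 1 * (l * 1) := by
          gcongr
          · exact (χ01 _).2
          · exact hV1 _
      _ = l := by ring
  · intro z
    by_cases hz : ‖z‖ ≤ N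
    · rw [abs_mul, abs_of_nonneg (χ01 _).1, hu]
      simp only
      rw [abs_mul, abs_of_nonneg hMi0]
      calc _ ≤ 1 * (M⁻¹ * M) := by
            gcongr
            · exact (χ01 _).2
            · exact (hmain z hz).1
        _ = 1 := by rw [inv_mul_cancel₀ hM0.ne', one_mul]
    · rw [hχN0 z (not_le.1 hz).le]
      simp
  · intro z
    by_cases hz : ‖z‖ ≤ N
    · have e1 : lapl (fun z => χN z * u z) z = χN z * (l * (M⁻¹ * lapl U (y + √l • z))) +
          2 * (N⁻¹ * dX χ (0 + N⁻¹ • z) * (M⁻¹ * (√l * dX U (y + √l • z))) +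
            N⁻¹ * dY χ (0 + N⁻¹ • z) * (M⁻¹ * (√l * dY U (y + √l • z)))) +
          N⁻¹ ^ 2 * lapl χ (0 + N⁻¹ • z) * (M⁻¹ * U (y + √l • z)) := by
        rw [lapl_mul sχ hus]
        have e2 := lapl_const_mul M⁻¹ sU
        have e3 := dX_const_mul M⁻¹ sU.diffl
        have e4 := dY_const_mul M⁻¹ sU.diffl
        rw [hu, e2, e3, e4]
        beta_reduce
        rw [(dχ z).1, (dχ z).2.1, (dχ z).2.2, (dU z).1, (dU z).2.1, (dU z).2.2, hsq]
        ring
      rw [e1, hχ2 z hz]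
      obtain ⟨hm1, hm2⟩ := hmain z hz
      set w := y + √l • z
      have hT1 : |χN z * l * M⁻¹ * (lapl U w + V w * U w)| ≤ l * (1 / 2 * (1 / n)) := by
        rw [abs_mul, abs_mul, abs_mul, abs_of_nonneg (χ01 _).1, abs_of_pos hl, abs_of_nonneg hMi0]
        calc _ ≤ 1 * l * 1 * (1 / 2 * (1 / n)) := by
              gcongr
              exact (χ01 _).2
          _ = _ := by ring
      have hT2 : |2 * (N⁻¹ * dX χ (0 + N⁻¹ • z) * (M⁻¹ * (√l * dX U w)) +
            N⁻¹ * dY χ (0 + N⁻¹ • z) * (M⁻¹ * (√l * dY U w))) +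
          N⁻¹ ^ 2 * lapl χ (0 + N⁻¹ • z) * (M⁻¹ * U w)| ≤ 5 * c * g := by
        by_cases hz2 : ‖z‖ < N / 2
        · obtain ⟨h1, h2, h3⟩ := χd (0 + N⁻¹ • z) (by
            rw [hnorm, inv_mul_lt_iff₀ hN0]; linarith)
          rw [h1, h2, h3]
          simp only [mul_zero, zero_mul, add_zero, abs_zero]
          positivity
        · obtain ⟨h1, h2, h3⟩ := hann z (not_lt.1 hz2) hz
          obtain ⟨k1, k2, k3⟩ := χc (0 + N⁻¹ • z)
          have t1 : |N⁻¹ * dX χ (0 + N⁻¹ • z) * (M⁻¹ * (√l * dX U w))| ≤ c * g := by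
            rw [abs_mul, abs_mul, abs_mul, abs_mul, abs_of_nonneg hMi0, abs_of_nonneg hNi0,
              abs_of_nonneg hs0]
            calc _ ≤ 1 * c * (1 * (1 * g)) := by gcongr
              _ = _ := by ring
          have t2 : |N⁻¹ * dY χ (0 + N⁻¹ • z) * (M⁻¹ * (√l * dY U w))| ≤ c * g := by
            rw [abs_mul, abs_mul, abs_mul, abs_mul, abs_of_nonneg hMi0, abs_of_nonneg hNi0,
              abs_of_nonneg hs0]
            calc _ ≤ 1 * c * (1 * (1 * g)) := by gcongr
              _ = _ := by ring
          have t3 : |N⁻¹ ^ 2 * lapl χ (0 + N⁻¹ • z) * (M⁻¹ * U w)| ≤ c * g := by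
            rw [abs_mul, abs_mul, abs_mul, abs_of_nonneg hMi0, abs_of_nonneg (by positivity)]
            have : N⁻¹ ^ 2 ≤ 1 := pow_le_one₀ hNi0 hNi
            calc _ ≤ 1 * c * (1 * g) := by gcongr
              _ = _ := by ring
          rw [abs_le] at t1 t2 t3 ⊢
          constructor <;> linarith [t1.1, t1.2, t2.1, t2.2, t3.1, t3.2]
      have hT3 := abs_add_le (χN z * l * M⁻¹ * (lapl U w + V w * U w))
        (2 * (N⁻¹ * dX χ (0 + N⁻¹ • z) * (M⁻¹ * (√l * dX U w)) +
            N⁻¹ * dY χ (0 + N⁻¹ • z) * (M⁻¹ * (√l * dY U w))) +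
          N⁻¹ ^ 2 * lapl χ (0 + N⁻¹ • z) * (M⁻¹ * U w))
      refine le_trans (le_of_eq ?_) (hT3.trans ((add_le_add hT1 (hT2.trans hcg)).trans
        (le_of_eq (by ring))))
      congr 1
      simp only [hu]
      ring
    · have hz' : N < ‖z‖ := not_le.1 hz
      have hev : (fun z => χN z * u z) =ᶠ[𝓝 z] fun _ => 0 := by
        have ho : IsOpen {w : ℂ | N < ‖w‖} := isOpen_lt continuous_const continuous_norm
        filter_upwards [ho.mem_nhds hz'] with w hw
        rw [hχN0 w (le_of_lt hw), zero_mul]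
      rw [lapl_congr hev, lapl_const, hχN0 z hz'.le]
      simp only [zero_mul, mul_zero, add_zero, abs_zero]
      positivity
  · simp only [hχN, hu, smul_zero, add_zero]
    rw [χ1 0 (by simp), one_mul]

/-- The scale of the rescaling and its elementary properties. -/
theorem scale_props {κ N b : ℝ} (hκ : 0 < κ) (hN : 2500 ≤ N) (hκN : (32 / κ) ^ 2 ≤ N)
    (hb : 0 ≤ b) (hbN : b ^ 2 ≤ N) :
    1 ≤ Real.log N ∧ 1 + Real.log (3 * N) ≤ 4 * Real.log N ∧
      4 ≤ √(κ / Real.log N) * √N ∧ 4 * b ≤ √(κ / Real.log N) * N := by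
  have hN0 : 0 < N := by linarith
  have h1 : 1 ≤ Real.log N := by
    rw [Real.le_log_iff_exp_le hN0]
    linarith [Real.exp_one_lt_d9]
  have hs0 : 0 < √N := Real.sqrt_pos.2 hN0
  have hss : √N * √N = N := Real.mul_self_sqrt hN0.le
  have h2 : Real.log (3 * N) ≤ 2 * Real.log N := by
    have : Real.log (3 * N) ≤ Real.log (N ^ 2) := Real.log_le_log (by positivity) (by nlinarith)
    rwa [Real.log_pow, Nat.cast_ofNat] at this
  have h3 : Real.log N ≤ 2 * √N := by
    have h := Real.log_le_sub_one_of_pos hs0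
    rw [Real.log_sqrt hN0.le] at h
    linarith
  have h4 : 32 / κ ≤ √N := Real.le_sqrt_of_sq_le hκN
  have h5 : 4 ≤ √(κ / Real.log N) * √N := by
    rw [← Real.sqrt_mul (by positivity)]
    refine Real.le_sqrt_of_sq_le ?_
    rw [div_mul_eq_mul_div, le_div_iff₀ (by linarith)]
    rw [div_le_iff₀ hκ] at h4
    calc (4 : ℝ) ^ 2 * Real.log N ≤ 4 ^ 2 * (2 * √N) := by gcongr
      _ = 32 * √N := by ring
      _ ≤ √N * κ * √N := by gcongr
      _ = κ * N := by rw [mul_comm (√N) κ, mul_assoc, hss]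
  refine ⟨h1, by linarith, h5, ?_⟩
  have h6 : b ≤ √N := Real.le_sqrt_of_sq_le hbN
  calc 4 * b ≤ √(κ / Real.log N) * √N * √N := by gcongr
    _ = _ := by rw [mul_assoc, hss]

/-- Far from the origin a solution with the given decay is extremely small. -/
theorem decay_le {κ N C B : ℝ} {U : ℂ → ℝ} (hκ : 0 < κ) (hN : 2500 ≤ N)
    (hlog : 1 ≤ Real.log N) (h4 : 4 ≤ √(κ / Real.log N) * √N) (hC : C * √κ = 8 * B) (hC0 : 0 < C)
    (hU : ∀ z, 2 < ‖z‖ → |U z| ≤ Real.exp (-(C * ‖z‖ * √(Real.log ‖z‖)))) {z : ℂ}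
    (hz : √(κ / Real.log N) * N / 4 ≤ ‖z‖) : |U z| ≤ Real.exp (-(B * N)) := by
  have hN0 : 0 < N := by linarith
  have hs0 : 0 < √N := Real.sqrt_pos.2 hN0
  have hss : √N * √N = N := Real.mul_self_sqrt hN0.le
  have hs2 : 2 < √N := Real.lt_sqrt_of_sq_lt (by linarith)
  have h1 : √N ≤ ‖z‖ := by
    refine le_trans ?_ hz
    rw [le_div_iff₀ (by norm_num)]
    calc √N * 4 ≤ √N * (√(κ / Real.log N) * √N) := by gcongr
      _ = _ := by rw [mul_comm (√(κ / Real.log N)), ← mul_assoc, hss, mul_comm]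
  refine (hU z (by linarith)).trans (Real.exp_le_exp.2 (neg_le_neg ?_))
  have h2 : √(Real.log N) / 2 ≤ √(Real.log ‖z‖) := by
    refine Real.le_sqrt_of_sq_le ?_
    rw [div_pow, Real.sq_sqrt (by linarith)]
    have := Real.log_le_log hs0 h1
    rw [Real.log_sqrt hN0.le] at this
    linarith
  have hl0 : 0 < √(Real.log N) := Real.sqrt_pos.2 (by linarith)
  calc B * N = C * (√(κ / Real.log N) * N / 4) * (√(Real.log N) / 2) := by
        rw [Real.sqrt_div hκ.le]
        field_simp
        linarith
    _ ≤ _ := by gcongr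

/-- The Landis-type theorem, in complex notation. -/
theorem exists_landis_const : ∃ C > 0, ∀ V U : ℂ → ℝ, Measurable V → (∀ᵐ z, |V z| ≤ 1) →
    Continuous U → (∀ h, ContDiff ℝ ∞ h → HasCompactSupport h →
      (∫ z, U z * lapl h z) + ∫ z, V z * U z * h z = 0) →
    (∀ z, 2 < ‖z‖ → |U z| ≤ Real.exp (-(C * ‖z‖ * √(Real.log ‖z‖)))) → ∀ y, U y = 0 := by
  obtain ⟨c1, hc1, A, hA, hcore⟩ := exists_core
  obtain ⟨c, hc, happ⟩ := exists_approxSol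
  set κ := min (c1 / 4) (1 / 25000) with hκdef
  have hκ : 0 < κ := lt_min (by positivity) (by norm_num)
  have hsκ : 0 < √κ := Real.sqrt_pos.2 hκ
  refine ⟨8 * (A + 3) / √κ, by positivity, ?_⟩
  set C := 8 * (A + 3) / √κ with hCdef
  have hC : C * √κ = 8 * (A + 3) := div_mul_cancel₀ _ hsκ.ne'
  have hC0 : 0 < C := by positivity
  intro V U hV hV1 hU hw hdec y
  obtain ⟨M, hM1, hM⟩ : ∃ M, 1 ≤ M ∧ ∀ z, |U z| ≤ M := by
    obtain ⟨M, hM⟩ := (isCompact_closedBall (0 : ℂ) 2).exists_bound_of_continuousOn hU.continuousOn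
    refine ⟨max M 1, le_max_right _ _, fun z => ?_⟩
    by_cases hz : ‖z‖ ≤ 2
    · exact (hM z (by rwa [mem_closedBall_zero_iff])).trans (le_max_left _ _)
    · refine ((hdec z (not_le.1 hz)).trans (Real.exp_le_one_iff.2 ?_)).trans (le_max_right _ _)
      rw [neg_nonpos]
      positivity
  by_contra hy
  have hy0 : 0 < |U y| := abs_pos.2 hy
  set b := ‖y‖ + 2 with hb
  have hb0 : 0 ≤ b := by positivity
  obtain ⟨N, hN1, hN2, hN3, hN4, hN5⟩ := ((eventually_ge_atTop (2500 : ℝ)).and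
    ((eventually_ge_atTop ((32 / κ) ^ 2)).and ((eventually_ge_atTop (b ^ 2)).and
    ((eventually_ge_atTop (20 * c / κ)).and (eventually_gt_atTop ((M + 1) / |U y|)))))).exists
  obtain ⟨hlog, hlog3, h4, h4b⟩ := scale_props hκ hN1 hN2 hb0 hN3
  have hN0 : 0 < N := by linarith
  set l := κ / Real.log N with hl
  have hlog0 : 0 < Real.log N := by linarith
  have hl0 : 0 < l := by positivity
  have hlκ : l ≤ κ := div_le_self hκ.le hlog
  have hl2 : l ≤ 1 / 25000 := hlκ.trans (min_le_right _ _)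
  have hs1 : √l ≤ 1 := Real.sqrt_le_one.2 (by linarith)
  have hlc : l * (1 + Real.log (3 * N)) ≤ c1 := by
    calc l * (1 + Real.log (3 * N)) ≤ l * (4 * Real.log N) := by gcongr
      _ = 4 * κ := by rw [hl]; field_simp
      _ ≤ c1 := by linarith [min_le_left (c1 / 4) (1 / 25000 : ℝ)]
  set n := ⌈Real.exp (A * N)⌉₊ with hn
  have hn1 : Real.exp (A * N) ≤ n := Nat.le_ceil _
  have hn0 : 0 < n := Nat.ceil_pos.2 (Real.exp_pos _)
  have hnr : (0 : ℝ) < n := by exact_mod_cast hn0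
  have hn2 : (n : ℝ) ≤ 2 * Real.exp (A * N) := by
    have h1 := (Nat.ceil_lt_add_one (Real.exp_pos (A * N)).le).le
    have h2 : 1 ≤ Real.exp (A * N) := Real.one_le_exp (by positivity)
    linarith
  set m := Real.exp (-((A + 3) * N)) with hm
  have hm0 : 0 < m := Real.exp_pos _
  obtain ⟨U', V', sU, sV, hV'1, happrox⟩ := exists_mollified hU hV hV1 hw
    (e := min (1 / 2 * (1 / n)) (1 / N)) (by positivity) (‖y‖ + N + 1)
  have hball : ∀ z : ℂ, ‖z‖ ≤ N → ‖y + √l • z‖ ≤ ‖y‖ + N := fun z hz => by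
    refine (norm_add_le _ _).trans ?_
    rw [norm_smul, Real.norm_of_nonneg (Real.sqrt_nonneg l)]
    nlinarith [norm_nonneg z]
  have hsmall : ∀ z : ℂ, N / 2 ≤ ‖z‖ → ‖z‖ ≤ N → ∀ ζ ∈ closedBall (y + √l • z) 1,
      |U' ζ| ≤ m ∧ |lapl U' ζ| ≤ m := by
    intro z hz1 hz2 ζ hζ
    rw [mem_closedBall, dist_eq_norm] at hζ
    have h1 := hball z hz2
    refine (happrox ζ ?_).2.2 m fun w hw => ?_
    · have := norm_sub_norm_le ζ (y + √l • z)
      linarith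
    · refine decay_le hκ hN1 hlog h4 hC hC0 hdec ?_
      have h2 : √l * (N / 2) ≤ ‖√l • z‖ := by
        rw [norm_smul, Real.norm_of_nonneg (Real.sqrt_nonneg l)]
        gcongr
      have h3 : ‖√l • z‖ ≤ ‖w‖ + ‖w - ζ‖ + ‖ζ - (y + √l • z)‖ + ‖y‖ := by
        have : √l • z = w - (w - ζ) - (ζ - (y + √l • z)) - y := by ring
        calc ‖√l • z‖ = ‖w - (w - ζ) - (ζ - (y + √l • z)) - y‖ := by rw [← this]
          _ ≤ ‖w - (w - ζ) - (ζ - (y + √l • z))‖ + ‖y‖ := norm_sub_le _ _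
          _ ≤ ‖w - (w - ζ)‖ + ‖ζ - (y + √l • z)‖ + ‖y‖ := by gcongr; exact norm_sub_le _ _
          _ ≤ _ := by gcongr; exact norm_sub_le _ _
      linarith
  have hg : c * (5 * m) ≤ l * (1 / 2 * (1 / n)) := by
    have h1 : N ^ 2 ≤ Real.exp (3 * N) :=
      (pow_le_exp_mul (by linarith) 2).trans (Real.exp_le_exp.2 (by push_cast; linarith))
    have h2 : 20 * c * N ≤ κ * Real.exp (3 * N) := by
      rw [div_le_iff₀ hκ] at hN4
      calc 20 * c * N ≤ N * κ * N := by gcongr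
        _ = κ * N ^ 2 := by ring
        _ ≤ _ := by gcongr
    have h3 : Real.log N ≤ N := by linarith [Real.log_le_sub_one_of_pos hN0]
    have h4 : m * (Real.exp (A * N) * Real.exp (3 * N)) = 1 := by
      rw [hm, ← Real.exp_add, ← Real.exp_add]
      ring_nf
      exact Real.exp_zero
    have h5 : c * (5 * m) * (4 * Real.exp (A * N) * N) ≤ κ := by
      calc c * (5 * m) * (4 * Real.exp (A * N) * N) = m * Real.exp (A * N) * (20 * c * N) := by ring
        _ ≤ m * Real.exp (A * N) * (κ * Real.exp (3 * N)) := by gcongr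
        _ = κ * (m * (Real.exp (A * N) * Real.exp (3 * N))) := by ring
        _ = κ := by rw [h4, mul_one]
    have h6 : l * (1 / 2 * (1 / n)) = κ / (2 * n * Real.log N) := by rw [hl]; field_simp
    rw [h6, le_div_iff₀ (by positivity)]
    refine le_trans ?_ h5
    have : 2 * (n : ℝ) * Real.log N ≤ 4 * Real.exp (A * N) * N :=
      mul_le_mul (by linarith) h3 hlog0.le (by positivity)
    gcongr
  obtain ⟨V2, v, hsol, hv0⟩ := happ hl0 hl2 hn0 (by linarith : 1 ≤ N) hM1
    (by positivity : 0 ≤ 5 * m) sU sV hV'1 (y := y) (N := N) (fun z hz => by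
      have h1 := happrox (y + √l • z) (by linarith [hball z hz])
      exact ⟨(h1.2.2 M fun w _ => hM w).1, h1.2.1.trans (min_le_left _ _)⟩)
    (fun z hz1 hz2 => by
      have h1 := hsmall z hz1 hz2
      have h2 := abs_dX_dY_le sU (d := 1 / 2) (M := m) (F := m) (by norm_num) hm0 (y + √l • z)
        (fun ζ hζ => (h1 ζ (by simpa using hζ)).1) (fun ζ hζ => (h1 ζ (by simpa using hζ)).2)
      have h3 := (h1 (y + √l • z) (by simp)).1
      refine ⟨by linarith, ?_, ?_⟩
      · linarith [h2.1]
      · linarith [h2.2]) hg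
  have hfin := hcore hsol hN1 hlc hn1
  rw [hv0, abs_mul, abs_of_nonneg (by positivity), inv_mul_le_iff₀ (by linarith)] at hfin
  have h1 := ((happrox y (by linarith)).1).trans (min_le_right _ _)
  have h2 : |U y| ≤ |U' y| + |U' y - U y| := by
    have := abs_sub_abs_le_abs_sub (U y) (U' y)
    rw [abs_sub_comm] at this
    linarith
  have h3 : |U y| ≤ (M + 1) / N := by
    rw [add_div]
    rw [mul_one_div] at hfin
    linarith
  rw [div_lt_iff₀ hy0] at hN5
  rw [le_div_iff₀ hN0] at h3
  linarith

/-- The identification of the complex plane with the Euclidean plane. -/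
def toPlane : ℂ ≃ₗᵢ[ℝ] E2 := Complex.orthonormalBasisOneI.repr

theorem toPlane_symm_single_zero : toPlane.symm (EuclideanSpace.single 0 1) = 1 := by
  simp [toPlane]

theorem toPlane_symm_single_one : toPlane.symm (EuclideanSpace.single 1 1) = Complex.I := by
  simp [toPlane]

theorem fderiv_comp_toPlane_symm (f : ℂ → ℝ) (x v : E2) :
    fderiv ℝ (fun y => f (toPlane.symm y)) x v = fderiv ℝ f (toPlane.symm x) (toPlane.symm v) := by
  have := toPlane.symm.toContinuousLinearEquiv.comp_right_fderiv (f := f) (x := x)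
  exact congrArg (fun L : E2 →L[ℝ] ℝ => L v) this

theorem lap_comp_toPlane_symm (h : ℂ → ℝ) (x : E2) :
    lap (fun y => h (toPlane.symm y)) x = lapl h (toPlane.symm x) := by
  simp only [lap, Fin.sum_univ_two, fderiv_comp_toPlane_symm, toPlane_symm_single_zero,
    toPlane_symm_single_one]
  rw [fderiv_comp_toPlane_symm (fun z => fderiv ℝ h z 1),
    fderiv_comp_toPlane_symm (fun z => fderiv ℝ h z Complex.I), toPlane_symm_single_zero,
    toPlane_symm_single_one]
  rfl

theorem integral_comp_toPlane (f : E2 → ℝ) : ∫ z, f (toPlane z) = ∫ x, f x :=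
  toPlane.measurePreserving.integral_comp toPlane.toHomeomorph.measurableEmbedding f

theorem IsWeakSol.comp_toPlane {V u : E2 → ℝ} (hu : IsWeakSol univ V u) {h : ℂ → ℝ}
    (hh : ContDiff ℝ ∞ h) (hs : HasCompactSupport h) :
    (∫ z, u (toPlane z) * lapl h z) + ∫ z, V (toPlane z) * u (toPlane z) * h z = 0 := by
  have h1 := hu (fun y => h (toPlane.symm y)) ⟨hh.comp toPlane.symm.contDiff,
    hs.comp_homeomorph toPlane.symm.toHomeomorph, subset_univ _⟩
  rw [Measure.restrict_univ, ← integral_comp_toPlane, ← integral_comp_toPlane] at h1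
  simpa only [lap_comp_toPlane_symm, LinearIsometryEquiv.symm_apply_apply] using h1

end Landis

/-- **Landis conjecture (weak form), Theorem 1.**  There is an absolute constant `C > 0` such
that any continuous (hence `C¹`) weak solution of `Δu + Vu = 0` on `ℝ²` with `|V| ≤ 1` a.e.
satisfying `|u(x)| ≤ exp(−C|x| (log|x|)^{1/2})` for `|x| > 2` vanishes identically. -/
theorem landis_conjecture_weak :
    ∃ C : ℝ, 0 < C ∧
      ∀ V u : E2 → ℝ, Measurable V → (∀ᵐ x : E2, |V x| ≤ 1) →
        LocallyIntegrable u volume → Continuous u →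
        IsWeakSol (Set.univ : Set E2) V u →
        (∀ x : E2, 2 < ‖x‖ → |u x| ≤ Real.exp (-(C * ‖x‖ * Real.sqrt (Real.log ‖x‖)))) →
        u = 0 := by
  obtain ⟨C, hC, hmain⟩ := Landis.exists_landis_const
  refine ⟨C, hC, fun V u hV hV1 _ hu hw hdec => funext fun x => ?_⟩
  have h := hmain (fun z => V (Landis.toPlane z)) (fun z => u (Landis.toPlane z))
    (hV.comp Landis.toPlane.continuous.measurable)
    (Landis.toPlane.measurePreserving.quasiMeasurePreserving.ae hV1)
    (hu.comp Landis.toPlane.continuous) (fun _ => Landis.IsWeakSol.comp_toPlane hw)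
    (fun z hz => by simpa using hdec (Landis.toPlane z) (by simpa using hz))
    (Landis.toPlane.symm x)
  simpa using h
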